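/- For every parameter α ∈ [1.9, 6.0], Wright's equation x'(t) = -α(e^{x(t-1)} - 1) has a slowly oscillating periodic solution, and this SOPS is unique up to time translation: if x and y are both SOPS at parameter α, then there exists τ ∈ ℝ such that y(t) = x(t + τ) for all t ∈ ℝ. -/

import Mathlib

open Real Set Filter

noncomputable section

/-- `x` solves Wright's equation `x'(t) = -α (e^{x(t-1)} - 1)` on all of `ℝ`. -/
def WrightSol (α : ℝ) (x : ℝ → ℝ) : Prop :=
  ∀ t : ℝ, HasDerivAt x (-α * (Real.exp (x (t - 1)) - 1)) t

/-- The space 𝒳: C¹ functions with `x 0 = 0`, `x' 0 > 0` and `x < 0` on `(-1,0)`. -/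
def InX (x : ℝ → ℝ) : Prop :=
  ContDiff ℝ 1 x ∧ x 0 = 0 ∧ 0 < deriv x 0 ∧ ∀ t ∈ Set.Ioo (-1 : ℝ) 0, x t < 0

/-- A slowly oscillating periodic solution in 𝒳, with first zero `q` and data `qbar`:
positive on `(0,q)`, negative on `(q, q+qbar)`, periodic with minimal period `q+qbar`. -/
def SOPSX (α q qbar : ℝ) (x : ℝ → ℝ) : Prop :=
  InX x ∧ WrightSol α x ∧ 1 < q ∧ 1 < qbar ∧
  (∀ t ∈ Set.Ioo 0 q, 0 < x t) ∧
  (∀ t ∈ Set.Ioo q (q + qbar), x t < 0) ∧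
  Function.Periodic x (q + qbar) ∧
  (∀ T : ℝ, 0 < T → Function.Periodic x T → q + qbar ≤ T)

/-- A slowly oscillating periodic solution (up to time translation). -/
def SOPS (α : ℝ) (x : ℝ → ℝ) : Prop :=
  WrightSol α x ∧
  ∃ q qbar : ℝ, 1 < q ∧ 1 < qbar ∧
    (∃ τ : ℝ, (∀ t ∈ Set.Ioo 0 q, 0 < x (t + τ)) ∧
      (∀ t ∈ Set.Ioo q (q + qbar), x (t + τ) < 0)) ∧
    Function.Periodic x (q + qbar) ∧
    (∀ T : ℝ, 0 < T → Function.Periodic x T → q + qbar ≤ T)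

structure Fb (f : ℝ → ℝ) : Prop where
  cont : Continuous f
  mono : StrictMono f
  zero : f 0 = 0

structure Hump (f : ℝ → ℝ) (τ q : ℝ) (u : ℝ → ℝ) : Prop where
  fb : Fb f
  τpos : 0 < τ
  hq : τ < q
  cont : Continuous u
  zero : u 0 = 0
  mono : StrictMonoOn u (Icc 0 τ)
  de : ∀ s, τ < s → HasDerivAt u (-f (u (s - τ))) s
  qz : u q = 0
  pos : ∀ s ∈ Ioo 0 q, 0 < u s

/-- weak ascending order -/
def AscLE (u1 : ℝ → ℝ) (τ1 : ℝ) (u2 : ℝ → ℝ) (τ2 : ℝ) : Prop :=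
  ∀ t ∈ Icc 0 τ1, ∀ s ∈ Icc 0 τ2, u2 s < u1 t → s ≤ t ∧ ∀ r ∈ Icc 0 s, u2 (s - r) ≤ u1 (t - r)

lemma Fb.pos {f : ℝ → ℝ} (h : Fb f) {v : ℝ} (hv : 0 < v) : 0 < f v := by
  have := h.mono hv; rwa [h.zero] at this

lemma Fb.nonneg {f : ℝ → ℝ} (h : Fb f) {v : ℝ} (hv : 0 ≤ v) : 0 ≤ f v := by
  have := h.mono.monotone hv; rwa [h.zero] at this

lemma Fb.neg {f : ℝ → ℝ} (h : Fb f) {v : ℝ} (hv : v < 0) : f v < 0 := by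
  have := h.mono hv; rwa [h.zero] at this

lemma barrier {φ ψ φ' ψ' : ℝ → ℝ} {a b : ℝ} (hφ : Continuous φ)
    (hφ' : ∀ x ∈ Ico a b, HasDerivWithinAt φ (φ' x) (Ici x) x)
    (hψ : Continuous ψ) (hψ' : ∀ x ∈ Ico a b, HasDerivWithinAt ψ (ψ' x) (Ici x) x)
    (h0 : φ a ≤ ψ a) (h : ∀ x ∈ Ico a b, φ x = ψ x → φ' x < ψ' x) :
    ∀ x ∈ Icc a b, φ x ≤ ψ x := fun _ hx =>
  image_le_of_deriv_right_lt_deriv_boundary' hφ.continuousOn hφ' h0 hψ.continuousOn hψ' h hx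

namespace Hump
variable {f : ℝ → ℝ} {τ q : ℝ} {u : ℝ → ℝ}

lemma nonneg (H : Hump f τ q u) {s : ℝ} (h0 : 0 ≤ s) (h1 : s ≤ q) : 0 ≤ u s := by
  rcases h0.eq_or_lt with h | h
  · rw [← h, H.zero]
  rcases h1.eq_or_lt with h' | h'
  · rw [h', H.qz]
  exact (H.pos s ⟨h, h'⟩).le

lemma anti (H : Hump f τ q u) : StrictAntiOn u (Icc τ (q + τ)) := by
  apply strictAntiOn_of_deriv_neg (convex_Icc _ _) H.cont.continuousOn
  intro x hx
  rw [interior_Icc] at hx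
  rw [(H.de x hx.1).deriv]
  have := H.fb.pos (H.pos (x - τ) ⟨by linarith [hx.1], by linarith [hx.2]⟩)
  linarith

lemma deR (H : Hump f τ q u) {s : ℝ} (hs : τ ≤ s) :
    HasDerivWithinAt u (-f (u (s - τ))) (Ici s) s := by
  rcases hs.eq_or_lt with h | h
  · subst h
    apply hasDerivWithinAt_Ici_of_tendsto_deriv (s := Ioi τ)
    · intro x hx; exact (H.de x hx).differentiableAt.differentiableWithinAt
    · exact H.cont.continuousWithinAt
    · exact self_mem_nhdsWithin
    · have : Tendsto (fun x => -f (u (x - τ))) (nhdsWithin τ (Ioi τ)) (nhds (-f (u (τ - τ)))) := by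
        have hc : Continuous (fun x => -f (u (x - τ))) :=
          (H.fb.cont.comp (H.cont.comp (continuous_id.sub continuous_const))).neg
        exact hc.continuousAt.tendsto.mono_left nhdsWithin_le_nhds
      refine this.congr' ?_
      filter_upwards [self_mem_nhdsWithin] with x hx
      exact (H.de x hx).deriv.symm
  · exact (H.de s h).hasDerivWithinAt

lemma le_max (H : Hump f τ q u) {s : ℝ} (h0 : 0 ≤ s) (h1 : s ≤ q + τ) : u s ≤ u τ := by
  have := H.τpos
  have := H.hq
  rcases le_total s τ with h | h
  · exact H.mono.monotoneOn ⟨h0, h⟩ ⟨by linarith, le_rfl⟩ h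
  · exact H.anti.antitoneOn ⟨le_rfl, by linarith⟩ ⟨h, h1⟩ h

lemma maxpos (H : Hump f τ q u) : 0 < u τ := H.pos τ ⟨H.τpos, H.hq⟩

/-- ascending time for a level -/
lemma asc_time (H : Hump f τ q u) {v : ℝ} (h0 : 0 ≤ v) (h1 : v ≤ u τ) :
    ∃ t ∈ Icc 0 τ, u t = v := by
  have := intermediate_value_Icc H.τpos.le H.cont.continuousOn
  rw [H.zero] at this
  exact this ⟨h0, h1⟩

lemma desc_time (H : Hump f τ q u) {v : ℝ} {a b : ℝ} (hab : a ≤ b)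
    (h0 : u b ≤ v) (h1 : v ≤ u a) :
    ∃ t ∈ Icc a b, u t = v :=
  intermediate_value_Icc' hab H.cont.continuousOn ⟨h0, h1⟩

end Hump

/-- weak form of AscLE -/
lemma AscLE.weak {u1 u2 : ℝ → ℝ} {τ1 τ2 : ℝ} (A : AscLE u1 τ1 u2 τ2)
    (c2 : Continuous u2) (m2 : StrictMonoOn u2 (Icc 0 τ2)) (z1 : u1 0 = 0)
    (z2 : u2 0 = 0)
    (m1 : StrictMonoOn u1 (Icc 0 τ1))
    {t s : ℝ} (ht : t ∈ Icc 0 τ1) (hs : s ∈ Icc 0 τ2) (h : u2 s ≤ u1 t) :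
    s ≤ t ∧ ∀ r ∈ Icc 0 s, u2 (s - r) ≤ u1 (t - r) := by
  rcases h.lt_or_eq with h | h
  · exact A t ht s hs h
  rcases hs.1.eq_or_lt with h0 | h0
  · subst h0
    refine ⟨ht.1, fun r hr => ?_⟩
    have : r = 0 := le_antisymm hr.2 hr.1
    subst this
    simpa using h.le
  · have key : ∀ s' ∈ Ico 0 s, s' ≤ t ∧ ∀ r ∈ Icc 0 s', u2 (s' - r) ≤ u1 (t - r) := by
      intro s' hs'
      apply A t ht s' ⟨hs'.1, hs'.2.le.trans hs.2⟩
      rw [← h]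
      exact m2 ⟨hs'.1, hs'.2.le.trans hs.2⟩ hs hs'.2
    have hst : s ≤ t := by
      by_contra hlt
      push Not at hlt
      have := (key ((s + t) / 2) ⟨by linarith [ht.1], by linarith⟩).1
      linarith
    refine ⟨hst, fun r hr => ?_⟩
    rcases hr.2.eq_or_lt with h' | h'
    · subst h'
      rw [sub_self, z2, ← z1]
      exact m1.monotoneOn ⟨le_rfl, ht.1.trans ht.2⟩ ⟨by linarith, by linarith [ht.2]⟩ (by linarith)
    · have hc : Tendsto (fun s' => u2 (s' - r)) (nhdsWithin s (Iio s)) (nhds (u2 (s - r))) := by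
        have : Continuous (fun s' => u2 (s' - r)) := c2.comp (continuous_id.sub continuous_const)
        exact this.continuousAt.tendsto.mono_left nhdsWithin_le_nhds
      apply le_of_tendsto hc
      filter_upwards [Ioo_mem_nhdsLT h'] with s' hs'
      exact (key s' ⟨by linarith [hr.1, hs'.1], hs'.2⟩).2 r ⟨hr.1, hs'.1.le⟩

/-- main comparison -/
theorem hump_cmp {f : ℝ → ℝ} {τ1 τ2 q1 q2 : ℝ} {u1 u2 : ℝ → ℝ}
    (H1 : Hump f τ1 q1 u1) (H2 : Hump f τ2 q2 u2) (hτ : τ1 ≤ τ2)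
    (A : AscLE u1 τ1 u2 τ2) (hM : u1 τ1 < u2 τ2) :
    ∀ t ∈ Icc τ1 (q1 + τ1), ∀ θ ∈ Icc τ2 (q2 + τ2), u1 t = u2 θ →
      u1 (t - τ1) < u2 (θ - τ2) := by
  by_contra hcon
  push Not at hcon
  obtain ⟨t0, ht0, θ0, hθ0, he0, hb0⟩ := hcon
  have hτ1 := H1.τpos
  have hτ2 := H2.τpos
  have hq1 := H1.hq
  have hq2 := H2.hq
  -- compact set of bad pairs
  let B : Set (ℝ × ℝ) := (Icc τ1 (q1 + τ1) ×ˢ Icc τ2 (q2 + τ2)) ∩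
    ({p | u1 p.1 = u2 p.2} ∩ {p | u2 (p.2 - τ2) ≤ u1 (p.1 - τ1)})
  have hBc : IsCompact B := by
    apply (isCompact_Icc.prod isCompact_Icc).inter_right
    apply IsClosed.inter
    · exact isClosed_eq (H1.cont.comp continuous_fst) (H2.cont.comp continuous_snd)
    · exact isClosed_le (H2.cont.comp (continuous_snd.sub continuous_const))
        (H1.cont.comp (continuous_fst.sub continuous_const))
  obtain ⟨⟨t, θ⟩, hm, hmin⟩ := hBc.exists_isMinOn ⟨(t0, θ0), ⟨⟨ht0, hθ0⟩, he0, hb0⟩⟩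
    continuous_fst.continuousOn
  obtain ⟨⟨ht, hθ⟩, he, hb⟩ := hm
  simp only [mem_ofPred_eq] at ht hθ he hb
  have good : ∀ t' ∈ Ico τ1 t, ∀ θ' ∈ Icc τ2 (q2 + τ2), u1 t' = u2 θ' →
      u1 (t' - τ1) < u2 (θ' - τ2) := by
    intro t' ht' θ' hθ' he'
    by_contra hlt
    push Not at hlt
    have := hmin (show (t', θ') ∈ B from ⟨⟨⟨ht'.1, ht'.2.le.trans ht.2⟩, hθ'⟩, he', hlt⟩)
    simp at this
    linarith [ht'.2]
  have hw1M : u1 (t - τ1) ≤ u1 τ1 := H1.le_max (by linarith [ht.1]) (by linarith [ht.2])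
  have hw2 : 0 ≤ u2 (θ - τ2) := H2.nonneg (by linarith [hθ.1]) (by linarith [hθ.2])
  rcases le_or_gt (θ - τ2) τ2 with hA | hB
  · -- case A
    obtain ⟨tw, htw, htwe⟩ := H1.asc_time hw2 (hb.trans hw1M)
    have htwt : tw ≤ t - τ1 := by
      rcases le_total (t - τ1) τ1 with h | h
      · by_contra hlt
        push Not at hlt
        have := H1.mono ⟨by linarith [ht.1], h⟩ htw hlt
        linarith
      · exact htw.2.trans h
    have hal := A.weak H2.cont H2.mono H1.zero H2.zero H1.mono htw
      (s := θ - τ2) ⟨by linarith [hθ.1], hA⟩ htwe.ge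
    have key : ∀ r ∈ Icc 0 (θ - τ2), u2 (θ - τ2 - r) ≤ u1 (t - τ1 - r) := by
      intro r hr
      rcases le_total (t - τ1 - r) tw with h | h
      · -- below tw
        have hr' : tw - (t - τ1 - r) ∈ Icc 0 (θ - τ2) := ⟨by linarith, by linarith [hr.2]⟩
        have h1 := hal.2 _ hr'
        have h2 : u2 (θ - τ2 - r) ≤ u2 (θ - τ2 - (tw - (t - τ1 - r))) :=
          H2.mono.monotoneOn ⟨by linarith [hr.2], by linarith [hr.1]⟩
            ⟨by linarith [hr'.2], by linarith [hr'.1]⟩ (by linarith)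
        rw [show tw - (tw - (t - τ1 - r)) = t - τ1 - r by ring] at h1
        linarith
      · have h2 : u2 (θ - τ2 - r) ≤ u2 (θ - τ2) :=
          H2.mono.monotoneOn ⟨by linarith [hr.2], by linarith [hr.1]⟩
            ⟨by linarith [hθ.1], hA⟩ (by linarith [hr.1])
        have h3 : u2 (θ - τ2) ≤ u1 (t - τ1 - r) := by
          rcases le_total (t - τ1 - r) τ1 with h' | h'
          · rw [← htwe]
            exact H1.mono.monotoneOn htw ⟨htw.1.trans h, h'⟩ h
          · refine hb.trans ?_
            exact H1.anti.antitoneOn ⟨h', by linarith [ht.2, hr.1]⟩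
              ⟨by linarith [hr.1], by linarith [ht.2]⟩ (by linarith [hr.1])
        linarith
    -- monotonicity of u1(t-r) - u2(θ-r)
    have hmono : MonotoneOn (fun r => u1 (t - r) - u2 (θ - r)) (Icc 0 (θ - τ2)) := by
      have hd : ∀ r ∈ Ioo 0 (θ - τ2), HasDerivAt (fun r => u1 (t - r) - u2 (θ - r))
          (f (u1 (t - τ1 - r)) - f (u2 (θ - τ2 - r))) r := by
        intro r hr
        have h1 := (H1.de (t - r) (by linarith [hr.2, hal.1])).comp_const_sub t r
        have h2 := (H2.de (θ - r) (by linarith [hr.2])).comp_const_sub θ r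
        rw [show t - r - τ1 = t - τ1 - r by ring] at h1
        rw [show θ - r - τ2 = θ - τ2 - r by ring] at h2
        have h3 := h1.sub h2
        simp only [neg_neg] at h3
        exact h3
      apply monotoneOn_of_deriv_nonneg (convex_Icc _ _)
      · exact ((H1.cont.comp (continuous_const.sub continuous_id)).sub
          (H2.cont.comp (continuous_const.sub continuous_id))).continuousOn
      · intro r hr
        rw [interior_Icc] at hr
        exact (hd r hr).differentiableAt.differentiableWithinAt
      · intro r hr
        rw [interior_Icc] at hr
        rw [(hd r hr).deriv]
        have := H1.fb.mono.monotone (key r ⟨hr.1.le, hr.2.le⟩)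
        linarith
    have h1 := hmono ⟨le_rfl, by linarith [hθ.1]⟩ ⟨by linarith [hθ.1], le_rfl⟩
      (show (0:ℝ) ≤ θ - τ2 by linarith [hθ.1])
    simp only [sub_zero, he, sub_self] at h1
    rw [show θ - (θ - τ2) = τ2 by ring] at h1
    have h2 : u1 (t - (θ - τ2)) ≤ u1 τ1 :=
      H1.le_max (by linarith [hal.1]) (by linarith [ht.2, hθ.1])
    linarith
  · -- case B
    have hθlt : u2 θ < u2 (θ - τ2) := H2.anti ⟨hB.le, by linarith [hθ.2]⟩ hθ (by linarith)
    have hq1w : u1 q1 ≤ u2 (θ - τ2) := by rw [H1.qz]; exact hw2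
    obtain ⟨tw, htw, htwe⟩ := H1.desc_time hq1.le hq1w (hb.trans hw1M)
    have htwe1 : tw ∈ Icc τ1 (q1 + τ1) := ⟨htw.1, by linarith [htw.2]⟩
    have htwt : tw < t := by
      by_contra hlt
      push Not at hlt
      have := H1.anti.antitoneOn ht htwe1 hlt
      linarith
    have htwt2 : t - τ1 ≤ tw := by
      rcases le_total (t - τ1) τ1 with h | h
      · linarith [htw.1]
      · by_contra hlt
        push Not at hlt
        have := H1.anti htwe1 ⟨h, by linarith [ht.2]⟩ hlt
        linarith
    -- derivative at start
    have hg := good tw ⟨htw.1, htwt⟩ (θ - τ2) ⟨hB.le, by linarith [hθ.2]⟩ htwe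
    have hex : ∃ r0 ∈ Ioo 0 (t - tw), u2 (θ - τ2 + r0) < u1 (tw + r0) := by
      by_contra hno
      push Not at hno
      have hd1 : HasDerivWithinAt (fun r => u1 (tw + r) - u2 (θ - τ2 + r))
          (-f (u1 (tw - τ1)) - -f (u2 (θ - τ2 - τ2))) (Ici 0) 0 := by
        have a1 : HasDerivWithinAt (fun r => u1 (tw + r)) (-f (u1 (tw - τ1))) (Ici 0) 0 := by
          have := (H1.deR htw.1)
          have h2 : HasDerivWithinAt (fun r : ℝ => tw + r) 1 (Ici 0) 0 :=
            ((hasDerivAt_id (0:ℝ)).const_add tw).hasDerivWithinAt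
          have h3 := HasDerivWithinAt.comp (s' := Ici tw) (h := fun r : ℝ => tw + r) (h₂ := u1)
            (h₂' := -f (u1 (tw - τ1))) (0:ℝ)
            (by simpa using this) h2 (fun x hx => by simp at hx ⊢; exact hx)
          simpa [Function.comp_def] using h3
        have a2 : HasDerivWithinAt (fun r => u2 (θ - τ2 + r)) (-f (u2 (θ - τ2 - τ2))) (Ici 0) 0 := by
          have := (H2.de (θ - τ2 + 0) (by linarith)).comp_const_add (θ - τ2) 0
          simpa using this.hasDerivWithinAt
        exact a1.sub a2
      have hpos : 0 < -f (u1 (tw - τ1)) - -f (u2 (θ - τ2 - τ2)) := by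
        have := H1.fb.mono hg
        linarith
      have hlim := hd1.Ioi_of_Ici
      rw [hasDerivWithinAt_iff_tendsto_slope' (by simp)] at hlim
      have hev := hlim.eventually (lt_mem_nhds hpos)
      have hev2 : ∀ᶠ r in nhdsWithin (0:ℝ) (Ioi 0), r ∈ Ioo 0 (t - tw) :=
        Ioo_mem_nhdsGT (by linarith)
      obtain ⟨r, hr1, hr2⟩ := (hev.and hev2).exists
      have := hno r hr2
      rw [slope_def_field] at hr1
      have h0 : (0:ℝ) < r - 0 := by linarith [hr2.1]
      rw [lt_div_iff₀ h0] at hr1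
      simp only [add_zero] at hr1
      linarith
    obtain ⟨r0, hr0, hlt0⟩ := hex
    have hu1lt : u1 (tw + r0) < u2 (θ - τ2) := by
      rw [← htwe]
      exact H1.anti htwe1 ⟨by linarith [htw.1, hr0.1], by linarith [hr0.2, ht.2]⟩ (by linarith [hr0.1])
    obtain ⟨θs, hθs, hθse⟩ := H2.desc_time (v := u1 (tw + r0)) (a := θ - τ2) (b := θ - τ2 + r0)
      (by linarith [hr0.1]) hlt0.le hu1lt.le
    have hθslt : θs < θ - τ2 + r0 := by
      rcases hθs.2.eq_or_lt with h | h
      · rw [h] at hθse; linarith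
      · exact h
    have hbar := barrier (φ := fun r => u2 (θs + r)) (ψ := fun r => u1 (tw + r0 + r))
      (φ' := fun r => -f (u2 (θs + r - τ2))) (ψ' := fun r => -f (u1 (tw + r0 + r - τ1)))
      (a := 0) (b := t - tw - r0)
      (H2.cont.comp (continuous_const.add continuous_id))
      (fun x hx => by
        have := (H2.de (θs + x) (by linarith [hx.1, hθs.1])).comp_const_add θs x
        exact this.hasDerivWithinAt)
      (H1.cont.comp (continuous_const.add continuous_id))
      (fun x hx => by
        have := (H1.de (tw + r0 + x) (by linarith [hx.1, hr0.1, htw.1])).comp_const_add (tw + r0) x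
        exact this.hasDerivWithinAt)
      (by simp [hθse])
      (by
        intro x hx hxe
        have := good (tw + r0 + x) ⟨by linarith [hx.1, hr0.1, htw.1], by linarith [hx.2]⟩
          (θs + x) ⟨by linarith [hx.1, hθs.1], by linarith [hx.2, hθ.2, hθslt]⟩ hxe.symm
        have := H1.fb.mono this
        show -f (u2 (θs + x - τ2)) < -f (u1 (tw + r0 + x - τ1))
        linarith)
      (t - tw - r0) ⟨by linarith [hr0.2], le_rfl⟩
    rw [show tw + r0 + (t - tw - r0) = t by ring, he] at hbar
    have : u2 θ < u2 (θs + (t - tw - r0)) :=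
      H2.anti ⟨by linarith [hθs.1, hr0.2], by linarith [hθ.2]⟩ hθ (by linarith)
    linarith

structure PreHump (f : ℝ → ℝ) (τ : ℝ) (u : ℝ → ℝ) : Prop where
  fb : Fb f
  τpos : 0 < τ
  cont : Continuous u
  zero : u 0 = 0
  mono : StrictMonoOn u (Icc 0 τ)
  de : ∀ s, τ < s → HasDerivAt u (-f (u (s - τ))) s

def flipf (f : ℝ → ℝ) : ℝ → ℝ := fun v => -f (-v)

lemma Fb.flip {f : ℝ → ℝ} (h : Fb f) : Fb (flipf f) where
  cont := (h.cont.comp continuous_neg).neg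
  mono := fun a b hab => by
    have := h.mono (neg_lt_neg hab)
    simp only [flipf]; linarith
  zero := by simp [flipf, h.zero]

lemma Hump.pre {f : ℝ → ℝ} {τ q : ℝ} {u : ℝ → ℝ} (H : Hump f τ q u) : PreHump f τ u :=
  ⟨H.fb, H.τpos, H.cont, H.zero, H.mono, H.de⟩

lemma Hump.next_de {f : ℝ → ℝ} {τ q : ℝ} {u : ℝ → ℝ} (H : Hump f τ q u) {s : ℝ} (hs : τ < q + s) :
    HasDerivAt (fun s => -u (q + s)) (-(flipf f (-u (q + (s - τ))))) s := by
  have := ((H.de (q + s) hs).comp_const_add q s).neg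
  simp only [flipf, neg_neg]
  rw [show q + (s - τ) = q + s - τ by ring]
  simp only [neg_neg] at this
  exact this

lemma Hump.next {f : ℝ → ℝ} {τ q : ℝ} {u : ℝ → ℝ} (H : Hump f τ q u) :
    PreHump (flipf f) τ (fun s => -u (q + s)) where
  fb := H.fb.flip
  τpos := H.τpos
  cont := (H.cont.comp (continuous_const.add continuous_id)).neg
  zero := by simp [H.qz]
  mono := fun a ha b hb hab => by
    have := H.hq
    have := H.anti (a := q + a) (b := q + b) ⟨by linarith [ha.1], by linarith [ha.2]⟩
      ⟨by linarith [hb.1], by linarith [hb.2]⟩ (by linarith)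
    simp only; linarith
  de := fun s hs => H.next_de (by linarith [H.hq, H.τpos])

/-- MVT bound: if the derivative on (a,b) is ≤ -c then u b ≤ u a - c (b-a). -/
lemma decr_bound {u u' : ℝ → ℝ} {a b c : ℝ} (hab : a ≤ b) (hc : Continuous u)
    (hd : ∀ s ∈ Ioo a b, HasDerivAt u (u' s) s) (hb : ∀ s ∈ Ioo a b, u' s ≤ c) :
    u b ≤ u a + c * (b - a) := by
  have := (convex_Icc a b).image_sub_le_mul_sub_of_deriv_le (f := u) (C := c) hc.continuousOn
    (fun x hx => by rw [interior_Icc] at hx; exact (hd x hx).differentiableAt.differentiableWithinAt)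
    (fun x hx => by rw [interior_Icc] at hx; rw [(hd x hx).deriv]; exact hb x hx)
    a ⟨le_rfl, hab⟩ b ⟨hab, le_rfl⟩ hab
  linarith

lemma incr_bound {u u' : ℝ → ℝ} {a b c : ℝ} (hab : a ≤ b) (hc : Continuous u)
    (hd : ∀ s ∈ Ioo a b, HasDerivAt u (u' s) s) (hb : ∀ s ∈ Ioo a b, c ≤ u' s) :
    u a + c * (b - a) ≤ u b := by
  have := (convex_Icc a b).mul_sub_le_image_sub_of_le_deriv (f := u) (C := c) hc.continuousOn
    (fun x hx => by rw [interior_Icc] at hx; exact (hd x hx).differentiableAt.differentiableWithinAt)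
    (fun x hx => by rw [interior_Icc] at hx; rw [(hd x hx).deriv]; exact hb x hx)
    a ⟨le_rfl, hab⟩ b ⟨hab, le_rfl⟩ hab
  linarith

lemma PreHump.pos_asc {f : ℝ → ℝ} {τ : ℝ} {u : ℝ → ℝ} (H : PreHump f τ u) {s : ℝ}
    (h0 : 0 < s) (h1 : s ≤ τ) : 0 < u s := by
  have := H.mono ⟨le_rfl, H.τpos.le⟩ ⟨h0.le, h1⟩ h0
  rwa [H.zero] at this

/-- first zero: if u ≤ 0 somewhere after τ then there is a hump -/
lemma PreHump.hump_of_nonpos {f : ℝ → ℝ} {τ : ℝ} {u : ℝ → ℝ} (H : PreHump f τ u) {T : ℝ}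
    (hT : τ ≤ T) (hu : u T ≤ 0) : ∃ q, q ≤ T ∧ Hump f τ q u := by
  have hne : (Icc τ T ∩ u ⁻¹' {0}).Nonempty := by
    obtain ⟨t, ht, he⟩ := intermediate_value_Icc' hT H.cont.continuousOn
      ⟨hu, (H.pos_asc H.τpos le_rfl).le⟩
    exact ⟨t, ht, he⟩
  have hcpt : IsCompact (Icc τ T ∩ u ⁻¹' {0}) :=
    isCompact_Icc.inter_right ((isClosed_singleton).preimage H.cont)
  obtain ⟨q, hq, hmin⟩ := hcpt.exists_isMinOn hne continuous_id.continuousOn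
  have hq0 : u q = 0 := hq.2
  have hτq : τ < q := by
    rcases hq.1.1.eq_or_lt with h | h
    · rw [← h] at hq0; exact absurd hq0 (H.pos_asc H.τpos le_rfl).ne'
    · exact h
  refine ⟨q, hq.1.2, H.fb, H.τpos, hτq, H.cont, H.zero, H.mono, H.de, hq0, ?_⟩
  intro s hs
  rcases le_total s τ with h | h
  · exact H.pos_asc hs.1 h
  · by_contra hneg
    push Not at hneg
    obtain ⟨t, ht, he⟩ := intermediate_value_Icc' h H.cont.continuousOn
      ⟨hneg, (H.pos_asc H.τpos le_rfl).le⟩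
    have := hmin (show t ∈ _ from ⟨⟨ht.1, ht.2.trans (hs.2.le.trans hq.1.2)⟩, he⟩)
    simp at this
    linarith [hs.2, ht.2]

lemma PreHump.crossing {f : ℝ → ℝ} {τ v0 Mb : ℝ} {u : ℝ → ℝ} (H : PreHump f τ u) (hv0 : 0 < v0)
    (hf : ∀ v, 0 < v → v ≤ v0 → v < τ * f v) (hM : u τ ≤ Mb) :
    ∃ q, q ≤ Mb / f v0 + 4 * τ ∧ Hump f τ q u := by
  have hτ := H.τpos
  have hfv := H.fb.pos hv0
  have hMb : 0 ≤ Mb := (H.pos_asc hτ le_rfl).le.trans hM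
  have hMd : 0 ≤ Mb / f v0 := div_nonneg hMb hfv.le
  set s1 := Mb / f v0 + 3 * τ with hs1
  by_cases hne : ∃ T, τ ≤ T ∧ T ≤ Mb / f v0 + 4 * τ ∧ u T ≤ 0
  · obtain ⟨T, h1, h2, h3⟩ := hne
    obtain ⟨q, hq, hh⟩ := H.hump_of_nonpos h1 h3
    exact ⟨q, hq.trans h2, hh⟩
  push Not at hne
  exfalso
  have hpos : ∀ s, 0 ≤ s → s ≤ s1 + τ → 0 ≤ u s := by
    intro s h0 h1
    rcases le_total s τ with h | h
    · rcases h0.eq_or_lt with h' | h'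
      · rw [← h', H.zero]
      · exact (H.pos_asc h' h).le
    · exact (hne s h (by linarith)).le
  have hanti : AntitoneOn u (Icc τ (s1 + τ)) := by
    apply antitoneOn_of_deriv_nonpos (convex_Icc _ _) H.cont.continuousOn
    · intro x hx
      rw [interior_Icc] at hx
      exact (H.de x hx.1).differentiableAt.differentiableWithinAt
    · intro x hx
      rw [interior_Icc] at hx
      rw [(H.de x hx.1).deriv]
      have := H.fb.nonneg (hpos (x - τ) (by linarith [hx.1]) (by linarith [hx.2]))
      linarith
  have hu1 : u s1 < v0 := by
    by_contra hge
    push Not at hge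
    have := decr_bound (u := u) (a := 2 * τ) (b := s1) (c := -f v0) (by linarith) H.cont
      (fun s hs => H.de s (by linarith [hs.1])) (by
        intro s hs
        have h1 : u s1 ≤ u (s - τ) := hanti ⟨by linarith [hs.1], by linarith [hs.2]⟩
          ⟨by linarith, by linarith⟩ (by linarith [hs.2])
        have := H.fb.mono.monotone (hge.trans h1)
        linarith)
    have h2 : u (2 * τ) ≤ u τ := hanti ⟨le_rfl, by linarith⟩ ⟨by linarith, by linarith⟩ (by linarith)
    have h3 : f v0 * (s1 - 2 * τ) = Mb + f v0 * τ := by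
      rw [hs1]; field_simp; ring
    have : 0 < f v0 * τ := by positivity
    linarith
  have hu1p : 0 < u s1 := hne s1 (by linarith) (by linarith)
  have := decr_bound (u := u) (a := s1) (b := s1 + τ) (c := -f (u s1)) (by linarith) H.cont
      (fun s hs => H.de s (by linarith [hs.1])) (by
        intro s hs
        have h1 : u s1 ≤ u (s - τ) := hanti ⟨by linarith [hs.1], by linarith [hs.2]⟩
          ⟨by linarith, by linarith⟩ (by linarith [hs.2])
        have := H.fb.mono.monotone h1
        linarith)
  have h4 := hf _ hu1p hu1.le
  have h5 := hne (s1 + τ) (by linarith) (by linarith)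
  nlinarith

section cmp
variable {f : ℝ → ℝ} {τ1 τ2 q1 q2 : ℝ} {u1 u2 : ℝ → ℝ}

/-- C1: minima are ordered -/
theorem hump_min (H1 : Hump f τ1 q1 u1) (H2 : Hump f τ2 q2 u2) (hτ : τ1 ≤ τ2)
    (A : AscLE u1 τ1 u2 τ2) (hM : u1 τ1 < u2 τ2) : u2 (q2 + τ2) < u1 (q1 + τ1) := by
  have hτ1 := H1.τpos
  have hτ2 := H2.τpos
  have hq1 := H1.hq
  have hq2 := H2.hq
  have cmp := hump_cmp H1 H2 hτ A hM
  by_contra hge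
  push Not at hge
  have h1 : u2 (q2 + τ2) ≤ u1 τ1 := by
    have := H2.anti (a := q2) (b := q2 + τ2) ⟨by linarith, by linarith⟩ ⟨by linarith, le_rfl⟩ (by linarith)
    rw [H2.qz] at this
    linarith [H1.maxpos]
  obtain ⟨t, ht, he⟩ := H1.desc_time (a := τ1) (b := q1 + τ1) (by linarith) hge h1
  have := cmp t ht (q2 + τ2) ⟨by linarith, le_rfl⟩ he
  rw [add_sub_cancel_right, H2.qz] at this
  have := H1.nonneg (s := t - τ1) (by linarith [ht.1]) (by linarith [ht.2])
  linarith

/-- C2: order for the next hump -/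
theorem hump_asc (H1 : Hump f τ1 q1 u1) (H2 : Hump f τ2 q2 u2) (hτ : τ1 ≤ τ2)
    (A : AscLE u1 τ1 u2 τ2) (hM : u1 τ1 < u2 τ2) :
    AscLE (fun s => -u1 (q1 + s)) τ1 (fun s => -u2 (q2 + s)) τ2 := by
  have hτ1 := H1.τpos
  have hτ2 := H2.τpos
  have hq1 := H1.hq
  have hq2 := H2.hq
  have cmp := hump_cmp H1 H2 hτ A hM
  intro t ht s hs hlt
  simp only at hlt
  have key : ∀ r ∈ Icc 0 (min s t), -u2 (q2 + s - r) ≤ -u1 (q1 + t - r) := by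
    apply barrier (φ' := fun r => -f (u2 (q2 + s - r - τ2))) (ψ' := fun r => -f (u1 (q1 + t - r - τ1)))
    · exact (H2.cont.comp (continuous_const.sub continuous_id)).neg
    · intro x hx
      have hx2 := lt_min_iff.1 hx.2
      have := ((H2.de (q2 + s - x) (by linarith)).comp_const_sub (q2 + s) x).neg
      simp only [neg_neg] at this
      exact this.hasDerivWithinAt
    · exact (H1.cont.comp (continuous_const.sub continuous_id)).neg
    · intro x hx
      have hx2 := lt_min_iff.1 hx.2
      have := ((H1.de (q1 + t - x) (by linarith)).comp_const_sub (q1 + t) x).neg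
      simp only [neg_neg] at this
      exact this.hasDerivWithinAt
    · simp only [sub_zero]; linarith
    · intro x hx he
      have hx2 := lt_min_iff.1 hx.2
      have := cmp (q1 + t - x) ⟨by linarith, by linarith [ht.2, hx.1]⟩ (q2 + s - x)
        ⟨by linarith, by linarith [hs.2, hx.1]⟩ (by linarith)
      have := H1.fb.mono this
      linarith
  have hst : s ≤ t := by
    by_contra hcon
    push Not at hcon
    have h1 := key t ⟨ht.1, le_min hcon.le le_rfl⟩
    rw [show q1 + t - t = q1 by ring, H1.qz] at h1
    have h2 := H2.anti (a := q2) (b := q2 + s - t) ⟨by linarith, by linarith⟩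
      ⟨by linarith, by linarith [hs.2, ht.1]⟩ (by linarith)
    rw [H2.qz] at h2
    linarith
  refine ⟨hst, fun r hr => ?_⟩
  have := key r ⟨hr.1, le_min hr.2 (hr.2.trans hst)⟩
  simp only
  rwa [← add_sub_assoc, ← add_sub_assoc]

/-- C3: order before the crossing -/
theorem hump_precross (H1 : Hump f τ1 q1 u1) (H2 : Hump f τ2 q2 u2) (hτ : τ1 ≤ τ2)
    (A : AscLE u1 τ1 u2 τ2) (hM : u1 τ1 < u2 τ2) {σ : ℝ} (h0 : 0 ≤ σ) (h1 : σ ≤ q1 - τ1)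
    (h2 : σ ≤ q2 - τ2) : u1 (q1 - σ) ≤ u2 (q2 - σ) := by
  have hτ1 := H1.τpos
  have hτ2 := H2.τpos
  have cmp := hump_cmp H1 H2 hτ A hM
  have key : ∀ r ∈ Icc 0 (min (q1 - τ1) (q2 - τ2)), u1 (q1 - r) ≤ u2 (q2 - r) := by
    apply barrier (φ' := fun r => f (u1 (q1 - r - τ1))) (ψ' := fun r => f (u2 (q2 - r - τ2)))
    · exact (H1.cont.comp (continuous_const.sub continuous_id))
    · intro x hx
      have hx2 := lt_min_iff.1 hx.2
      have := ((H1.de (q1 - x) (by linarith)).comp_const_sub q1 x)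
      simp only [neg_neg] at this
      exact this.hasDerivWithinAt
    · exact (H2.cont.comp (continuous_const.sub continuous_id))
    · intro x hx
      have hx2 := lt_min_iff.1 hx.2
      have := ((H2.de (q2 - x) (by linarith)).comp_const_sub q2 x)
      simp only [neg_neg] at this
      exact this.hasDerivWithinAt
    · simp [H1.qz, H2.qz]
    · intro x hx he
      have hx2 := lt_min_iff.1 hx.2
      have := cmp (q1 - x) ⟨by linarith, by linarith [hx.1]⟩ (q2 - x)
        ⟨by linarith, by linarith [hx.1]⟩ he
      exact H1.fb.mono this
  exact key σ ⟨h0, le_min h1 h2⟩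

end cmp

/-! AscLE calculus -/
section asc
variable {u1 u2 u3 : ℝ → ℝ} {τ1 τ2 τ3 : ℝ}

lemma AscLE.le (A : AscLE u1 τ1 u2 τ2) (c1 : Continuous u1) (z : u1 0 ≤ u2 0)
    {s : ℝ} (h0 : 0 ≤ s) (h1 : s ≤ τ1) (h2 : s ≤ τ2) : u1 s ≤ u2 s := by
  by_contra hlt
  push Not at hlt
  rcases h0.eq_or_lt with h | h
  · subst h; linarith
  have hev : ∀ᶠ t in nhdsWithin s (Iio s), u2 s < u1 t :=
    (c1.continuousAt.tendsto.mono_left nhdsWithin_le_nhds).eventually (lt_mem_nhds hlt)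
  obtain ⟨t, ht1, ht2⟩ := (hev.and (Ioo_mem_nhdsLT h)).exists
  have := (A t ⟨ht2.1.le, ht2.2.le.trans h1⟩ s ⟨h0, h2⟩ ht1).1
  linarith [ht2.2]

lemma AscLE.max (A : AscLE u1 τ1 u2 τ2) (c1 : Continuous u1) (h1 : 0 < τ1) (hτ : τ1 ≤ τ2) :
    u1 τ1 ≤ u2 τ2 := by
  by_contra hlt
  push Not at hlt
  have hev : ∀ᶠ t in nhdsWithin τ1 (Iio τ1), u2 τ2 < u1 t :=
    (c1.continuousAt.tendsto.mono_left nhdsWithin_le_nhds).eventually (lt_mem_nhds hlt)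
  obtain ⟨t, ht1, ht2⟩ := (hev.and (Ioo_mem_nhdsLT h1)).exists
  have := (A t ⟨ht2.1.le, ht2.2.le⟩ τ2 ⟨by linarith, le_rfl⟩ ht1).1
  linarith [ht2.2]

lemma AscLE.trans (A : AscLE u1 τ1 u2 τ2) (B : AscLE u2 τ2 u3 τ3) (c2 : Continuous u2)
    (h2 : 0 ≤ τ2) (z2 : u2 0 = 0) (n3 : ∀ s ∈ Icc 0 τ3, 0 ≤ u3 s)
    (hM : ∀ t ∈ Icc 0 τ1, u1 t ≤ u2 τ2) : AscLE u1 τ1 u3 τ3 := by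
  intro t ht s hs hlt
  have hv : (u3 s + u1 t) / 2 ∈ Icc (u2 0) (u2 τ2) := by
    rw [z2]; exact ⟨by linarith [n3 s hs], by linarith [hM t ht]⟩
  obtain ⟨t2, ht2, he⟩ := intermediate_value_Icc h2 c2.continuousOn hv
  obtain ⟨a1, a2⟩ := A t ht t2 ht2 (by linarith)
  obtain ⟨b1, b2⟩ := B t2 ht2 s hs (by linarith)
  exact ⟨b1.trans a1, fun r hr => (b2 r hr).trans (a2 r ⟨hr.1, hr.2.trans b1⟩)⟩

/-- pointwise limits -/
lemma AscLE.lim_right {v : ℕ → ℝ → ℝ} (A : ∀ n, AscLE u1 τ1 (v n) τ2)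
    (hl : ∀ s ∈ Icc 0 τ2, Tendsto (fun n => v n s) atTop (nhds (u2 s))) : AscLE u1 τ1 u2 τ2 := by
  intro t ht s hs hlt
  have hev := (hl s hs).eventually (gt_mem_nhds hlt)
  obtain ⟨n, hn⟩ := hev.exists
  refine ⟨(A n t ht s hs hn).1, fun r hr => ?_⟩
  apply le_of_tendsto (hl (s - r) ⟨by linarith [hr.2], by linarith [hr.1, hs.2]⟩)
  filter_upwards [hev] with n hn
  exact (A n t ht s hs hn).2 r hr

/-- lower profile rule -/
lemma AscLE.of_lower {P w : ℝ → ℝ} {a τ : ℝ} (ha : 0 ≤ a) (haτ : a ≤ τ) (z : P 0 = w 0)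
    (hw : MonotoneOn w (Icc 0 τ)) (hP : MonotoneOn P (Icc 0 a))
    (hconc : ∀ s t r, 0 ≤ r → r ≤ s → s ≤ t → t ≤ a → P t - P (t - r) ≤ P s - P (s - r))
    (hinc : ∀ x y, 0 ≤ x → x ≤ y → y ≤ a → P y - P x ≤ w y - w x) : AscLE P a w τ := by
  intro t ht s hs hlt
  have hle : ∀ x, 0 ≤ x → x ≤ a → P x ≤ w x := fun x h0 h1 => by
    have := hinc 0 x le_rfl h0 h1
    linarith
  have hsa : s < a := by
    by_contra hge
    push Not at hge
    have h1 := hw ⟨ha, haτ⟩ hs hge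
    have h2 := hP ht ⟨ha, le_rfl⟩ ht.2
    linarith [hle a ha le_rfl]
  have hst : s ≤ t := by
    by_contra hge
    push Not at hge
    have h2 := hP ht ⟨hs.1, hsa.le⟩ hge.le
    linarith [hle s hs.1 hsa.le]
  refine ⟨hst, fun r hr => ?_⟩
  have h1 := hconc s t r hr.1 hr.2 hst ht.2
  have h2 := hinc (s - r) s (by linarith [hr.2]) (by linarith [hr.1]) hsa.le
  linarith

/-- upper profile rule -/
lemma AscLE.of_upper {P w : ℝ → ℝ} {a τ : ℝ} (hτa : τ ≤ a) (z : P 0 = w 0)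
    (hP : StrictMonoOn P (Icc 0 a))
    (hconc : ∀ s t r, 0 ≤ r → r ≤ s → s ≤ t → t ≤ a → P t - P (t - r) ≤ P s - P (s - r))
    (hinc : ∀ x y, 0 ≤ x → x ≤ y → y ≤ τ → w y - w x ≤ P y - P x) : AscLE w τ P a := by
  intro t ht s hs hlt
  have hst : s ≤ t := by
    by_contra hge
    push Not at hge
    have h2 := hP ⟨ht.1, ht.2.trans hτa⟩ hs hge
    have := hinc 0 t le_rfl ht.1 ht.2
    linarith
  refine ⟨hst, fun r hr => ?_⟩
  have h1 := hconc s t r hr.1 hr.2 hst (ht.2.trans hτa)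
  have h2 := hinc (t - r) t (by linarith [hr.2]) (by linarith [hr.1]) ht.2
  linarith

/-- level-limited linear rule -/
lemma AscLE.of_lin {w : ℝ → ℝ} {γ a τ sm : ℝ} (hγ : 0 < γ) (hsm : sm ∈ Icc 0 τ) (z : w 0 = 0)
    (hw : MonotoneOn w (Icc 0 τ)) (hlev : γ * a ≤ w sm)
    (hinc : ∀ x y, 0 ≤ x → x ≤ y → y ≤ sm → γ * (y - x) ≤ w y - w x) :
    AscLE (fun s => γ * s) a w τ := by
  intro t ht s hs hlt
  have hs1 : s ≤ sm := by
    by_contra hge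
    push Not at hge
    have h1 := hw hsm hs hge.le
    have : γ * t ≤ γ * a := by nlinarith [ht.2]
    linarith
  have h1 := hinc 0 s le_rfl hs.1 hs1
  have h2 : γ * s < γ * t := by linarith
  refine ⟨(lt_of_mul_lt_mul_left h2 hγ.le).le, fun r hr => ?_⟩
  have h3 := hinc (s - r) s (by linarith [hr.2]) (by linarith [hr.1]) hs1
  simp only at hlt ⊢
  nlinarith

end asc

def fP : ℝ → ℝ := fun v => Real.exp v - 1
def fN : ℝ → ℝ := fun v => 1 - Real.exp (-v)

lemma fP_fb : Fb fP where
  cont := by unfold fP; fun_prop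
  mono := fun a b h => by simp only [fP]; linarith [Real.exp_lt_exp.2 h]
  zero := by simp [fP]

lemma flip_fP : flipf fP = fN := by funext v; simp [flipf, fP, fN]
lemma flip_fN : flipf fN = fP := by funext v; simp [flipf, fP, fN]
lemma fN_fb : Fb fN := flip_fP ▸ fP_fb.flip

section steps
variable {f g : ℝ → ℝ} {τ : ℝ}

def stp (f g : ℝ → ℝ) (τ : ℝ) : ℕ → ℝ → ℝ
  | 0 => fun s => g (min s τ)
  | n + 1 => fun s => g (min s τ) - ∫ r in τ..(max s τ), f (stp f g τ n (r - τ))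

lemma stp_cont (hf : Continuous f) (hg : Continuous g) (n : ℕ) : Continuous (stp f g τ n) := by
  induction n with
  | zero => exact hg.comp (continuous_id.min continuous_const)
  | succ n ih =>
    have h1 : Continuous fun r => f (stp f g τ n (r - τ)) :=
      hf.comp (ih.comp (continuous_id.sub continuous_const))
    have h2 : Continuous fun x => ∫ r in τ..x, f (stp f g τ n (r - τ)) :=
      intervalIntegral.continuous_primitive (fun a b => h1.intervalIntegrable a b) τ
    exact (hg.comp (continuous_id.min continuous_const)).sub
      (h2.comp (continuous_id.max continuous_const))

lemma stp_low (n : ℕ) {s : ℝ} (hs : s ≤ τ) : stp f g τ n s = g s := by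
  cases n <;> simp [stp, hs]

lemma stp_agree (hτ : 0 < τ) (n : ℕ) : ∀ s, s ≤ (n + 1) * τ → stp f g τ (n + 1) s = stp f g τ n s := by
  induction n with
  | zero => intro s hs; rw [stp_low, stp_low] <;> simpa using hs
  | succ n ih =>
    intro s hs
    push_cast at hs
    simp only [stp]
    rw [sub_right_inj]
    apply intervalIntegral.integral_congr
    intro r hr
    rw [uIcc_of_le (le_max_right _ _)] at hr
    have : r ≤ max s τ := hr.2
    have h3 : max s τ ≤ (n + 1 + 1) * τ := max_le hs (by nlinarith [Nat.cast_nonneg (α := ℝ) n])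
    have := ih (r - τ) (by linarith)
    simp only [stp] at this
    simp only [this]

lemma stp_agree' (hτ : 0 < τ) (n : ℕ) (k : ℕ) {s : ℝ} (hs : s ≤ (n + 1) * τ) :
    stp f g τ (n + k) s = stp f g τ n s := by
  induction k with
  | zero => rfl
  | succ k ih =>
    rw [← ih, ← add_assoc]
    apply stp_agree hτ
    push_cast
    nlinarith [Nat.cast_nonneg (α := ℝ) k]

theorem exists_steps (hf : Continuous f) (hg : Continuous g) (hτ : 0 < τ) :
    ∃ U : ℝ → ℝ, Continuous U ∧ (∀ s, s ≤ τ → U s = g s) ∧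
      ∀ s, τ < s → HasDerivAt U (-f (U (s - τ))) s := by
  let U : ℝ → ℝ := fun s => stp f g τ ⌈s / τ⌉₊ s
  have hU : ∀ (n : ℕ) s, s ≤ n * τ → U s = stp f g τ n s := by
    intro n s hs
    have h1 : ⌈s / τ⌉₊ ≤ n := Nat.ceil_le.2 ((div_le_iff₀ hτ).2 hs)
    have h2 : s ≤ (⌈s / τ⌉₊ : ℝ) * τ := (div_le_iff₀ hτ).1 (Nat.le_ceil _)
    obtain ⟨k, rfl⟩ := Nat.exists_eq_add_of_le h1
    exact (stp_agree' hτ _ k (by linarith)).symm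
  have hev : ∀ s0, ∃ n : ℕ, s0 < n * τ := fun s0 => by
    obtain ⟨n, hn⟩ := exists_nat_gt (s0 / τ)
    exact ⟨n, (div_lt_iff₀ hτ).1 hn⟩
  have hev2 : ∀ (n : ℕ) s0, s0 < n * τ → U =ᶠ[nhds s0] stp f g τ n := fun n s0 h => by
    filter_upwards [Iio_mem_nhds h] with s hs using hU n s (le_of_lt hs)
  refine ⟨U, ?_, fun s hs => stp_low _ hs, ?_⟩
  · rw [continuous_iff_continuousAt]
    intro s0
    obtain ⟨n, hn⟩ := hev s0
    exact ((stp_cont hf hg n).continuousAt).congr (hev2 n s0 hn).symm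
  · intro s hs
    obtain ⟨n, hn⟩ := hev s
    have hn1 : s < ((n + 1 : ℕ) : ℝ) * τ := by push_cast; linarith
    have h1 : Continuous fun r => f (stp f g τ n (r - τ)) :=
      hf.comp ((stp_cont hf hg n).comp (continuous_id.sub continuous_const))
    have h2 : HasDerivAt (fun x => g τ - ∫ r in τ..x, f (stp f g τ n (r - τ)))
        (-f (stp f g τ n (s - τ))) s :=
      (intervalIntegral.integral_hasDerivAt_right (h1.intervalIntegrable _ _)
        (h1.stronglyMeasurableAtFilter _ _) h1.continuousAt).const_sub _
    rw [hU n (s - τ) (by linarith)]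
    refine h2.congr_of_eventuallyEq ?_
    filter_upwards [hev2 (n + 1) s hn1, Ioi_mem_nhds hs] with x hx hx2
    have hx2 : τ < x := hx2
    rw [hx]
    simp only [stp, min_eq_right hx2.le, max_eq_left hx2.le]

theorem steps_unique {u v : ℝ → ℝ} (hτ : 0 < τ) (hu : Continuous u) (hv : Continuous v)
    (du : ∀ s, τ < s → HasDerivAt u (-f (u (s - τ))) s)
    (dv : ∀ s, τ < s → HasDerivAt v (-f (v (s - τ))) s)
    (h : ∀ s ∈ Icc 0 τ, u s = v s) : ∀ s, 0 ≤ s → u s = v s := by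
  have key : ∀ n : ℕ, ∀ s, 0 ≤ s → s ≤ (n + 1) * τ → u s = v s := by
    intro n
    induction n with
    | zero => intro s h0 h1; exact h s ⟨h0, by simpa using h1⟩
    | succ n ih =>
      intro s h0 h1
      push_cast at h1
      by_cases hs : s ≤ τ
      · exact h s ⟨h0, hs⟩
      push Not at hs
      have hd : ∀ r ∈ Ioo τ s, HasDerivAt (fun r => u r - v r) (0 : ℝ) r := fun r hr => by
        have := (du r hr.1).sub (dv r hr.1)
        rwa [ih (r - τ) (by linarith [hr.1]) (by linarith [hr.2]), sub_self] at this
      have e1 := decr_bound (c := 0) hs.le (hu.sub hv) hd (fun _ _ => le_rfl)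
      have e2 := incr_bound (c := 0) hs.le (hu.sub hv) hd (fun _ _ => le_rfl)
      have := h τ ⟨hτ.le, le_rfl⟩
      simp only [Pi.sub_apply] at e1 e2
      linarith
  intro s hs
  obtain ⟨n, hn⟩ := exists_nat_gt (s / τ)
  have := (div_lt_iff₀ hτ).1 hn
  exact key n s hs (by linarith)

end steps

/-- Normalised slowly oscillating periodic orbit in scaled time. -/
structure Orb (τ q b : ℝ) (U : ℝ → ℝ) : Prop where
  de : ∀ s, HasDerivAt U (-fP (U (s - τ))) s
  H : Hump fP τ q U
  N : Hump fN τ b (fun s => -U (q + s))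
  per : ∀ s, U (s + (q + b)) = U s

lemma Hump.q_unique {f f' : ℝ → ℝ} {τ q τ' q' : ℝ} {u v : ℝ → ℝ} (H : Hump f τ q u)
    (H' : Hump f' τ' q' v) (h : ∀ s, 0 ≤ s → u s = v s) : q = q' := by
  have h1 := H.hq; have h2 := H.τpos; have h3 := H'.hq; have h4 := H'.τpos
  rcases lt_trichotomy q q' with hl | hl | hl
  · have := H'.pos q ⟨by linarith, hl⟩
    rw [← h q (by linarith), H.qz] at this; exact absurd this (lt_irrefl _)
  · exact hl
  · have := H.pos q' ⟨by linarith, hl⟩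
    rw [h q' (by linarith), H'.qz] at this; exact absurd this (lt_irrefl _)

theorem Orb.unique {τ q b q' b' : ℝ} {U V : ℝ → ℝ} (hU : Orb τ q b U) (hV : Orb τ q' b' V)
    (h : ∀ s ∈ Icc 0 τ, U s = V s) : U = V := by
  have e := steps_unique hU.H.τpos hU.H.cont hV.H.cont hU.H.de hV.H.de h
  have eq := hU.H.q_unique hV.H e
  subst eq
  have hq0 : 0 < q := hU.H.τpos.trans hU.H.hq
  have eb := hU.N.q_unique hV.N (fun s hs => by simp only [e (q + s) (by linarith)])
  subst eb
  have hL : 0 < q + b := by linarith [hU.N.τpos, hU.N.hq]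
  funext s
  have p1 : Function.Periodic U (q + b) := hU.per
  have p2 : Function.Periodic V (q + b) := hV.per
  obtain ⟨n, hn⟩ := exists_nat_gt (-s / (q + b))
  have := (div_lt_iff₀ hL).1 hn
  rw [← p1.nat_mul n s, ← p2.nat_mul n s]
  exact e _ (by linarith)

theorem SOPS.orb {α : ℝ} (hα : 0 < α) {x : ℝ → ℝ} (h : SOPS α x) :
    ∃ U q b t0, Orb α q b U ∧ ∀ t, x t = U (α * (t - t0)) := by
  obtain ⟨hx, q, b, hq, hb, ⟨t0, hp, hn⟩, per, -⟩ := h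
  have xc : Continuous x := continuous_iff_continuousAt.2 fun t => (hx t).continuousAt
  have hL : 0 < q + b := by linarith
  have np : ∀ t ∈ Ioo (-b) 0, x (t + t0) < 0 := fun t ht => by
    have := hn (t + (q + b)) ⟨by linarith [ht.1], by linarith [ht.2]⟩
    rwa [show t + (q + b) + t0 = t + t0 + (q + b) by ring, per] at this
  have yc : Continuous fun t => x (t + t0) := by fun_prop
  have cl : ∀ {a c : ℝ} (_ : a < c) {P : ℝ → ℝ} (_ : Continuous P) (_ : ∀ t ∈ Ioo a c, 0 ≤ P t),
      0 ≤ P a ∧ 0 ≤ P c := by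
    intro a c hac P hP h0
    have hcl : Icc a c ⊆ {t | 0 ≤ P t} := by
      rw [← closure_Ioo hac.ne]
      exact closure_minimal h0 (isClosed_le continuous_const hP)
    exact ⟨hcl ⟨le_rfl, hac.le⟩, hcl ⟨hac.le, le_rfl⟩⟩
  have A := cl (a := 0) (c := q) (by linarith) yc (fun t ht => (hp t ht).le)
  have B := cl (a := q) (c := q + b) (by linarith) yc.neg (fun t ht => by
    have := hn t ht
    show 0 ≤ -x (t + t0); linarith)
  have C := cl (a := -b) (c := 0) (by linarith) yc.neg (fun t ht => by
    have := np t ht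
    show 0 ≤ -x (t + t0); linarith)
  simp only [Pi.neg_apply] at B C
  have z0 : x (0 + t0) = 0 := le_antisymm (by linarith [C.2]) A.1
  have zq : x (q + t0) = 0 := le_antisymm (by linarith [B.1]) A.2
  let U : ℝ → ℝ := fun s => x (s / α + t0)
  have Ude : ∀ s, HasDerivAt U (-fP (U (s - α))) s := fun s => by
    have h1 : HasDerivAt (fun s : ℝ => s / α + t0) (1 / α) s :=
      ((hasDerivAt_id s).div_const α).add_const t0
    have := (hx (s / α + t0)).comp s h1
    refine this.congr_deriv ?_
    simp only [U, fP]
    rw [show (s - α) / α + t0 = s / α + t0 - 1 by field_simp; ring]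
    field_simp
  have Uc : Continuous U := continuous_iff_continuousAt.2 fun t => (Ude t).continuousAt
  have Upos : ∀ s ∈ Ioo 0 (α * q), 0 < U s := fun s hs => by
    exact hp (s / α) ⟨by have := hs.1; positivity, by rw [div_lt_iff₀ hα]; linarith [hs.2]⟩
  have Uneg : ∀ s ∈ Ioo (-(α * b)) 0, U s < 0 := fun s hs => by
    exact np (s / α) ⟨by rw [lt_div_iff₀ hα]; linarith [hs.1], by rw [div_lt_iff₀ hα]; linarith [hs.2]⟩
  have Uneg2 : ∀ s ∈ Ioo (α * q) (α * (q + b)), U s < 0 := fun s hs => by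
    exact hn (s / α) ⟨by rw [lt_div_iff₀ hα]; linarith [hs.1], by rw [div_lt_iff₀ hα]; linarith [hs.2]⟩
  have qa : α < α * q := by nlinarith
  have ba : α < α * b := by nlinarith
  have Uqz : U (α * q) = 0 := by simp only [U]; rw [mul_div_cancel_left₀ _ hα.ne']; exact zq
  have Uz : U 0 = 0 := by simp only [U]; rw [zero_div]; exact z0
  have Uper : ∀ s, U (s + (α * q + α * b)) = U s := fun s => by
    simp only [U]
    rw [show (s + (α * q + α * b)) / α + t0 = s / α + t0 + (q + b) by field_simp; ring, per]
  refine ⟨U, α * q, α * b, t0, ⟨Ude, ?_, ?_, Uper⟩, fun t => ?_⟩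
  · refine ⟨fP_fb, hα, qa, Uc, Uz, ?_, fun s _ => Ude s, Uqz, Upos⟩
    apply strictMonoOn_of_deriv_pos (convex_Icc _ _) Uc.continuousOn
    intro s hs
    rw [interior_Icc] at hs
    rw [(Ude s).deriv]
    have := fP_fb.neg (Uneg (s - α) ⟨by linarith [hs.1], by linarith [hs.2]⟩)
    linarith
  · have de2 : ∀ s, HasDerivAt (fun s => -U (α * q + s)) (fP (U (α * q + s - α))) s := fun s => by
      have := ((Ude (α * q + s)).comp_const_add (α * q) s).neg
      simp only [neg_neg] at this
      exact this
    have c2 : Continuous (fun s => -U (α * q + s)) := by fun_prop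
    refine ⟨fN_fb, hα, ba, c2, by simp [Uqz], ?_, fun s _ => ?_, ?_, fun s hs => ?_⟩
    · apply strictMonoOn_of_deriv_pos (convex_Icc _ _) c2.continuousOn
      intro s hs
      rw [interior_Icc] at hs
      rw [(de2 s).deriv]
      exact fP_fb.pos (Upos _ ⟨by linarith [hs.1], by linarith [hs.2]⟩)
    · refine (de2 s).congr_deriv ?_
      simp only [fN, fP]
      rw [show α * q + (s - α) = α * q + s - α by ring]; ring_nf
    · have := Uper 0
      rw [zero_add, Uz] at this
      simp [this]
    · have := Uneg2 (α * q + s) ⟨by linarith [hs.1], by linarith [hs.2]⟩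
      show 0 < -U (α * q + s); linarith
  · simp only [U]
    rw [mul_div_cancel_left₀ _ hα.ne', sub_add_cancel]

theorem Orb.sops {α : ℝ} (hα : 0 < α) {q b : ℝ} {U : ℝ → ℝ} (h : Orb α q b U) :
    SOPS α (fun t => U (α * t)) := by
  have hq : 1 < q / α := by rw [lt_div_iff₀ hα]; linarith [h.H.hq]
  have hb : 1 < b / α := by rw [lt_div_iff₀ hα]; linarith [h.N.hq]
  have e : α * (q / α + b / α) = q + b := by field_simp
  have hL : 0 < q / α + b / α := by linarith
  have neg : ∀ s ∈ Ioo q (q + b), U s < 0 := fun s hs => by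
    have := h.N.pos (s - q) ⟨by linarith [hs.1], by linarith [hs.2]⟩
    simp only [add_sub_cancel] at this; linarith
  have hqp : 0 < q := by linarith [h.H.hq]
  refine ⟨fun t => ?_, q / α, b / α, hq, hb, ⟨0, fun t ht => ?_, fun t ht => ?_⟩, fun t => ?_, ?_⟩
  · have h1 : HasDerivAt (fun s : ℝ => α * s) α t := by simpa using (hasDerivAt_id t).const_mul α
    have := (h.de (α * t)).comp t h1
    refine this.congr_deriv ?_
    simp only [fP]
    rw [show α * (t - 1) = α * t - α by ring]; ring
  · rw [add_zero]
    have := (lt_div_iff₀ hα).1 ht.2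
    exact h.H.pos _ ⟨mul_pos hα ht.1, by linarith⟩
  · rw [add_zero]
    have h1 := (div_lt_iff₀ hα).1 ht.1
    have h2 := mul_lt_mul_of_pos_left ht.2 hα
    rw [e] at h2
    exact neg _ ⟨by linarith, by linarith⟩
  · show U (α * (t + (q / α + b / α))) = U (α * t)
    rw [mul_add, e, h.per]
  · intro T hT hp
    by_contra hlt
    push Not at hlt
    have hp' : ∀ s, U (s + α * T) = U s := fun s => by
      have := hp (s / α)
      simp only [mul_add] at this
      rwa [mul_div_cancel₀ _ hα.ne'] at this
    have h2 := mul_lt_mul_of_pos_left hlt hα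
    rw [e] at h2
    set S := α * T
    have hS : 0 < S := mul_pos hα hT
    have hS0 : U S = 0 := by rw [← zero_add S, hp', h.H.zero]
    have hSq : S = q := by
      rcases lt_trichotomy S q with hl | hl | hl
      · have := h.H.pos S ⟨hS, hl⟩; linarith
      · exact hl
      · have := neg S ⟨hl, h2⟩; linarith
    have m : 0 < min q b := lt_min hqp (by linarith [h.N.hq])
    have h3 := h.H.pos (min q b / 2) ⟨by linarith, by linarith [min_le_left q b]⟩
    have h4 := neg (min q b / 2 + q) ⟨by linarith, by linarith [min_le_right q b]⟩
    have h5 := hp' (min q b / 2)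
    rw [hSq] at h5
    linarith

def NL (f : ℝ → ℝ) : Prop := ∀ v, 0 ≤ v → v ≤ 0.0285 → 0.985 * v ≤ f v ∧ f v ≤ 1.015 * v

lemma exp_quad {v : ℝ} (h0 : 0 ≤ v) (h1 : v ≤ 0.0285) : Real.exp v ≤ 1 + v + 0.51 * v ^ 2 := by
  have h := Real.exp_bound' h0 (by linarith) (n := 3) (by norm_num)
  norm_num [Finset.sum_range_succ, Nat.factorial] at h
  nlinarith [sq_nonneg v, mul_nonneg h0 (sq_nonneg v), mul_nonneg (sub_nonneg.2 h1) (sq_nonneg v)]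

lemma fP_nl : NL fP := fun v h0 h1 => by
  simp only [fP]
  have := Real.add_one_le_exp v
  have := exp_quad h0 h1
  constructor <;> nlinarith

lemma fN_nl : NL fN := fun v h0 h1 => by
  simp only [fN]
  have h2 := Real.add_one_le_exp (-v)
  have h3 := exp_quad h0 h1
  have h4 : Real.exp (-v) ≤ 1 - 0.985 * v := by
    rw [Real.exp_neg]
    apply inv_le_of_inv_le₀ (by nlinarith)
    have := Real.quadratic_le_exp_of_nonneg h0
    have h5 : (1 - 0.985 * v)⁻¹ ≤ 1 + v + v ^ 2 / 2 := by
      rw [inv_le_iff_one_le_mul₀ (by nlinarith)]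
      have h7 : v ^ 2 ≤ 0.0285 * v := by nlinarith
      have h8 : v ^ 3 ≤ 0.0285 ^ 2 * v := by nlinarith
      nlinarith
    linarith
  constructor <;> linarith

lemma small_half {f : ℝ → ℝ} (hf : Fb f) (hn : NL f) {γ : ℝ} (hγ : 0 < γ) (hγ1 : γ ≤ 0.015) :
    ∃ G q, Hump f 1.9 q G ∧ (∀ s, s ≤ 1.9 → G s = γ * s) ∧
      AscLE (fun s => 1.005 * γ * s) 1.9 (fun s => -G (q + s)) 1.9 ∧
      1.005 * γ * 1.9 ≤ -G (q + 1.9) := by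
  obtain ⟨G, Gc, G0, Gd⟩ := exists_steps (τ := 1.9) hf.cont
    (g := fun s => γ * s) (by fun_prop) (by norm_num)
  have pre : PreHump f 1.9 G := ⟨hf, by norm_num, Gc, by rw [G0 0 (by norm_num)]; simp,
    fun a ha b hb hab => by rw [G0 a ha.2, G0 b hb.2]; exact mul_lt_mul_of_pos_left hab hγ, Gd⟩
  have Gτ : G 1.9 = 1.9 * γ := by rw [G0 _ le_rfl]; ring
  have dq : ∀ c s : ℝ, HasDerivAt (fun s : ℝ => c * (s - 1.9) ^ 2 / 2) (c * (s - 1.9)) s := by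
    intro c s
    have := ((((hasDerivAt_id s).sub_const 1.9).pow 2).const_mul c).div_const 2
    refine this.congr_deriv ?_
    simp; ring
  have lo : ∀ s, 1.9 ≤ s → s ≤ 3.8 → γ * (1.9 - 0.5075 * (s - 1.9) ^ 2) ≤ G s := by
    intro s h1 h2
    have := incr_bound (u := fun s => G s + (1.015 * γ) * (s - 1.9) ^ 2 / 2)
      (u' := fun s => -f (G (s - 1.9)) + 1.015 * γ * (s - 1.9)) (c := 0) h1 (by fun_prop)
      (fun r hr => (Gd r hr.1).add (dq _ r)) (fun r hr => by
        rw [G0 _ (by linarith [hr.2])]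
        have := (hn (γ * (r - 1.9)) (mul_nonneg hγ.le (by linarith [hr.1]))
          (by nlinarith [hr.1, hr.2])).2
        linarith)
    simp only [Gτ] at this
    linarith
  have hi : G 3.8 ≤ 0.1221 * γ := by
    have := decr_bound (u := fun s => G s + (0.985 * γ) * (s - 1.9) ^ 2 / 2)
      (u' := fun s => -f (G (s - 1.9)) + 0.985 * γ * (s - 1.9)) (c := 0) (a := 1.9) (b := 3.8)
      (by norm_num) (by fun_prop)
      (fun r hr => (Gd r hr.1).add (dq _ r)) (fun r hr => by
        rw [G0 _ (by linarith [hr.2])]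
        have := (hn (γ * (r - 1.9)) (mul_nonneg hγ.le (by linarith [hr.1]))
          (by nlinarith [hr.1, hr.2])).1
        linarith)
    simp only [Gτ] at this
    norm_num at this ⊢
    linarith
  have up1 : ∀ s, 1.9 ≤ s → s ≤ 3.8 → G s ≤ 1.9 * γ := fun s h1 h2 => by
    have := decr_bound (u := G) (u' := fun s => -f (G (s - 1.9))) (c := 0) h1 Gc
      (fun r hr => Gd r hr.1) (fun r hr => by
        rw [G0 _ (by linarith [hr.2])]
        have := hf.nonneg (v := γ * (r - 1.9)) (mul_nonneg hγ.le (by linarith [hr.1]))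
        linarith)
    linarith
  have h387 : G 3.87 ≤ 0 := by
    have := decr_bound (u := G) (u' := fun s => -f (G (s - 1.9))) (c := -(1.8614 * γ))
      (a := 3.8) (b := 3.87) (by norm_num) Gc
      (fun r hr => Gd r (by linarith [hr.1])) (fun r hr => by
        have e1 := lo (r - 1.9) (by linarith [hr.1]) (by linarith [hr.2])
        have e2 : (r - 1.9 - 1.9) ^ 2 ≤ 0.0049 := by nlinarith [hr.1, hr.2]
        have e0 : 1.8975 * γ ≤ G (r - 1.9) := by nlinarith
        have e3 := up1 (r - 1.9) (by linarith [hr.1]) (by linarith [hr.2])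
        have := (hn (G (r - 1.9)) (by linarith) (by linarith)).1
        linarith)
    linarith
  obtain ⟨q, hq, H⟩ := pre.hump_of_nonpos (by norm_num) h387
  have q38 : 3.8 < q := by
    by_contra hcon
    push Not at hcon
    have h1 := lo 3.8 (by norm_num) le_rfl
    have h2 := H.anti.antitoneOn (a := q) (b := 3.8) ⟨H.hq.le, by linarith⟩
      ⟨by norm_num, by linarith [H.hq]⟩ hcon
    rw [H.qz] at h2
    norm_num at h1
    nlinarith
  have wde : ∀ s, 0 ≤ s → HasDerivAt (fun s => -G (q + s)) (f (G (q + s - 1.9))) s := fun s hs => by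
    have := ((Gd (q + s) (by linarith)).comp_const_add q s).neg
    simp only [neg_neg] at this
    exact this
  have wc : Continuous fun s => -G (q + s) := by fun_prop
  have wl : ∀ s, 0 ≤ s → s ≤ 1.23 → 0.985 * γ * (1.9 - 0.5075 * (s + 0.07) ^ 2) ≤ f (G (q + s - 1.9)) := by
    intro s h0 h1
    have e1 := lo (q + s - 1.9) (by linarith) (by linarith)
    have e2 : (q + s - 1.9 - 1.9) ^ 2 ≤ (s + 0.07) ^ 2 := by
      apply pow_le_pow_left₀ <;> linarith
    have e4 : (s + 0.07) ^ 2 ≤ 1.69 := by nlinarith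
    have e3 := up1 (q + s - 1.9) (by linarith) (by linarith)
    have e5 : γ * (1.9 - 0.5075 * (s + 0.07) ^ 2) ≤ G (q + s - 1.9) := by
      refine le_trans ?_ e1
      apply mul_le_mul_of_nonneg_left _ hγ.le
      linarith
    have e6 : 0 ≤ γ * (1.9 - 0.5075 * (s + 0.07) ^ 2) := mul_nonneg hγ.le (by linarith)
    have := (hn (G (q + s - 1.9)) (by linarith) (by linarith)).1
    linarith
  have dc : ∀ s : ℝ, HasDerivAt (fun s : ℝ => 0.985 * γ * (1.9 * s - 0.5075 * (s + 0.07) ^ 3 / 3))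
      (0.985 * γ * (1.9 - 0.5075 * (s + 0.07) ^ 2)) s := by
    intro s
    have h1 := (((((hasDerivAt_id s).add_const 0.07).pow 3).const_mul 0.5075).div_const 3)
    have := ((((hasDerivAt_id s).const_mul 1.9).sub h1).const_mul (0.985 * γ))
    refine this.congr_deriv ?_
    simp only [id]; norm_num; left; ring
  have lev : 1.005 * γ * 1.9 ≤ -G (q + 1.23) := by
    have := incr_bound (u := fun s => -G (q + s) - (0.985 * γ * (1.9 * s - 0.5075 * (s + 0.07) ^ 3 / 3)))
      (u' := fun s => f (G (q + s - 1.9)) - 0.985 * γ * (1.9 - 0.5075 * (s + 0.07) ^ 2)) (c := 0)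
      (a := 0) (b := 1.23) (by norm_num) (by fun_prop)
      (fun r hr => (wde r hr.1.le).sub (dc r)) (fun r hr => by
        have := wl r hr.1.le hr.2.le
        linarith)
    simp only [add_zero, H.qz] at this
    norm_num at this ⊢
    linarith
  have wm : MonotoneOn (fun s => -G (q + s)) (Icc 0 1.9) := fun a ha b hb hab => by
    have := H.anti.antitoneOn (a := q + a) (b := q + b) ⟨by linarith [ha.1], by linarith [ha.2]⟩
      ⟨by linarith [hb.1], by linarith [hb.2]⟩ (by linarith)
    simp only; linarith
  refine ⟨G, q, H, G0, ?_, ?_⟩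
  · refine AscLE.of_lin (sm := 1.23) (by positivity) ⟨by norm_num, by norm_num⟩ (by simp [H.qz]) wm lev ?_
    intro x y h0 h1 h2
    have := incr_bound (u := fun s => -G (q + s)) (u' := fun s => f (G (q + s - 1.9)))
      (c := 1.005 * γ) h1 wc
      (fun r hr => wde r (by linarith [hr.1])) (fun r hr => by
        have e := wl r (by linarith [hr.1]) (by linarith [hr.2])
        have : (r + 0.07) ^ 2 ≤ 1.69 := by nlinarith [hr.1, hr.2]
        nlinarith)
    linarith
  · have := wm (a := 1.23) (b := 1.9) ⟨by norm_num, by norm_num⟩ ⟨by norm_num, by norm_num⟩ (by norm_num)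
    linarith

lemma lin_lin {γ γ' : ℝ} (h0 : 0 < γ') (h : γ' ≤ γ) {a τ : ℝ} (ha : 0 ≤ a) (haτ : a ≤ τ) :
    AscLE (fun s => γ' * s) a (fun s => γ * s) τ := by
  refine AscLE.of_lin (sm := a) h0 ⟨ha, haτ⟩ (by simp) ?_ ?_ ?_
  · intro x _ y _ hxy; exact mul_le_mul_of_nonneg_left hxy (by linarith)
  · exact mul_le_mul_of_nonneg_right h ha
  · intro x y _ hxy _; nlinarith

lemma lin_weaken {γ γ' : ℝ} (h0 : 0 < γ') (h : γ' ≤ γ) {a τ : ℝ} (ha : 0 ≤ a) {T : ℝ → ℝ}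
    (A : AscLE (fun s => γ * s) a T τ) (n : ∀ s ∈ Icc 0 τ, 0 ≤ T s) :
    AscLE (fun s => γ' * s) a T τ := by
  refine (lin_lin h0 h ha le_rfl).trans A (by fun_prop) ha (by simp) n ?_
  intro t ht
  have := ht.1; have := ht.2
  nlinarith

lemma Hump.next_nonneg {f : ℝ → ℝ} {τ q : ℝ} {u : ℝ → ℝ} (H : Hump f τ q u) :
    ∀ s ∈ Icc 0 τ, 0 ≤ -u (q + s) := fun s hs => by
  rcases eq_or_lt_of_le hs.1 with h | h
  · rw [← h]; simp [H.qz]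
  · exact (H.next.pos_asc h hs.2).le

lemma small_step {f : ℝ → ℝ} (hn : NL f) {γ α q : ℝ} (hγ : 0 < γ) (hγ1 : γ ≤ 0.015)
    (hα : 1.9 ≤ α) {T : ℝ → ℝ} (H : Hump f α q T) (A : AscLE (fun s => γ * s) 1.9 T α) :
    AscLE (fun s => 1.002 * γ * s) 1.9 (fun s => -T (q + s)) α := by
  have A' := lin_weaken (γ' := γ / 1.001) (by positivity) (by rw [div_le_iff₀ (by norm_num)]; linarith)
    (by norm_num) A (fun s hs => H.nonneg hs.1 (by linarith [hs.2, H.hq]))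
  have mx := A.max (by fun_prop) (by norm_num) hα
  obtain ⟨G, qG, HG, G0, AG, lev⟩ := small_half H.fb hn (γ := γ / 1.001) (by positivity)
    (by rw [div_le_iff₀ (by norm_num)]; linarith)
  have A2 : AscLE G 1.9 T α := by
    intro t ht s hs hts
    rw [G0 t ht.2] at hts
    obtain ⟨h1, h2⟩ := A' t ht s hs hts
    refine ⟨h1, fun r hr => ?_⟩
    rw [G0 _ (by linarith [hr.1, ht.2])]
    exact h2 r hr
  have B := hump_asc HG H hα A2 (by
    rw [G0 _ le_rfl]
    refine lt_of_lt_of_le ?_ mx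
    rw [div_mul_eq_mul_div, div_lt_iff₀ (by norm_num)]
    nlinarith)
  have B2 := AG.trans B HG.next.cont (by norm_num) (by simp [HG.qz]) H.next_nonneg (fun t ht => by
    refine le_trans ?_ lev
    exact mul_le_mul_of_nonneg_left ht.2 (by positivity))
  refine lin_weaken (by positivity) ?_ (by norm_num) B2 H.next_nonneg
  rw [← mul_div_assoc, le_div_iff₀ (by norm_num)]; nlinarith

lemma AscLE.eq_of_max {u1 u2 : ℝ → ℝ} {τ : ℝ} (A : AscLE u1 τ u2 τ) (hτ : 0 < τ)
    (c1 : Continuous u1) (c2 : Continuous u2) (m1 : StrictMonoOn u1 (Icc 0 τ))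
    (m2 : StrictMonoOn u2 (Icc 0 τ)) (z1 : u1 0 = 0) (z2 : u2 0 = 0) (h : u2 τ ≤ u1 τ) :
    ∀ s ∈ Icc 0 τ, u1 s = u2 s := by
  intro s hs
  have h1 := A.le c1 (by rw [z1, z2]) hs.1 hs.2 hs.2
  have h2 := (A.weak c2 m2 z1 z2 m1 (t := τ) (s := τ) ⟨hτ.le, le_rfl⟩ ⟨hτ.le, le_rfl⟩ h).2
    (τ - s) ⟨by linarith [hs.2], by linarith [hs.1]⟩
  simp only [sub_sub_cancel] at h2
  exact le_antisymm h1 h2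

lemma AscLE.self {u : ℝ → ℝ} {τ : ℝ} (m : StrictMonoOn u (Icc 0 τ)) : AscLE u τ u τ := by
  intro t ht s hs h
  have hst : s < t := (m.lt_iff_lt hs ht).1 h
  exact ⟨hst.le, fun r hr => m.monotoneOn ⟨by linarith [hr.2], by linarith [hr.1, hs.2]⟩
    ⟨by linarith [hr.2], by linarith [hr.1, ht.2]⟩ (by linarith)⟩

theorem hump_asc_le {f : ℝ → ℝ} {τ q1 q2 : ℝ} {u1 u2 : ℝ → ℝ} (H1 : Hump f τ q1 u1)
    (H2 : Hump f τ q2 u2) (A : AscLE u1 τ u2 τ) :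
    AscLE (fun s => -u1 (q1 + s)) τ (fun s => -u2 (q2 + s)) τ := by
  rcases lt_or_ge (u1 τ) (u2 τ) with h | h
  · exact hump_asc H1 H2 le_rfl A h
  · have e := A.eq_of_max H1.τpos H1.cont H2.cont H1.mono H2.mono H1.zero H2.zero h
    have e2 := steps_unique H1.τpos H1.cont H2.cont H1.de H2.de e
    have e3 := H1.q_unique H2 e2
    subst e3
    intro t ht s hs
    have hq : 0 < q1 := H1.τpos.trans H1.hq
    have key := AscLE.self H1.next.mono t ht s hs
    simp only at key ⊢
    intro h4
    rw [← e2 _ (by linarith [hs.1])] at h4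
    obtain ⟨k1, k2⟩ := key h4
    refine ⟨k1, fun r hr => ?_⟩
    rw [← e2 _ (by linarith [hr.2])]
    exact k2 r hr

lemma Orb.next_next {τ q b : ℝ} {Y : ℝ → ℝ} (h : Orb τ q b Y) :
    (fun s => -(fun s => -Y (q + s)) (b + s)) = Y := by
  funext s
  simp only [neg_neg]
  rw [← h.per s]; congr 1; ring

lemma Orb.nonneg {τ q b : ℝ} {Y : ℝ → ℝ} (h : Orb τ q b Y) : ∀ s ∈ Icc 0 τ, 0 ≤ Y s :=
  fun s hs => h.H.nonneg hs.1 (by linarith [hs.2, h.H.hq])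

lemma Orb.neg_before {τ q b : ℝ} {Y : ℝ → ℝ} (h : Orb τ q b Y) {s : ℝ} (h0 : -b < s) (h1 : s < 0) :
    Y s < 0 := by
  have := h.N.pos (b + s) ⟨by linarith, by linarith⟩
  rw [← h.per s, show s + (q + b) = q + (b + s) by ring]
  linarith

lemma Orb.lin_init {τ q b : ℝ} {Y : ℝ → ℝ} (h : Orb τ q b Y) :
    ∃ γ, 0 < γ ∧ AscLE (fun s => γ * s) 1.9 Y τ := by
  have hτ := h.H.τpos
  have hb := h.N.hq
  have hc : ContinuousOn (fun s => -fP (Y (s - τ))) (Icc 0 (τ / 2)) := by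
    have := fP_fb.cont; have := h.H.cont; fun_prop
  obtain ⟨s0, hs0, hmin⟩ := isCompact_Icc.exists_isMinOn ⟨0, ⟨le_rfl, by linarith⟩⟩ hc
  set c := -fP (Y (s0 - τ)) with hcdef
  have hcp : 0 < c := by
    have := fP_fb.neg (h.neg_before (s := s0 - τ) (by linarith [hs0.1]) (by linarith [hs0.2]))
    linarith
  have hY : 0 < Y (τ / 2) := h.H.pos _ ⟨by linarith, by linarith [h.H.hq]⟩
  refine ⟨min c (Y (τ / 2) / 1.9), lt_min hcp (by positivity), ?_⟩
  refine AscLE.of_lin (sm := τ / 2) (lt_min hcp (by positivity)) ⟨by linarith, by linarith⟩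
    h.H.zero h.H.mono.monotoneOn ?_ ?_
  · have := min_le_right c (Y (τ / 2) / 1.9)
    rwa [le_div_iff₀ (by norm_num)] at this
  · intro x y h0 hxy hy
    have := incr_bound (u := Y) (c := c) hxy h.H.cont (fun r _ => h.de r) (fun r hr =>
      hmin ⟨by linarith [hr.1], by linarith [hr.2]⟩)
    have h3 := min_le_left c (Y (τ / 2) / 1.9)
    nlinarith

theorem Orb.lin_step {α q b γ : ℝ} {Y : ℝ → ℝ} (hα : 1.9 ≤ α) (h : Orb α q b Y) (h0 : 0 < γ)
    (h1 : γ ≤ 0.0149) (A : AscLE (fun s => γ * s) 1.9 Y α) :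
    AscLE (fun s => 1.002 * γ * s) 1.9 Y α := by
  have B := small_step fP_nl h0 (by linarith) hα h.H A
  have C := small_step fN_nl (by positivity) (by linarith) hα h.N B
  rw [h.next_next] at C
  exact lin_weaken (by positivity) (by linarith) (by norm_num) C h.nonneg

theorem Orb.lin {α q b : ℝ} {Y : ℝ → ℝ} (hα : 1.9 ≤ α) (h : Orb α q b Y) :
    AscLE (fun s => 0.0149 * s) 1.9 Y α := by
  obtain ⟨γ, hγ, A⟩ := h.lin_init
  have key : ∀ n : ℕ, AscLE (fun s => min (1.002 ^ n * γ) 0.0149 * s) 1.9 Y α := by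
    intro n
    induction n with
    | zero => exact lin_weaken (lt_min (by positivity) (by norm_num)) (by simp) (by norm_num) A h.nonneg
    | succ n ih =>
      have hp : 0 < min (1.002 ^ n * γ) 0.0149 := lt_min (by positivity) (by norm_num)
      refine lin_weaken (lt_min (by positivity) (by norm_num)) ?_ (by norm_num)
        (h.lin_step hα hp (min_le_right _ _) ih) h.nonneg
      rcases le_total (1.002 ^ n * γ) 0.0149 with h1 | h1
      · rw [min_eq_left h1]
        refine (min_le_left _ _).trans (le_of_eq ?_)
        ring
      · rw [min_eq_right h1]
        exact (min_le_right _ _).trans (by norm_num)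
  obtain ⟨n, hn⟩ := pow_unbounded_of_one_lt (0.0149 / γ) (by norm_num : (1 : ℝ) < 1.002)
  have := key n
  rwa [min_eq_right ((div_lt_iff₀ hγ).1 hn).le] at this

structure Cy (τ : ℝ) (X : ℝ → ℝ) (q b : ℝ) : Prop where
  H : Hump fP τ q X
  N : Hump fN τ b (fun s => -X (q + s))
  lin : AscLE (fun s => 0.0149 * s) 1.9 X τ
  lip : ∀ x y, 0 ≤ x → x ≤ y → y ≤ τ → X y - X x ≤ y - x
  hq : q ≤ τ / fP 1 + 4 * τ
  hb : b ≤ τ * exp τ / fN 0.5 + 4 * τ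

lemma Cy.mk' {τ : ℝ} (hτ : 1.9 ≤ τ) {X : ℝ → ℝ} (P : PreHump fP τ X)
    (lin : AscLE (fun s => 0.0149 * s) 1.9 X τ)
    (lip : ∀ x y, 0 ≤ x → x ≤ y → y ≤ τ → X y - X x ≤ y - x) : ∃ q b, Cy τ X q b := by
  have hτ0 : 0 < τ := by linarith
  have Xle : ∀ s, 0 ≤ s → s ≤ τ → X s ≤ s := fun s h0 h1 => by
    have := lip 0 s le_rfl h0 h1
    rw [P.zero] at this; linarith
  obtain ⟨q, hq, H⟩ := P.crossing (v0 := 1) (Mb := τ) (by norm_num) (fun v h0 h1 => by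
    have := Real.add_one_lt_exp h0.ne'
    simp only [fP]; nlinarith) (Xle τ hτ0.le le_rfl)
  have P2 : PreHump fN τ (fun s => -X (q + s)) := flip_fP ▸ H.next
  have hM : (fun s => -X (q + s)) τ ≤ τ * exp τ := by
    have := decr_bound (u := fun s => -X (q + s)) (u' := fun s => -fN (-X (q + (s - τ)))) (a := 0) (b := τ)
      (c := exp τ) hτ0.le P2.cont (fun s hs => flip_fP ▸ H.next_de (by linarith [H.hq, hs.1]))
      (fun s hs => by
        have h1 := H.le_max (s := q + (s - τ)) (by linarith [H.hq, hs.1]) (by linarith [hs.2])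
        have h2 := Xle τ hτ0.le le_rfl
        have h3 := Real.exp_le_exp.2 (h1.trans h2)
        simp only [fN, neg_neg]; linarith)
    simp only [add_zero, H.qz] at this
    linarith
  obtain ⟨b, hb, N⟩ := P2.crossing (v0 := 0.5) (Mb := τ * exp τ) (by norm_num) (fun v h0 h1 => by
    have h3 : v * 0.75 ≤ fN v := by
      simp only [fN]
      have h4 : exp (-v) ≤ 1 - 0.75 * v := by
        rw [Real.exp_neg]
        apply inv_le_of_inv_le₀ (by nlinarith)
        have := Real.quadratic_le_exp_of_nonneg h0.le
        have h5 : (1 - 0.75 * v)⁻¹ ≤ 1 + v + v ^ 2 / 2 := by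
          rw [inv_le_iff_one_le_mul₀ (by nlinarith)]
          nlinarith [mul_nonneg h0.le (sub_nonneg.2 h1), mul_nonneg (sq_nonneg v) (sub_nonneg.2 h1)]
        linarith
      linarith
    nlinarith) hM
  exact ⟨q, b, H, N, lin, lip, hq, hb⟩

lemma Cy.wlin {τ : ℝ} (hτ : 1.9 ≤ τ) {X : ℝ → ℝ} {q b : ℝ} (h : Cy τ X q b) :
    AscLE (fun s => 0.0149 * s) 1.9 (fun s => -X (q + s)) τ :=
  lin_weaken (by norm_num) (by norm_num) (by norm_num)
    (small_step fP_nl (by norm_num) (by norm_num) hτ h.H h.lin) h.H.next_nonneg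

lemma Cy.next {τ : ℝ} (hτ : 1.9 ≤ τ) {X : ℝ → ℝ} {q b : ℝ} (h : Cy τ X q b) :
    ∃ q' b', Cy τ (fun s => X (q + b + s)) q' b' := by
  have e : (fun s => -(fun s => -X (q + s)) (b + s)) = fun s => X (q + b + s) := by
    funext s; simp only [neg_neg, add_assoc]
  have hq := h.H.hq; have hb := h.N.hq; have h0 := h.H.τpos
  refine Cy.mk' hτ (e ▸ flip_fN ▸ h.N.next) ?_ ?_
  · have := small_step fN_nl (by norm_num) (by norm_num) hτ h.N (h.wlin hτ)
    rw [e] at this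
    refine lin_weaken (by norm_num) (by norm_num) (by norm_num) this ?_
    have := h.N.next_nonneg
    intro s hs
    have := this s hs
    simp only [neg_neg, ← add_assoc] at this
    exact this
  · intro x y hx hxy hy
    have := decr_bound (u := X) (a := q + b + x) (b := q + b + y) (c := 1) (by linarith) h.H.cont
      (fun r hr => h.H.de r (by linarith [hr.1])) (fun r _ => by
        simp only [fP]; linarith [Real.exp_pos (X (r - τ))])
    linarith

lemma Cy.up {τ : ℝ} {X : ℝ → ℝ} {q b : ℝ} (h : Cy τ X q b) {s : ℝ} (hs : 0 ≤ s) : X s ≤ s := by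
  have h1 : ∀ s, 0 ≤ s → s ≤ τ → X s ≤ s := fun s h0 h1 => by
    have := h.lip 0 s le_rfl h0 h1
    rw [h.H.zero] at this; linarith
  rcases le_total s τ with h2 | h2
  · exact h1 s hs h2
  · have := decr_bound (u := X) (a := τ) (b := s) (c := 1) h2 h.H.cont
      (fun r hr => h.H.de r (by linarith [hr.1])) (fun r _ => by
        simp only [fP]; linarith [Real.exp_pos (X (r - τ))])
    linarith [h1 τ h.H.τpos.le le_rfl]

lemma Cy.lipT {τ : ℝ} {X : ℝ → ℝ} {q b : ℝ} (h : Cy τ X q b) {T x y : ℝ} (hx : 0 ≤ x) (hxy : x ≤ y)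
    (hy : y ≤ T) : |X y - X x| ≤ exp T * (y - x) := by
  have hτ := h.H.τpos
  have A : ∀ x y, 0 ≤ x → x ≤ y → y ≤ T → y ≤ τ → |X y - X x| ≤ exp T * (y - x) := by
    intro x y h0 h1 h2 h3
    have := h.lip x y h0 h1 h3
    have m := h.H.mono.monotoneOn (a := x) (b := y) ⟨h0, by linarith⟩ ⟨by linarith, h3⟩ h1
    rw [abs_of_nonneg (by linarith)]
    have : 1 ≤ exp T := Real.one_le_exp (by linarith)
    nlinarith
  have B : ∀ x y, τ ≤ x → x ≤ y → y ≤ T → |X y - X x| ≤ exp T * (y - x) := by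
    intro x y h0 h1 h2
    have e : 1 ≤ exp T := Real.one_le_exp (by linarith)
    have u := decr_bound (u := X) (c := exp T) h1 h.H.cont
      (fun r hr => h.H.de r (by linarith [hr.1])) (fun r _ => by
        simp only [fP]; linarith [Real.exp_pos (X (r - τ))])
    have l := incr_bound (u := X) (c := -exp T) h1 h.H.cont
      (fun r hr => h.H.de r (by linarith [hr.1])) (fun r hr => by
        have := h.up (s := r - τ) (by linarith [hr.1])
        have := Real.exp_le_exp.2 (show X (r - τ) ≤ T by linarith [hr.2])
        simp only [fP]; linarith)
    rw [abs_le]; constructor <;> linarith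
  rcases le_total y τ with h1 | h1
  · exact A x y hx hxy hy h1
  rcases le_total τ x with h2 | h2
  · exact B x y h2 hxy hy
  have a := A x τ hx h2 (h1.trans hy) le_rfl
  have b := B τ y le_rfl h1 hy
  have := abs_sub_le (X y) (X τ) (X x)
  linarith

lemma Cy.seq {τ : ℝ} (hτ : 1.9 ≤ τ) : ∃ (X : ℕ → ℝ → ℝ) (q b : ℕ → ℝ), (∀ n, Cy τ (X n) (q n) (b n)) ∧
    (∀ s, s ≤ τ → X 0 s = s) ∧ ∀ n s, X (n + 1) s = X n (q n + b n + s) := by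
  obtain ⟨U, Uc, U0, Ud⟩ := exists_steps (τ := τ) fP_fb.cont (g := fun s => s) (by fun_prop) (by linarith)
  obtain ⟨q0, b0, h0⟩ := Cy.mk' hτ (X := U) ⟨fP_fb, by linarith, Uc, U0 0 (by linarith), fun a ha b hb hab => by
      rw [U0 a ha.2, U0 b hb.2]; exact hab, Ud⟩ (by
      refine AscLE.of_lin (sm := 1.9) (by norm_num) ⟨by norm_num, hτ⟩ (U0 0 (by linarith)) ?_ ?_ ?_
      · intro a ha b hb hab; rw [U0 a ha.2, U0 b hb.2]; exact hab
      · rw [U0 _ hτ]; norm_num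
      · intro x y h1 h2 h3; rw [U0 x (by linarith), U0 y (by linarith)]; linarith) (fun x y h1 h2 h3 => by
      rw [U0 x (by linarith), U0 y (by linarith)])
  choose! Q B hQB using fun (p : (ℝ → ℝ) × ℝ × ℝ) (h : Cy τ p.1 p.2.1 p.2.2) => h.next hτ
  let S : ℕ → (ℝ → ℝ) × ℝ × ℝ := fun n => Nat.rec (U, q0, b0)
    (fun _ p => (fun s => p.1 (p.2.1 + p.2.2 + s), Q p, B p)) n
  have hS : ∀ n, Cy τ (S n).1 (S n).2.1 (S n).2.2 := by
    intro n
    induction n with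
    | zero => exact h0
    | succ n ih => exact hQB _ ih
  exact ⟨fun n => (S n).1, fun n => (S n).2.1, fun n => (S n).2.2, hS, U0, fun n s => rfl⟩

lemma Cy.dom {τ : ℝ} {X Y : ℝ → ℝ} {q b q' b' : ℝ} (h : Cy τ X q b) (H : Hump fP τ q' Y)
    (N : Hump fN τ b' (fun s => -Y (q' + s))) (A : AscLE Y τ X τ) :
    AscLE (fun s => Y (q' + b' + s)) τ (fun s => X (q + b + s)) τ := by
  have := hump_asc_le N h.N (hump_asc_le H h.H A)
  simp only [neg_neg, ← add_assoc] at this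
  exact this

lemma asc_id {τ : ℝ} {X Y : ℝ → ℝ} (hX : ∀ s, s ≤ τ → X s = s) (z : Y 0 = 0) (hτ : 0 < τ)
    (lip : ∀ x y, 0 ≤ x → x ≤ y → y ≤ τ → Y y - Y x ≤ y - x) : AscLE Y τ X τ := by
  refine AscLE.of_upper le_rfl (by rw [hX 0 hτ.le, z]) ?_ ?_ ?_
  · intro a ha b hb hab; rw [hX a ha.2, hX b hb.2]; exact hab
  · intro s t r h0 h1 h2 h3
    rw [hX t h3, hX _ (by linarith), hX s (by linarith), hX (s - r) (by linarith)]; linarith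
  · intro x y h0 h1 h2
    rw [hX x (by linarith), hX y h2]; exact lip x y h0 h1 h2

lemma pos_of_limit {f u : ℝ → ℝ} {τ q : ℝ} (hf : Fb f) (hτ : 0 < τ) (uc : Continuous u)
    (de : ∀ s, τ < s → HasDerivAt u (-f (u (s - τ))) s) (p : ∀ s ∈ Ioc 0 τ, 0 < u s) (hq : τ ≤ q)
    (qz : u q = 0) (nn : ∀ s ∈ Icc 0 q, 0 ≤ u s) : τ < q ∧ ∀ s ∈ Ioo 0 q, 0 < u s := by
  have hK : IsCompact (Icc τ q ∩ {s | u s = 0}) :=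
    isCompact_Icc.inter_right (isClosed_eq uc continuous_const)
  obtain ⟨c, ⟨hc, hc0⟩, hmin⟩ := hK.exists_isLeast ⟨q, ⟨hq, le_rfl⟩, qz⟩
  have hc0 : u c = 0 := hc0
  have hcτ : τ < c := by
    rcases eq_or_lt_of_le hc.1 with h | h
    · have := p τ ⟨hτ, le_rfl⟩
      rw [h, hc0] at this; exact absurd this (lt_irrefl _)
    · exact h
  have pos : ∀ s ∈ Ioo 0 c, 0 < u s := by
    intro s hs
    rcases le_total s τ with h | h
    · exact p s ⟨hs.1, h⟩
    · refine lt_of_le_of_ne (nn s ⟨hs.1.le, by linarith [hs.2, hc.2]⟩) fun h0 => ?_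
      have := hmin ⟨⟨h, by linarith [hs.2, hc.2]⟩, h0.symm⟩
      linarith [hs.2]
  have hcq : c = q := by
    by_contra hne
    have hlt : c < q := lt_of_le_of_ne hc.2 hne
    have hm : c < min q (c + τ) := lt_min hlt (by linarith)
    have := strictAntiOn_of_deriv_neg (convex_Icc c (min q (c + τ))) uc.continuousOn (fun s hs => by
      rw [interior_Icc] at hs
      have hs2 := lt_min_iff.1 hs.2
      rw [(de s (by linarith [hs.1])).deriv]
      have := hf.pos (pos (s - τ) ⟨by linarith [hs.1], by linarith [hs2.2]⟩)
      linarith)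
    have := this ⟨le_rfl, hm.le⟩ ⟨hm.le, le_rfl⟩ hm
    have h2 := nn (min q (c + τ)) ⟨by linarith, min_le_left _ _⟩
    linarith
  rw [hcq] at hcτ pos
  exact ⟨hcτ, pos⟩

/-- periodic extension -/
lemma per_ext {τ q b : ℝ} {U : ℝ → ℝ} (hτ : 0 < τ) (hL : 0 < q + b)
    (Ud : ∀ s, τ < s → HasDerivAt U (-fP (U (s - τ))) s)
    (hp : ∀ s, 0 ≤ s → U (s + (q + b)) = U s) :
    ∃ Z : ℝ → ℝ, (∀ s, 0 ≤ s → Z s = U s) ∧ (∀ s, HasDerivAt Z (-fP (Z (s - τ))) s) ∧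
      ∀ s, Z (s + (q + b)) = Z s := by
  have hpn : ∀ (n : ℕ) s, 0 ≤ s → U (s + n * (q + b)) = U s := by
    intro n
    induction n with
    | zero => intro s _; simp
    | succ n ih =>
      intro s hs
      rw [← ih s hs, ← hp (s + n * (q + b)) (by positivity)]
      congr 1; push_cast; ring
  let Z : ℝ → ℝ := fun s => U (Int.fract (s / (q + b)) * (q + b))
  have Zp : ∀ s, Z (s + (q + b)) = Z s := fun s => by
    simp only [Z]
    rw [add_div, div_self hL.ne', Int.fract_add_one]
  have ZU : ∀ s, 0 ≤ s → Z s = U s := fun s hs => by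
    simp only [Z]
    have h0 : 0 ≤ s / (q + b) := by positivity
    rw [← hpn ⌊s / (q + b)⌋₊ _ (mul_nonneg (Int.fract_nonneg _) hL.le)]
    congr 1
    have h1 : ((⌊s / (q + b)⌋₊ : ℕ) : ℝ) = (⌊s / (q + b)⌋ : ℤ) := by
      rw [← Int.natCast_floor_eq_floor h0]; rfl
    rw [h1, ← add_mul, Int.fract_add_floor]
    field_simp
  refine ⟨Z, ZU, fun s => ?_, Zp⟩
  have Zper : Function.Periodic Z (q + b) := Zp
  obtain ⟨n, hn⟩ := exists_nat_gt ((τ - s) / (q + b))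
  have hn := (div_lt_iff₀ hL).1 hn
  have h1 := (Ud (s + n * (q + b)) (by linarith)).comp_add_const s (n * (q + b))
  rw [← ZU _ (by linarith), show s + n * (q + b) - τ = (s - τ) + n * (q + b) by ring,
    Zper.nat_mul n (s - τ)] at h1
  refine h1.congr_of_eventuallyEq ?_
  filter_upwards [Ioi_mem_nhds (show τ - n * (q + b) < s by linarith)] with x hx
  have hx : τ - n * (q + b) < x := hx
  rw [← ZU _ (by linarith), Zper.nat_mul n x]

theorem exists_orb {τ : ℝ} (hτ : 1.9 ≤ τ) : ∃ Z q b, Orb τ q b Z ∧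
    ∀ Y qY bY, Orb τ qY bY Y → AscLE Y τ Z τ := by
  have hτ0 : 0 < τ := by linarith
  obtain ⟨X, q, b, hC, X0, Xs⟩ := Cy.seq hτ
  have dec : ∀ n, AscLE (X (n + 1)) τ (X n) τ := by
    intro n
    induction n with
    | zero => exact asc_id X0 (hC 1).H.zero hτ0 (hC 1).lip
    | succ n ih =>
      have := (hC n).dom (hC (n + 1)).H (hC (n + 1)).N ih
      rwa [← funext (Xs n), ← funext (Xs (n + 1))] at this
  have domY : ∀ Y qY bY, Orb τ qY bY Y → ∀ n, AscLE Y τ (X n) τ := by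
    intro Y qY bY hY n
    induction n with
    | zero =>
      refine asc_id X0 hY.H.zero hτ0 fun x y _ h1 _ => ?_
      have := decr_bound (u := Y) (c := 1) h1 hY.H.cont (fun r _ => hY.de r) (fun r _ => by
        simp only [fP]; linarith [Real.exp_pos (Y (r - τ))])
      linarith
    | succ n ih =>
      have := (hC n).dom hY.H hY.N ih
      rw [← funext (Xs n)] at this
      convert this using 1
      funext s
      rw [← hY.per s, add_comm]
  -- limit profile
  let pr : ℝ → ℝ := fun s => max 0 (min s τ)
  have pr0 : ∀ s, 0 ≤ pr s := fun s => le_max_left _ _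
  have prτ : ∀ s, pr s ≤ τ := fun s => max_le hτ0.le (min_le_right _ _)
  have pre : ∀ s, 0 ≤ s → s ≤ τ → pr s = s := fun s h0 h1 => by simp [pr, h0, h1]
  have Xanti : ∀ s, 0 ≤ s → s ≤ τ → Antitone (fun n => X n s) := fun s h0 h1 =>
    antitone_nat_of_succ_le fun n => (dec n).le (hC _).H.cont
      (by rw [(hC _).H.zero, (hC _).H.zero]) h0 h1 h1
  have Xnn : ∀ n s, 0 ≤ s → s ≤ τ → 0 ≤ X n s := fun n s h0 h1 =>
    (hC n).H.nonneg h0 (by linarith [(hC n).H.hq])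
  have lim0 : ∀ s, 0 ≤ s → s ≤ τ → Tendsto (fun n => X n s) atTop (nhds (⨅ n, X n s)) :=
    fun s h0 h1 => tendsto_atTop_ciInf (Xanti s h0 h1) ⟨0, by rintro _ ⟨n, rfl⟩; exact Xnn n s h0 h1⟩
  let g : ℝ → ℝ := fun s => ⨅ n, X n (pr s)
  have gl : ∀ s, Tendsto (fun n => X n (pr s)) atTop (nhds (g s)) := fun s => lim0 _ (pr0 s) (prτ s)
  have prLip : ∀ x y, |pr x - pr y| ≤ |x - y| := fun x y => by
    have h1 := abs_max_sub_max_le_max 0 (min x τ) 0 (min y τ)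
    have h2 := abs_min_sub_min_le_max x τ y τ
    simp only [sub_self, abs_zero, pr] at *
    refine h1.trans (max_le (abs_nonneg _) (h2.trans (max_le le_rfl (abs_nonneg _))))
  have Xlip : ∀ n x y, 0 ≤ x → 0 ≤ y → x ≤ τ → y ≤ τ → |X n x - X n y| ≤ |x - y| := by
    have aux : ∀ n x y, 0 ≤ x → x ≤ y → y ≤ τ → |X n x - X n y| ≤ |x - y| := by
      intro n x y h0 h1 h2
      have := (hC n).lip x y h0 h1 h2
      have m := (hC n).H.mono.monotoneOn (a := x) (b := y) ⟨h0, by linarith⟩ ⟨by linarith, h2⟩ h1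
      rw [abs_sub_comm, abs_of_nonneg (by linarith), abs_sub_comm, abs_of_nonneg (by linarith)]
      exact this
    intro n x y h0 h1 h2 h3
    rcases le_total x y with h | h
    · exact aux n x y h0 h h3
    · rw [abs_sub_comm, abs_sub_comm x]; exact aux n y x h1 h h2
  have gLip : ∀ x y, |g x - g y| ≤ |x - y| := fun x y => by
    refine le_of_tendsto ((gl x).sub (gl y)).abs (Eventually.of_forall fun n => ?_)
    exact (Xlip n _ _ (pr0 x) (pr0 y) (prτ x) (prτ y)).trans (prLip x y)
  have gc : Continuous g := by
    have : LipschitzWith 1 g := LipschitzWith.of_dist_le_mul fun x y => by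
      simpa [Real.dist_eq] using gLip x y
    exact this.continuous
  obtain ⟨U, Uc, U0, Ud⟩ := exists_steps (τ := τ) fP_fb.cont gc hτ0
  -- pointwise convergence
  have conv : ∀ k : ℕ, ∀ s, 0 ≤ s → s ≤ (k + 1) * τ → Tendsto (fun n => X n s) atTop (nhds (U s)) := by
    intro k
    induction k with
    | zero =>
      intro s h0 h1
      have h1 : s ≤ τ := by simpa using h1
      have := gl s
      rwa [pre s h0 h1, ← U0 s h1] at this
    | succ k ih =>
      intro s h0 h1
      push_cast at h1
      have hk : 0 ≤ (k : ℝ) * τ := by positivity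
      rcases le_total s τ with h2 | h2
      · exact ih s h0 (by linarith)
      have fl : ∀ {V : ℝ → ℝ} (_ : Continuous V) (_ : ∀ s, τ < s → HasDerivAt V (-fP (V (s - τ))) s),
          V s = V τ + ∫ r in τ..s, -fP (V (r - τ)) := by
        intro V Vc Vd
        have : ∫ r in τ..s, -fP (V (r - τ)) = V s - V τ := by
          apply intervalIntegral.integral_eq_sub_of_hasDerivAt_of_le h2 Vc.continuousOn
            (fun r hr => Vd r hr.1)
          apply Continuous.intervalIntegrable
          have := fP_fb.cont; fun_prop
        linarith
      rw [fl Uc Ud]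
      simp_rw [fun n => fl (hC n).H.cont (hC n).H.de]
      refine (ih τ hτ0.le (by linarith)).add ?_
      refine intervalIntegral.tendsto_integral_filter_of_dominated_convergence (fun _ => exp s + 1)
        (Eventually.of_forall fun n => ?_) (Eventually.of_forall fun n => ?_) (by simp) ?_
      · apply Continuous.aestronglyMeasurable
        have := fP_fb.cont; have := (hC n).H.cont; fun_prop
      · refine Eventually.of_forall fun r hr => ?_
        rw [uIoc_of_le h2] at hr
        have := (hC n).up (s := r - τ) (by linarith [hr.1])
        have := Real.exp_le_exp.2 (show X n (r - τ) ≤ s by linarith [hr.2])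
        have h5 := Real.exp_pos (X n (r - τ))
        rw [Real.norm_eq_abs, abs_le]
        simp only [fP]
        constructor <;> linarith
      · refine Eventually.of_forall fun r hr => ?_
        rw [uIoc_of_le h2] at hr
        exact ((fP_fb.cont.tendsto _).comp (ih (r - τ) (by linarith [hr.1]) (by linarith [hr.2]))).neg
  have conv : ∀ s, 0 ≤ s → Tendsto (fun n => X n s) atTop (nhds (U s)) := fun s hs => by
    obtain ⟨k, hk⟩ := exists_nat_gt (s / τ)
    have := (div_lt_iff₀ hτ0).1 hk
    exact conv k s hs (by linarith)
  -- subsequence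
  obtain ⟨p, -, φ, hφ, hp⟩ := (isCompact_Icc (a := τ) (b := τ / fP 1 + 4 * τ)).prod
    (isCompact_Icc (a := τ) (b := τ * exp τ / fN 0.5 + 4 * τ)) |>.tendsto_subseq
    (x := fun n => (q n, b n)) (fun n => ⟨⟨(hC n).H.hq.le, (hC n).hq⟩, ⟨(hC n).N.hq.le, (hC n).hb⟩⟩)
  obtain ⟨Q, B⟩ := p
  have hq : Tendsto (fun n => q (φ n)) atTop (nhds Q) := (continuous_fst.tendsto _).comp hp
  have hb : Tendsto (fun n => b (φ n)) atTop (nhds B) := (continuous_snd.tendsto _).comp hp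
  have hQτ : τ ≤ Q := ge_of_tendsto hq (Eventually.of_forall fun n => (hC _).H.hq.le)
  have hBτ : τ ≤ B := ge_of_tendsto hb (Eventually.of_forall fun n => (hC _).N.hq.le)
  have conv2 : ∀ (sn : ℕ → ℝ) s, (∀ n, 0 ≤ sn n) → 0 ≤ s → Tendsto sn atTop (nhds s) →
      Tendsto (fun n => X (φ n) (sn n)) atTop (nhds (U s)) := by
    intro sn s hn hs ht
    have h1 := (conv s hs).comp hφ.tendsto_atTop
    have h2 : Tendsto (fun n => exp (s + 1) * |sn n - s|) atTop (nhds 0) := by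
      have := ((ht.sub_const s).abs.const_mul (exp (s + 1)))
      simpa using this
    have h3 : Tendsto (fun n => X (φ n) (sn n) - X (φ n) s) atTop (nhds 0) := by
      refine squeeze_zero_norm' ?_ h2
      filter_upwards [ht.eventually (Iio_mem_nhds (show s < s + 1 by linarith))] with n hn1
      have hn1 : sn n < s + 1 := hn1
      rw [Real.norm_eq_abs]
      rcases le_total (sn n) s with h | h
      · rw [abs_sub_comm, abs_sub_comm (sn n), abs_of_nonneg (sub_nonneg.2 h)]
        exact (hC _).lipT (hn n) h (by linarith)
      · rw [abs_of_nonneg (sub_nonneg.2 h)]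
        exact (hC _).lipT hs h hn1.le
    have := h3.add h1
    simpa using this
  have qn0 : ∀ n, 0 ≤ q n := fun n => by linarith [(hC n).H.hq]
  have bn0 : ∀ n, 0 ≤ b n := fun n => by linarith [(hC n).N.hq]
  have Uper : ∀ s, 0 ≤ s → U (s + (Q + B)) = U s := fun s hs => by
    have h1 := conv2 (fun n => q (φ n) + b (φ n) + s) (Q + B + s)
      (fun n => by have := qn0 (φ n); have := bn0 (φ n); positivity) (by linarith)
      ((hq.add hb).add_const s)
    simp_rw [← Xs] at h1
    have h2 := ((conv s hs).comp (tendsto_add_atTop_nat 1)).comp hφ.tendsto_atTop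
    rw [add_comm s]
    exact tendsto_nhds_unique h1 h2
  have UW : ∀ s, 0 ≤ s → Tendsto (fun n => -X (φ n) (q (φ n) + s)) atTop (nhds (-U (Q + s))) :=
    fun s hs => (conv2 (fun n => q (φ n) + s) (Q + s)
      (fun n => by have := qn0 (φ n); positivity) (by linarith) (hq.add_const s)).neg
  have Uz : U 0 = 0 := tendsto_nhds_unique (conv 0 le_rfl)
    (by simp_rw [fun n => (hC n).H.zero]; exact tendsto_const_nhds)
  have UQ : U Q = 0 := by
    have := UW 0 le_rfl
    simp only [add_zero, fun n => (hC n).H.qz] at this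
    have := tendsto_nhds_unique this tendsto_const_nhds
    linarith
  have UB : U (Q + B) = 0 := by have := Uper 0 le_rfl; rwa [zero_add, Uz] at this
  have linlow : ∀ {T : ℝ → ℝ} (_ : AscLE (fun s => 0.0149 * s) 1.9 T τ) (_ : T 0 = 0)
      (_ : MonotoneOn T (Icc 0 τ)) s, 0 ≤ s → s ≤ τ → 0.0149 * min s 1.9 ≤ T s := by
    intro T A z m s h0 h1
    have hm : 0 ≤ min s 1.9 := le_min h0 (by norm_num)
    have := A.le (by fun_prop) (by simp [z]) (s := min s 1.9) hm (min_le_right _ _)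
      ((min_le_left _ _).trans h1)
    exact this.trans (m ⟨hm, (min_le_left _ _).trans h1⟩ ⟨h0, h1⟩ (min_le_left _ _))
  have Upos1 : ∀ s ∈ Ioc 0 τ, 0 < U s := fun s hs => by
    have : 0.0149 * min s 1.9 ≤ U s := ge_of_tendsto (conv s hs.1.le) (Eventually.of_forall fun n =>
      linlow (hC n).lin (hC n).H.zero (hC n).H.mono.monotoneOn s hs.1.le hs.2)
    have h2 : 0 < min s 1.9 := lt_min hs.1 (by norm_num)
    linarith
  have Wpos1 : ∀ s ∈ Ioc 0 τ, 0 < -U (Q + s) := fun s hs => by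
    have : 0.0149 * min s 1.9 ≤ -U (Q + s) := ge_of_tendsto (UW s hs.1.le) (Eventually.of_forall fun n =>
      linlow ((hC _).wlin hτ) (hC _).N.zero (hC _).N.mono.monotoneOn s hs.1.le hs.2)
    have h2 : 0 < min s 1.9 := lt_min hs.1 (by norm_num)
    linarith
  have cl : ∀ {a c : ℝ} (_ : a < c) {P : ℝ → ℝ} (_ : Continuous P) (_ : ∀ t ∈ Ioo a c, 0 ≤ P t),
      ∀ t ∈ Icc a c, 0 ≤ P t := by
    intro a c hac P hP h0
    rw [← closure_Ioo hac.ne]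
    exact closure_minimal h0 (isClosed_le continuous_const hP)
  have Unn : ∀ s ∈ Icc 0 Q, 0 ≤ U s := cl (by linarith) Uc fun s hs => by
    refine ge_of_tendsto ((conv s hs.1.le).comp hφ.tendsto_atTop) ?_
    filter_upwards [hq.eventually (Ioi_mem_nhds hs.2)] with n hn
    exact ((hC _).H.pos s ⟨hs.1, hn⟩).le
  have Wc : Continuous fun s => -U (Q + s) := by fun_prop
  have Wnn : ∀ s ∈ Icc 0 B, 0 ≤ -U (Q + s) := cl (by linarith) Wc fun s hs => by
    refine ge_of_tendsto (UW s hs.1.le) ?_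
    filter_upwards [hb.eventually (Ioi_mem_nhds hs.2)] with n hn
    exact ((hC _).N.pos s ⟨hs.1, hn⟩).le
  obtain ⟨hQ, Upos⟩ := pos_of_limit fP_fb hτ0 Uc Ud Upos1 hQτ UQ Unn
  have Wd : ∀ s, τ < Q + s → HasDerivAt (fun s => -U (Q + s)) (-fN (-U (Q + (s - τ)))) s := fun s hs => by
    have := ((Ud (Q + s) hs).comp_const_add Q s).neg
    rw [← flip_fP]
    simp only [flipf, neg_neg] at this ⊢
    rw [show Q + (s - τ) = Q + s - τ by ring]
    exact this
  obtain ⟨hB, Wpos⟩ := pos_of_limit fN_fb hτ0 Wc (fun s hs => Wd s (by linarith)) Wpos1 hBτ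
    (by simp [UB]) Wnn
  obtain ⟨Z, ZU, Zd, Zp⟩ := per_ext hτ0 (show 0 < Q + B by linarith) Ud Uper
  have Zc : Continuous Z := continuous_iff_continuousAt.2 fun s => (Zd s).continuousAt
  refine ⟨Z, Q, B, ⟨Zd, ?_, ?_, Zp⟩, fun Y qY bY hY => ?_⟩
  · refine ⟨fP_fb, hτ0, hQ, Zc, by rw [ZU 0 le_rfl, Uz], ?_, fun s _ => Zd s, by
      rw [ZU Q (by linarith), UQ], fun s hs => by rw [ZU s hs.1.le]; exact Upos s hs⟩
    apply strictMonoOn_of_deriv_pos (convex_Icc _ _) Zc.continuousOn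
    intro s hs
    rw [interior_Icc] at hs
    rw [(Zd s).deriv, ← Zp, ZU _ (by linarith [hs.1])]
    have := Wpos (s - τ + B) ⟨by linarith [hs.1], by linarith [hs.2]⟩
    have := fP_fb.neg (v := U (s - τ + (Q + B))) (by
      rw [show s - τ + (Q + B) = Q + (s - τ + B) by ring]; linarith)
    linarith
  · have ZW : ∀ s, 0 ≤ Q + s → -Z (Q + s) = -U (Q + s) := fun s hs => by rw [ZU _ hs]
    have Wd' : ∀ s, HasDerivAt (fun s => -Z (Q + s)) (-fN (-Z (Q + (s - τ)))) s := fun s => by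
      have := ((Zd (Q + s)).comp_const_add Q s).neg
      rw [← flip_fP]
      simp only [flipf, neg_neg] at this ⊢
      rw [show Q + (s - τ) = Q + s - τ by ring]
      exact this
    have ZWc : Continuous fun s => -Z (Q + s) := by fun_prop
    refine ⟨fN_fb, hτ0, hB, ZWc, ?_, ?_, fun s _ => Wd' s, ?_, fun s hs => ?_⟩
    · simp only [add_zero]; rw [ZU Q (by linarith), UQ, neg_zero]
    · apply strictMonoOn_of_deriv_pos (convex_Icc _ _) ZWc.continuousOn
      intro s hs
      rw [interior_Icc] at hs
      rw [(Wd' s).deriv, ZU _ (by linarith [hs.1])]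
      have := Upos (Q + (s - τ)) ⟨by linarith [hs.1], by linarith [hs.2]⟩
      have := fN_fb.neg (v := -U (Q + (s - τ))) (by linarith)
      linarith
    · rw [ZU _ (by linarith), UB, neg_zero]
    · rw [ZU _ (by linarith [hs.1])]; exact Wpos s hs
  · refine AscLE.lim_right (domY Y qY bY hY) fun s hs => ?_
    rw [ZU s hs.1]
    exact conv s hs.1

lemma exp_sub_le (a b : ℝ) : exp a - exp b ≤ exp a * (a - b) := by
  have := Real.add_one_le_exp (b - a)
  have h : exp b = exp a * exp (b - a) := by rw [← Real.exp_add]; congr 1; ring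
  rw [h]
  nlinarith [Real.exp_pos a]

structure Pair (τ qY bY qZ bZ : ℝ) (Y Z : ℝ → ℝ) : Prop where
  hY : Orb τ qY bY Y
  hZ : Orb τ qZ bZ Z
  A : AscLE Y τ Z τ
  hM : Y τ < Z τ
  bY2 : 2 * τ ≤ bY
  bZ2 : 2 * τ ≤ bZ
  qY2 : qY ≤ 2 * τ
  qZ2 : qZ ≤ 2 * τ
  E : ∫ s in (0 : ℝ)..(bY - τ), exp (Y (qY + s)) ≤ 1

lemma Orb.cont {τ q b : ℝ} {Y : ℝ → ℝ} (h : Orb τ q b Y) : Continuous Y := h.H.cont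

lemma Orb.per' {τ q b : ℝ} {Y : ℝ → ℝ} (h : Orb τ q b Y) (s : ℝ) : Y (q + (b + s)) = Y s := by
  rw [← h.per s]; congr 1; ring

lemma Orb.ge_min {τ q b : ℝ} {Y : ℝ → ℝ} (h : Orb τ q b Y) {s : ℝ} (h0 : q ≤ s) (h1 : s ≤ q + b + τ) :
    Y (q + τ) ≤ Y s := by
  have := h.N.le_max (s := s - q) (by linarith) (by linarith)
  simp only [add_sub_cancel] at this
  linarith

/-- monotone on `[-τ,0]` when `b ≥ 2τ` -/
lemma Orb.mono_pre {τ q b : ℝ} {Y : ℝ → ℝ} (h : Orb τ q b Y) :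
    StrictMonoOn Y (Icc (-(b - τ)) τ) := by
  intro x hx y hy hxy
  have := h.N.anti (a := b + x) (b := b + y) ⟨by linarith [hx.1], by linarith [hx.2]⟩
    ⟨by linarith [hy.1], by linarith [hy.2]⟩ (by linarith)
  simp only [h.per'] at this
  linarith

lemma Orb.dexp {τ q b : ℝ} {Y : ℝ → ℝ} (h : Orb τ q b Y) (s : ℝ) :
    HasDerivAt Y (1 - exp (Y (s - τ))) s := (h.de s).congr_deriv (by simp [fP])

namespace Pair
variable {τ qY bY qZ bZ : ℝ} {Y Z : ℝ → ℝ}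

lemma pre (P : Pair τ qY bY qZ bZ Y Z) {s : ℝ} (h0 : -τ ≤ s) (h1 : s ≤ 0) : Z s ≤ Y s := by
  have := P.bY2; have := P.bZ2
  have B := hump_asc P.hY.H P.hZ.H le_rfl P.A P.hM
  have C := hump_min P.hY.H P.hZ.H le_rfl P.A P.hM
  have D := hump_precross P.hY.N P.hZ.N le_rfl B (by linarith) (σ := -s) (by linarith)
    (by linarith) (by linarith)
  simp only [sub_neg_eq_add, P.hY.per', P.hZ.per'] at D
  linarith

lemma zmono (P : Pair τ qY bY qZ bZ Y Z) : MonotoneOn (fun s => Z s - Y s) (Icc 0 τ) := by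
  intro x hx y hy hxy
  have := incr_bound (u := fun s => Z s - Y s) (c := 0) hxy (P.hZ.cont.sub P.hY.cont)
    (fun r _ => (P.hZ.dexp r).sub (P.hY.dexp r)) (fun r hr => by
      have := Real.exp_le_exp.2 (P.pre (s := r - τ) (by linarith [hr.1, hx.1]) (by linarith [hr.2, hy.2]))
      linarith)
  simp only at this ⊢
  linarith

lemma znn (P : Pair τ qY bY qZ bZ Y Z) {s : ℝ} (h0 : 0 ≤ s) (h1 : s ≤ τ) : Y s ≤ Z s := by
  have := P.zmono (a := 0) (b := s) ⟨le_rfl, by linarith⟩ ⟨h0, h1⟩ h0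
  simp only [P.hY.H.zero, P.hZ.H.zero] at this
  linarith

lemma zle (P : Pair τ qY bY qZ bZ Y Z) {s : ℝ} (h0 : 0 ≤ s) (h1 : s ≤ 2 * τ) :
    Z s - Y s ≤ Z τ - Y τ := by
  have hτ := P.hY.H.τpos
  rcases le_total s τ with h | h
  · exact P.zmono ⟨h0, h⟩ ⟨hτ.le, le_rfl⟩ h
  · have := decr_bound (u := fun s => Z s - Y s) (c := 0) h (P.hZ.cont.sub P.hY.cont)
      (fun r _ => (P.hZ.dexp r).sub (P.hY.dexp r)) (fun r hr => by
        have := Real.exp_le_exp.2 (P.znn (s := r - τ) (by linarith [hr.1]) (by linarith [hr.2]))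
        linarith)
    linarith

lemma preq (P : Pair τ qY bY qZ bZ Y Z) {r : ℝ} (h0 : -τ ≤ r) (h1 : r ≤ 0) :
    Y (qY + r) ≤ Z (qZ + r) := by
  have hτ := P.hY.H.τpos
  have hqY := P.hY.H.hq; have hqZ := P.hZ.H.hq
  have C3 : ∀ σ, 0 ≤ σ → σ ≤ qY - τ → σ ≤ qZ - τ → Y (qY - σ) ≤ Z (qZ - σ) := fun σ a b c =>
    hump_precross P.hY.H P.hZ.H le_rfl P.A P.hM a b c
  rcases le_total qY qZ with hq | hq
  · rcases le_total (-r) (qY - τ) with h | h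
    · have := C3 (-r) (by linarith) h (by linarith)
      simpa using this
    rcases le_total (qZ + r) τ with h2 | h2
    · exact (P.znn (s := qY + r) (by linarith) (by linarith)).trans
        (P.hZ.H.mono.monotoneOn ⟨by linarith, by linarith⟩ ⟨by linarith, h2⟩ (by linarith))
    · have e1 := C3 (qY - τ) (by linarith) le_rfl (by linarith)
      rw [sub_sub_cancel] at e1
      have e2 := P.hZ.H.anti.antitoneOn (a := qZ + r) (b := qZ - (qY - τ)) ⟨h2, by linarith⟩
        ⟨by linarith, by linarith⟩ (by linarith)
      have e3 := P.hY.H.le_max (s := qY + r) (by linarith) (by linarith)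
      linarith
  · rcases le_total (-r) (qZ - τ) with h | h
    · have := C3 (-r) (by linarith) (by linarith) h
      simpa using this
    have e0 := hump_cmp P.hY.H P.hZ.H le_rfl P.A P.hM qY ⟨hqY.le, by linarith⟩ qZ
      ⟨hqZ.le, by linarith⟩ (by rw [P.hY.H.qz, P.hZ.H.qz])
    have := incr_bound (u := fun r => Z (qZ + r) - Y (qY + r)) (c := 0) h0
      (by have := P.hZ.cont; have := P.hY.cont; fun_prop)
      (fun x _ => ((P.hZ.dexp (qZ + x)).comp_const_add qZ x).sub
        ((P.hY.dexp (qY + x)).comp_const_add qY x)) (fun x hx => by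
      have e1 := P.pre (s := qZ + x - τ) (by linarith [hx.1]) (by linarith [hx.2])
      have e2 := P.hY.mono_pre.monotoneOn (a := qZ + x - τ) (b := qY + x - τ)
        ⟨by linarith [P.bY2, hx.1], by linarith [hx.2]⟩
        ⟨by linarith [P.bY2, hx.1], by linarith [hx.2, P.qY2]⟩ (by linarith)
      have := Real.exp_le_exp.2 (e1.trans e2)
      linarith)
    rw [← sub_eq_add_neg, ← sub_eq_add_neg] at this
    linarith

lemma Dmono (P : Pair τ qY bY qZ bZ Y Z) {s : ℝ} (h0 : 0 ≤ s) (h1 : s ≤ τ) :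
    0 ≤ Y (qY + s) - Z (qZ + s) ∧ Y (qY + s) - Z (qZ + s) ≤ Y (qY + τ) - Z (qZ + τ) := by
  have key : ∀ x y, 0 ≤ x → x ≤ y → y ≤ τ → Y (qY + x) - Z (qZ + x) ≤ Y (qY + y) - Z (qZ + y) := by
    intro x y hx hxy hy
    have := incr_bound (u := fun r => Y (qY + r) - Z (qZ + r)) (c := 0) hxy
      (by have := P.hZ.cont; have := P.hY.cont; fun_prop)
      (fun x _ => ((P.hY.dexp (qY + x)).comp_const_add qY x).sub
        ((P.hZ.dexp (qZ + x)).comp_const_add qZ x)) (fun r hr => by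
      have := Real.exp_le_exp.2 (P.preq (r := r - τ) (by linarith [hr.1]) (by linarith [hr.2]))
      rw [← add_sub_assoc, ← add_sub_assoc] at this
      linarith)
    linarith
  refine ⟨?_, key s τ h0 h1 le_rfl⟩
  have := key 0 s le_rfl h0 h1
  simp only [add_zero, P.hY.H.qz, P.hZ.H.qz] at this
  linarith

lemma Kpos (P : Pair τ qY bY qZ bZ Y Z) : 0 < Y (qY + τ) - Z (qZ + τ) :=
  sub_pos.2 (hump_min P.hY.H P.hZ.H le_rfl P.A P.hM)

lemma Dbd (P : Pair τ qY bY qZ bZ Y Z) {s : ℝ} (h0 : 0 ≤ s) (h1 : s ≤ bY) :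
    0 ≤ Y (qY + s) - Z (qZ + s) ∧ Y (qY + s) - Z (qZ + s) ≤ Y (qY + τ) - Z (qZ + τ) := by
  set K := Y (qY + τ) - Z (qZ + τ) with hK
  have hτ := P.hY.H.τpos
  have Yc := P.hY.cont
  have Zc := P.hZ.cont
  have key : ∀ n : ℕ, ∀ s, 0 ≤ s → s ≤ bY → s ≤ (n + 1) * τ →
      0 ≤ Y (qY + s) - Z (qZ + s) ∧ Y (qY + s) - Z (qZ + s) ≤ K := by
    intro n
    induction n with
    | zero => intro s a b c; exact P.Dmono a (by simpa using c)
    | succ n ih =>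
      intro s a b c
      push_cast at c
      rcases le_total s τ with h | h
      · exact P.Dmono a h
      have dD : ∀ x, HasDerivAt (fun r => Y (qY + r) - Z (qZ + r))
          ((1 - exp (Y (qY + x - τ))) - (1 - exp (Z (qZ + x - τ)))) x := fun x =>
        ((P.hY.dexp (qY + x)).comp_const_add qY x).sub ((P.hZ.dexp (qZ + x)).comp_const_add qZ x)
      constructor
      · -- lower bound
        have dI : ∀ x, HasDerivAt (fun x => ∫ r in (0 : ℝ)..(x - τ), exp (Y (qY + r)))
            (exp (Y (qY + (x - τ)))) x := fun x => by
          have c1 : Continuous fun r => exp (Y (qY + r)) := by fun_prop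
          exact (intervalIntegral.integral_hasDerivAt_right (c1.intervalIntegrable _ _)
            (c1.stronglyMeasurableAtFilter _ _) c1.continuousAt).comp_sub_const x τ
        have cI : Continuous fun x => ∫ r in (0 : ℝ)..(x - τ), exp (Y (qY + r)) :=
          continuous_iff_continuousAt.2 fun x => (dI x).continuousAt
        have e := incr_bound (u := fun r => (Y (qY + r) - Z (qZ + r)) +
            K * ∫ x in (0 : ℝ)..(r - τ), exp (Y (qY + x))) (c := 0) h
          (by fun_prop) (fun x _ => (dD x).add ((dI x).const_mul K)) (fun r hr => by
            have e1 := ih (r - τ) (by linarith [hr.1]) (by linarith [hr.2]) (by linarith [hr.2])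
            have e2 := exp_sub_le (Y (qY + (r - τ))) (Z (qZ + (r - τ)))
            have e3 := mul_le_mul_of_nonneg_left e1.2 (Real.exp_pos (Y (qY + (r - τ)))).le
            rw [← add_sub_assoc, ← add_sub_assoc] at *
            linarith)
        simp only [sub_self, intervalIntegral.integral_same, mul_zero, zero_mul, add_zero] at e
        have hI : ∫ x in (0 : ℝ)..(s - τ), exp (Y (qY + x)) ≤ 1 := by
          refine le_trans ?_ P.E
          apply intervalIntegral.integral_mono_interval le_rfl (by linarith) (by linarith)
          · exact Eventually.of_forall fun x => (Real.exp_pos _).le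
          · apply Continuous.intervalIntegrable; fun_prop
        have := mul_le_mul_of_nonneg_left hI P.Kpos.le
        linarith
      · have e := decr_bound (u := fun r => Y (qY + r) - Z (qZ + r)) (c := 0) h
          (by fun_prop) (fun x _ => dD x) (fun r hr => by
            have e1 := ih (r - τ) (by linarith [hr.1]) (by linarith [hr.2]) (by linarith [hr.2])
            have e2 := Real.exp_le_exp.2 (sub_nonneg.1 e1.1)
            rw [← add_sub_assoc, ← add_sub_assoc] at e2
            linarith)
        linarith
  obtain ⟨n, hn⟩ := exists_nat_gt (s / τ)
  have := (div_lt_iff₀ hτ).1 hn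
  exact key n s h0 h1 (by linarith)

lemma dpos (P : Pair τ qY bY qZ bZ Y Z) : bY ≤ bZ := by
  have h := (P.Dbd (s := bY) (by linarith [P.hY.N.hq, P.hY.H.τpos]) le_rfl).1
  have e : Y (qY + bY) = 0 := by have := P.hY.per' 0; rwa [add_zero, P.hY.H.zero] at this
  by_contra hcon
  push Not at hcon
  have := P.hZ.N.anti (a := bZ) (b := min bY (bZ + τ)) ⟨P.hZ.N.hq.le, by linarith [P.hY.H.τpos]⟩
    ⟨le_min (by linarith [P.hY.N.hq]) (by linarith [P.hZ.N.hq, P.hY.H.τpos]), min_le_right _ _⟩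
    (lt_min hcon (by linarith [P.hY.H.τpos]))
  have e2 : Z (qZ + bZ) = 0 := by have := P.hZ.per' 0; rwa [add_zero, P.hZ.H.zero] at this
  simp only [e2] at this
  have h3 := (P.Dbd (s := min bY (bZ + τ)) (le_min (by linarith [P.hY.N.hq, P.hY.H.τpos])
    (by linarith [P.hZ.N.hq, P.hY.H.τpos])) (min_le_left _ _)).1
  have h4 := P.hY.N.nonneg (s := min bY (bZ + τ)) (le_min (by linarith [P.hY.N.hq, P.hY.H.τpos])
    (by linarith [P.hZ.N.hq, P.hY.H.τpos])) (min_le_left _ _)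
  linarith

lemma dle (P : Pair τ qY bY qZ bZ Y Z) :
    (bZ - bY) * (1 - exp (Y (-τ))) ≤ Y (qY + τ) - Z (qZ + τ) := by
  have hτ := P.hY.H.τpos
  have h := (P.Dbd (s := bY) (by linarith [P.hY.N.hq]) le_rfl).2
  have e : Y (qY + bY) = 0 := by have := P.hY.per' 0; rwa [add_zero, P.hY.H.zero] at this
  have e2 : Z (qZ + bZ) = 0 := by have := P.hZ.per' 0; rwa [add_zero, P.hZ.H.zero] at this
  have := incr_bound (u := fun r => Z (qZ + r)) (c := 1 - exp (Y (-τ))) P.dpos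
    (by have := P.hZ.cont; fun_prop) (fun x _ => (P.hZ.dexp (qZ + x)).comp_const_add qZ x)
    (fun r hr => by
      have e3 := P.hZ.N.anti.antitoneOn (a := r - τ) (b := bZ - τ)
        ⟨by linarith [hr.1, P.bY2], by linarith [hr.2]⟩ ⟨by linarith [P.bZ2], by linarith⟩
        (by linarith [hr.2])
      have e4 := P.pre (s := -τ) le_rfl (by linarith)
      have e5 := P.hZ.per' (-τ)
      rw [← sub_eq_add_neg] at e5
      simp only [e5] at e3
      have := Real.exp_le_exp.2 (show Z (qZ + r - τ) ≤ Y (-τ) by rw [add_sub_assoc]; linarith)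
      linarith)
  simp only [e2] at this
  linarith

end Pair

namespace Pair
variable {τ qY bY qZ bZ : ℝ} {Y Z : ℝ → ℝ}

lemma delta (P : Pair τ qY bY qZ bZ Y Z) {σ : ℝ} (h0 : 0 ≤ σ) (h1 : σ ≤ τ) :
    Y (-σ) - Z (-σ) ≤ (Y (qY + τ) - Z (qZ + τ)) * (σ + Y (-σ)) +
      (bZ - bY) * (exp (Z (qZ + min (bY - τ - σ) τ)) - exp (Z (qZ + τ))) := by
  have hτ := P.hY.H.τpos
  have hd := P.dpos
  have b2 := P.bY2
  have b2' := P.bZ2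
  set K := Y (qY + τ) - Z (qZ + τ) with hK
  set d := bZ - bY with hdd
  have hd0 : 0 ≤ d := by linarith
  set g : ℝ → ℝ := fun t => exp (Z (qZ + min t τ)) with hg
  have gc : Continuous g := by have := P.hZ.cont; fun_prop
  have hgτ : ∀ x, τ ≤ x → g x = exp (Z (qZ + τ)) := fun x hx => by simp only [hg, min_eq_right hx]
  -- minimum
  have hmin : ∀ t, 0 ≤ t → t ≤ bZ + τ → exp (Z (qZ + τ)) ≤ exp (Z (qZ + t)) := fun t ht ht' =>
    Real.exp_le_exp.2 (P.hZ.ge_min (by linarith) (by linarith))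
  have ganti : ∀ x y, 0 ≤ x → x ≤ y → g y ≤ g x := by
    intro x y hx hxy
    refine Real.exp_le_exp.2 ?_
    have := P.hZ.N.mono.monotoneOn (a := min x τ) (b := min y τ) ⟨le_min hx hτ.le, min_le_right _ _⟩
      ⟨le_min (hx.trans hxy) hτ.le, min_le_right _ _⟩ (min_le_min_right _ hxy)
    linarith
  set Γ : ℝ → ℝ := fun x => ∫ s in (0 : ℝ)..x, g s with hΓ
  have Γd : ∀ x, HasDerivAt Γ (g x) x := fun x =>
    intervalIntegral.integral_hasDerivAt_right (gc.intervalIntegrable _ _)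
      (gc.stronglyMeasurableAtFilter _ _) gc.continuousAt
  have Γc : Continuous Γ := continuous_iff_continuousAt.2 fun x => (Γd x).continuousAt
  have key := decr_bound (a := 0) (b := σ) (c := 0)
    (u := fun s => (Y (-s) - Z (-s)) - K * (s + Y (-s)) - (Γ (bZ - τ - s) - Γ (bY - τ - s)))
    (u' := fun s => (-(1 - exp (Y (-s - τ))) - -(1 - exp (Z (-s - τ))))
      - K * (1 + -(1 - exp (Y (-s - τ)))) - (-g (bZ - τ - s) - -g (bY - τ - s))) h0
    (by have := P.hZ.cont; have := P.hY.cont; fun_prop)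
    (fun s _ => by
      have a1 : HasDerivAt (fun s => Y (-s)) (-(1 - exp (Y (-s - τ)))) s := by
        exact ((P.hY.dexp (-s)).comp s (hasDerivAt_neg s)).congr_deriv (by ring)
      have a2 : HasDerivAt (fun s => Z (-s)) (-(1 - exp (Z (-s - τ)))) s := by
        exact ((P.hZ.dexp (-s)).comp s (hasDerivAt_neg s)).congr_deriv (by ring)
      have a3 : ∀ c, HasDerivAt (fun s => Γ (c - s)) (-g (c - s)) s := fun c => by
        exact ((Γd (c - s)).comp s ((hasDerivAt_id s).const_sub c)).congr_deriv (by simp)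
      exact ((a1.sub a2).sub (((hasDerivAt_id s).add a1).const_mul K)).sub ((a3 _).sub (a3 _)))
    (fun s hs => by
      set t := bY - τ - s with ht
      have e1 : Y (-s - τ) = Y (qY + t) := by
        rw [← P.hY.per' (-s - τ)]; congr 1; rw [ht]; ring
      have e2 : Z (-s - τ) = Z (qZ + (t + d)) := by
        rw [← P.hZ.per' (-s - τ)]; congr 1; rw [ht]; ring
      have e3 : bZ - τ - s = t + d := by rw [ht]; ring
      rw [e1, e2, e3]
      have t0 : 0 ≤ t := by linarith [hs.2]
      have tb : t ≤ bY - τ := by linarith [hs.1]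
      have D := (P.Dbd t0 (by linarith)).2
      have c1 := exp_sub_le (Y (qY + t)) (Z (qZ + t))
      have c2 : exp (Z (qZ + t)) - exp (Z (qZ + (t + d))) ≤ g t - g (t + d) := by
        rcases le_total t τ with h | h
        · have : g t = exp (Z (qZ + t)) := by simp only [hg, min_eq_left h]
          rw [this]
          rcases le_total (t + d) τ with h' | h'
          · simp only [hg, min_eq_left h', le_refl]
          · rw [hgτ _ h']
            linarith [hmin (t + d) (by linarith) (by linarith)]
        · rw [hgτ _ h, hgτ _ (by linarith)]
          have := P.hZ.N.anti.antitoneOn (a := t) (b := t + d) ⟨h, by linarith⟩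
            ⟨by linarith, by linarith⟩ (by linarith)
          have := Real.exp_le_exp.2 (show Z (qZ + t) ≤ Z (qZ + (t + d)) by linarith)
          linarith
      have c3 : exp (Y (qY + t)) * (Y (qY + t) - Z (qZ + t)) ≤ exp (Y (qY + t)) * K :=
        mul_le_mul_of_nonneg_left D (Real.exp_pos _).le
      nlinarith)
  simp only [neg_zero, P.hY.H.zero, P.hZ.H.zero, sub_zero, zero_mul, add_zero, mul_zero] at key
  have B1 := incr_bound (u := Γ) (u' := g) (c := exp (Z (qZ + τ))) (a := bY - τ) (b := bZ - τ)
    (by linarith) Γc (fun s _ => Γd s) (fun s hs => (hgτ s (by linarith [hs.1])).ge)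
  have B2 := decr_bound (u := Γ) (u' := g) (c := g (bY - τ - σ)) (a := bY - τ - σ) (b := bZ - τ - σ)
    (by linarith) Γc (fun s _ => Γd s) (fun s hs => ganti _ _ (by linarith) hs.1.le)
  have : g (bY - τ - σ) = exp (Z (qZ + min (bY - τ - σ) τ)) := rfl
  rw [← this]
  have e1 : bZ - τ - σ - (bY - τ - σ) = d := by ring
  have e2 : bZ - τ - (bY - τ) = d := by ring
  rw [e1] at B2; rw [e2] at B1
  linarith

lemma contr (P : Pair τ qY bY qZ bZ Y Z) {J : ℝ} (hJ : qZ + Z τ - Z (qZ + τ) ≤ J) :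
    Y (qY + τ) - Z (qZ + τ) ≤ ∫ σ in (0 : ℝ)..τ, (J - 1 - τ + σ) *
      (exp (Y (-σ)) - exp (Z (-σ))) := by
  have hτ := P.hY.H.τpos
  have hq := P.hZ.H.hq
  have cY := P.hY.cont
  have cZ := P.hZ.cont
  set κ := Z τ - Y τ with hκ
  have κ0 : 0 < κ := sub_pos.2 P.hM
  have dz : ∀ s, HasDerivAt (fun s => Z s - Y s) (exp (Y (s - τ)) - exp (Z (s - τ))) s := fun s =>
    ((P.hZ.dexp s).sub (P.hY.dexp s)).congr_deriv (by ring)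
  -- step 1
  set I : ℝ → ℝ := fun x => ∫ s in (0 : ℝ)..x, (Z s - Y s) with hI
  have zc : Continuous (fun s => Z s - Y s) := cZ.sub cY
  have Id : ∀ x, HasDerivAt I (Z x - Y x) x := fun x =>
    intervalIntegral.integral_hasDerivAt_right (zc.intervalIntegrable _ _)
      (zc.stronglyMeasurableAtFilter _ _) zc.continuousAt
  have S1 : ∫ s in (0 : ℝ)..τ, (J - 1 - s) * (exp (Y (s - τ)) - exp (Z (s - τ))) =
      (J - 1 - τ) * κ + I τ := by
    rw [intervalIntegral.integral_eq_sub_of_hasDerivAt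
      (f := fun s => (J - 1 - s) * (Z s - Y s) + I s)]
    · simp [hI, P.hY.H.zero, P.hZ.H.zero, hκ]
    · intro s _
      exact ((((hasDerivAt_id s).const_sub (J - 1)).mul (dz s)).add (Id s)).congr_deriv
        (by simp only [id_eq]; ring)
    · exact Continuous.intervalIntegrable (by fun_prop) _ _
  have S2 : ∫ σ in (0 : ℝ)..τ, (J - 1 - τ + σ) * (exp (Y (-σ)) - exp (Z (-σ))) =
      (J - 1 - τ) * κ + I τ := by
    rw [← S1]
    have := intervalIntegral.integral_comp_sub_left (a := 0) (b := τ)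
      (fun s => (J - 1 - s) * (exp (Y (s - τ)) - exp (Z (s - τ)))) τ
    simp only [sub_self, sub_zero] at this
    rw [← this]
    congr 1; ext σ
    have : τ - σ - τ = -σ := by ring
    rw [this]; ring
  rw [S2]
  -- step 2
  set B : ℝ → ℝ := fun s => (s - Z (s + τ)) + Z τ with hB
  have dB : ∀ s, HasDerivAt B (exp (Z s)) s := fun s => by
    have := (P.hZ.dexp (s + τ)).comp_add_const s τ
    refine (((hasDerivAt_id s).sub this).add_const (Z τ)).congr_deriv (by simp)
  have Bc : Continuous B := by fun_prop
  have dA : ∀ s, HasDerivAt (fun s => Y (s + τ) - Z (s + τ)) (exp (Z s) - exp (Y s)) s := fun s => by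
    have h1 := (P.hZ.dexp (s + τ)).comp_add_const s τ
    have h2 := (P.hY.dexp (s + τ)).comp_add_const s τ
    refine (h2.sub h1).congr_deriv (by simp)
  have Ic : Continuous I := continuous_iff_continuousAt.2 fun x => (Id x).continuousAt
  have T1 := decr_bound (a := 0) (b := τ) (c := 0)
    (u := fun s => (Y (s + τ) - Z (s + τ)) - κ * B s + κ * s - I s)
    (u' := fun s => (exp (Z s) - exp (Y s)) - κ * exp (Z s) + κ * 1 - (Z s - Y s)) hτ.le
    (by fun_prop)
    (fun s _ => (((dA s).sub ((dB s).const_mul κ)).add ((hasDerivAt_id s).const_mul κ)).sub (Id s))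
    (fun s hs => by
      have h1 := exp_sub_le (Z s) (Y s)
      have h2 := P.zle hs.1.le (by linarith [hs.2])
      have h3 := Real.one_le_exp (P.hZ.H.nonneg hs.1.le (by linarith [hs.2]))
      nlinarith)
  have T2 := decr_bound (a := τ) (b := qZ) (c := 0)
    (u := fun s => (Y (s + τ) - Z (s + τ)) - κ * B s)
    (u' := fun s => (exp (Z s) - exp (Y s)) - κ * exp (Z s)) hq.le
    (by fun_prop)
    (fun s _ => ((dA s).sub ((dB s).const_mul κ)))
    (fun s hs => by
      have h1 := exp_sub_le (Z s) (Y s)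
      have h2 := P.zle (s := s) (by linarith [hs.1]) (by linarith [hs.2, P.qZ2])
      have h3 := Real.exp_pos (Z s)
      nlinarith)
  have I0 : I 0 = 0 := by simp [hI]
  simp only [zero_add, I0, hB, mul_zero, sub_zero, zero_mul, add_zero] at T1 T2
  have g := P.hY.ge_min (s := qZ + τ) (by linarith [P.qY2]) (by linarith [P.qZ2, P.bY2, P.hY.H.hq])
  rw [add_comm qZ τ] at g hJ ⊢
  rw [add_comm qZ τ] at T2
  nlinarith
end Pair

/-- forcing evaluation -/
def force {β : Type} (n : ℕ) (k : ℕ → β) : β :=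
  Nat.rec (k 0) (fun m _ => k (Nat.succ m)) n

lemma force_eq {β : Type} (n : ℕ) (k : ℕ → β) : force n k = k n := by
  cases n <;> rfl

/-- a cell: bounds for the delayed exponential and for its integral -/
structure Cell where
  cl : ℕ
  ch : ℕ
  il : ℕ
  ih : ℕ

/-- a record: bounds of `exp u` at a node, upper bound of the delayed exponential on the cell before -/
structure NRec where
  yl : ℕ
  yh : ℕ
  c : ℕ

def eL (s i : ℕ) : ℕ := (6 * s ^ 3 + 6 * s ^ 2 * i + 3 * s * i ^ 2 + i ^ 3) / (6 * s ^ 2)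
def eU (s i : ℕ) : ℕ :=
  (120 * s ^ 4 + 120 * s ^ 3 * i + 60 * s ^ 2 * i ^ 2 + 20 * s * i ^ 3 + 7 * i ^ 4) / (120 * s ^ 3) + 1

def nyl (s e yl ih : ℕ) : ℕ := if Nat.ble ih s then yl * e / eU s ih else 0
def nyh (s e yh il : ℕ) : ℕ := yh * e / eL s il + 1
def ncl (s h yl ch : ℕ) : ℕ := yl * (s * s - h * (ch - s)) / (s * s)
def nch (s h yh cl : ℕ) : ℕ := force (h * (s - cl)) fun t =>
  yh * (s ^ 4 + t * s ^ 2 + t ^ 2) / s ^ 4 + 1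
def nil (s h yl ch : ℕ) : ℕ := yl * h * (2 * s ^ 2 + h * s - h * ch) / (2 * s ^ 3)
def nih (s h yh cl : ℕ) : ℕ := force ((h * s - h * cl) + (h * cl - h * s)) fun z =>
  yh * h * ((2 * s ^ 2 + h * s - h * cl) * 5 * s ^ 2 + 2 * z ^ 2) / (10 * s ^ 5) + 1

/-- `n` steps.  `F ++ B.reverse` is the queue of cells -/
def eng (s h el eh : ℕ) : ℕ → List Cell → List Cell → ℕ → ℕ → List NRec → List NRec
  | 0, _, _, _, _, R => R
  | n + 1, [], B, yl, yh, R =>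
    match B.reverse with
    | [] => R
    | c :: F =>
      force (nyl s el yl c.ih) fun yl' => force (nyh s eh yh c.il) fun yh' =>
      force (ncl s h yl c.ch) fun cl' => force (nch s h yh c.cl) fun ch' =>
      force (nil s h yl c.ch) fun il' => force (nih s h yh c.cl) fun ih' =>
      eng s h el eh n F [⟨cl', ch', il', ih'⟩] yl' yh' (⟨yl', yh', c.ch⟩ :: R)
  | n + 1, c :: F, B, yl, yh, R =>
      force (nyl s el yl c.ih) fun yl' => force (nyh s eh yh c.il) fun yh' =>
      force (ncl s h yl c.ch) fun cl' => force (nch s h yh c.cl) fun ch' =>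
      force (nil s h yl c.ch) fun il' => force (nih s h yh c.cl) fun ih' =>
      eng s h el eh n F (⟨cl', ch', il', ih'⟩ :: B) yl' yh' (⟨yl', yh', c.ch⟩ :: R)


/-- on `(t,t+h)` we have `u' = 1-c`, `c ∈ [cl,ch]`; the increment is `h - I`, `I ∈ [il,ih]` -/
structure DCell (h : ℝ) (u : ℝ → ℝ) (t cl ch il ih : ℝ) : Prop where
  der : ∀ x ∈ Ioo t (t + h), ∃ c, cl ≤ c ∧ c ≤ ch ∧ HasDerivAt u (1 - c) x
  lo : u t + h - ih ≤ u (t + h)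
  hi : u (t + h) ≤ u t + h - il

lemma exp_le_quad {z : ℝ} (hz : z ≤ 2 / 5) : exp z ≤ 1 + z + 0.6 * z ^ 2 := by
  rcases le_total z 0 with h | h
  · have h1 := Real.quadratic_le_exp_of_nonneg (x := -z) (by linarith)
    rw [Real.exp_neg] at h1
    have h2 := Real.exp_pos z
    have h3 : (1 + (-z) + (-z) ^ 2 / 2) * exp z ≤ 1 := by
      have := mul_le_mul_of_nonneg_right h1 h2.le
      rwa [inv_mul_cancel₀ h2.ne'] at this
    have h4 : 1 ≤ (1 + (-z) + (-z) ^ 2 / 2) * (1 + z + 0.6 * z ^ 2) := by nlinarith [sq_nonneg z, mul_nonneg (sq_nonneg z) (sq_nonneg z), mul_nonneg (neg_nonneg.2 h) (sq_nonneg z)]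
    by_contra hc
    push Not at hc
    nlinarith [sq_nonneg z]
  · have := Real.exp_bound' h (by linarith) (n := 3) (by norm_num)
    simp only [Finset.sum_range_succ, Finset.sum_range_zero, Nat.factorial] at this
    norm_num at this
    nlinarith [mul_nonneg h (sq_nonneg z), sq_nonneg z, mul_nonneg (sq_nonneg z) (sub_nonneg.2 hz)]

section
variable {h a t cl ch il ih yl yh : ℝ} {u : ℝ → ℝ}

lemma DCell.up (D : DCell h u t cl ch il ih) (hu : Continuous u) (y0 : 0 ≤ yl)
    (hy : yl ≤ exp (u t)) {r : ℝ} (r0 : 0 ≤ r) (rh : r ≤ h) :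
    yl * (1 + r * (1 - ch)) ≤ exp (u (t + r)) := by
  choose! c c1 c2 c3 using D.der
  have := incr_bound (a := t) (b := t + r) (c := 1 - ch) (u' := fun x => 1 - c x) (by linarith) hu
    (fun x hx => c3 x ⟨hx.1, by linarith [hx.2]⟩)
    (fun x hx => by linarith [c2 x ⟨hx.1, by linarith [hx.2]⟩])
  have e1 : u t + r * (1 - ch) ≤ u (t + r) := by nlinarith
  have e2 := Real.exp_le_exp.2 e1
  rw [Real.exp_add] at e2
  have e3 := Real.add_one_le_exp (r * (1 - ch))
  have e4 := Real.exp_pos (r * (1 - ch))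
  calc yl * (1 + r * (1 - ch)) ≤ yl * exp (r * (1 - ch)) := by nlinarith
    _ ≤ exp (u t) * exp (r * (1 - ch)) := by nlinarith
    _ ≤ _ := e2

lemma DCell.dn (D : DCell h u t cl ch il ih) (hu : Continuous u) (cl0 : 0 ≤ cl) (h2 : h ≤ 2 / 5)
    (hy : exp (u t) ≤ yh) {r : ℝ} (r0 : 0 ≤ r) (rh : r ≤ h) :
    exp (u (t + r)) ≤ yh * (1 + r * (1 - cl) + 0.6 * (r * (1 - cl)) ^ 2) := by
  choose! c c1 c2 c3 using D.der
  have := decr_bound (a := t) (b := t + r) (c := 1 - cl) (u' := fun x => 1 - c x) (by linarith) hu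
    (fun x hx => c3 x ⟨hx.1, by linarith [hx.2]⟩)
    (fun x hx => by linarith [c1 x ⟨hx.1, by linarith [hx.2]⟩])
  have e1 : u (t + r) ≤ u t + r * (1 - cl) := by nlinarith
  have e2 := Real.exp_le_exp.2 e1
  rw [Real.exp_add] at e2
  have e3 := exp_le_quad (z := r * (1 - cl)) (by nlinarith)
  have e4 := Real.exp_pos (r * (1 - cl))
  have e5 := Real.exp_pos (u t)
  calc exp (u (t + r)) ≤ exp (u t) * exp (r * (1 - cl)) := e2
    _ ≤ yh * exp (r * (1 - cl)) := by nlinarith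
    _ ≤ _ := mul_le_mul_of_nonneg_left e3 (by linarith)

lemma DCell.incU (D : DCell h u t cl ch il ih) (hu : Continuous u) (h0 : 0 ≤ h) (y0 : 0 ≤ yl)
    (hy : yl ≤ exp (u t)) (de : ∀ x ∈ Ioo t (t + h), HasDerivAt u (1 - exp (u x)) (x + a)) :
    u (t + a + h) ≤ u (t + a) + h - yl * h * (1 + h * (1 - ch) / 2) := by
  have := decr_bound (a := 0) (b := h) (c := 0)
    (u := fun r => u (t + a + r) - r + yl * (r + (1 - ch) / 2 * r ^ 2))
    (u' := fun r => (1 - exp (u (t + r))) - 1 + yl * (1 + (1 - ch) / 2 * (2 * r))) h0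
    (by fun_prop)
    (fun r hr => by
      have d1 := de (t + r) ⟨by linarith [hr.1], by linarith [hr.2]⟩
      have d2 : HasDerivAt (fun r => u (t + a + r)) (1 - exp (u (t + r))) r := by
        rw [show t + r + a = t + a + r by ring] at d1
        exact d1.comp_const_add (t + a) r
      have d3 : HasDerivAt (fun r : ℝ => r ^ 2) (2 * r) r := by simpa using hasDerivAt_pow 2 r
      exact (d2.sub (hasDerivAt_id r)).add
        (((hasDerivAt_id r).add (d3.const_mul ((1 - ch) / 2))).const_mul yl))
    (fun r hr => by
      have := D.up hu y0 hy hr.1.le hr.2.le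
      linarith)
  simp only [add_zero, sub_zero, zero_mul] at this
  nlinarith

lemma DCell.incL (D : DCell h u t cl ch il ih) (hu : Continuous u) (h0 : 0 ≤ h)
    (cl0 : 0 ≤ cl) (h2 : h ≤ 2 / 5)
    (hy : exp (u t) ≤ yh) (de : ∀ x ∈ Ioo t (t + h), HasDerivAt u (1 - exp (u x)) (x + a)) :
    u (t + a) + h - yh * h * (1 + h * (1 - cl) / 2 + 0.2 * (h * (1 - cl)) ^ 2) ≤ u (t + a + h) := by
  have := incr_bound (a := 0) (b := h) (c := 0)
    (u := fun r => u (t + a + r) - r + yh * (r + (1 - cl) / 2 * r ^ 2 + 0.2 * (1 - cl) ^ 2 * r ^ 3))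
    (u' := fun r => (1 - exp (u (t + r))) - 1 + yh * (1 + (1 - cl) / 2 * (2 * r)
      + 0.2 * (1 - cl) ^ 2 * (3 * r ^ 2))) h0
    (by fun_prop)
    (fun r hr => by
      have d1 := de (t + r) ⟨by linarith [hr.1], by linarith [hr.2]⟩
      have d2 : HasDerivAt (fun r => u (t + a + r)) (1 - exp (u (t + r))) r := by
        rw [show t + r + a = t + a + r by ring] at d1
        exact d1.comp_const_add (t + a) r
      have d3 : HasDerivAt (fun r : ℝ => r ^ 2) (2 * r) r := by simpa using hasDerivAt_pow 2 r
      have d4 : HasDerivAt (fun r : ℝ => r ^ 3) (3 * r ^ 2) r := by simpa using hasDerivAt_pow 3 r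
      exact (d2.sub (hasDerivAt_id r)).add
        ((((hasDerivAt_id r).add (d3.const_mul ((1 - cl) / 2))).add
          (d4.const_mul (0.2 * (1 - cl) ^ 2))).const_mul yh))
    (fun r hr => by
      have := D.dn hu cl0 h2 hy hr.1.le hr.2.le
      nlinarith)
  simp only [add_zero, sub_zero, zero_mul] at this
  nlinarith
end

lemma cdiv_up (m n : ℕ) (hn : 0 < n) : (m : ℝ) / n ≤ ((m / n : ℕ) : ℝ) + 1 := by
  have h1 : m < n * (m / n + 1) := Nat.lt_mul_div_succ m hn
  have h2 : (m : ℝ) < n * (((m / n : ℕ) : ℝ) + 1) := by exact_mod_cast h1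
  rw [div_le_iff₀ (by exact_mod_cast hn)]
  linarith

lemma csub_le (a b : ℕ) : (a : ℝ) - b ≤ ((a - b : ℕ) : ℝ) := by
  have : a ≤ (a - b) + b := by omega
  have : (a : ℝ) ≤ ((a - b : ℕ) : ℝ) + b := by exact_mod_cast this
  linarith

lemma csub_cases (a b : ℕ) : ((a - b : ℕ) : ℝ) = 0 ∧ (a : ℝ) ≤ b ∨ ((a - b : ℕ) : ℝ) = a - b := by
  rcases le_total b a with h | h
  · right; exact Nat.cast_sub h
  · left
    exact ⟨by rw [Nat.sub_eq_zero_of_le h]; simp, by exact_mod_cast h⟩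

section
variable {s : ℕ} (hs : 0 < s)
include hs

lemma eL_le (i : ℕ) : (eL s i : ℝ) / s ≤ exp ((i : ℝ) / s) := by
  have h0 : (0 : ℝ) < s := by exact_mod_cast hs
  have h1 : (eL s i : ℝ) ≤ _ := Nat.cast_div_le
  have h2 := Real.sum_le_exp_of_nonneg (x := (i : ℝ) / s) (by positivity) 4
  simp only [Finset.sum_range_succ, Finset.sum_range_zero, Nat.factorial] at h2
  refine le_trans ((div_le_div_iff_of_pos_right h0).2 h1) (le_trans (le_of_eq ?_) h2)
  push_cast
  field_simp
  ring

lemma le_eU {i : ℕ} (hi : i ≤ s) : exp ((i : ℝ) / s) ≤ (eU s i : ℝ) / s := by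
  have h0 : (0 : ℝ) < s := by exact_mod_cast hs
  have hx : (i : ℝ) / s ≤ 1 := by
    rw [div_le_one h0]; exact_mod_cast hi
  have h2 := Real.exp_bound' (x := (i : ℝ) / s) (by positivity) hx (n := 4) (by norm_num)
  simp only [Finset.sum_range_succ, Finset.sum_range_zero, Nat.factorial] at h2
  have h1 := cdiv_up (120 * s ^ 4 + 120 * s ^ 3 * i + 60 * s ^ 2 * i ^ 2 + 20 * s * i ^ 3 + 7 * i ^ 4)
    (120 * s ^ 3) (by positivity)
  have h3 : ((eU s i : ℕ) : ℝ) = _ := Nat.cast_add_one _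
  rw [h3]
  refine le_trans h2 (le_trans ?_ ((div_le_div_iff_of_pos_right h0).2 h1))
  push_cast
  have : (0 : ℝ) ≤ (i : ℝ) ^ 4 / s ^ 4 := by positivity
  have e : ((120 * (s : ℝ) ^ 4 + 120 * s ^ 3 * i + 60 * s ^ 2 * i ^ 2 + 20 * s * i ^ 3 + 7 * i ^ 4) /
    (120 * s ^ 3)) / s = 1 + i / s + (i / s) ^ 2 / 2 + (i / s) ^ 3 / 6 + 7 / 120 * (i ^ 4 / s ^ 4) := by
    field_simp
    ring
  rw [e]
  have e2 : ((i : ℝ) / s) ^ 4 = i ^ 4 / s ^ 4 := by rw [div_pow]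
  norm_num [e2]
  linarith

lemma eU_pos (i : ℕ) : (0 : ℝ) < eU s i := by
  have : 0 < eU s i := Nat.succ_pos _
  exact_mod_cast this

lemma eL_pos (i : ℕ) : (0 : ℝ) < eL s i := by
  have : 0 < eL s i := by
    unfold eL
    apply Nat.div_pos
    · have : 6 * s ^ 2 ≤ 6 * s ^ 3 := by
        have : s ^ 2 ≤ s ^ 3 := Nat.pow_le_pow_right hs (by norm_num)
        omega
      nlinarith [Nat.zero_le (6 * s ^ 2 * i), Nat.zero_le (3 * s * i ^ 2), Nat.zero_le (i ^ 3)]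
    · positivity
  exact_mod_cast this

end

/-- cell as natural numbers over the scale `s` -/
def NC (s h : ℕ) (u : ℝ → ℝ) (t : ℝ) (c : Cell) : Prop :=
  DCell ((h : ℝ) / s) u t ((c.cl : ℝ) / s) ((c.ch : ℝ) / s) ((c.il : ℝ) / s) ((c.ih : ℝ) / s)

def YB (s : ℕ) (u : ℝ → ℝ) (t : ℝ) (yl yh : ℕ) : Prop :=
  (yl : ℝ) / s ≤ exp (u t) ∧ exp (u t) ≤ (yh : ℝ) / s

section
variable {s h yl yh : ℕ} {u : ℝ → ℝ} {t a : ℝ} {c : Cell}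

lemma step_y (hs : 0 < s) (hh : h ≤ s) (hc : NC s h u t c) (hy : YB s u t yl yh) :
    YB s u (t + (h : ℝ) / s) (nyl s (eL s h) yl c.ih) (nyh s (eU s h) yh c.il) := by
  have h0 : (0 : ℝ) < s := by exact_mod_cast hs
  have k1 := eL_le hs h
  have k2 := le_eU hs hh
  have p0 := Real.exp_pos (u t)
  obtain ⟨y1, y2⟩ := hy
  constructor
  · unfold nyl
    split_ifs with hi
    · have hi' := Nat.le_of_ble_eq_true hi
      have k3 := le_eU hs hi'
      have k4 := eU_pos hs c.ih
      have e1 : ((yl * eL s h / eU s c.ih : ℕ) : ℝ) ≤ _ := Nat.cast_div_le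
      have e2 := Real.exp_le_exp.2 hc.lo
      rw [sub_eq_add_neg, Real.exp_add, Real.exp_add, Real.exp_neg] at e2
      refine le_trans ((div_le_div_iff_of_pos_right h0).2 e1) (le_trans ?_ e2)
      have e3 : ((yl * eL s h : ℕ) : ℝ) / eU s c.ih / s = yl / s * (eL s h / s) * ((eU s c.ih / s : ℝ))⁻¹ := by
        push_cast
        field_simp
      rw [e3]
      have := Real.exp_pos ((h : ℝ) / s)
      have := Real.exp_pos ((c.ih : ℝ) / s)
      gcongr
    · simp only [Nat.cast_zero, zero_div]
      exact (Real.exp_pos _).le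
  · unfold nyh
    have k3 := eL_le hs c.il
    have k4 := eL_pos hs c.il
    have k4' : 0 < eL s c.il := by exact_mod_cast k4
    have e1 := cdiv_up (yh * eU s h) (eL s c.il) k4'
    have e2 := Real.exp_le_exp.2 hc.hi
    rw [sub_eq_add_neg, Real.exp_add, Real.exp_add, Real.exp_neg] at e2
    rw [Nat.cast_add_one]
    refine le_trans e2 (le_trans ?_ ((div_le_div_iff_of_pos_right h0).2 e1))
    have e3 : ((yh * eU s h : ℕ) : ℝ) / eL s c.il / s = yh / s * (eU s h / s) * ((eL s c.il / s : ℝ))⁻¹ := by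
      push_cast
      field_simp
    rw [e3]
    have := Real.exp_pos ((h : ℝ) / s)
    have : (0 : ℝ) < eL s c.il / s := by positivity
    gcongr

lemma step_c (hs : 0 < s) (hh : 5 * h ≤ 2 * s) (hu : Continuous u) (hc : NC s h u t c)
    (hy : YB s u t yl yh)
    (de : ∀ x ∈ Ioo t (t + (h : ℝ) / s), HasDerivAt u (1 - exp (u x)) (x + a)) :
    NC s h u (t + a) ⟨ncl s h yl c.ch, nch s h yh c.cl, nil s h yl c.ch, nih s h yh c.cl⟩ := by
  have h0 : (0 : ℝ) < s := by exact_mod_cast hs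
  obtain ⟨y1, y2⟩ := hy
  set H := (h : ℝ) / s with hH
  have H0 : 0 ≤ H := by positivity
  have H1 : H ≤ 2 / 5 := by
    rw [hH, div_le_div_iff₀ h0 (by norm_num)]
    have : (5 * h : ℝ) ≤ 2 * s := by exact_mod_cast hh
    linarith
  have yl0 : (0 : ℝ) ≤ yl / s := by positivity
  have yh0 : (0 : ℝ) ≤ yh / s := by positivity
  have D : DCell H u t ((c.cl : ℝ) / s) ((c.ch : ℝ) / s) ((c.il : ℝ) / s) ((c.ih : ℝ) / s) := hc
  have D1 : DCell H u t (min ((c.cl : ℝ) / s) 1) ((c.ch : ℝ) / s) ((c.il : ℝ) / s) ((c.ih : ℝ) / s) :=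
    ⟨fun x hx => by
      obtain ⟨c', h1, h2, h3⟩ := D.der x hx
      exact ⟨c', (min_le_left _ _).trans h1, h2, h3⟩, D.lo, D.hi⟩
  have cl1 : (0 : ℝ) ≤ min ((c.cl : ℝ) / s) 1 := le_min (by positivity) (by norm_num)
  refine ⟨fun x hx => ?_, ?_, ?_⟩
  · -- pointwise
    have hr0 : 0 ≤ x - a - t := by linarith [hx.1]
    have hr1 : x - a - t ≤ H := by linarith [hx.2]
    have hx' := de (x - a) ⟨by linarith [hx.1], by linarith [hx.2]⟩
    rw [sub_add_cancel] at hx'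
    refine ⟨_, ?_, ?_, hx'⟩
    · have e1 := D.up hu yl0 y1 hr0 hr1
      rw [show t + (x - a - t) = x - a by ring] at e1
      have e2 : ((ncl s h yl c.ch : ℕ) : ℝ) ≤ _ := Nat.cast_div_le
      refine le_trans ((div_le_div_iff_of_pos_right h0).2 e2) ?_
      push_cast
      have e4 := csub_le c.ch s
      have e5 : (0 : ℝ) ≤ ((c.ch - s : ℕ) : ℝ) := Nat.cast_nonneg _
      rcases csub_cases (s * s) (h * (c.ch - s)) with ⟨e3, _⟩ | e3
      · rw [e3]; simp only [mul_zero, zero_div]; exact (Real.exp_pos _).le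
      · rw [e3]
        refine le_trans ?_ e1
        push_cast
        have e6 : (yl : ℝ) * (s * s - h * ((c.ch - s : ℕ) : ℝ)) / (s * s) / s
          = yl / s * (1 - H * (((c.ch - s : ℕ) : ℝ) / s)) := by
          rw [hH]; field_simp
        rw [e6]
        apply mul_le_mul_of_nonneg_left _ yl0
        have e7 : (c.ch : ℝ) / s - 1 ≤ ((c.ch - s : ℕ) : ℝ) / s := by
          rw [← div_self h0.ne', ← sub_div]
          exact (div_le_div_iff_of_pos_right h0).2 e4
        have e8 : (0 : ℝ) ≤ ((c.ch - s : ℕ) : ℝ) / s := by positivity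
        nlinarith
    · have e1 := D1.dn hu cl1 H1 y2 hr0 hr1
      rw [show t + (x - a - t) = x - a by ring] at e1
      refine le_trans e1 ?_
      simp only [nch, force_eq]
      have e2 := cdiv_up (yh * (s ^ 4 + h * (s - c.cl) * s ^ 2 + (h * (s - c.cl)) ^ 2)) (s ^ 4) (by positivity)
      rw [Nat.cast_add_one]
      refine le_trans ?_ ((div_le_div_iff_of_pos_right h0).2 e2)
      push_cast
      have e3 : (yh : ℝ) * (s ^ 4 + h * ((s - c.cl : ℕ) : ℝ) * s ^ 2 + (h * ((s - c.cl : ℕ) : ℝ)) ^ 2) / s ^ 4 / s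
        = yh / s * (1 + H * (((s - c.cl : ℕ) : ℝ) / s) + (H * (((s - c.cl : ℕ) : ℝ) / s)) ^ 2) := by
        rw [hH]; field_simp
      rw [e3]
      apply mul_le_mul_of_nonneg_left _ yh0
      have e4 : 1 - min ((c.cl : ℝ) / s) 1 ≤ ((s - c.cl : ℕ) : ℝ) / s := by
        rcases le_total ((c.cl : ℝ) / s) 1 with h1 | h1
        · rw [min_eq_left h1]
          have := csub_le s c.cl
          rw [← div_self h0.ne', ← sub_div]
          exact (div_le_div_iff_of_pos_right h0).2 this
        · rw [min_eq_right h1]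
          simp only [sub_self]; positivity
      have e5 : 0 ≤ 1 - min ((c.cl : ℝ) / s) 1 := by linarith [min_le_right ((c.cl : ℝ) / s) 1]
      have e6 : (x - a - t) * (1 - min ((c.cl : ℝ) / s) 1) ≤ H * (((s - c.cl : ℕ) : ℝ) / s) :=
        mul_le_mul hr1 e4 e5 H0
      have e7 : 0 ≤ (x - a - t) * (1 - min ((c.cl : ℝ) / s) 1) := mul_nonneg hr0 e5
      nlinarith
  · have e1 := D.incL (a := a) hu H0 (by positivity) H1 y2 de
    have e2 := cdiv_up (yh * h * ((2 * s ^ 2 + h * s - h * c.cl) * 5 * s ^ 2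
      + 2 * ((h * s - h * c.cl) + (h * c.cl - h * s)) ^ 2)) (10 * s ^ 5) (by positivity)
    simp only [nih, force_eq]
    rw [Nat.cast_add_one]
    refine le_trans ?_ e1
    have e3 := (div_le_div_iff_of_pos_right h0).2 e2
    have e4 : yh / s * H * (1 + H * (1 - c.cl / s) / 2 + 0.2 * (H * (1 - c.cl / s)) ^ 2) ≤
      ((yh * h * ((2 * s ^ 2 + h * s - h * c.cl) * 5 * s ^ 2
      + 2 * ((h * s - h * c.cl) + (h * c.cl - h * s)) ^ 2) : ℕ) : ℝ) / ((10 * s ^ 5 : ℕ) : ℝ) / s := by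
      have e5 := csub_le (2 * s ^ 2 + h * s) (h * c.cl)
      have e6 : (((h * s - h * c.cl : ℕ) : ℝ) + ((h * c.cl - h * s : ℕ) : ℝ)) ^ 2 = ((h : ℝ) * s - h * c.cl) ^ 2 := by
        rcases le_total (h * s) (h * c.cl) with h1 | h1
        · rw [Nat.sub_eq_zero_of_le h1, Nat.cast_sub h1]; push_cast; ring
        · rw [Nat.sub_eq_zero_of_le h1, Nat.cast_sub h1]; push_cast; ring
      push_cast at e5 ⊢
      rw [e6]
      have e7 : yh / s * H * (1 + H * (1 - c.cl / s) / 2 + 0.2 * (H * (1 - c.cl / s)) ^ 2)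
        = yh * h * ((2 * s ^ 2 + h * s - h * c.cl) * 5 * s ^ 2 + 2 * ((h : ℝ) * s - h * c.cl) ^ 2) / (10 * s ^ 5) / s := by
        rw [hH]; field_simp; ring
      rw [e7]
      gcongr
    linarith
  · have e2 : ((nil s h yl c.ch : ℕ) : ℝ) ≤ _ := Nat.cast_div_le
    have e2' := (div_le_div_iff_of_pos_right h0).2 e2
    rcases csub_cases (2 * s ^ 2 + h * s) (h * c.ch) with ⟨e3, _⟩ | e3
    · have e1 := D.incU (a := a) hu H0 le_rfl (Real.exp_pos _).le de
      push_cast at e2'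
      rw [e3] at e2'
      simp only [mul_zero, zero_div] at e2'
      simp only [zero_mul, sub_zero] at e1
      have : 0 ≤ ((nil s h yl c.ch : ℕ) : ℝ) / s := by positivity
      simp only
      linarith
    · have e1 := D.incU (a := a) hu H0 yl0 y1 de
      push_cast at e2' e3
      rw [e3] at e2'
      have e7 : (yl : ℝ) * h * (2 * s ^ 2 + h * s - h * c.ch) / (2 * s ^ 3) / s
        = yl / s * H * (1 + H * (1 - c.ch / s) / 2) := by
        rw [hH]; field_simp; ring
      rw [e7] at e2'
      simp only
      linarith
end

def QV (s h : ℕ) (u : ℝ → ℝ) : ℕ → List Cell → Prop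
  | _, [] => True
  | k, c :: L => NC s h u ((k : ℝ) * ((h : ℝ) / s)) c ∧ QV s h u (k + 1) L

def RV (s h : ℕ) (u : ℝ → ℝ) : List NRec → Prop
  | [] => True
  | r :: R => (YB s u ((R.length : ℝ) * ((h : ℝ) / s)) r.yl r.yh ∧
      (∀ x, ((R.length : ℝ) - 1) * ((h : ℝ) / s) < x → x < (R.length : ℝ) * ((h : ℝ) / s) → 0 < x →
        ∃ c, c ≤ (r.c : ℝ) / s ∧ HasDerivAt u (1 - c) x)) ∧ RV s h u R

lemma QV_append {s h : ℕ} {u : ℝ → ℝ} (L M : List Cell) (k : ℕ) :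
    QV s h u k (L ++ M) ↔ QV s h u k L ∧ QV s h u (k + L.length) M := by
  induction L generalizing k with
  | nil => simp [QV]
  | cons c L ih =>
    simp only [List.cons_append, QV, ih, List.length_cons]
    rw [show k + 1 + L.length = k + (L.length + 1) by ring]
    tauto

def initC (s h : ℕ) : List ℕ → List Cell
  | [] => []
  | z :: L => force (h * z / s) fun i => ⟨z, z, i, i + 1⟩ :: initC s h L

section
variable {s h N : ℕ} {u : ℝ → ℝ}

lemma eng_step (hs : 0 < s) (hh : 5 * h ≤ 2 * s) (hu : Continuous u)
    (de : ∀ x, 0 < x → HasDerivAt u (1 - exp (u x)) (x + N * ((h : ℝ) / s)))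
    {k yl yh : ℕ} {c : Cell} {F B : List Cell} {R : List NRec}
    (hlen : (c :: F).length + B.length = N) (hQ : QV s h u k (c :: F ++ B.reverse))
    (hy : YB s u ((k : ℝ) * ((h : ℝ) / s)) yl yh) (hR : RV s h u R) (hl : R.length = k + 1) :
    QV s h u (k + 1) (F ++ (⟨ncl s h yl c.ch, nch s h yh c.cl, nil s h yl c.ch, nih s h yh c.cl⟩ :: B).reverse) ∧
    YB s u (((k + 1 : ℕ) : ℝ) * ((h : ℝ) / s)) (nyl s (eL s h) yl c.ih) (nyh s (eU s h) yh c.il) ∧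
    RV s h u (⟨nyl s (eL s h) yl c.ih, nyh s (eU s h) yh c.il, c.ch⟩ :: R) := by
  have h0 : (0 : ℝ) < s := by exact_mod_cast hs
  have H0 : (0 : ℝ) ≤ (h : ℝ) / s := by positivity
  obtain ⟨h1, h2⟩ := hQ
  have hk : ((k + 1 : ℕ) : ℝ) * ((h : ℝ) / s) = k * ((h : ℝ) / s) + (h : ℝ) / s := by push_cast; ring
  have k1 := step_y hs (by omega) h1 hy
  rw [← hk] at k1
  have k2 := step_c (a := N * ((h : ℝ) / s)) hs hh hu h1 hy (fun x hx => de x (by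
    have : (0 : ℝ) ≤ k * ((h : ℝ) / s) := by positivity
    linarith [hx.1]))
  refine ⟨?_, k1, ⟨⟨?_, ?_⟩, hR⟩⟩
  · rw [List.reverse_cons, ← List.append_assoc, QV_append]
    refine ⟨h2, ?_, trivial⟩
    convert k2 using 1
    rw [List.length_append, List.length_reverse]
    simp only [List.length_cons] at hlen
    rw [← hlen]; push_cast; ring
  · rw [hl]; exact k1
  · rw [hl]
    intro x hx1 hx2 hx3
    obtain ⟨c', a1, a2, a3⟩ := h1.der x ⟨by push_cast at hx1; linarith, by rw [hk] at hx2; exact hx2⟩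
    exact ⟨c', a2, a3⟩

theorem eng_sound (hs : 0 < s) (hh : 5 * h ≤ 2 * s) (hN : 0 < N) (hu : Continuous u)
    (de : ∀ x, 0 < x → HasDerivAt u (1 - exp (u x)) (x + N * ((h : ℝ) / s))) (n : ℕ) :
    ∀ (k yl yh : ℕ) (F B : List Cell) (R : List NRec),
    F.length + B.length = N → QV s h u k (F ++ B.reverse) →
    YB s u ((k : ℝ) * ((h : ℝ) / s)) yl yh → RV s h u R → R.length = k + 1 →
    RV s h u (eng s h (eL s h) (eU s h) n F B yl yh R) ∧
      (eng s h (eL s h) (eU s h) n F B yl yh R).length = R.length + n := by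
  induction n with
  | zero => intro k yl yh F B R h1 h2 h3 h4 h5; simp only [eng]; exact ⟨h4, by simp⟩
  | succ n ih =>
    intro k yl yh F B R h1 h2 h3 h4 h5
    match F with
    | [] =>
      simp only [List.nil_append] at h2
      match hB : B.reverse with
      | [] =>
        have : B = [] := by simpa using hB
        subst this
        simp at h1
        omega
      | c :: F =>
        simp only [eng, hB, force_eq]
        have hl : (c :: F).length = B.length := by rw [← hB, List.length_reverse]
        rw [hB] at h2
        obtain ⟨a1, a2, a3⟩ := eng_step (N := N) (B := []) (F := F) (c := c) hs hh hu de
          (by rw [hl]; simpa using h1) (by simpa using h2) h3 h4 h5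
        have := ih (k + 1) _ _ F [_] _ (by
          simp only [List.length_cons, List.length_nil] at hl h1 ⊢; omega) a1 a2 a3 (by simp [h5])
        refine ⟨this.1, this.2.trans ?_⟩
        simp only [List.length_cons]; omega
    | c :: F =>
      simp only [eng, force_eq]
      obtain ⟨a1, a2, a3⟩ := eng_step (N := N) hs hh hu de h1 h2 h3 h4 h5
      have := ih (k + 1) _ _ F (_ :: B) _ (by
          simp only [List.length_cons] at h1 ⊢; omega) a1 a2 a3 (by simp [h5])
      refine ⟨this.1, this.2.trans ?_⟩
      simp only [List.length_cons]; omega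

lemma RV.get {R : List NRec} (hR : RV s h u R) {i : ℕ} {r : NRec} (hr : R[i]? = some r) {k : ℕ}
    (hk : R.length = k + i + 1) : YB s u ((k : ℝ) * ((h : ℝ) / s)) r.yl r.yh ∧
      (∀ x, ((k : ℝ) - 1) * ((h : ℝ) / s) < x → x < (k : ℝ) * ((h : ℝ) / s) → 0 < x →
        ∃ c, c ≤ (r.c : ℝ) / s ∧ HasDerivAt u (1 - c) x) := by
  induction R generalizing i with
  | nil => simp at hr
  | cons r' R ih =>
    cases i with
    | zero =>
      simp at hr
      subst hr
      have : R.length = k := by simpa using hk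
      rw [← this]
      exact hR.1
    | succ i =>
      simp only [List.getElem?_cons_succ] at hr
      exact ih hR.2 hr (by simp only [List.length_cons] at hk; omega)
end

/-! piecewise linear profile -/

def prof (h : ℝ) (p : ℕ → ℝ) (N : ℕ) (x : ℝ) : ℝ :=
  ∑ i ∈ Finset.range N, (p i - p (i + 1)) * min x (((i : ℝ) + 1) * h)

section
variable {h : ℝ} {p : ℕ → ℝ} {N : ℕ}

lemma prof_cont : Continuous (prof h p N) := by unfold prof; fun_prop

lemma prof_zero (hh : 0 ≤ h) : prof h p N 0 = 0 := by
  unfold prof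
  apply Finset.sum_eq_zero
  intro i _
  rw [min_eq_left (by positivity)]; ring

lemma prof_lin (hh : 0 ≤ h) (hp : p N = 0) {k : ℕ} (hk : k < N) {x y : ℝ} (x0 : (k : ℝ) * h ≤ x)
    (x1 : x ≤ ((k : ℝ) + 1) * h) (y0 : (k : ℝ) * h ≤ y) (y1 : y ≤ ((k : ℝ) + 1) * h) :
    prof h p N y - prof h p N x = p k * (y - x) := by
  unfold prof
  rw [← Finset.sum_sub_distrib]
  have e : ∀ i ∈ Finset.range N, ((p i - p (i + 1)) * min y (((i : ℝ) + 1) * h) -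
      (p i - p (i + 1)) * min x (((i : ℝ) + 1) * h)) = if k ≤ i then (p i - p (i + 1)) * (y - x) else 0 := by
    intro i _
    split_ifs with hi
    · have : ((k : ℝ) + 1) * h ≤ ((i : ℝ) + 1) * h := by
        have : (k : ℝ) ≤ i := by exact_mod_cast hi
        gcongr
      rw [min_eq_left (by linarith), min_eq_left (by linarith)]; ring
    · have : ((i : ℝ) + 1) * h ≤ k * h := by
        have : (i : ℝ) + 1 ≤ k := by exact_mod_cast (by omega : i + 1 ≤ k)
        gcongr
      rw [min_eq_right (by linarith), min_eq_right (by linarith)]; ring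
  rw [Finset.sum_congr rfl e, ← Finset.sum_filter]
  have e2 : (Finset.range N).filter (fun i => k ≤ i) = Finset.Ico k N := by
    ext i; simp [Finset.mem_Ico]; tauto
  rw [e2, ← Finset.sum_mul]
  congr 1
  have e3 := Finset.sum_Ico_sub (fun i => p i) hk.le
  have e4 : ∑ i ∈ Finset.Ico k N, (p i - p (i + 1)) = - ∑ i ∈ Finset.Ico k N, (p (i + 1) - p i) := by
    rw [← Finset.sum_neg_distrib]; apply Finset.sum_congr rfl; intros; ring
  rw [e4, e3, hp]; ring

lemma prof_der (hh : 0 ≤ h) (hp : p N = 0) {k : ℕ} (hk : k < N) {x : ℝ} (x0 : (k : ℝ) * h < x)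
    (x1 : x < ((k : ℝ) + 1) * h) : HasDerivAt (prof h p N) (p k) x := by
  have h1 : HasDerivAt (fun y => prof h p N x + p k * (y - x)) (p k) x := by
    have := (((hasDerivAt_id x).sub_const x).const_mul (p k)).const_add (prof h p N x)
    exact this.congr_deriv (by ring)
  refine h1.congr_of_eventuallyEq ?_
  filter_upwards [Ioo_mem_nhds x0 x1] with y hy
  have := prof_lin hh hp hk x0.le x1.le hy.1.le hy.2.le
  linarith

lemma min_conc {s t r c : ℝ} (hr : 0 ≤ r) (hst : s ≤ t) :
    min t c - min (t - r) c ≤ min s c - min (s - r) c := by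
  rcases le_total t c with h1 | h1 <;> rcases le_total (t - r) c with h2 | h2 <;>
  rcases le_total s c with h3 | h3 <;> rcases le_total (s - r) c with h4 | h4 <;>
  simp only [h1, h2, h3, h4, min_eq_left, min_eq_right] <;> linarith

lemma prof_conc (hm : ∀ i < N, p (i + 1) ≤ p i) (s t r : ℝ) (hr : 0 ≤ r) (hst : s ≤ t) :
    prof h p N t - prof h p N (t - r) ≤ prof h p N s - prof h p N (s - r) := by
  unfold prof
  rw [← Finset.sum_sub_distrib, ← Finset.sum_sub_distrib]
  apply Finset.sum_le_sum
  intro i hi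
  have := hm i (Finset.mem_range.1 hi)
  rw [← mul_sub, ← mul_sub]
  exact mul_le_mul_of_nonneg_left (min_conc hr hst) (by linarith)

lemma prof_mono (hm : ∀ i < N, p (i + 1) ≤ p i) {x y : ℝ} (hxy : x ≤ y) : prof h p N x ≤ prof h p N y := by
  unfold prof
  apply Finset.sum_le_sum
  intro i hi
  have := hm i (Finset.mem_range.1 hi)
  exact mul_le_mul_of_nonneg_left (min_le_min_right _ hxy) (by linarith)

lemma prof_smono (hm : ∀ i < N, p (i + 1) ≤ p i) (hN : 0 < N) (hl : p N < p (N - 1)) :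
    StrictMonoOn (prof h p N) (Icc 0 (N * h)) := by
  intro x hx y hy hxy
  unfold prof
  apply Finset.sum_lt_sum
  · intro i hi
    have := hm i (Finset.mem_range.1 hi)
    exact mul_le_mul_of_nonneg_left (min_le_min_right _ hxy.le) (by linarith)
  · refine ⟨N - 1, Finset.mem_range.2 (by omega), ?_⟩
    have e : (((N - 1 : ℕ) : ℝ) + 1) = N := by
      rw [Nat.cast_sub (by omega)]; simp
    rw [show N - 1 + 1 = N by omega, e, min_eq_left hy.2, min_eq_left (hxy.le.trans hy.2)]
    exact mul_lt_mul_of_pos_left hxy (by linarith)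

/-- increments of the profile against increments of `w` -/
lemma prof_inc_le (hh : 0 < h) (hp : p N = 0) {w w' : ℝ → ℝ} (hw : Continuous w) {n : ℕ} (hn : n ≤ N)
    {T : ℝ} (hT : T ≤ n * h)
    (hd : ∀ x ∈ Ioo 0 T, HasDerivAt w (w' x) x)
    (hb : ∀ k < n, ∀ x ∈ Ioo 0 T, (k : ℝ) * h < x → x < ((k : ℝ) + 1) * h → p k ≤ w' x) :
    ∀ x y, 0 ≤ x → x ≤ y → y ≤ T → prof h p N y - prof h p N x ≤ w y - w x := by
  -- it suffices to treat y in cell k, by induction on k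
  have key : ∀ k : ℕ, k ≤ n → ∀ x y, 0 ≤ x → x ≤ y → y ≤ T → y ≤ k * h →
      prof h p N y - prof h p N x ≤ w y - w x := by
    intro k
    induction k with
    | zero =>
      intro _ x y h1 h2 h3 h4
      have : x = y := by simp at h4; linarith
      rw [this]; simp
    | succ k ih =>
      intro hk x y h1 h2 h3 h4
      push_cast at h4
      have cell : ∀ x, 0 ≤ x → x ≤ y → k * h ≤ x → prof h p N y - prof h p N x ≤ w y - w x := by
        intro x x0 xy xk
        rw [prof_lin hh.le hp (by omega : k < N) xk (by linarith) (by linarith) h4]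
        have := incr_bound (a := x) (b := y) (c := p k) xy hw
          (fun z hz => hd z ⟨by linarith [hz.1], by linarith [hz.2]⟩)
          (fun z hz => hb k (by omega) z ⟨by linarith [hz.1], by linarith [hz.2]⟩ (by linarith [hz.1]) (by linarith [hz.2]))
        linarith
      rcases le_total y (k * h) with h5 | h5
      · exact ih (by omega) x y h1 h2 h3 h5
      rcases le_total x (k * h) with h6 | h6
      · have a1 := ih (by omega) x (k * h) h1 h6 (by linarith) le_rfl
        have a2 := cell (k * h) (by positivity) h5 le_rfl
        linarith
      · exact cell x h1 h2 h6
  intro x y h1 h2 h3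
  exact key n le_rfl x y h1 h2 h3 (by linarith)

lemma prof_inc_ge (hh : 0 < h) (hp : p N = 0) {w w' : ℝ → ℝ} (hw : Continuous w)
    {T : ℝ} (hT : T ≤ N * h)
    (hd : ∀ x ∈ Ioo 0 T, HasDerivAt w (w' x) x)
    (hb : ∀ k < N, ∀ x ∈ Ioo 0 T, (k : ℝ) * h < x → x < ((k : ℝ) + 1) * h → w' x ≤ p k) :
    ∀ x y, 0 ≤ x → x ≤ y → y ≤ T → w y - w x ≤ prof h p N y - prof h p N x := by
  intro x y h1 h2 h3
  have e : ∀ x, prof h (fun i => -p i) N x = - prof h p N x := by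
    intro x; unfold prof; rw [← Finset.sum_neg_distrib]; apply Finset.sum_congr rfl; intros; ring
  have := prof_inc_le (p := fun i => - p i) (w := fun x => -w x) (w' := fun x => -w' x) hh (by simp [hp])
    hw.neg le_rfl hT (fun x hx => (hd x hx).neg)
    (fun k hk x hx a b => by have := hb k hk x hx a b; linarith) x y h1 h2 h3
  rw [e, e] at this
  linarith
end

lemma AscLE.of_lower' {P w : ℝ → ℝ} {a a' τ : ℝ} (haτ : a' ≤ τ) (z : P 0 = w 0) (a0 : 0 ≤ a')
    (hw : MonotoneOn w (Icc 0 τ)) (hP : MonotoneOn P (Icc 0 a))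
    (hconc : ∀ s t r, 0 ≤ r → s ≤ t → P t - P (t - r) ≤ P s - P (s - r))
    (hinc : ∀ x y, 0 ≤ x → x ≤ y → y ≤ a' → P y - P x ≤ w y - w x)
    (ht : P a ≤ w a') (ha : a' ≤ a) : AscLE P a w τ := by
  intro t ht' s hs h
  have h1 : P t ≤ P a := hP ht' ⟨ht'.1.trans ht'.2, le_rfl⟩ ht'.2
  have h2 : s < a' := by
    by_contra hc
    push Not at hc
    have := hw ⟨a0, haτ⟩ hs hc
    linarith
  have h3 : P s ≤ w s := by have := hinc 0 s le_rfl hs.1 h2.le; linarith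
  have h4 : s < t := by
    by_contra hc
    push Not at hc
    have := hP ht' ⟨hs.1, by linarith⟩ hc
    linarith
  refine ⟨h4.le, fun r hr => ?_⟩
  have h5 := hinc (s - r) s (by linarith [hr.2]) (by linarith [hr.1]) h2.le
  have h6 := hconc s t r hr.1 h4.le
  linarith

def pz (s : ℕ) (Z : List ℕ) (k : ℕ) : ℝ :=
  match Z[k]? with
  | some c => 1 - (c : ℝ) / s
  | none => 0

structure OKZ (s : ℕ) (Z : List ℕ) : Prop where
  N0 : 0 < Z.length
  mono : ∀ i < Z.length, pz s Z (i + 1) ≤ pz s Z i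
  last : 0 < pz s Z (Z.length - 1)

lemma pz_len (s : ℕ) (Z : List ℕ) : pz s Z Z.length = 0 := by simp [pz]

def mchk (s : ℕ) : ℕ → List ℕ → Bool
  | p, [] => Nat.blt p s
  | p, z :: L => Nat.ble p z && mchk s z L

lemma mchk_lt {s : ℕ} {Z : List ℕ} : ∀ {p : ℕ}, mchk s p Z = true → p < s := by
  induction Z with
  | nil => intro p h; simpa [mchk] using h
  | cons z L ih =>
    intro p h
    simp only [mchk, Bool.and_eq_true, Nat.ble_eq] at h
    exact lt_of_le_of_lt h.1 (ih h.2)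

lemma mchk_all {s : ℕ} {Z : List ℕ} : ∀ {p : ℕ}, mchk s p Z = true → ∀ (i c : ℕ), Z[i]? = some c → p ≤ c ∧ c < s := by
  induction Z with
  | nil => intro p h i c hc; simp at hc
  | cons z L ih =>
    intro p h i c hc
    simp only [mchk, Bool.and_eq_true, Nat.ble_eq] at h
    cases i with
    | zero => simp at hc; subst hc; exact ⟨h.1, mchk_lt h.2⟩
    | succ i =>
      simp only [List.getElem?_cons_succ] at hc
      have := ih h.2 i c hc
      exact ⟨h.1.trans this.1, this.2⟩

lemma mchk_mono {s : ℕ} {Z : List ℕ} : ∀ {p : ℕ}, mchk s p Z = true →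
    ∀ (i j c d : ℕ), i ≤ j → Z[i]? = some c → Z[j]? = some d → c ≤ d := by
  induction Z with
  | nil => intro p h i j c d _ hc; simp at hc
  | cons z L ih =>
    intro p h i j c d hij hc hd
    simp only [mchk, Bool.and_eq_true, Nat.ble_eq] at h
    cases j with
    | zero =>
      have : i = 0 := by omega
      subst this
      rw [hc] at hd; simp at hd; exact hd.le
    | succ j =>
      simp only [List.getElem?_cons_succ] at hd
      cases i with
      | zero => simp at hc; subst hc; exact (mchk_all h.2 j d hd).1
      | succ i =>
        simp only [List.getElem?_cons_succ] at hc
        exact ih h.2 i j c d (by omega) hc hd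

lemma okz_of {s : ℕ} {Z : List ℕ} (h : mchk s 0 Z = true) (h0 : 0 < Z.length) : OKZ s Z := by
  have hs : (0 : ℝ) < s := by exact_mod_cast mchk_lt h
  have hlt : ∀ i < Z.length, 0 < pz s Z i := by
    intro i hi
    have e : Z[i]? = some Z[i] := List.getElem?_eq_getElem hi
    have := (mchk_all h i _ e).2
    simp only [pz, e]
    have : (Z[i] : ℝ) < s := by exact_mod_cast this
    have := (div_lt_one hs).2 this
    linarith
  refine ⟨h0, fun i hi => ?_, hlt _ (by omega)⟩
  rcases lt_or_ge (i + 1) Z.length with h1 | h1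
  · have e : Z[i]? = some Z[i] := List.getElem?_eq_getElem hi
    have e' : Z[i + 1]? = some Z[i + 1] := List.getElem?_eq_getElem h1
    have := mchk_mono h i (i + 1) _ _ (by omega) e e'
    simp only [pz, e, e']
    have : (Z[i] : ℝ) ≤ (Z[i + 1] : ℝ) := by exact_mod_cast this
    have := (div_le_div_iff_of_pos_right hs).2 this
    linarith
  · have : i + 1 = Z.length := by omega
    rw [this, pz_len]
    exact (hlt i hi).le

structure Run (s h : ℕ) (Z : List ℕ) (u : ℝ → ℝ) : Prop where
  cont : Continuous u
  low : ∀ x, x ≤ Z.length * ((h : ℝ) / s) → u x = prof ((h : ℝ) / s) (pz s Z) Z.length x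
  de : ∀ x, Z.length * ((h : ℝ) / s) < x → HasDerivAt u (-fP (u (x - Z.length * ((h : ℝ) / s)))) x

lemma run_exists {s h : ℕ} {Z : List ℕ} (hs : 0 < s) (hh : 0 < h) (hZ : 0 < Z.length) : ∃ u, Run s h Z u := by
  have : (0 : ℝ) < s := by exact_mod_cast hs
  have : (0 : ℝ) < h := by exact_mod_cast hh
  have : (0 : ℝ) < Z.length := by exact_mod_cast hZ
  obtain ⟨U, h1, h2, h3⟩ := exists_steps fP_fb.cont (prof_cont (h := (h : ℝ) / s) (p := pz s Z) (N := Z.length))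
    (τ := Z.length * ((h : ℝ) / s)) (by positivity)
  exact ⟨U, h1, h2, h3⟩

section
variable {s h : ℕ} {Z : List ℕ} {u : ℝ → ℝ}

lemma Run.pre (r : Run s h Z u) (hs : 0 < s) (hh : 0 < h) (hZ : OKZ s Z) :
    PreHump fP (Z.length * ((h : ℝ) / s)) u := by
  have h1 : (0 : ℝ) < s := by exact_mod_cast hs
  have h2 : (0 : ℝ) < h := by exact_mod_cast hh
  have h3 : (0 : ℝ) < Z.length := by exact_mod_cast hZ.N0
  have h4 : 0 < Z.length * ((h : ℝ) / s) := by positivity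
  refine ⟨fP_fb, h4, r.cont, ?_, ?_, r.de⟩
  · rw [r.low 0 h4.le, prof_zero (by positivity)]
  · intro x hx y hy hxy
    rw [r.low x hx.2, r.low y hy.2]
    exact prof_smono hZ.mono hZ.N0 (by rw [pz_len]; exact hZ.last) hx hy hxy

lemma initC_get (Z : List ℕ) (i : ℕ) : (initC s h Z)[i]? = (Z[i]?).map fun z => ⟨z, z, h * z / s, h * z / s + 1⟩ := by
  induction Z generalizing i with
  | nil => simp [initC]
  | cons z L ih =>
    simp only [initC, force_eq]
    cases i with
    | zero => simp
    | succ i => simp [ih]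

lemma initC_len (Z : List ℕ) : (initC s h Z).length = Z.length := by
  induction Z with
  | nil => simp [initC]
  | cons z L ih => simp [initC, force_eq, ih]

lemma QV_of {L : List Cell} : ∀ {k : ℕ}, (∀ (i : ℕ) c, L[i]? = some c → NC s h u (((k + i : ℕ) : ℝ) * ((h : ℝ) / s)) c) →
    QV s h u k L := by
  induction L with
  | nil => intro k _; trivial
  | cons c L ih =>
    intro k hk
    refine ⟨by simpa using hk 0 c (by simp), ih fun i c' hc => ?_⟩
    have := hk (i + 1) c' (by simpa using hc)
    rwa [show k + (i + 1) = k + 1 + i by ring] at this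

theorem Run.recs (r : Run s h Z u) (hs : 0 < s) (hh : 0 < h) (h5 : 5 * h ≤ 2 * s) (hZ : OKZ s Z) (n : ℕ) :
    RV s h u (eng s h (eL s h) (eU s h) n (initC s h Z) [] s s [⟨s, s, s⟩]) ∧
      (eng s h (eL s h) (eU s h) n (initC s h Z) [] s s [⟨s, s, s⟩]).length = n + 1 := by
  have h1 : (0 : ℝ) < s := by exact_mod_cast hs
  have h2 : (0 : ℝ) < h := by exact_mod_cast hh
  have H0 : (0 : ℝ) < (h : ℝ) / s := by positivity
  have P := r.pre hs hh hZ
  have hy : YB s u ((0 : ℕ) * ((h : ℝ) / s)) s s := by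
    simp [YB, P.zero, div_self h1.ne']
  have := eng_sound (N := Z.length) hs h5 hZ.N0 r.cont (u := u) (fun x hx => by
    have := r.de (x + Z.length * ((h : ℝ) / s)) (by linarith)
    rw [add_sub_cancel_right] at this
    exact this.congr_deriv (by simp [fP])) n 0 s s (initC s h Z) [] [⟨s, s, s⟩] (by simp [initC_len]) (by
      rw [List.reverse_nil, List.append_nil]
      apply QV_of
      intro i c hc
      rw [initC_get] at hc
      obtain ⟨z, hz, rfl⟩ := Option.map_eq_some_iff.1 hc
      obtain ⟨hi, -⟩ := List.getElem?_eq_some_iff.1 hz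
      have hi1 : (i : ℝ) + 1 ≤ Z.length := by exact_mod_cast hi
      have hp : pz s Z i = 1 - (z : ℝ) / s := by simp [pz, hz]
      rw [zero_add]
      have hle : (i : ℝ) * ((h : ℝ) / s) + (h : ℝ) / s ≤ Z.length * ((h : ℝ) / s) := by nlinarith
      have inc := prof_lin H0.le (pz_len s Z) hi (x := i * ((h : ℝ) / s)) (y := i * ((h : ℝ) / s) + (h : ℝ) / s)
        le_rfl (by linarith) (by linarith) (by linarith)
      rw [hp] at inc
      have l1 := r.low (i * ((h : ℝ) / s)) (by linarith)
      have l2 := r.low (i * ((h : ℝ) / s) + (h : ℝ) / s) hle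
      have e : (h : ℝ) / s * (z / s) = ((h * z : ℕ) : ℝ) / s / s := by push_cast; field_simp
      refine ⟨fun x hx => ⟨(z : ℝ) / s, le_rfl, le_rfl, ?_⟩, ?_, ?_⟩
      · rw [← hp]
        have := prof_der H0.le (pz_len s Z) hi hx.1 (by linarith [hx.2])
        refine this.congr_of_eventuallyEq ?_
        filter_upwards [Iio_mem_nhds (lt_of_lt_of_le hx.2 hle)] with y hy
        exact r.low y (le_of_lt hy)
      · rw [l1, l2]
        have := cdiv_up (h * z) s hs
        have := (div_le_div_iff_of_pos_right h1).2 this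
        simp only
        push_cast at e this ⊢
        linarith
      · rw [l1, l2]
        have : ((h * z / s : ℕ) : ℝ) ≤ _ := Nat.cast_div_le
        have := (div_le_div_iff_of_pos_right h1).2 this
        simp only
        push_cast at e this ⊢
        linarith) hy (by
        refine ⟨⟨by simpa using hy, fun x h1 h2 h3 => ?_⟩, trivial⟩
        simp at h2; linarith) (by simp)
  refine ⟨this.1, this.2.trans (by simp; omega)⟩
end

/-! checks -/

def all2 (p : NRec → ℕ → Bool) : List NRec → List ℕ → Bool
  | _, [] => true
  | [], _ :: _ => false
  | r :: R, z :: Z => p r z && all2 p R Z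

lemma all2_get {p : NRec → ℕ → Bool} {Z : List ℕ} : ∀ {R : List NRec}, all2 p R Z = true →
    ∀ (i z : ℕ), Z[i]? = some z → ∃ r, R[i]? = some r ∧ p r z = true := by
  induction Z with
  | nil => intro R _ i z hz; simp at hz
  | cons z Z ih =>
    intro R h i z' hz
    match R with
    | [] => simp [all2] at h
    | r :: R =>
      simp only [all2, Bool.and_eq_true] at h
      cases i with
      | zero => simp at hz; subst hz; exact ⟨r, by simp, h.1⟩
      | succ i => simpa using ih h.2 i z' (by simpa using hz)

def at? (R : List NRec) (i : ℕ) (p : NRec → Bool) : Bool :=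
  match R.drop i with
  | [] => false
  | r :: _ => p r

lemma at?_get {R : List NRec} {i : ℕ} {p : NRec → Bool} (h : at? R i p = true) :
    ∃ r, R[i]? = some r ∧ p r = true := by
  unfold at? at h
  have e : (R.drop i)[0]? = R[i]? := by simp
  match hd : R.drop i with
  | [] => simp [hd] at h
  | r :: L => 
    rw [hd] at h e
    exact ⟨r, by simpa using e.symm, h⟩

def loChk (s h SQ N iL qlo qhi rho : ℕ) (z e : List ℕ) : List NRec → Bool
  | [] => false
  | r :: R =>
    Nat.ble (s * s + rho * s + rho * rho) (r.yl * s) && (Nat.ble rho h &&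
    ((R.take (iL - 1 - qhi)).all (fun r => Nat.blt r.yh s) &&
    (all2 (fun r z => force (rho * (s - r.c)) fun t =>
      Nat.ble (r.yh * (2 * s ^ 4 + t * t - 2 * t * s ^ 2)) (2 * s ^ 4 * (z * SQ))) R z.reverse &&
    (at? R N (fun r => match z with | [] => false | z :: _ => Nat.ble r.yh (z * SQ)) &&
    (at? R (iL - 1 - qhi) (fun r => Nat.ble r.yh s) &&
    (((R.drop (iL - 1 - qlo)).take (qlo + 1 - N)).all (fun r => Nat.blt s r.yl) &&
    all2 (fun r z => Nat.ble r.yh (z * SQ)) (R.drop (iL - 1 - (qlo + N))) e))))))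

def loPre (s h Q SQ N iL qlo qhi : ℕ) (z e : List ℕ) : Bool :=
  Nat.beq s (Q * SQ) && (Nat.blt 0 s && (Nat.blt 0 h && (Nat.ble (5 * h) (2 * s) && (Nat.ble 3 N &&
  (Nat.ble N qlo && (Nat.ble qlo qhi && (Nat.ble qhi (qlo + N) && (Nat.ble (qhi + N + 1) iL &&
  (Nat.beq z.length N && (Nat.beq e.length N && mchk Q 0 z))))))))))

/-- `z = [ζ_N, …, ζ_1]`, with `ζ_0 = 1` -/
def zv (Q : ℕ) (z : List ℕ) (j : ℕ) : ℝ := ((z.getD (z.length - j) Q : ℕ) : ℝ) / Q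

lemma zv_zero {Q : ℕ} (hQ : 0 < Q) (z : List ℕ) : zv Q z 0 = 1 := by
  have : (0 : ℝ) < Q := by exact_mod_cast hQ
  simp [zv, div_self this.ne']

lemma zv_get {Q : ℕ} {z : List ℕ} {j : ℕ} (h0 : 0 < j) (h1 : j ≤ z.length) :
    ∃ v, z[z.length - j]? = some v ∧ zv Q z j = (v : ℝ) / Q := by
  have h : z.length - j < z.length := by omega
  refine ⟨z[z.length - j], List.getElem?_eq_getElem h, ?_⟩
  simp [zv, List.getD_eq_getElem?_getD, List.getElem?_eq_getElem h]

structure LoF (a h : ℝ) (N : ℕ) (ζ η : ℕ → ℝ) (u : ℝ → ℝ) (q b : ℝ) : Prop where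
  H : Hump fP a q u
  D : Hump fN a b (fun s => -u (q + s))
  Zf : ∀ j ≤ N, ∀ σ, j * h ≤ σ → σ ≤ a → exp (u (q + b - σ)) ≤ ζ j
  Ef : ∀ j ≤ N, ∀ r, j * h ≤ r → r ≤ a → exp (u (q + r)) ≤ η j

lemma exp_neg_quad {x : ℝ} (hx : 0 ≤ x) : exp (-x) ≤ 1 - x + x ^ 2 / 2 := by
  have := incr_bound (a := 0) (b := x) (c := 0) (u := fun x => 1 - x + x ^ 2 / 2 - exp (-x))
    (u' := fun x => -1 + x + exp (-x)) hx (by fun_prop)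
    (fun y _ => by
      have d3 : HasDerivAt (fun r : ℝ => r ^ 2) (2 * y) y := by simpa using hasDerivAt_pow 2 y
      have d4 : HasDerivAt (fun r : ℝ => exp (-r)) (exp (-y) * (-1)) y :=
        (Real.hasDerivAt_exp (-y)).comp y ((hasDerivAt_id y).neg)
      have := ((((hasDerivAt_id y).const_sub 1).add (d3.div_const 2))).sub d4
      exact this.congr_deriv (by ring))
    (fun y _ => by have := Real.add_one_le_exp (-y); linarith)
  simp at this
  linarith

section
variable {s h Q SQ N iL qlo qhi rho : ℕ} {z e Z : List ℕ} {u : ℝ → ℝ}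

set_option maxHeartbeats 2000000 in
theorem lo_sound (r : Run s h Z u) (hZN : Z.length = N) (hZ : OKZ s Z)
    (pre : loPre s h Q SQ N iL qlo qhi z e = true)
    (chk : loChk s h SQ N iL qlo qhi rho z e
      (eng s h (eL s h) (eU s h) iL (initC s h Z) [] s s [⟨s, s, s⟩]) = true) :
    ∃ q b, LoF (N * ((h : ℝ) / s)) ((h : ℝ) / s) N (zv Q z) (zv Q e) u q b := by
  simp only [loPre, Bool.and_eq_true, Nat.ble_eq, Nat.beq_eq, Nat.blt_eq] at pre
  obtain ⟨p1, hs, hh, h5, hN, p2, p3, p4, p5, p6, p7, p8⟩ := pre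
  obtain ⟨rv, rl⟩ := r.recs hs hh h5 hZ iL
  generalize eng s h (eL s h) (eU s h) iL (initC s h Z) [] s s [⟨s, s, s⟩] = R0 at rv rl chk
  match R0 with
  | [] => simp at rl
  | r0 :: R =>
  simp only [loChk, Bool.and_eq_true, Nat.ble_eq, force_eq] at chk
  obtain ⟨c1, c2, c3, c4, c5, c6, c7, c8⟩ := chk
  have rl' : R.length = iL := by simpa using rl
  have h0 : (0 : ℝ) < s := by exact_mod_cast hs
  have hh0 : (0 : ℝ) < h := by exact_mod_cast hh
  have P := r.pre hs hh hZ
  rw [hZN] at P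
  have Rde := r.de
  rw [hZN] at Rde
  set Hh := (h : ℝ) / s with hH
  have H0 : 0 < Hh := by positivity
  set a := (N : ℝ) * Hh with ha
  have a0 : 0 < a := P.τpos
  have Q0 : 0 < Q := mchk_lt p8
  have Q0' : (0 : ℝ) < Q := by exact_mod_cast Q0
  have SQ0 : 0 < SQ := by
    rcases Nat.eq_zero_or_pos SQ with h | h
    · subst h; simp at p1; omega
    · exact h
  have SQ0' : (0 : ℝ) < SQ := by exact_mod_cast SQ0
  have sQ : (s : ℝ) = Q * SQ := by exact_mod_cast p1
  have scal : ∀ v : ℕ, ((v * SQ : ℕ) : ℝ) / s = (v : ℝ) / Q := by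
    intro v; rw [sQ]; push_cast; field_simp
  -- node access
  have node : ∀ i k r, R[i]? = some r → iL = k + i + 1 → _ := fun i k r hr hk =>
    RV.get (k := k) rv.2 hr (by rw [rl']; exact hk)
  have ofle : ∀ {x : ℝ}, exp x ≤ 1 → x ≤ 0 := fun {x} hx => by
    by_contra hc; push Not at hc
    have := Real.add_one_le_exp x; linarith
  have mulle : ∀ {m n : ℕ}, m ≤ n → (m : ℝ) * Hh ≤ n * Hh := fun {m n} hmn => by
    have : (m : ℝ) ≤ n := by exact_mod_cast hmn
    gcongr
  -- q
  obtain ⟨r6, g6, b6⟩ := at?_get c6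
  have y6 := (node _ qhi r6 g6 (by omega)).1.2
  have u6 : u (qhi * Hh) ≤ 0 := ofle (y6.trans (by
    rw [div_le_one h0]; exact_mod_cast Nat.le_of_ble_eq_true b6))
  obtain ⟨q, hq, Hq⟩ := P.hump_of_nonpos (mulle (by omega)) u6
  have Nx : PreHump fN a (fun s => -u (q + s)) := by have := Hq.next; rwa [flip_fP] at this
  have aq : a < q := Hq.hq
  -- u positive at iL h - rho
  have rhoh : (rho : ℝ) / s ≤ Hh := (div_le_div_iff_of_pos_right h0).2 (by exact_mod_cast c2)
  have rho0 : (0 : ℝ) ≤ (rho : ℝ) / s := by positivity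
  set ρ := (rho : ℝ) / s with hρ
  have Hle : Hh ≤ 2 / 5 := by
    rw [hH, div_le_div_iff₀ h0 (by norm_num)]
    have : (5 * h : ℝ) ≤ 2 * s := by exact_mod_cast h5
    linarith
  have iLc : ((iL - 1 : ℕ) : ℝ) = (iL : ℝ) - 1 := by rw [Nat.cast_sub (by omega)]; simp
  have iLN : (qhi : ℝ) * Hh + a + Hh ≤ iL * Hh := by
    have := mulle (m := qhi + N + 1) (n := iL) p5
    push_cast at this; rw [ha]; linarith
  have y0 := (rv.1.1).1
  rw [rl'] at y0
  have dinc : ∀ x y, a ≤ x → x ≤ y → u y ≤ u x + 1 * (y - x) := by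
    intro x y hx hxy
    exact decr_bound (u' := fun t => -fP (u (t - a))) hxy r.cont (fun t ht => Rde t (by linarith [ht.1])) (fun t _ => by
      simp only [fP]; linarith [Real.exp_pos (u (t - a))])
  have u0 : 0 ≤ u (iL * Hh - ρ) := by
    have k1 := dinc (iL * Hh - ρ) (iL * Hh) (by linarith) (by linarith)
    have k2 := exp_le_quad (z := ρ) (by linarith)
    have k3 : 1 + ρ + ρ ^ 2 ≤ (r0.yl : ℝ) / s := by
      have : ((s * s + rho * s + rho * rho : ℕ) : ℝ) ≤ ((r0.yl * s : ℕ) : ℝ) := by exact_mod_cast c1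
      push_cast at this
      rw [hρ, le_div_iff₀ h0, ← mul_le_mul_iff_left₀ h0]
      calc _ = (s : ℝ) * s + rho * s + rho * rho := by field_simp
        _ ≤ _ := this
    have k4 : exp ρ ≤ exp (u (iL * Hh)) := by nlinarith [sq_nonneg ρ]
    have := Real.exp_le_exp.1 k4
    linarith
  obtain ⟨b, hb, Hb⟩ := Nx.hump_of_nonpos (T := iL * Hh - ρ - q) (by linarith) (by
    simp only [add_sub_cancel]; linarith)
  have ab : a < b := Hb.hq
  set L := q + b with hL
  have Lhi : L ≤ iL * Hh - ρ := by linarith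
  -- q > qlo h
  have neg : ∀ x, q ≤ x → x ≤ L → u x ≤ 0 := fun x h1 h2 => by
    have := Hb.nonneg (s := x - q) (by linarith) (by linarith)
    simp only [add_sub_cancel] at this; linarith
  have posL : ∀ x, L ≤ x → x ≤ L + a → 0 ≤ u x := fun x h1 h2 => by
    have := Hb.anti.antitoneOn (a := b) (b := x - q) ⟨by linarith, by linarith⟩ ⟨by linarith, by linarith⟩ (by linarith)
    have e := Hb.qz
    simp only [add_sub_cancel] at this e
    linarith
  have posn : ∀ k, N ≤ k → k ≤ qlo → 0 < u (k * Hh) := by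
    intro k k1 k2
    have hi : iL - 1 - k < R.length := by omega
    have g := List.getElem?_eq_getElem hi
    have y := (node _ k _ g (by omega)).1.1
    have hm : R[iL - 1 - k] ∈ (R.drop (iL - 1 - qlo)).take (qlo + 1 - N) := by
      rw [List.mem_take_iff_getElem]
      refine ⟨qlo - k, by rw [List.length_drop]; omega, ?_⟩
      rw [List.getElem_drop]
      congr 1; omega
    have := List.all_eq_true.1 c7 _ hm
    have : s < R[iL - 1 - k].yl := by simpa using this
    have : 1 < exp (u (k * Hh)) := lt_of_lt_of_le (by rw [one_lt_div h0]; exact_mod_cast this) y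
    by_contra hc; push Not at hc
    have := Real.exp_le_one_iff.2 hc
    linarith
  -- all nodes after qhi are negative
  have negn : ∀ k, qhi < k → k < iL → u (k * Hh) < 0 := by
    intro k k1 k2
    have hi : iL - 1 - k < R.length := by omega
    have g := List.getElem?_eq_getElem hi
    have y := (node _ k _ g (by omega)).1.2
    have hm : R[iL - 1 - k] ∈ R.take (iL - 1 - qhi) := by
      rw [List.mem_take_iff_getElem]
      exact ⟨iL - 1 - k, by omega, rfl⟩
    have := List.all_eq_true.1 c3 _ hm
    have : R[iL - 1 - k].yh < s := by simpa using this
    have : exp (u (k * Hh)) < 1 := lt_of_le_of_lt y (by rw [div_lt_one h0]; exact_mod_cast this)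
    by_contra hc; push Not at hc
    have := Real.one_le_exp hc
    linarith
  have qh : (qhi : ℝ) * Hh ≤ qlo * Hh + a := by
    have := mulle p4; push_cast at this; rw [ha]; linarith
  have hHa : Hh ≤ a := by
    have := mulle (m := 1) (n := N) (by omega)
    rw [ha]; simpa using this
  have qq : (qlo : ℝ) * Hh ≤ qhi * Hh := mulle p3
  have hqlo : qlo * Hh < q := by
    by_contra hc; push Not at hc
    set k := ⌈q / Hh⌉₊ with hk
    have k1 : q / Hh ≤ k := Nat.le_ceil _
    have k2 : (k : ℝ) < q / Hh + 1 := Nat.ceil_lt_add_one (div_nonneg (by linarith) H0.le)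
    have k3 : q ≤ k * Hh := (div_le_iff₀ H0).1 k1
    have k4 : k * Hh ≤ q + Hh := by
      have : (k : ℝ) * Hh < (q / Hh + 1) * Hh := by gcongr
      have e : (q / Hh + 1) * Hh = q + Hh := by field_simp
      linarith
    have k5 : k ≤ qlo := by
      apply Nat.ceil_le.2
      rw [div_le_iff₀ H0]; exact hc
    have k6 : N < k := by
      have : (N : ℝ) * Hh < k * Hh := by linarith
      have := lt_of_mul_lt_mul_right this H0.le
      exact_mod_cast this
    have := posn k k6.le k5
    linarith [neg _ k3 (by linarith)]
  have Llo : ((iL : ℝ) - 1) * Hh < L := by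
    by_contra hc; push Not at hc
    set k := ⌈L / Hh⌉₊ with hk
    have k1 : L / Hh ≤ k := Nat.le_ceil _
    have k2 : (k : ℝ) < L / Hh + 1 := Nat.ceil_lt_add_one (div_nonneg (by linarith) H0.le)
    have k3 : L ≤ k * Hh := (div_le_iff₀ H0).1 k1
    have k4 : k * Hh ≤ L + Hh := by
      have : (k : ℝ) * Hh < (L / Hh + 1) * Hh := by gcongr
      have e : (L / Hh + 1) * Hh = L + Hh := by field_simp
      linarith
    have k5 : k ≤ iL - 1 := by
      apply Nat.ceil_le.2
      rw [iLc, div_le_iff₀ H0]; exact hc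
    have k6 : qhi < k := by
      have : (qhi : ℝ) * Hh < k * Hh := by linarith
      have := lt_of_mul_lt_mul_right this H0.le
      exact_mod_cast this
    have := negn k k6 (by omega)
    have hHa : Hh ≤ a := by
      have := mulle (m := 1) (n := N) (by omega)
      rw [ha]; simpa using this
    linarith [posL _ k3 (by linarith)]
  have anti : ∀ x y, a ≤ x → x ≤ y → y ≤ q + a → u y ≤ u x := fun x y h1 h2 h3 =>
    Hq.anti.antitoneOn ⟨h1, by linarith⟩ ⟨by linarith, h3⟩ h2
  have mono : ∀ x y, q + a ≤ x → x ≤ y → y ≤ L + a → u x ≤ u y := fun x y h1 h2 h3 => by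
    have := Hb.anti.antitoneOn (a := x - q) (b := y - q) ⟨by linarith, by linarith⟩ ⟨by linarith, by linarith⟩ (by linarith)
    simp only [add_sub_cancel] at this; linarith
  refine ⟨q, b, Hq, Hb, ?_, ?_⟩
  · intro j hj σ s1 s2
    rcases Nat.eq_zero_or_pos j with rfl | j0
    · rw [zv_zero Q0]
      exact Real.exp_le_one_iff.2 (neg _ (by linarith) (by simp at s1; linarith))
    obtain ⟨v, v1, v2⟩ := zv_get (Q := Q) (z := z) j0 (by omega)
    rw [v2]
    have Nc : (iL : ℝ) * Hh - Hh - a = ((iL - 1 - N : ℕ) : ℝ) * Hh := by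
      rw [Nat.sub_sub, Nat.cast_sub (by omega), ha]; push_cast; ring
    rcases le_total (L - σ) (q + a) with h1 | h1
    · obtain ⟨r5, g5, b5⟩ := at?_get c5
      have y5 := (node _ (iL - 1 - N) r5 g5 (by omega)).1.2
      have k1 := anti ((iL - 1 - N : ℕ) * Hh) (L - σ) (by rw [← Nc]; linarith) (by rw [← Nc]; linarith) h1
      refine (Real.exp_le_exp.2 k1).trans (y5.trans ?_)
      match z, b5 with
      | z0 :: z', b5 =>
        have b5' : r5.yh ≤ z0 * SQ := by simpa using b5
        have m1 := mchk_mono p8 0 ((z0 :: z').length - j) z0 v (by omega) (by simp) v1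
        calc (r5.yh : ℝ) / s ≤ ((z0 * SQ : ℕ) : ℝ) / s := by
              apply (div_le_div_iff_of_pos_right h0).2; exact_mod_cast b5'
          _ = (z0 : ℝ) / Q := scal z0
          _ ≤ _ := by apply (div_le_div_iff_of_pos_right Q0').2; exact_mod_cast m1
    · have e1 : z.reverse[j - 1]? = some v := by
        rw [List.getElem?_reverse (by omega), ← v1]
        congr 1; omega
      obtain ⟨rr, g4, b4⟩ := all2_get c4 _ _ e1
      obtain ⟨⟨_, y4⟩, d4⟩ := node _ (iL - j) rr g4 (by omega)
      have jc : ((iL - j : ℕ) : ℝ) * Hh = iL * Hh - j * Hh := by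
        rw [Nat.cast_sub (by omega)]; ring
      rw [jc] at y4 d4
      have j1 : Hh ≤ j * Hh := by
        have := mulle (m := 1) (n := j) (by omega); simpa using this
      set x1 := iL * Hh - j * Hh - ρ with hx1
      have k1 := mono (L - σ) x1 h1 (by linarith) (by linarith)
      -- shift back by rho
      set T := ρ * (((s - rr.c : ℕ) : ℝ) / s) with hT
      have T0 : 0 ≤ T := by positivity
      have k2 := incr_bound (a := x1) (b := iL * Hh - j * Hh) (c := ((s - rr.c : ℕ) : ℝ) / s)
        (u' := fun t => -fP (u (t - a))) (by linarith) r.cont (fun t ht => Rde t (by linarith [ht.1])) (fun t ht => by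
          have g1 := Rde t (by linarith [ht.1])
          obtain ⟨c', q1, q2⟩ := d4 t (by
            have : ((iL - j : ℕ) : ℝ) - 1 = iL - j - 1 := by rw [Nat.cast_sub (by omega)]
            rw [this]
            have := ht.1
            nlinarith) ht.2 (by linarith [ht.1])
          have q3 := g1.unique q2
          have q4 : u (t - a) ≤ 0 := neg _ (by linarith [ht.1]) (by linarith [ht.2])
          have q5 := Real.exp_le_one_iff.2 q4
          rcases csub_cases s rr.c with ⟨q6, _⟩ | q6
          · rw [q6]; simp only [fP]; rw [zero_div]; linarith
          · rw [q6, q3, sub_div, div_self h0.ne']; linarith)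
      have k3 : u x1 + T ≤ u (iL * Hh - j * Hh) := by
        have : ((s - rr.c : ℕ) : ℝ) / s * (iL * Hh - j * Hh - x1) = T := by rw [hx1, hT]; ring
        linarith
      have k4 : exp (u x1) ≤ rr.yh / s * (1 - T + T ^ 2 / 2) := by
        have : exp (u x1) ≤ exp (u (iL * Hh - j * Hh)) * exp (-T) := by
          rw [← Real.exp_add]; exact Real.exp_le_exp.2 (by linarith)
        have e5 := exp_neg_quad T0
        have := Real.exp_pos (u (iL * Hh - j * Hh))
        have := Real.exp_pos (-T)
        calc _ ≤ exp (u (iL * Hh - j * Hh)) * exp (-T) := by assumption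
          _ ≤ rr.yh / s * exp (-T) := by gcongr
          _ ≤ _ := by gcongr
      refine (Real.exp_le_exp.2 k1).trans (k4.trans ?_)
      rw [← scal v]
      set t := rho * (s - rr.c) with ht
      have tT : T = (t : ℝ) / s ^ 2 := by
        rw [hT, ht, hρ]; push_cast; field_simp
      have b4' : rr.yh * (2 * s ^ 4 + t * t - 2 * t * s ^ 2) ≤ 2 * s ^ 4 * (v * SQ) := by simpa using b4
      have b4'' : ((rr.yh * (2 * s ^ 4 + t * t - 2 * t * s ^ 2) : ℕ) : ℝ) ≤ ((2 * s ^ 4 * (v * SQ) : ℕ) : ℝ) := by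
        exact_mod_cast b4'
      have cs := csub_le (2 * s ^ 4 + t * t) (2 * t * s ^ 2)
      push_cast at b4'' cs
      have e6 : (rr.yh : ℝ) / s * (1 - T + T ^ 2 / 2) = rr.yh * (2 * s ^ 4 + t * t - 2 * t * s ^ 2) / (2 * s ^ 5) := by
        rw [tT]; field_simp; ring
      rw [e6, div_le_div_iff₀ (by positivity) h0]
      push_cast
      have e7 : (rr.yh : ℝ) * (2 * s ^ 4 + t * t - 2 * t * s ^ 2) ≤ 2 * s ^ 4 * (v * SQ) := by
        refine le_trans ?_ b4''
        exact mul_le_mul_of_nonneg_left cs (Nat.cast_nonneg _)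
      calc _ ≤ 2 * (s : ℝ) ^ 4 * (v * SQ) * s := mul_le_mul_of_nonneg_right e7 h0.le
        _ = _ := by ring
  · intro j hj rr s1 s2
    rcases Nat.eq_zero_or_pos j with rfl | j0
    · rw [zv_zero Q0]
      exact Real.exp_le_one_iff.2 (neg _ (by simp at s1; linarith) (by linarith))
    obtain ⟨v, v1, v2⟩ := zv_get (Q := Q) (z := e) j0 (by omega)
    rw [v2]
    obtain ⟨r8, g8, b8⟩ := all2_get c8 _ _ v1
    rw [List.getElem?_drop] at g8
    have y8 := (node _ (qlo + j) r8 g8 (by omega)).1.2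
    have e1 : ((qlo + j : ℕ) : ℝ) * Hh = qlo * Hh + j * Hh := by push_cast; ring
    rw [e1] at y8
    have e2 : a ≤ qlo * Hh := mulle p2
    have e3 : 0 ≤ j * Hh := by positivity
    have k1 := anti (qlo * Hh + j * Hh) (q + rr) (by linarith) (by linarith) (by linarith)
    refine (Real.exp_le_exp.2 k1).trans (y8.trans ?_)
    rw [← scal v]
    apply (div_le_div_iff_of_pos_right h0).2
    exact_mod_cast (by simpa using b8 : r8.yh ≤ v * SQ)
end

def pZ (s SQ : ℕ) : List ℕ → List ℕ
  | [] => [s - 1]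
  | v :: z => force (v * SQ + 1) fun c => c :: pZ s SQ z

lemma pZ_len (s SQ : ℕ) (z : List ℕ) : (pZ s SQ z).length = z.length + 1 := by
  induction z with
  | nil => simp [pZ]
  | cons v z ih => simp [pZ, force_eq, ih]

lemma pZ_get (s SQ : ℕ) (z : List ℕ) (i : ℕ) (hi : i < z.length) :
    (pZ s SQ z)[i]? = some (z[i] * SQ + 1) := by
  induction z generalizing i with
  | nil => simp at hi
  | cons v z ih =>
    cases i with
    | zero => simp [pZ, force_eq]
    | succ i =>
      simp only [pZ, force_eq, List.getElem?_cons_succ, List.getElem_cons_succ]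
      exact ih i (by simpa using hi)

lemma pZ_last (s SQ : ℕ) (z : List ℕ) : (pZ s SQ z)[z.length]? = some (s - 1) := by
  induction z with
  | nil => simp [pZ]
  | cons v z ih => simpa [pZ, force_eq] using ih

/-- the profile of a list -/
def PR (s h SQ : ℕ) (z : List ℕ) : ℝ → ℝ :=
  prof ((h : ℝ) / s) (pz s (pZ s SQ z.tail)) (pZ s SQ z.tail).length

lemma prof_le {s h Q SQ N : ℕ} {z : List ℕ} (hzN : z.length = N) (hN : 3 ≤ N) (hsQ : s = Q * SQ) (hs : 0 < s)
    (hh : 0 < h) (hZ : OKZ s (pZ s SQ z.tail)) {w G : ℝ → ℝ} {τ h1 : ℝ} (haτ : N * ((h : ℝ) / s) ≤ τ)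
    (hh1 : h1 ≤ (h : ℝ) / s) (hw : Continuous w) (w0 : w 0 = 0) (wm : MonotoneOn w (Icc 0 τ))
    (wd : ∀ x ∈ Ioo 0 τ, HasDerivAt w (1 - G x) x)
    (wG : ∀ j ≤ N, ∀ x ∈ Ioo 0 τ, j * h1 ≤ τ - x → G x ≤ zv Q z j) :
    AscLE (PR s h SQ z) (N * ((h : ℝ) / s)) w τ ∧ PR s h SQ z (N * ((h : ℝ) / s)) < w τ := by
  have h0 : (0 : ℝ) < s := by exact_mod_cast hs
  have hh0 : (0 : ℝ) < h := by exact_mod_cast hh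
  have Q0 : 0 < Q := by
    rcases Nat.eq_zero_or_pos Q with h | h
    · subst h; simp at hsQ; omega
    · exact h
  have SQ0 : 0 < SQ := by
    rcases Nat.eq_zero_or_pos SQ with h | h
    · subst h; simp at hsQ; omega
    · exact h
  have Q0' : (0 : ℝ) < Q := by exact_mod_cast Q0
  have SQ0' : (0 : ℝ) < SQ := by exact_mod_cast SQ0
  have sQ : (s : ℝ) = Q * SQ := by exact_mod_cast hsQ
  have tl : z.tail.length = N - 1 := by simp [hzN]
  have pl : (pZ s SQ z.tail).length = N := by rw [pZ_len, tl]; omega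
  unfold PR
  have hp := pz_len s (pZ s SQ z.tail)
  have hm := hZ.mono
  rw [pl] at *
  set p := pz s (pZ s SQ z.tail) with hpd
  set H := (h : ℝ) / s with hH
  have H0 : 0 < H := by positivity
  set P := prof H p N with hP
  have Nc : ((N - 1 : ℕ) : ℝ) = (N : ℝ) - 1 := by rw [Nat.cast_sub (by omega)]; simp
  have N3 : (3 : ℝ) ≤ N := by exact_mod_cast hN
  -- slopes
  have pk : ∀ k, k < N - 1 → p k = 1 - zv Q z (N - 1 - k) - 1 / s := by
    intro k hk
    have g := pZ_get s SQ z.tail k (by omega)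
    have : p k = 1 - ((z.tail[k] * SQ + 1 : ℕ) : ℝ) / s := by simp only [hpd, pz, g]
    rw [this]
    obtain ⟨v, v1, v2⟩ := zv_get (Q := Q) (z := z) (j := N - 1 - k) (by omega) (by omega)
    have e : z.tail[k] = v := by
      rw [List.getElem_tail]
      have : z[k + 1]? = some v := by rw [← v1]; congr 1; omega
      rw [List.getElem?_eq_getElem (by omega)] at this
      exact Option.some.inj this
    rw [e, v2, sQ]
    push_cast
    field_simp
    ring
  have plast : p (N - 1) = 1 / s := by
    have g := pZ_last s SQ z.tail
    rw [tl] at g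
    have : p (N - 1) = 1 - ((s - 1 : ℕ) : ℝ) / s := by simp only [hpd, pz, g]
    rw [this, Nat.cast_sub (by omega)]
    field_simp
    simp
  have ha' : ((N - 1 : ℕ) : ℝ) * H ≤ N * H := by rw [Nc]; nlinarith
  have s1 : (0 : ℝ) < 1 / s := by positivity
  have pw : ∀ k < N - 1, ∀ x ∈ Ioo 0 (((N - 1 : ℕ) : ℝ) * H), (k : ℝ) * H < x → x < ((k : ℝ) + 1) * H → p k + 1 / s ≤ 1 - G x := by
    intro k hk x hx x1 x2
    have kc : ((N - 1 - k : ℕ) : ℝ) = (N : ℝ) - 1 - k := by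
      rw [Nat.cast_sub (by omega), Nc]
    have := wG (N - 1 - k) (by omega) x ⟨hx.1, by linarith [hx.2]⟩ (by
      calc ((N - 1 - k : ℕ) : ℝ) * h1 ≤ ((N - 1 - k : ℕ) : ℝ) * H := by gcongr
        _ = N * H - ((k : ℝ) + 1) * H := by rw [kc]; ring
        _ ≤ τ - x := by linarith)
    rw [pk k hk]; linarith
  have hinc := prof_inc_le (p := p) (N := N) (w := w) (w' := fun x => 1 - G x) (n := N - 1) H0 hp hw (by omega) (T := ((N - 1 : ℕ) : ℝ) * H) le_rfl
    (fun x hx => wd x ⟨hx.1, by linarith [hx.2]⟩)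
    (fun k hk x hx x1 x2 => by linarith [pw k hk x hx x1 x2])
  have hinc2 := prof_inc_le (p := p) (N := N) (w := fun x => w x - 1 / s * x) (w' := fun x => 1 - G x - 1 / s) (n := N - 1) H0 hp (by fun_prop) (by omega) (T := ((N - 1 : ℕ) : ℝ) * H) le_rfl
    (fun x hx => by
      have := (wd x ⟨hx.1, by linarith [hx.2]⟩).sub ((hasDerivAt_id x).const_mul (1 / (s : ℝ)))
      exact this.congr_deriv (by ring))
    (fun k hk x hx x1 x2 => by linarith [pw k hk x hx x1 x2]) 0 _ le_rfl (by positivity) le_rfl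
  have P0 : P 0 = 0 := prof_zero H0.le
  have top := prof_lin H0.le hp (k := N - 1) (by omega) (x := ((N - 1 : ℕ) : ℝ) * H) (y := N * H) le_rfl
    (by linarith) ha' (by rw [Nc]; linarith)
  rw [plast, ← hP] at top
  rw [← hP] at hinc2
  have A1 : 0 ≤ ((N - 1 : ℕ) : ℝ) * H := by positivity
  have ht : P (N * H) < w (((N - 1 : ℕ) : ℝ) * H) := by
    have e : 1 / (s : ℝ) * (N * H - ((N - 1 : ℕ) : ℝ) * H) = 1 / s * H := by rw [Nc]; ring
    have e2 : 1 / (s : ℝ) * H < 1 / s * (((N - 1 : ℕ) : ℝ) * H) := by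
      apply mul_lt_mul_of_pos_left _ s1
      rw [Nc]; nlinarith
    rw [w0, P0] at hinc2
    rw [e] at top
    linarith
  refine ⟨AscLE.of_lower' (a' := ((N - 1 : ℕ) : ℝ) * H) (by linarith) (by rw [P0, w0]) A1 wm
    (fun x _ y _ hxy => prof_mono hm hxy) (fun s t r hr hst => prof_conc hm s t r hr hst) hinc ht.le ha', ?_⟩
  exact lt_of_lt_of_le ht (wm ⟨A1, by linarith⟩ ⟨by linarith, le_rfl⟩ (by linarith))

def PC (a : ℝ) (P : ℝ → ℝ) : Prop :=
  ∀ α Y q b, a ≤ α → Orb α q b Y → AscLE P a Y α ∧ P a < Y α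

def S1 (a h1 : ℝ) (N : ℕ) (ζ η : ℕ → ℝ) : Prop :=
  ∀ α Y q b, a ≤ α → Orb α q b Y →
    (∀ j ≤ N, ∀ σ, j * h1 ≤ σ → σ ≤ α → exp (Y (-σ)) ≤ ζ j) ∧
    (∀ j ≤ N, ∀ r, j * h1 ≤ r → r ≤ α → exp (Y (q + r)) ≤ η j)

lemma AscLE.congr_left {u v w : ℝ → ℝ} {a τ : ℝ} (A : AscLE u a w τ) (h : ∀ x ∈ Icc 0 a, v x = u x) :
    AscLE v a w τ := by
  intro t ht s hs hst
  rw [h t ht] at hst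
  obtain ⟨h1, h2⟩ := A t ht s hs hst
  refine ⟨h1, fun r hr => ?_⟩
  rw [h (t - r) ⟨by linarith [hr.2], by linarith [hr.1, ht.2]⟩]
  exact h2 r hr

section
variable {a h : ℝ} {N : ℕ} {ζ η : ℕ → ℝ} {u : ℝ → ℝ} {q1 b1 : ℝ}

/-- everything the comparison gives about the negative part -/
lemma LoF.cmp (F : LoF a h N ζ η u q1 b1) (hP : PC a u) {α q b : ℝ} {Y : ℝ → ℝ} (hα : a ≤ α) (hY : Orb α q b Y) :
    AscLE (fun s => -u (q1 + s)) a (fun s => -Y (q + s)) α ∧ -u (q1 + a) < -Y (q + α) := by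
  obtain ⟨A, M⟩ := hP α Y q b hα hY
  have m := hump_min F.H hY.H hα A M
  exact ⟨hump_asc F.H hY.H hα A M, by linarith⟩

lemma LoF.asc (F : LoF a h N ζ η u q1 b1) (hP : PC a u) : PC a (fun s => u (q1 + b1 + s)) := by
  intro α Y q b hα hY
  obtain ⟨A, M⟩ := F.cmp hP hα hY
  have m := hump_min F.D hY.N hα A M
  have B := hump_asc F.D hY.N hα A M
  have e1 : (fun s => -(fun s => -u (q1 + s)) (b1 + s)) = fun s => u (q1 + b1 + s) := by
    funext s; simp only [neg_neg]; congr 1; ring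
  have e2 : (fun s => -(fun s => -Y (q + s)) (b + s)) = Y := by
    funext s; simp only [neg_neg]; rw [← hY.per s]; congr 1; ring
  rw [e1, e2] at B
  refine ⟨B, ?_⟩
  have e3 := congrFun e1 a
  have e4 := congrFun e2 α
  simp only at e3 e4 m
  linarith

lemma LoF.S (F : LoF a h N ζ η u q1 b1) (hP : PC a u) (haN : N * h = a) (h0 : 0 ≤ h) (hm : η N ≤ exp (-a))
    (hηζ : η N ≤ ζ N) (hζ : ∀ j ≤ N, ζ N ≤ ζ j) : S1 a h N ζ η := by
  intro α Y q b hα hY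
  obtain ⟨A, M⟩ := F.cmp hP hα hY
  have a0 := F.H.τpos
  have jle : ∀ j : ℕ, j ≤ N → j * h ≤ a := fun j hj => by
    rw [← haN]; have : (j : ℝ) ≤ N := by exact_mod_cast hj
    gcongr
  have nz : (fun s => -u (q1 + s)) 0 ≤ (fun s => -Y (q + s)) 0 := by
    have z1 := F.D.zero
    have z2 := hY.N.zero
    exact z1.le.trans z2.ge
  have E : ∀ j ≤ N, ∀ r, j * h ≤ r → r ≤ α → exp (Y (q + r)) ≤ η j := by
    intro j hj r r1 r2
    have r0 : 0 ≤ r := le_trans (by positivity) r1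
    have k1 := A.le F.D.cont nz (s := min r a) (le_min r0 a0.le) (min_le_right _ _) ((min_le_left _ _).trans r2)
    have k2 := hY.N.mono.monotoneOn (a := min r a) (b := r) ⟨le_min r0 a0.le, (min_le_left _ _).trans r2⟩ ⟨r0, r2⟩ (min_le_left _ _)
    have k3 := F.Ef j hj (min r a) (le_min r1 (jle j hj)) (min_le_right _ _)
    exact (Real.exp_le_exp.2 (by linarith)).trans k3
  refine ⟨fun j hj σ s1 s2 => ?_, E⟩
  have slope : ∀ {τ q b : ℝ} {v : ℝ → ℝ}, Hump fN τ b (fun s => -v (q + s)) → -v (q + τ) ≤ b - τ := by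
    intro τ q b v Hv
    have := incr_bound (a := τ) (b := b) (c := -1) (u := fun s => -v (q + s)) Hv.hq.le Hv.cont
      (fun s hs => Hv.de s hs.1) (fun s hs => by simp only [fN]; linarith [Real.exp_pos (-(-v (q + (s - τ))))])
    have e := Hv.qz
    linarith
  have m1 : a ≤ -u (q1 + a) := by
    have := (F.Ef N le_rfl a (jle N le_rfl) le_rfl).trans hm
    have := Real.exp_le_exp.1 this
    linarith
  have c1 := slope F.D
  have c2 := slope hY.N
  have s0 : 0 ≤ σ := le_trans (by positivity) s1
  have ye : ∀ x, Y (q + (b - x)) = Y (-x) := fun x => by rw [← hY.per (-x)]; congr 1; ring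
  rcases le_total σ (b - α) with h1 | h1
  · have k1 := hump_precross F.D hY.N hα A M (σ := min σ a) (le_min s0 a0.le) ((min_le_right _ _).trans (by linarith))
      ((min_le_left _ _).trans h1)
    have k2 := hY.mono_pre.monotoneOn (a := -σ) (b := -min σ a) ⟨by linarith, by linarith⟩
      ⟨by linarith [min_le_left σ a], by linarith [le_min s0 a0.le]⟩ (by linarith [min_le_left σ a])
    have k3 := F.Zf j hj (min σ a) (le_min s1 (jle j hj)) (min_le_right _ _)
    rw [ye, show q1 + (b1 - min σ a) = q1 + b1 - min σ a by ring] at k1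
    exact (Real.exp_le_exp.2 (by linarith)).trans k3
  · have := E N le_rfl (b - σ) (by linarith [jle N le_rfl]) (by linarith)
    rw [ye] at this
    exact this.trans (hηζ.trans (hζ j hj))
end

section
variable {s h Q SQ N iL qlo qhi rho : ℕ} {zin z e : List ℕ}

def runChk (s h Q SQ N iL qlo qhi rho : ℕ) (zin z e : List ℕ) : Bool :=
  loPre s h Q SQ N iL qlo qhi z e && (Nat.beq zin.length N && (mchk s 0 (pZ s SQ zin.tail) &&
  loChk s h SQ N iL qlo qhi rho z e
      (eng s h (eL s h) (eU s h) iL (initC s h (pZ s SQ zin.tail)) [] s s [⟨s, s, s⟩])))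

structure Par (s h Q SQ N : ℕ) : Prop where
  sQ : s = Q * SQ
  s0 : 0 < s
  h0 : 0 < h
  h5 : 5 * h ≤ 2 * s
  N3 : 3 ≤ N

lemma runChk_par (hc : runChk s h Q SQ N iL qlo qhi rho zin z e = true) : Par s h Q SQ N ∧ mchk Q 0 z = true ∧ z.length = N ∧ e.length = N := by
  simp only [runChk, loPre, Bool.and_eq_true, Nat.ble_eq, Nat.beq_eq, Nat.blt_eq] at hc
  obtain ⟨⟨p1, hs, hh, h5, hN, p2, p3, p4, p5, p6, p7, p8⟩, _⟩ := hc
  exact ⟨⟨p1, hs, hh, h5, hN⟩, p8, p6, p7⟩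

theorem run_sound (hc : runChk s h Q SQ N iL qlo qhi rho zin z e = true)
    (hP : PC (N * ((h : ℝ) / s)) (PR s h SQ zin)) :
    ∃ u q b, LoF (N * ((h : ℝ) / s)) ((h : ℝ) / s) N (zv Q z) (zv Q e) u q b ∧ PC (N * ((h : ℝ) / s)) u ∧
      ∀ x, N * ((h : ℝ) / s) < x → HasDerivAt u (1 - exp (u (x - N * ((h : ℝ) / s)))) x := by
  obtain ⟨⟨p1, hs, hh, h5, hN⟩, _⟩ := runChk_par hc
  simp only [runChk, Bool.and_eq_true, Nat.beq_eq] at hc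
  obtain ⟨c1, c2, c3, c4⟩ := hc
  have pl : (pZ s SQ zin.tail).length = N := by rw [pZ_len, List.length_tail]; omega
  have hZ := okz_of c3 (by omega)
  obtain ⟨u, ru⟩ := run_exists (Z := pZ s SQ zin.tail) hs hh (by omega)
  obtain ⟨q, b, F⟩ := lo_sound ru pl hZ c1 c4
  have rl := ru.low
  have rd := ru.de
  rw [pl] at rl rd
  refine ⟨u, q, b, F, fun α Y q' b' hα hY => ?_, fun x hx => (rd x hx).congr_deriv (by simp only [fP]; ring)⟩
  obtain ⟨A, M⟩ := hP α Y q' b' hα hY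
  have e : ∀ x, x ≤ N * ((h : ℝ) / s) → u x = PR s h SQ zin x := fun x hx => by
    rw [rl x hx, PR, pl]
  exact ⟨A.congr_left fun x hx => e x hx.2, by rw [e _ le_rfl]; exact M⟩

theorem chain_step (hc : runChk s h Q SQ N iL qlo qhi rho zin z e = true)
    (hZ : mchk s 0 (pZ s SQ z.tail) = true)
    (hP : PC (N * ((h : ℝ) / s)) (PR s h SQ zin)) : PC (N * ((h : ℝ) / s)) (PR s h SQ z) := by
  obtain ⟨⟨p1, hs, hh, h5, hN⟩, _, zl, _⟩ := runChk_par hc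
  obtain ⟨u, q, b, F, hu, de⟩ := run_sound hc hP
  have hA := F.asc hu
  have aq := F.H.hq
  have ab := F.D.hq
  have a0 := F.H.τpos
  set a := N * ((h : ℝ) / s) with ha
  have Ac : Continuous fun s => u (q + b + s) := F.H.cont.comp (continuous_const.add continuous_id)
  have A0 : u (q + b + 0) = 0 := by
    have := F.D.qz; rw [add_zero]; linarith
  have := prof_le (z := z) (w := fun s => u (q + b + s)) (G := fun x => exp (u (q + b - (a - x)))) (τ := a) (h1 := (h : ℝ) / s)
    zl hN p1 hs hh (okz_of hZ (by rw [pZ_len]; omega)) le_rfl le_rfl Ac A0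
    (fun x hx y hy hxy => by
      have := F.D.anti.antitoneOn (a := b + x) (b := b + y) ⟨by linarith [hx.1], by linarith [hx.2]⟩ ⟨by linarith [hy.1], by linarith [hy.2]⟩ (by linarith)
      simp only [← add_assoc] at this; simp only; linarith)
    (fun x hx => by
      have := (de (q + b + x) (by linarith [hx.1])).comp_const_add (q + b) x
      rw [show q + b + x - a = q + b - (a - x) by ring] at this
      exact this)
    (fun j hj x hx h1 => F.Zf j hj (a - x) h1 (by linarith [hx.1]))
  obtain ⟨B, hB⟩ := this
  intro α Y q' b' hα hY
  obtain ⟨C, hC⟩ := hA α Y q' b' hα hY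
  refine ⟨B.trans C Ac a0.le A0 (fun x hx => hY.H.nonneg hx.1 (hx.2.trans hY.H.hq.le)) (fun t ht => ?_), hB.trans hC⟩
  refine le_trans ?_ hB.le
  have hm := (okz_of hZ (by rw [pZ_len]; omega)).mono
  exact prof_mono hm ht.2

theorem run_S (hc : runChk s h Q SQ N iL qlo qhi rho zin z e = true)
    (hP : PC (N * ((h : ℝ) / s)) (PR s h SQ zin)) (hm : zv Q e N ≤ exp (-(N * ((h : ℝ) / s))))
    (hez : zv Q e N ≤ zv Q z N) : S1 (N * ((h : ℝ) / s)) ((h : ℝ) / s) N (zv Q z) (zv Q e) := by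
  obtain ⟨⟨p1, hs, hh, h5, hN⟩, mz, zl, _⟩ := runChk_par hc
  obtain ⟨u, q, b, F, hu, de⟩ := run_sound hc hP
  refine F.S hu rfl (by positivity) hm hez fun j hj => ?_
  have Q0 := mchk_lt mz
  have Q0' : (0 : ℝ) < Q := by exact_mod_cast Q0
  obtain ⟨v, v1, v2⟩ := zv_get (Q := Q) (z := z) (j := N) (by omega) (by omega)
  rw [v2]
  rcases Nat.eq_zero_or_pos j with rfl | j0
  · rw [zv_zero Q0, div_le_one Q0']
    exact_mod_cast (mchk_all mz _ _ v1).2.le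
  · obtain ⟨v', v1', v2'⟩ := zv_get (Q := Q) (z := z) (j := j) (by omega) (by omega)
    rw [v2']
    apply (div_le_div_iff_of_pos_right Q0').2
    exact_mod_cast mchk_mono mz _ _ _ _ (by omega) v1 v1'

/-- next parameter -/
theorem S_next {a1 h1 : ℝ} {η : ℕ → ℝ} (hpar : Par s h Q SQ N) (zl : z.length = N)
    (hS : S1 a1 h1 N (zv Q z) η) (ha : a1 ≤ N * ((h : ℝ) / s)) (hh1 : h1 ≤ (h : ℝ) / s)
    (hZ : mchk s 0 (pZ s SQ z.tail) = true) : PC (N * ((h : ℝ) / s)) (PR s h SQ z) := by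
  intro α Y q b hα hY
  obtain ⟨S, -⟩ := hS α Y q b (ha.trans hα) hY
  obtain ⟨p1, hs, hh, h5, hN⟩ := hpar
  exact prof_le (w := Y) (G := fun x => exp (Y (x - α))) zl hN p1 hs hh (okz_of hZ (by rw [pZ_len]; omega)) hα hh1 hY.cont
    hY.H.zero hY.H.mono.monotoneOn (fun x _ => hY.dexp x)
    (fun j hj x hx h1 => by
      have := S j hj (α - x) h1 (by linarith [hx.1])
      rwa [show -(α - x) = x - α by ring] at this)

theorem lin_next (hpar : Par s h Q SQ N) (zl : z.length = N) (ha : N * ((h : ℝ) / s) = 1.9)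
    (hz : ∀ j ≤ N, 1 - 0.0149 ≤ zv Q z j)
    (hZ : mchk s 0 (pZ s SQ z.tail) = true) : PC (N * ((h : ℝ) / s)) (PR s h SQ z) := by
  intro α Y q b hα hY
  obtain ⟨p1, hs, hh, h5, hN⟩ := hpar
  have hZ' := okz_of hZ (by rw [pZ_len]; omega)
  obtain ⟨B, hB⟩ := prof_le (w := fun s => 0.0149 * s) (G := fun x => 1 - 0.0149) (z := z) (Q := Q) (τ := N * ((h : ℝ) / s)) zl hN p1 hs hh hZ'
    le_rfl le_rfl (by fun_prop) (by simp) (fun x _ y _ hxy => by simp only; linarith)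
    (fun x _ => ((hasDerivAt_id x).const_mul 0.0149).congr_deriv (by norm_num))
    (fun j hj x _ _ => hz j hj)
  have C := hY.lin (by linarith)
  rw [ha] at *
  have m := C.max (by fun_prop) (by norm_num) hα
  refine ⟨B.trans C (by fun_prop) (by norm_num) (by simp) (fun x hx => hY.H.nonneg hx.1 (hx.2.trans hY.H.hq.le)) (fun t ht => ?_), lt_of_lt_of_le hB m⟩
  exact (prof_mono hZ'.mono ht.2).trans hB.le
end

def vZ (s h : ℕ) : ℕ → ℕ → List ℕ → List ℕ
  | 0, _, L => L
  | n + 1, c, L => force (c * (s - h) / s - 1) fun d => vZ s h n d (d :: L)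

def vchk (s h : ℕ) : ℕ → List ℕ → Bool
  | _, [] => true
  | c, d :: L => Nat.ble ((d + 1) * s) (c * (s - h)) && vchk s h d L

def muAll (s h mu : ℕ) : ℕ → List NRec → Bool
  | 0, _ => true
  | n + 1, r :: r' :: R => Nat.ble mu (ncl s h r'.yl r.c) && muAll s h mu n (r' :: R)
  | _ + 1, _ => false

def vRec (s N mu h : ℕ) (R : List NRec) : Bool :=
  at? R N (fun r => Nat.ble r.yh s) && muAll s h mu N R

def vRun (s h N mu : ℕ) (Z : List ℕ) : Bool :=
  Nat.beq Z.length N && (mchk s 0 Z && (vchk s h s Z.reverse &&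
    vRec s N mu h (eng s h (eL s h) (eU s h) (3 * N) (initC s h Z) [] s s [⟨s, s, s⟩])))

def vChk (s h N mu : ℕ) : Bool :=
  Nat.blt 0 s && (Nat.blt 0 h && (Nat.ble (5 * h) (2 * s) && (Nat.blt 0 N && vRun s h N mu (vZ s h N s []))))

lemma vchk_get {s h : ℕ} (hs : 0 < s) (hh : h ≤ s) {L : List ℕ} : ∀ {c : ℕ} {t : ℝ}, vchk s h c L = true →
    (c : ℝ) / s ≤ exp (-t) → ∀ (i d : ℕ), L[i]? = some d → ((d : ℝ) + 1) / s ≤ exp (-(t + ((i : ℝ) + 1) * ((h : ℝ) / s))) := by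
  have h0 : (0 : ℝ) < s := by exact_mod_cast hs
  have hh' : (h : ℝ) ≤ s := by exact_mod_cast hh
  induction L with
  | nil => intro c t _ _ i d h; simp at h
  | cons v L ih =>
    intro c t hc ht i d hd
    simp only [vchk, Bool.and_eq_true, Nat.ble_eq] at hc
    have key : ((v : ℝ) + 1) / s ≤ exp (-(t + (h : ℝ) / s)) := by
      have e1 : ((v : ℝ) + 1) * s ≤ c * (s - h) := by
        have : (((v + 1) * s : ℕ) : ℝ) ≤ ((c * (s - h) : ℕ) : ℝ) := by exact_mod_cast hc.1
        push_cast [Nat.cast_sub hh] at this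
        exact this
      have e2 : 1 - (h : ℝ) / s ≤ exp (-((h : ℝ) / s)) := by linarith [Real.add_one_le_exp (-((h : ℝ) / s))]
      have e3 : 0 ≤ 1 - (h : ℝ) / s := by rw [sub_nonneg, div_le_one h0]; exact hh'
      calc ((v : ℝ) + 1) / s ≤ (c / s) * (1 - (h : ℝ) / s) := by
            rw [div_le_iff₀ h0, show (c : ℝ) / s * (1 - (h : ℝ) / s) * s = c * (s - h) / s by field_simp, le_div_iff₀ h0]
            exact e1
        _ ≤ exp (-t) * exp (-((h : ℝ) / s)) := by gcongr
        _ = _ := by rw [← Real.exp_add]; congr 1; ring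
    cases i with
    | zero =>
      simp at hd; subst hd; simpa using key
    | succ i =>
      have := ih (c := v) (t := t + (h : ℝ) / s) hc.2 (le_trans (by gcongr; linarith) key) i d (by simpa using hd)
      push_cast
      convert this using 2
      ring

lemma muAll_get {s h mu : ℕ} : ∀ {n : ℕ} {R : List NRec}, muAll s h mu n R = true → ∀ i < n,
    ∃ r r', R[i]? = some r ∧ R[i + 1]? = some r' ∧ mu ≤ ncl s h r'.yl r.c := by
  intro n
  induction n with
  | zero => intro R _ i hi; omega
  | succ n ih =>
    intro R hR i hi
    match R with
    | [] => simp [muAll] at hR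
    | [r] => simp [muAll] at hR
    | r :: r' :: R =>
      simp only [muAll, Bool.and_eq_true, Nat.ble_eq] at hR
      cases i with
      | zero => exact ⟨r, r', by simp, by simp, hR.1⟩
      | succ i =>
        obtain ⟨a, b, h1, h2, h3⟩ := ih hR.2 i (by omega)
        exact ⟨a, b, by simpa using h1, by simpa using h2, h3⟩

lemma Orb.neg_ge {τ q b : ℝ} {Y : ℝ → ℝ} (hY : Orb τ q b Y) {σ : ℝ} (h0 : 0 ≤ σ) : -σ ≤ Y (-σ) := by
  have := decr_bound (a := -σ) (b := 0) (c := 1) (by linarith) hY.cont (fun s _ => hY.dexp s)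
    (fun s _ => by linarith [Real.exp_pos (Y (s - τ))])
  rw [hY.H.zero] at this
  linarith

theorem v_sound {s h N mu : ℕ} (hc : vChk s h N mu = true) {τ q b : ℝ} {Y : ℝ → ℝ} (hY : Orb τ q b Y)
    (hτ : τ ≤ N * ((h : ℝ) / s)) : (mu : ℝ) / s ≤ exp (Y (q + τ)) := by
  rcases Nat.eq_zero_or_pos mu with mu0 | mu0
  · subst mu0; simp [(Real.exp_pos _).le]
  simp only [vChk, Bool.and_eq_true, Nat.ble_eq, Nat.blt_eq] at hc
  obtain ⟨hs, hh, h5, hN, hc⟩ := hc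
  generalize vZ s h N s [] = Z at hc
  simp only [vRun, vRec, Bool.and_eq_true, Nat.beq_eq] at hc
  obtain ⟨hl, hm, hv, c1, c2⟩ := hc
  have hZ := okz_of hm (by omega)
  obtain ⟨V, rV⟩ := run_exists (Z := Z) hs hh (by omega)
  obtain ⟨rv, rl⟩ := rV.recs hs hh h5 hZ (3 * N)
  have P := rV.pre hs hh hZ
  have Vlow := rV.low
  rw [hl] at P Vlow
  have hp := pz_len s Z
  have mono := hZ.mono
  have last := hZ.last
  rw [hl] at hp mono last
  have h0 : (0 : ℝ) < s := by exact_mod_cast hs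
  have hh0 : (0 : ℝ) < h := by exact_mod_cast hh
  set H := (h : ℝ) / s with hH
  have H0 : 0 < H := by positivity
  set a := (N : ℝ) * H with ha
  generalize eng s h (eL s h) (eU s h) (3 * N) (initC s h Z) [] s s [⟨s, s, s⟩] = R at rv rl c1 c2
  have mulle : ∀ {m n : ℕ}, m ≤ n → (m : ℝ) * H ≤ n * H := fun {m n} hmn => by
    have : (m : ℝ) ≤ n := by exact_mod_cast hmn
    gcongr
  -- zero of V
  obtain ⟨r6, g6, b6⟩ := at?_get c1
  have y6 := (rv.get g6 (k := 2 * N) (by omega)).1.2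
  have u6 : V ((2 * N : ℕ) * H) ≤ 0 := by
    have : exp (V ((2 * N : ℕ) * H)) ≤ 1 := y6.trans (by
      rw [div_le_one h0]; exact_mod_cast Nat.le_of_ble_eq_true b6)
    linarith [Real.add_one_le_exp (V ((2 * N : ℕ) * H))]
  obtain ⟨qV, hq, Hq⟩ := P.hump_of_nonpos (mulle (by omega)) u6
  have t0 := hY.H.τpos
  -- comparison
  have pk : ∀ k < N, 1 - exp (-(((N : ℝ) - k) * H)) ≤ pz s Z k - 1 / s := by
    intro k hk
    obtain ⟨c, hc⟩ : ∃ c, Z[k]? = some c := ⟨Z[k]'(by omega), by simp⟩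
    have e := vchk_get hs (by omega) hv (t := 0) (by rw [div_self h0.ne']; simp) (N - 1 - k) c (by
      rw [List.getElem?_reverse (by omega), ← hc]; congr 1; omega)
    have kc : ((N - 1 - k : ℕ) : ℝ) = (N : ℝ) - 1 - k := by
      rw [Nat.cast_sub (by omega), Nat.cast_sub (by omega)]; simp
    rw [kc, ← hH, show (0 : ℝ) + ((N : ℝ) - 1 - k + 1) * H = ((N : ℝ) - k) * H by ring] at e
    have : pz s Z k = 1 - (c : ℝ) / s := by simp only [pz, hc]
    rw [this]
    rw [add_div] at e
    linarith
  have inc := prof_inc_ge (p := pz s Z) (N := N) (h := H) (w := fun x => Y x + 1 / s * x) (w' := fun x => 1 - exp (Y (x - τ)) + 1 / s)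
    H0 hp (by have := hY.cont; fun_prop) (T := τ) hτ
    (fun x _ => ((hY.dexp x).add ((hasDerivAt_id x).const_mul (1 / (s : ℝ)))).congr_deriv (by ring))
    (fun k hk x hx x1 x2 => by
      have e1 := hY.neg_ge (σ := τ - x) (by linarith [hx.2])
      rw [show -(τ - x) = x - τ by ring] at e1
      have e2 : exp (-(((N : ℝ) - k) * H)) ≤ exp (Y (x - τ)) := Real.exp_le_exp.2 (by
        have : ((N : ℝ) - k) * H = a - k * H := by rw [ha]; ring
        rw [this]; linarith)
      linarith [pk k hk])
  have is0 : (0 : ℝ) < 1 / s := by positivity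
  have V0 := P.zero
  have p0 : prof H (pz s Z) N 0 = 0 := prof_zero H0.le
  have A : AscLE Y τ V a := AscLE.of_upper hτ (by rw [V0, hY.H.zero]) P.mono
    (fun s t r hr hrs hst hta => by
      rw [Vlow t hta, Vlow s (by linarith), Vlow (t - r) (by linarith), Vlow (s - r) (by linarith)]
      exact prof_conc mono s t r hr hst)
    (fun x y h1 h2 h3 => by
      rw [Vlow x (by linarith), Vlow y (by linarith)]
      have := inc x y h1 h2 h3
      have : 0 ≤ 1 / (s : ℝ) * (y - x) := mul_nonneg is0.le (by linarith)
      linarith)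
  have M : Y τ < V a := by
    have k1 := inc 0 τ le_rfl t0.le le_rfl
    have k2 := P.mono.monotoneOn (a := τ) (b := a) ⟨t0.le, hτ⟩ ⟨P.τpos.le, le_rfl⟩ hτ
    rw [Vlow τ hτ] at k2
    have : 0 < 1 / (s : ℝ) * τ := by positivity
    rw [p0, hY.H.zero] at k1
    linarith
  have hmin := hump_min hY.H Hq hτ A M
  refine le_trans ?_ (Real.exp_le_exp.2 hmin.le)
  -- evaluate
  set x := qV + a with hx
  have x1 : 2 * a < x := by linarith [Hq.hq]
  have x2 : x ≤ 3 * a := by push_cast at hq; linarith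
  set m := ⌈x / H⌉₊ with hm'
  have m1 : x ≤ m * H := by rw [← div_le_iff₀ H0]; exact Nat.le_ceil _
  have x0 : 0 < x := by linarith [P.τpos]
  have m2 : ((m : ℝ) - 1) * H < x := by
    rw [← lt_div_iff₀ H0]
    have := Nat.ceil_lt_add_one (a := x / H) (by positivity)
    linarith
  have m3 : m ≤ 3 * N := Nat.ceil_le.2 (by rw [div_le_iff₀ H0]; push_cast; linarith)
  have m4 : 2 * N < m := Nat.lt_ceil.2 (by rw [lt_div_iff₀ H0]; push_cast; linarith)
  obtain ⟨r, r', g, g', hmu⟩ := muAll_get c2 (3 * N - m) (by omega)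
  have G1 := (rv.get g (k := m) (by omega)).2
  have G2 := (rv.get g' (k := m - 1) (by omega)).1.1
  have mc : ((m - 1 : ℕ) : ℝ) = (m : ℝ) - 1 := by rw [Nat.cast_sub (by omega)]; simp
  rw [mc, ← hH] at G2
  rw [← hH] at G1
  set t := ((m : ℝ) - 1) * H with ht
  have tpos : 0 < t := by
    have : (1 : ℝ) < m := by exact_mod_cast (by omega : 1 < m)
    rw [ht]; apply mul_pos _ H0; linarith
  have ex : ∀ y : ℝ, ∃ c : ℝ, y ∈ Ioo t x → c ≤ (r.c : ℝ) / s ∧ HasDerivAt V (1 - c) y := by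
    intro y
    by_cases hy : y ∈ Ioo t x
    · obtain ⟨c, hc⟩ := G1 y hy.1 (by linarith [hy.2]) (by linarith [hy.1])
      exact ⟨c, fun _ => hc⟩
    · exact ⟨0, fun h => absurd h hy⟩
  choose c hc using ex
  have ib := incr_bound (u' := fun y => 1 - c y) (c := 1 - (r.c : ℝ) / s) m2.le rV.cont (fun y hy => (hc y hy).2)
    (fun y hy => by linarith [(hc y hy).1])
  have xt : x - t ≤ H := by
    have : (m : ℝ) * H = t + H := by rw [ht]; ring
    linarith
  have k1 : (r'.yl : ℝ) / s * (1 + (1 - (r.c : ℝ) / s) * (x - t)) ≤ exp (V x) := by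
    have e1 : 1 + (1 - (r.c : ℝ) / s) * (x - t) ≤ exp ((1 - (r.c : ℝ) / s) * (x - t)) := by
      linarith [Real.add_one_le_exp ((1 - (r.c : ℝ) / s) * (x - t))]
    calc _ ≤ (r'.yl : ℝ) / s * exp ((1 - (r.c : ℝ) / s) * (x - t)) := by gcongr
      _ ≤ exp (V t) * exp ((1 - (r.c : ℝ) / s) * (x - t)) := by gcongr
      _ = exp (V t + (1 - (r.c : ℝ) / s) * (x - t)) := by rw [Real.exp_add]
      _ ≤ _ := Real.exp_le_exp.2 ib
  refine le_trans ?_ k1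
  have n1 : (mu : ℝ) ≤ r'.yl * ((s * s - h * (r.c - s) : ℕ) : ℝ) / (s * s) := by
    have : (mu : ℝ) ≤ ((r'.yl * (s * s - h * (r.c - s)) / (s * s) : ℕ) : ℝ) := by exact_mod_cast hmu
    refine this.trans ?_
    have := @Nat.cast_div_le ℝ _ _ _ (r'.yl * (s * s - h * (r.c - s))) (s * s)
    push_cast at this ⊢
    exact this
  have n2 : ((s * s - h * (r.c - s) : ℕ) : ℝ) ≤ s * s * (1 + (1 - (r.c : ℝ) / s) * (x - t)) ∨ mu = 0 := by
    have d0 := csub_le r.c s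
    rcases csub_cases (s * s) (h * (r.c - s)) with ⟨e, _⟩ | e
    · right
      rw [e] at n1; simp at n1; exact n1
    · left
      rw [e]; push_cast
      have f1 : (s : ℝ) * s * (1 + (1 - (r.c : ℝ) / s) * (x - t)) = s * s - (r.c - s) * (s * (x - t)) := by field_simp; ring
      rw [f1]
      have f2 : (s : ℝ) * (x - t) ≤ h := by
        have := mul_le_mul_of_nonneg_left xt h0.le
        rwa [hH, mul_div_cancel₀ _ h0.ne'] at this
      have f3 : 0 ≤ (s : ℝ) * (x - t) := mul_nonneg h0.le (by linarith)
      have f4 : ((r.c : ℝ) - s) * (s * (x - t)) ≤ ((r.c - s : ℕ) : ℝ) * h :=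
        (mul_le_mul_of_nonneg_right d0 f3).trans (mul_le_mul_of_nonneg_left f2 (Nat.cast_nonneg _))
      linarith
  rcases n2 with n2 | n2
  · calc (mu : ℝ) / s ≤ (r'.yl * ((s * s - h * (r.c - s) : ℕ) : ℝ) / (s * s)) / s := by gcongr
      _ ≤ (r'.yl * (s * s * (1 + (1 - (r.c : ℝ) / s) * (x - t))) / (s * s)) / s := by gcongr
      _ = _ := by field_simp
  · omega

section
variable {τ q b : ℝ} {Y : ℝ → ℝ}

lemma Orb.slope (hY : Orb τ q b Y) : -Y (q + τ) ≤ b - τ := by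
  have Hv := hY.N
  have := incr_bound (a := τ) (b := b) (c := -1) (u := fun s => -Y (q + s)) Hv.hq.le Hv.cont
    (fun s hs => Hv.de s hs.1) (fun s hs => by simp only [fN]; linarith [Real.exp_pos (-(-Y (q + (s - τ))))])
  have e := Hv.qz
  linarith

lemma Orb.b_eq (hY : Orb τ q b Y) : ∫ s in (0 : ℝ)..(b - τ), exp (Y (q + s)) = b - τ + Y (q + τ) := by
  have c : Continuous Y := hY.cont
  have e1 : ∫ s in (0 : ℝ)..(b - τ), (1 - exp (Y (q + s))) = Y (q + b) - Y (q + τ) := by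
    have := intervalIntegral.integral_eq_sub_of_hasDerivAt (a := 0) (b := b - τ) (f := fun s => Y (q + τ + s))
      (f' := fun s => 1 - exp (Y (q + s))) (fun s _ => by
        have := (hY.dexp (q + τ + s)).comp_const_add (q + τ) s
        rwa [show q + τ + s - τ = q + s by ring] at this) (by
        apply Continuous.intervalIntegrable; fun_prop)
    rw [this]; congr 2 <;> ring
  rw [intervalIntegral.integral_sub (by simp) (by apply Continuous.intervalIntegrable; fun_prop)] at e1
  have e2 := hY.N.qz
  simp at e1 e2
  linarith

lemma Orb.M_le (hY : Orb τ q b Y) : Y τ ≤ τ - 1 + exp (-τ) := by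
  have t0 := hY.H.τpos
  have c := hY.cont
  have := decr_bound (a := 0) (b := τ) (c := 0) (u := fun x => Y x - x + exp (x - τ))
    (u' := fun x => 1 - exp (Y (x - τ)) - 1 + exp (x - τ)) t0.le (by fun_prop)
    (fun x _ => by
      have h1 := (hY.dexp x).sub (hasDerivAt_id x)
      have h2 := (((hasDerivAt_id x).sub_const τ).exp)
      exact (h1.add h2).congr_deriv (by simp))
    (fun x hx => by
      have := hY.neg_ge (σ := τ - x) (by linarith [hx.2])
      rw [show -(τ - x) = x - τ by ring] at this
      have := Real.exp_le_exp.2 this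
      linarith)
  rw [hY.H.zero] at this
  simp at this
  linarith

lemma Orb.pre_le (hY : Orb τ q b Y) (hb : 2 * τ ≤ b) {x y : ℝ} (h0 : -τ ≤ x) (hxy : x ≤ y) (h1 : y ≤ τ) : Y x ≤ Y y :=
  hY.mono_pre.monotoneOn ⟨by linarith, by linarith⟩ ⟨by linarith, h1⟩ hxy

/-- concavity on the ascending piece -/
lemma Orb.conc (hY : Orb τ q b Y) (hb : 2 * τ ≤ b) {x : ℝ} (h0 : 0 ≤ x) (h1 : x ≤ τ) : Y τ / τ * x ≤ Y x := by
  have t0 := hY.H.τpos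
  set c := 1 - exp (Y (x - τ)) with hc
  have k1 := incr_bound (a := 0) (b := x) (c := c) h0 hY.cont (fun s _ => hY.dexp s) (fun s hs => by
    have := Real.exp_le_exp.2 (hY.pre_le hb (x := s - τ) (y := x - τ) (by linarith [hs.1]) (by linarith [hs.2]) (by linarith))
    simp only [hc]; linarith)
  have k2 := decr_bound (a := x) (b := τ) (c := c) h1 hY.cont (fun s _ => hY.dexp s) (fun s hs => by
    have := Real.exp_le_exp.2 (hY.pre_le hb (x := x - τ) (y := s - τ) (by linarith) (by linarith [hs.1]) (by linarith [hs.2]))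
    simp only [hc]; linarith)
  rw [hY.H.zero] at k1
  rw [div_mul_eq_mul_div, div_le_iff₀ t0]
  have k3 := mul_le_mul_of_nonneg_right k2 h0
  have k4 := mul_le_mul_of_nonneg_left k1 (by linarith : 0 ≤ τ - x)
  nlinarith

lemma Orb.q_le (hY : Orb τ q b Y) (hb : 2 * τ ≤ b) (ht : 1.9 ≤ τ) (hM : 0.158 ≤ Y τ) : q ≤ 2 * τ := by
  have t0 := hY.H.τpos
  have cY := hY.cont
  set M := Y τ with hMd
  have M0 : 0 ≤ M := by linarith
  set p := M / τ with hp
  have p0 : 0 ≤ p := by positivity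
  have k := decr_bound (a := 0) (b := τ) (c := 0) (u := fun s => Y (τ + s) + p * s ^ 2 / 2 + p ^ 2 * s ^ 3 / 6)
    (u' := fun s => 1 - exp (Y s) + p * s + p ^ 2 * s ^ 2 / 2) t0.le (by fun_prop)
    (fun s _ => by
      have h1 := (hY.dexp (τ + s)).comp_const_add τ s
      rw [add_sub_cancel_left] at h1
      have h2 := ((hasDerivAt_pow 2 s).const_mul p).div_const 2
      have h3 := ((hasDerivAt_pow 3 s).const_mul (p ^ 2)).div_const 6
      exact ((h1.add h2).add h3).congr_deriv (by push_cast; ring))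
    (fun s hs => by
      have h1 := hY.conc hb hs.1.le hs.2.le
      have h2 : 0 ≤ p * s := mul_nonneg p0 hs.1.le
      have h3 := Real.quadratic_le_exp_of_nonneg h2
      have h4 := Real.exp_le_exp.2 h1
      have : (p * s) ^ 2 = p ^ 2 * s ^ 2 := by ring
      simp only [hp, hMd] at *
      linarith)
  have pt : p * τ = M := by rw [hp]; field_simp
  have k' : Y (2 * τ) + M * τ / 2 + M ^ 2 * τ / 6 ≤ M := by
    have e1 : p * τ ^ 2 / 2 = M * τ / 2 := by rw [← pt]; ring
    have e2 : p ^ 2 * τ ^ 3 / 6 = M ^ 2 * τ / 6 := by rw [← pt]; ring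
    simp only [add_zero] at k
    rw [e1, e2, ← two_mul] at k
    simpa using k
  have neg : Y (2 * τ) ≤ 0 := by nlinarith [mul_nonneg M0 (by linarith : 0 ≤ M - 0.158), mul_nonneg M0 (by linarith : 0 ≤ τ - 1.9), mul_nonneg (mul_nonneg M0 M0) (by linarith : 0 ≤ τ - 1.9)]
  by_contra hc
  push Not at hc
  linarith [hY.H.pos (2 * τ) ⟨by linarith, hc⟩]

lemma Orb.E_low (hY : Orb τ q b Y) : 1 - exp (Y (q + τ)) ≤ (exp (Y τ) - 1) * ∫ s in (0 : ℝ)..τ, exp (Y (q + s)) := by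
  have t0 := hY.H.τpos
  have c := hY.cont
  have hq := hY.H.hq
  set f : ℝ → ℝ := fun s => exp (Y (q + s)) with hf
  have fc : Continuous f := by rw [hf]; fun_prop
  have hI : ∀ x, HasDerivAt (fun x => ∫ s in (0 : ℝ)..x, f s) (f x) x := fun x =>
    intervalIntegral.integral_hasDerivAt_right (fc.intervalIntegrable _ _) (fc.stronglyMeasurableAtFilter _ _) fc.continuousAt
  have := incr_bound (a := 0) (b := τ) (c := 0) (u := fun x => f x + (exp (Y τ) - 1) * ∫ s in (0 : ℝ)..x, f s)
    (u' := fun x => f x * (1 - exp (Y (q + x - τ))) + (exp (Y τ) - 1) * f x) t0.le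
    (fc.add (continuous_const.mul (continuous_iff_continuousAt.2 fun x => (hI x).continuousAt)))
    (fun x _ => by
      have h1 := ((hY.dexp (q + x)).comp_const_add q x).exp
      exact h1.add ((hI x).const_mul _))
    (fun x hx => by
      have h1 : Y (q + x - τ) ≤ Y τ := by
        rcases le_total (q + x - τ) τ with h | h
        · exact hY.H.mono.monotoneOn ⟨by linarith [hx.1], h⟩ ⟨t0.le, le_rfl⟩ h
        · exact hY.H.anti.antitoneOn (a := τ) (b := q + x - τ) ⟨le_rfl, by linarith⟩ ⟨h, by linarith [hx.2]⟩ h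
      have h2 := Real.exp_le_exp.2 h1
      have h3 : 0 ≤ f x := (Real.exp_pos _).le
      have := mul_nonneg h3 (sub_nonneg.2 h2)
      linarith)
  simp only [hf] at this
  rw [add_zero, hY.H.qz, intervalIntegral.integral_same] at this
  simp at this
  linarith
end

def sqU (s : ℕ) : ℕ → ℕ → ℕ
  | 0, v => v
  | k + 1, v => force (v * v / s + 1) fun v => sqU s k v

def sqL (s : ℕ) : ℕ → ℕ → ℕ
  | 0, v => v
  | k + 1, v => force (v * v / s) fun v => sqL s k v

lemma sqU_le {s : ℕ} (hs : 0 < s) : ∀ (k v : ℕ) (x : ℝ), exp x ≤ (v : ℝ) / s → exp (2 ^ k * x) ≤ (sqU s k v : ℝ) / s := by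
  have h0 : (0 : ℝ) < s := by exact_mod_cast hs
  intro k
  induction k with
  | zero => intro v x h; simpa [sqU] using h
  | succ k ih =>
    intro v x h
    simp only [sqU, force_eq]
    have := ih (v * v / s + 1) (2 * x) (by
      have e : exp (2 * x) ≤ (v : ℝ) / s * (v / s) := by
        rw [two_mul, Real.exp_add]; gcongr
      have := cdiv_up (v * v) s hs
      push_cast at this ⊢
      refine e.trans ?_
      rw [show (v : ℝ) / s * (v / s) = (v * v / s) / s by field_simp]
      gcongr)
    convert this using 2
    ring

lemma sqL_le {s : ℕ} (hs : 0 < s) : ∀ (k v : ℕ) (x : ℝ), (v : ℝ) / s ≤ exp x → (sqL s k v : ℝ) / s ≤ exp (2 ^ k * x) := by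
  have h0 : (0 : ℝ) < s := by exact_mod_cast hs
  intro k
  induction k with
  | zero => intro v x h; simpa [sqL] using h
  | succ k ih =>
    intro v x h
    simp only [sqL, force_eq]
    have := ih (v * v / s) (2 * x) (by
      have e : (v : ℝ) / s * (v / s) ≤ exp (2 * x) := by
        rw [two_mul, Real.exp_add]; gcongr
      have := @Nat.cast_div_le ℝ _ _ _ (v * v) s
      push_cast at this ⊢
      refine le_trans ?_ e
      rw [show (v : ℝ) / s * (v / s) = (v * v / s) / s by field_simp]
      gcongr)
    convert this using 2
    ring

def eSum : ℕ → List ℕ → ℕ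
  | _, [] => 0
  | c, z :: L => c + eSum z L

lemma int_bd {F : ℝ → ℝ} (hF : Continuous F) {a b c : ℝ} (hab : a ≤ b) (h : ∀ x ∈ Icc a b, F x ≤ c) :
    ∫ x in a..b, F x ≤ (b - a) * c := by
  have := intervalIntegral.integral_mono_on hab (hF.intervalIntegrable (μ := MeasureTheory.volume) _ _) (intervalIntegrable_const (c := c)) h
  simpa using this

lemma eSum_bd {f : ℝ → ℝ} (hf : Continuous f) {H T Q : ℝ} (H0 : 0 ≤ H) {L : List ℕ} : ∀ {j c : ℕ},
    (∀ x, j * H ≤ x → x ≤ T → f x ≤ c / Q) →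
    (∀ (i z : ℕ), L[i]? = some z → ∀ x, ((j : ℝ) + 1 + i) * H ≤ x → x ≤ T → f x ≤ z / Q) →
    ((j : ℝ) + L.length) * H ≤ T → ∫ x in (j * H)..(((j : ℝ) + L.length) * H), f x ≤ H * eSum c L / Q := by
  induction L with
  | nil => intro j c _ _ _; simp [eSum]
  | cons z L ih =>
    intro j c h1 h2 h3
    simp only [List.length_cons] at h3 ⊢
    push_cast at h3 ⊢
    have l0 : (0 : ℝ) ≤ (L.length : ℝ) * H := by positivity
    have k1 := int_bd hf (a := j * H) (b := ((j : ℝ) + 1) * H) (by linarith) (fun x hx => h1 x hx.1 (by linarith [hx.2]))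
    have k2 := ih (j := j + 1) (c := z) (fun x hx hT => h2 0 z (by simp) x (by push_cast at hx; simpa using hx) hT)
      (fun i v hv x hx hT => h2 (i + 1) v (by simpa using hv) x (by push_cast at hx ⊢; linarith) hT) (by push_cast; linarith)
    push_cast at k2
    rw [show (j : ℝ) + 1 + L.length = j + (L.length + 1) by ring] at k2
    rw [← intervalIntegral.integral_add_adjacent_intervals (b := ((j : ℝ) + 1) * H) (hf.intervalIntegrable _ _) (hf.intervalIntegrable _ _)]
    simp only [eSum]
    push_cast
    have e : H * ((c : ℝ) + eSum z L) / Q = (((j : ℝ) + 1) * H - j * H) * (c / Q) + H * eSum z L / Q := by ring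
    rw [e]
    linarith

def thc (s h Q C A erN : ℕ) : ℕ → ℕ → ℕ → List ℕ → List ℕ → ℕ
  | j, zc, w, [], _ => (A - j * h) * zc * (A - w + erN) * (C + A)
  | _, _, _, _ :: _, [] => s ^ 3 * Q
  | j, zc, w, z :: zs, er :: ers =>
    match Nat.ble z zc with
    | false => s ^ 3 * Q
    | true => force (j + 1) fun j' => force (w + 2 * (zc - z) * s / (zc + z)) fun w' =>
      h * zc * (j' * h - w + er) * (C + j' * h) + thc s h Q C A erN j' z w' zs ers

lemma log_step {z c : ℝ} (hz : 0 ≤ z) (hc : 0 < c) (hzc : z ≤ c) : z ≤ c * exp (-(2 * (c - z) / (c + z))) := by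
  rcases hz.eq_or_lt with rfl | z0
  · positivity
  have h := Real.le_log_one_add_of_nonneg (x := (c - z) / z) (by apply div_nonneg <;> linarith)
  have e1 : 2 * ((c - z) / z) / ((c - z) / z + 2) = 2 * (c - z) / (c + z) := by
    have hne : c + z ≠ 0 := by linarith
    rw [show (c - z) / z + 2 = (c + z) / z by field_simp; ring]
    field_simp
  have e2 : 1 + (c - z) / z = c / z := by field_simp; ring
  rw [e1, e2] at h
  have := Real.exp_le_exp.2 (neg_le_neg h)
  rw [Real.exp_neg, Real.exp_log (by positivity), inv_div] at this
  calc z = c * (z / c) := by field_simp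
    _ ≤ _ := by gcongr

section
variable {s h Q C A erN : ℕ} {F X ρ : ℝ → ℝ} {τ : ℝ}

/-- pointwise bound -/
lemma th_pt (hs : 0 < s) (hQ : 0 < Q) {zc w t er : ℕ} {σ : ℝ} (σ0 : 0 ≤ σ) (σt : σ ≤ (t : ℝ) / s) (x0 : 0 ≤ σ + X σ) (r0 : 0 ≤ ρ σ)
    (hF : F σ ≤ ((C : ℝ) / s + σ) * (exp (X σ) * (σ + X σ + ρ σ)))
    (hz : exp (X σ) ≤ (zc : ℝ) / Q) (hw : (zc : ℝ) / Q ≤ exp (-((w : ℝ) / s))) (hr : ρ σ ≤ (er : ℝ) / s) :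
    F σ ≤ ((zc * (t - w + er) * (C + t) : ℕ) : ℝ) / (s ^ 2 * Q) := by
  have h0 : (0 : ℝ) < s := by exact_mod_cast hs
  have Q0 : (0 : ℝ) < Q := by exact_mod_cast hQ
  have k1 : X σ ≤ -((w : ℝ) / s) := Real.exp_le_exp.1 (hz.trans hw)
  have k2 : σ + X σ + ρ σ ≤ ((t - w + er : ℕ) : ℝ) / s := by
    have := csub_le t w
    calc σ + X σ + ρ σ ≤ ((t : ℝ) - w + er) / s := by rw [add_div, sub_div]; linarith
      _ ≤ _ := by push_cast; gcongr
  have k3 : (C : ℝ) / s + σ ≤ ((C + t : ℕ) : ℝ) / s := by push_cast; rw [add_div]; linarith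
  refine hF.trans ?_
  have e : ((zc * (t - w + er) * (C + t) : ℕ) : ℝ) / (s ^ 2 * Q) = ((C + t : ℕ) : ℝ) / s * ((zc : ℝ) / Q * (((t - w + er : ℕ) : ℝ) / s)) := by
    push_cast; field_simp
  rw [e]
  have := Real.exp_pos (X σ)
  apply mul_le_mul k3 (mul_le_mul hz k2 (by linarith) (by positivity)) (mul_nonneg this.le (by linarith)) (by positivity)

lemma thc_bd (hs : 0 < s) (hQ : 0 < Q) (hF : Continuous F) (hτA : τ ≤ (A : ℝ) / s)
    (x0 : ∀ σ ∈ Icc 0 τ, 0 ≤ σ + X σ) (r0 : ∀ σ ∈ Icc 0 τ, 0 ≤ ρ σ)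
    (hb : ∀ σ ∈ Icc 0 τ, F σ ≤ ((C : ℝ) / s + σ) * (exp (X σ) * (σ + X σ + ρ σ))) {zs : List ℕ} :
    ∀ {j zc w : ℕ} {ers : List ℕ}, 
    (∀ σ, j * ((h : ℝ) / s) ≤ σ → σ ≤ τ → exp (X σ) ≤ (zc : ℝ) / Q) → (zc : ℝ) / Q ≤ exp (-((w : ℝ) / s)) →
    (∀ (i z : ℕ), zs[i]? = some z → ∀ σ, ((j : ℝ) + 1 + i) * ((h : ℝ) / s) ≤ σ → σ ≤ τ → exp (X σ) ≤ (z : ℝ) / Q) →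
    (∀ (i r : ℕ), i < zs.length → ers[i]? = some r → ∀ σ, 0 ≤ σ → ((j : ℝ) + i) * ((h : ℝ) / s) ≤ σ → σ ≤ ((j : ℝ) + i + 1) * ((h : ℝ) / s) → σ ≤ τ → ρ σ ≤ (r : ℝ) / s) →
    (∀ σ, ((j : ℝ) + zs.length) * ((h : ℝ) / s) ≤ σ → σ ≤ τ → ρ σ ≤ (erN : ℝ) / s) →
    ((j : ℝ) + zs.length) * ((h : ℝ) / s) ≤ τ →
    thc s h Q C A erN j zc w zs ers < s ^ 3 * Q →
    ∫ σ in (j * ((h : ℝ) / s))..τ, F σ ≤ (thc s h Q C A erN j zc w zs ers : ℝ) / (s ^ 3 * Q) := by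
  have h0 : (0 : ℝ) < s := by exact_mod_cast hs
  have Q0 : (0 : ℝ) < Q := by exact_mod_cast hQ
  induction zs with
  | nil =>
    intro j zc w ers i1 i2 _ _ i5 i6 _
    simp only [List.length_nil, Nat.cast_zero, add_zero] at i5 i6
    have jh : 0 ≤ (j : ℝ) * ((h : ℝ) / s) := by positivity
    have k1 := int_bd hF i6 (fun σ hσ => th_pt (t := A) hs hQ (jh.trans hσ.1) (hσ.2.trans hτA) (x0 σ ⟨jh.trans hσ.1, hσ.2⟩)
      (r0 σ ⟨jh.trans hσ.1, hσ.2⟩) (hb σ ⟨jh.trans hσ.1, hσ.2⟩) (i1 σ hσ.1 hσ.2) i2 (i5 σ hσ.1 hσ.2))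
    refine k1.trans ?_
    have k2 : τ - j * ((h : ℝ) / s) ≤ ((A - j * h : ℕ) : ℝ) / s := by
      have := csub_le A (j * h)
      calc τ - j * ((h : ℝ) / s) ≤ ((A : ℝ) - (j * h : ℕ)) / s := by
            rw [sub_div]; push_cast; rw [mul_div_assoc]; linarith
        _ ≤ _ := by gcongr
    refine (mul_le_mul_of_nonneg_right k2 (by positivity)).trans (le_of_eq ?_)
    simp only [thc]
    push_cast
    field_simp
  | cons z zs ih =>
    intro j zc w ers i1 i2 i3 i4 i5 i6 i7
    match ers with
    | [] => simp [thc] at i7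
    | er :: ers =>
    simp only [List.length_cons] at i5 i6
    push_cast at i5 i6
    cases hzz : Nat.ble z zc with
    | false => simp [thc, hzz] at i7
    | true =>
    have hz := Nat.le_of_ble_eq_true hzz
    simp only [thc, hzz, force_eq] at i7 ⊢
    have H0 : 0 ≤ (h : ℝ) / s := by positivity
    have jh : 0 ≤ (j : ℝ) * ((h : ℝ) / s) := by positivity
    have lh : 0 ≤ (zs.length : ℝ) * ((h : ℝ) / s) := by positivity
    have j1 : ((j : ℝ) + 1) * ((h : ℝ) / s) = (((j + 1) * h : ℕ) : ℝ) / s := by push_cast; ring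
    have k1 := int_bd hF (a := j * ((h : ℝ) / s)) (b := ((j : ℝ) + 1) * ((h : ℝ) / s)) (by linarith) (fun σ hσ => by
      have σ0 := jh.trans hσ.1
      have στ : σ ≤ τ := by linarith [hσ.2]
      exact th_pt (t := (j + 1) * h) (er := er) (zc := zc) (w := w) hs hQ σ0 (hσ.2.trans j1.le) (x0 σ ⟨σ0, στ⟩)
        (r0 σ ⟨σ0, στ⟩) (hb σ ⟨σ0, στ⟩) (i1 σ hσ.1 στ) i2 (i4 0 er (by simp) (by simp) σ σ0 (by simpa using hσ.1) (by simpa using hσ.2) στ))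
    have k2 := ih (j := j + 1) (zc := z) (w := w + 2 * (zc - z) * s / (zc + z)) (ers := ers)
      (fun σ h1 h2 => i3 0 z (by simp) σ (by push_cast at h1; simpa using h1) h2)
      (by
        rcases Nat.eq_zero_or_pos zc with hz0 | hz0
        · have : z = 0 := by omega
          subst this; simp; positivity
        have c0 : (0 : ℝ) < zc := by exact_mod_cast hz0
        have l := log_step (z := z) (c := zc) (by positivity) c0 (by exact_mod_cast hz)
        have d1 : ((2 * (zc - z) * s / (zc + z) : ℕ) : ℝ) / s ≤ 2 * ((zc : ℝ) - z) / (zc + z) := by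
          have := @Nat.cast_div_le ℝ _ _ _ (2 * (zc - z) * s) (zc + z)
          push_cast [Nat.cast_sub hz] at this ⊢
          rw [div_le_iff₀ h0]
          refine this.trans (le_of_eq ?_)
          ring
        calc (z : ℝ) / Q ≤ (zc * exp (-(2 * ((zc : ℝ) - z) / (zc + z)))) / Q := by gcongr
          _ = (zc : ℝ) / Q * exp (-(2 * ((zc : ℝ) - z) / (zc + z))) := by ring
          _ ≤ exp (-((w : ℝ) / s)) * exp (-(((2 * (zc - z) * s / (zc + z) : ℕ) : ℝ) / s)) := by gcongr
          _ = _ := by rw [← Real.exp_add]; congr 1; push_cast; ring)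
      (fun i v hv σ h1 h2 => i3 (i + 1) v (by simpa using hv) σ (by push_cast at h1 ⊢; linarith) h2)
      (fun i v hi hv σ h0 h1 h2 h3 => i4 (i + 1) v (by simpa using hi) (by simpa using hv) σ h0 (by push_cast at h1 ⊢; linarith) (by push_cast at h2 ⊢; linarith) h3)
      (fun σ h1 h2 => i5 σ (by push_cast at h1; linarith) h2)
      (by push_cast; linarith) (by omega)
    push_cast at k2
    rw [← intervalIntegral.integral_add_adjacent_intervals (b := ((j : ℝ) + 1) * ((h : ℝ) / s)) (hF.intervalIntegrable _ _) (hF.intervalIntegrable _ _)]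
    refine (add_le_add k1 k2).trans (le_of_eq ?_)
    push_cast
    field_simp
    ring
end

lemma zv_rev {Q : ℕ} {e : List ℕ} {i v : ℕ} (h : e.reverse[i]? = some v) : i < e.length ∧ zv Q e (i + 1) = (v : ℝ) / Q := by
  have hi : i < e.length := by
    by_contra hc
    rw [List.getElem?_eq_none (by simp; omega)] at h
    simp at h
  refine ⟨hi, ?_⟩
  obtain ⟨w, w1, w2⟩ := zv_get (Q := Q) (z := e) (j := i + 1) (by omega) (by omega)
  rw [List.getElem?_reverse hi] at h
  rw [show e.length - 1 - i = e.length - (i + 1) by omega, w1] at h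
  rw [w2, Option.some.inj h]

def cellChk (s h h2 Q SQ N mu kb i0 iv i2 iM : ℕ) (z e : List ℕ) : Bool :=
  Nat.beq s (Q * SQ) && (Nat.blt 0 s && (Nat.blt 0 h && (Nat.beq z.length N && (Nat.beq e.length N &&
  (Nat.ble (19 * s) (10 * (N * h)) &&
  (Nat.ble (e.getD 0 Q) (z.getD 0 Q) && (Nat.blt (z.getD 0 Q) Q &&
  (Nat.ble 1 kb && (Nat.ble kb N && (Nat.ble i0 s && (Nat.ble iM s && (Nat.ble (N * h2) (256 * i0) && (Nat.beq (N * h2) (256 * i2) &&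
  (Nat.ble (158 * s * Q) (1000 * ((N - N / 2) * h) * (Q - z.getD (N - N / 2) Q)) &&
  (Nat.ble (e.getD 0 Q * sqU s 8 (eU s i0)) (Q * s) &&
  (Nat.ble (s * s) (mu * sqL s 8 (eL s iv)) &&
  (Nat.ble (s * s) ((256 * iM + s - N * h2) * sqL s 8 (eL s i2)) &&
  (Nat.ble (h * eSum Q e.reverse + (256 * iv - N * h) * z.getD 0 Q) (s * (Q - z.getD 0 Q)) &&
  (Nat.ble ((kb * h + N * h2 - 256 * i0) * (sqU s 8 (eU s iM) - s) * Q) (s * s * (Q - e.getD 0 Q)) &&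
  Nat.blt (thc s h Q (N * h2 + 256 * iM + 256 * iv - s) (N * h2) ((e.getD (N - kb) Q * SQ - mu) * Q / (Q - z.getD 0 Q) + 1)
    0 Q 0 z.reverse (List.replicate kb 0 ++ e.tail.map fun η => (η * SQ - mu) * Q / (Q - z.getD 0 Q) + 1))
    (s ^ 3 * Q))))))))))))))))))))

section
variable {s h h2 Q SQ N mu kb i0 iv i2 iM : ℕ} {z e : List ℕ}

lemma orb_M {a h1 : ℝ} {N : ℕ} {ζ η : ℕ → ℝ} (hS : S1 a h1 N ζ η) {τ q b : ℝ} {Y : ℝ → ℝ} (hY : Orb τ q b Y) (ha : a ≤ τ)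
    {j : ℕ} (hj : j ≤ N) (h0 : 0 ≤ h1) (hjt : j * h1 ≤ τ) : (τ - j * h1) * (1 - ζ j) ≤ Y τ := by
  have k := incr_bound (a := 0) (b := τ - j * h1) (c := 1 - ζ j) (by linarith) hY.cont (fun x _ => hY.dexp x)
    (fun x hx => by
      have := (hS τ Y q b ha hY).1 j hj (τ - x) (by linarith [hx.2]) (by linarith [hx.1])
      rw [show -(τ - x) = x - τ by ring] at this
      linarith)
  rw [hY.H.zero] at k
  have j0 : 0 ≤ (j : ℝ) * h1 := by positivity
  have := hY.H.mono.monotoneOn (a := τ - j * h1) (b := τ) ⟨by linarith, by linarith⟩ ⟨by linarith, le_rfl⟩ (by linarith)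
  linarith

set_option maxHeartbeats 4000000 in
theorem cell_sound (hc : cellChk s h h2 Q SQ N mu kb i0 iv i2 iM z e = true)
    (hv : vChk s h2 N mu = true)
    (hS : S1 (N * ((h : ℝ) / s)) ((h : ℝ) / s) N (zv Q z) (zv Q e)) {τ : ℝ} (h1 : N * ((h : ℝ) / s) ≤ τ)
    (h2' : τ ≤ N * ((h2 : ℝ) / s)) {qY bY qZ bZ : ℝ} {Y Z : ℝ → ℝ} (hY : Orb τ qY bY Y) (hZ : Orb τ qZ bZ Z)
    (A : AscLE Y τ Z τ) (hM : Y τ < Z τ) : False := by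
  simp only [cellChk, Bool.and_eq_true, Nat.ble_eq, Nat.beq_eq, Nat.blt_eq] at hc
  obtain ⟨c1, hs, hh, zl, el, c19, cez, cy1, kb1, kbN, i0s, iMs, cm0, ca2, cM, cη, cμ, cMv, cE, cB, cth⟩ := hc
  have h0 : (0 : ℝ) < s := by exact_mod_cast hs
  have hh0 : (0 : ℝ) < h := by exact_mod_cast hh
  have Qp : 0 < Q := by omega
  have Q0 : (0 : ℝ) < Q := by exact_mod_cast Qp
  have sQ : (s : ℝ) = Q * SQ := by exact_mod_cast c1
  have SQ0 : (0 : ℝ) < SQ := by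
    rcases Nat.eq_zero_or_pos SQ with h | h
    · subst h; simp at c1; omega
    · exact_mod_cast h
  have t0 := hY.H.τpos
  set H := (h : ℝ) / s with hH
  have H0 : 0 < H := by positivity
  set y1 := z.getD 0 Q with hy1
  have zN : zv Q z N = (y1 : ℝ) / Q := by simp [zv, zl, hy1]
  have eN : zv Q e N = ((e.getD 0 Q : ℕ) : ℝ) / Q := by simp [zv, el]
  have jle : ∀ j : ℕ, j ≤ N → j * H ≤ N * H := fun j hj => by
    have : (j : ℝ) ≤ N := by exact_mod_cast hj
    gcongr
  -- constants
  set m0 : ℝ := (256 * i0 : ℕ) / s with hm0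
  set mv : ℝ := (256 * iv : ℕ) / s with hmv
  set Mv : ℝ := (256 * iM : ℕ) / s with hMv
  set a2 : ℝ := (N * h2 : ℕ) / s with ha2
  have a2e : N * ((h2 : ℝ) / s) = a2 := by rw [ha2]; push_cast; ring
  rw [a2e] at h2'
  have s8 : ∀ i : ℕ, (2 : ℝ) ^ 8 * ((i : ℝ) / s) = (256 * i : ℕ) / s := fun i => by push_cast; ring
  have em0 : zv Q e N ≤ exp (-m0) := by
    have u := sqU_le hs 8 _ _ (le_eU hs i0s)
    rw [s8, ← hm0] at u
    have c : (((e.getD 0 Q) * sqU s 8 (eU s i0) : ℕ) : ℝ) ≤ ((Q * s : ℕ) : ℝ) := by exact_mod_cast cη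
    push_cast at c
    rw [eN, Real.exp_neg, div_le_iff₀ Q0]
    have ep := Real.exp_pos m0
    rw [inv_mul_eq_div, le_div_iff₀ ep]
    calc _ ≤ ((e.getD 0 Q : ℕ) : ℝ) * (sqU s 8 (eU s i0) / s) := by gcongr
      _ = ((e.getD 0 Q : ℕ) : ℝ) * sqU s 8 (eU s i0) / s := by ring
      _ ≤ _ := by rw [div_le_iff₀ h0]; exact c
  have emv : exp (-mv) ≤ (mu : ℝ) / s := by
    have l := sqL_le hs 8 _ _ (eL_le (s := s) hs iv)
    rw [s8, ← hmv] at l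
    have c : ((s * s : ℕ) : ℝ) ≤ ((mu * sqL s 8 (eL s iv) : ℕ) : ℝ) := by exact_mod_cast cμ
    push_cast at c
    have ep := Real.exp_pos mv
    rw [Real.exp_neg, inv_le_iff_one_le_mul₀ ep]
    calc (1 : ℝ) = s * s / (s * s) := by field_simp
      _ ≤ mu * sqL s 8 (eL s iv) / (s * s) := by gcongr
      _ = (mu : ℝ) / s * (sqL s 8 (eL s iv) / s) := by field_simp
      _ ≤ _ := by gcongr
  have m0a : a2 ≤ m0 := by rw [ha2, hm0]; gcongr
  -- facts about each orbit
  have gen : ∀ {q b : ℝ} {U : ℝ → ℝ}, Orb τ q b U → m0 ≤ -U (q + τ) ∧ -U (q + τ) ≤ mv ∧ (mu : ℝ) / s ≤ exp (U (q + τ)) ∧ 2 * τ ≤ b ∧ q ≤ 2 * τ := by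
    intro q b U hU
    have k1 := ((hS τ U q b h1 hU).2 N le_rfl τ h1 le_rfl).trans em0
    have k1 := Real.exp_le_exp.1 k1
    have k2 := v_sound hv hU (by rw [a2e]; exact h2')
    have k3 := Real.exp_le_exp.1 (emv.trans k2)
    have k4 := hU.slope
    have b2 : 2 * τ ≤ b := by linarith
    refine ⟨by linarith, by linarith, k2, b2, hU.q_le b2 ?_ ?_⟩
    · refine le_trans ?_ h1
      have : ((19 * s : ℕ) : ℝ) ≤ ((10 * (N * h) : ℕ) : ℝ) := by exact_mod_cast c19
      push_cast at this
      rw [hH, ← mul_div_assoc, le_div_iff₀ h0]; linarith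
    · have := orb_M hS hU h1 (j := N / 2) (Nat.div_le_self _ _) H0.le ((jle _ (Nat.div_le_self _ _)).trans h1)
      refine le_trans ?_ this
      have zz : zv Q z (N / 2) = ((z.getD (N - N / 2) Q : ℕ) : ℝ) / Q := by simp [zv, zl]
      have c : ((158 * s * Q : ℕ) : ℝ) ≤ ((1000 * ((N - N / 2) * h) * (Q - z.getD (N - N / 2) Q) : ℕ) : ℝ) := by exact_mod_cast cM
      have n1 : ((N - N / 2 : ℕ) : ℝ) = (N : ℝ) - ((N / 2 : ℕ) : ℝ) := Nat.cast_sub (Nat.div_le_self _ _)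
      rcases csub_cases Q (z.getD (N - N / 2) Q) with ⟨e1, _⟩ | e1
      · push_cast at c; rw [e1] at c; exfalso
        have : (0 : ℝ) < 158 * s * Q := by positivity
        linarith
      push_cast [n1, e1] at c
      rw [zz]
      have pp : 0 ≤ 1 - ((z.getD (N - N / 2) Q : ℕ) : ℝ) / Q := by
        rw [sub_nonneg, div_le_one Q0]
        have := Nat.cast_nonneg (α := ℝ) (Q - z.getD (N - N / 2) Q)
        rw [e1] at this; linarith
      have n0 : 0 ≤ (N : ℝ) - ((N / 2 : ℕ) : ℝ) := by rw [← n1]; positivity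
      calc (0.158 : ℝ) = 158 * s * Q / (1000 * s * Q) := by field_simp; norm_num
        _ ≤ (1000 * (((N : ℝ) - ((N / 2 : ℕ) : ℝ)) * h) * (Q - ((z.getD (N - N / 2) Q : ℕ) : ℝ))) / (1000 * s * Q) := by gcongr
        _ = (N * H - (N / 2 : ℕ) * H) * (1 - ((z.getD (N - N / 2) Q : ℕ) : ℝ) / Q) := by rw [hH]; field_simp
        _ ≤ _ := by gcongr
  obtain ⟨mY1, mY2, μY, bY2, qY2⟩ := gen hY
  obtain ⟨mZ1, mZ2, μZ, bZ2, qZ2⟩ := gen hZ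
  obtain ⟨SY, SYe⟩ := hS τ Y qY bY h1 hY
  obtain ⟨SZ, SZe⟩ := hS τ Z qZ bZ h1 hZ
  have y1lt : (y1 : ℝ) / Q < 1 := by rw [div_lt_one Q0]; exact_mod_cast cy1
  have eY := hY.b_eq
  have cY := hY.cont
  have cZ := hZ.cont
  have fc : Continuous fun s => exp (Y (qY + s)) := by fun_prop
  set E := ∫ s in (0 : ℝ)..(bY - τ), exp (Y (qY + s)) with hE
  have split : E = (∫ s in (0 : ℝ)..τ, exp (Y (qY + s))) + ∫ s in τ..(bY - τ), exp (Y (qY + s)) := by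
    rw [hE, intervalIntegral.integral_add_adjacent_intervals (fc.intervalIntegrable _ _) (fc.intervalIntegrable _ _)]
  have yN : ∀ σ, τ ≤ σ → σ ≤ bY - τ → exp (Y (-σ)) ≤ (y1 : ℝ) / Q := by
    intro σ s1 s2
    have := hY.mono_pre.monotoneOn (a := -σ) (b := -τ) ⟨by linarith, by linarith⟩ ⟨by linarith, by linarith⟩ (by linarith)
    exact (Real.exp_le_exp.2 this).trans ((SY N le_rfl τ h1 le_rfl).trans zN.le)
  have E1 : E ≤ 1 := by
    have k1 := eSum_bd (Q := Q) fc H0.le (T := τ) (L := e.reverse) (j := 0) (c := Q)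
      (fun x hx hT => by
        rw [div_self Q0.ne', ← zv_zero Qp e]
        exact SYe 0 (Nat.zero_le _) x hx hT)
      (fun i v hv x hx hT => by
        obtain ⟨hi, hv⟩ := zv_rev (Q := Q) hv
        rw [← hv]
        exact SYe (i + 1) (by omega) x (by push_cast at hx ⊢; linarith) hT)
      (by rw [List.length_reverse, el]; push_cast; linarith)
    simp only [List.length_reverse, el, Nat.cast_zero, zero_mul, zero_add] at k1
    have k2 := int_bd fc h1 (c := (y1 : ℝ) / Q) (fun x hx => by
      refine (SYe N le_rfl x hx.1 hx.2).trans ?_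
      rw [eN]
      have : ((e.getD 0 Q : ℕ) : ℝ) ≤ y1 := by exact_mod_cast cez
      gcongr)
    have k3 := int_bd fc (a := τ) (b := bY - τ) (by linarith) (c := (y1 : ℝ) / Q) (fun x hx => by
      have := yN (bY - x) (by linarith [hx.2]) (by linarith [hx.1])
      rw [← hY.per' (-(bY - x))] at this
      rwa [show bY + -(bY - x) = x by ring] at this)
    have k4 := intervalIntegral.integral_add_adjacent_intervals (fc.intervalIntegrable (μ := MeasureTheory.volume) 0 (N * H)) (fc.intervalIntegrable (N * H) τ)
    have c : ((h * eSum Q e.reverse + (256 * iv - N * h) * y1 : ℕ) : ℝ) ≤ ((s * (Q - y1) : ℕ) : ℝ) := by exact_mod_cast cE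
    push_cast [Nat.cast_sub cy1.le] at c
    have k5 := csub_le (256 * iv) (N * h)
    have k6 : H * eSum Q e.reverse / Q + (mv - N * H) * (y1 / Q) ≤ 1 - y1 / Q := by
      have e1 : H * eSum Q e.reverse / Q + (mv - N * H) * (y1 / Q) = (h * eSum Q e.reverse + (((256 * iv : ℕ) : ℝ) - (N * h : ℕ)) * y1) / (s * Q) := by
        rw [hH, hmv]; push_cast; field_simp
      have e2 : 1 - (y1 : ℝ) / Q = s * (Q - y1) / (s * Q) := by field_simp
      rw [e1, e2]
      have : (((256 * iv : ℕ) : ℝ) - (N * h : ℕ)) * y1 ≤ ((256 * iv - N * h : ℕ) : ℝ) * y1 := by gcongr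
      gcongr
      linarith
    have yq : 0 ≤ (y1 : ℝ) / Q := by positivity
    obtain ⟨y, hy⟩ : ∃ y, y = (y1 : ℝ) / Q := ⟨_, rfl⟩
    rw [← hy] at k2 k3 k6 yq y1lt
    have k7 : -Y (qY + τ) * y ≤ mv * y := by gcongr
    have k8 : E ≤ H * eSum Q e.reverse / Q + (τ - N * H) * y + (bY - τ - τ) * y := by linarith
    have k9 : bY = E + τ - Y (qY + τ) := by linarith
    rw [k9] at k8
    have k10 : E * (1 - y) ≤ 1 - y := by linarith
    exact le_of_mul_le_mul_right (by linarith) (sub_pos.2 y1lt)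
  have P : Pair τ qY bY qZ bZ Y Z := ⟨hY, hZ, A, hM, bY2, bZ2, qY2, qZ2, E1⟩
  set K := Y (qY + τ) - Z (qZ + τ) with hK
  have Kp : 0 < K := P.Kpos
  -- M bound
  have MvB : ∀ {q b : ℝ} {U : ℝ → ℝ}, Orb τ q b U → U τ ≤ Mv := by
    intro q b U hU
    have k1 := hU.M_le
    have k2 := exp_sub_le (-τ) (-a2)
    have k3 : exp (-τ) ≤ 1 := Real.exp_le_one_iff.2 (by linarith)
    have k4 : exp (-τ) * (-τ - -a2) ≤ 1 * (-τ - -a2) := by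
      apply mul_le_mul_of_nonneg_right k3; linarith
    have k5 : exp (-a2) ≤ Mv - a2 + 1 := by
      have l := sqL_le hs 8 _ _ (eL_le (s := s) hs i2)
      rw [s8, ← ca2, ← ha2] at l
      have c : ((s * s : ℕ) : ℝ) ≤ (((256 * iM + s - N * h2) * sqL s 8 (eL s i2) : ℕ) : ℝ) := by exact_mod_cast cMv
      have hle : N * h2 ≤ 256 * iM + s := by
        by_contra hcon
        rw [Nat.sub_eq_zero_of_le (by omega)] at cMv
        have := Nat.mul_pos hs hs
        omega
      have e1 : Mv - a2 + 1 = ((256 * iM + s - N * h2 : ℕ) : ℝ) / s := by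
        rw [hMv, ha2, Nat.cast_sub hle]; push_cast; field_simp; ring
      rw [e1]
      have ep := Real.exp_pos a2
      rw [Real.exp_neg, inv_le_iff_one_le_mul₀ ep]
      calc (1 : ℝ) = (s * s : ℕ) / (s * s) := by push_cast; field_simp
        _ ≤ (((256 * iM + s - N * h2) * sqL s 8 (eL s i2) : ℕ) : ℝ) / (s * s) := by gcongr
        _ = ((256 * iM + s - N * h2 : ℕ) : ℝ) / s * (sqL s 8 (eL s i2) / s) := by push_cast; field_simp
        _ ≤ _ := by gcongr
    linarith
  -- bY - 2 τ ≥ kb H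
  have hkb : kb * H ≤ bY - 2 * τ := by
    have k1 := hY.E_low
    have k2 : 0 ≤ ∫ s in τ..(bY - τ), exp (Y (qY + s)) := intervalIntegral.integral_nonneg (by linarith) fun _ _ => (Real.exp_pos _).le
    set E0 := ∫ s in (0 : ℝ)..τ, exp (Y (qY + s)) with hE0
    have k3 := Real.exp_le_exp.2 (MvB hY)
    have u := sqU_le hs 8 _ _ (le_eU hs iMs)
    rw [s8, ← hMv] at u
    have E00 : 0 ≤ E0 := intervalIntegral.integral_nonneg t0.le fun _ _ => (Real.exp_pos _).le
    set G := ((sqU s 8 (eU s iM) - s : ℕ) : ℝ) / s with hG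
    have k4 : exp (Y τ) - 1 ≤ G := by
      have := csub_le (sqU s 8 (eU s iM)) s
      calc exp (Y τ) - 1 ≤ ((sqU s 8 (eU s iM) : ℝ) - s) / s := by rw [sub_div, div_self h0.ne']; linarith
        _ ≤ _ := by rw [hG]; gcongr
    have M1 := Real.add_one_le_exp (Y τ)
    have Yp : 0 < Y τ := hY.H.pos τ ⟨t0, hY.H.hq⟩
    have Gp : 0 < G := by linarith
    have k5 : 1 - zv Q e N ≤ G * E0 := by
      have := SYe N le_rfl τ h1 le_rfl
      have := mul_le_mul_of_nonneg_right k4 E00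
      linarith
    have c : (((kb * h + N * h2 - 256 * i0) * (sqU s 8 (eU s iM) - s) * Q : ℕ) : ℝ) ≤ ((s * s * (Q - e.getD 0 Q) : ℕ) : ℝ) := by exact_mod_cast cB
    push_cast [Nat.cast_sub (cez.trans cy1.le)] at c
    have k6 := csub_le (kb * h + N * h2) (256 * i0)
    have k7 : (kb * H + a2 - m0) * G ≤ 1 - zv Q e N := by
      calc (kb * H + a2 - m0) * G = (((kb * h + N * h2 : ℕ) : ℝ) - (256 * i0 : ℕ)) / s * G := by
            rw [hH, ha2, hm0]; push_cast; ring
        _ ≤ ((kb * h + N * h2 - 256 * i0 : ℕ) : ℝ) / s * G := by gcongr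
        _ = ((kb * h + N * h2 - 256 * i0 : ℕ) : ℝ) * ((sqU s 8 (eU s iM) - s : ℕ) : ℝ) * Q / (s * s * Q) := by rw [hG]; field_simp
        _ ≤ s * s * (Q - ((e.getD 0 Q : ℕ) : ℝ)) / (s * s * Q) := by gcongr
        _ = _ := by rw [eN]; field_simp
    have k8 : kb * H + a2 - m0 ≤ E0 := by
      by_contra hcon
      push Not at hcon
      have := mul_lt_mul_of_pos_right hcon Gp
      linarith
    linarith
  -- the main estimate
  have dle := P.dle
  have dp := P.dpos
  set d := bZ - bY with hd
  have d0 : 0 ≤ d := by linarith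
  have y1p : 0 < 1 - (y1 : ℝ) / Q := by linarith
  have dK : d ≤ K / (1 - (y1 : ℝ) / Q) := by
    rw [le_div_iff₀ y1p]
    have := SY N le_rfl τ h1 le_rfl
    rw [zN] at this
    refine le_trans ?_ dle
    gcongr
  set rr : ℝ → ℝ := fun σ => exp (Z (qZ + min (bY - τ - σ) τ)) - exp (Z (qZ + τ)) with hrr
  have rr0 : ∀ σ ∈ Icc 0 τ, 0 ≤ rr σ := by
    intro σ hσ
    have h3 : 0 ≤ min (bY - τ - σ) τ := le_min (by linarith [hσ.2]) t0.le
    have := hZ.ge_min (s := qZ + min (bY - τ - σ) τ) (by linarith) (by linarith [min_le_right (bY - τ - σ) τ, hZ.N.hq])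
    have := Real.exp_le_exp.2 this
    simp only [hrr]; linarith
  have rrU : ∀ σ ∈ Icc 0 τ, ∀ i ≤ N, i * H ≤ bY - τ - σ → rr σ ≤ zv Q e i - (mu : ℝ) / s := by
    intro σ hσ i hi hle
    have := SZe i hi (min (bY - τ - σ) τ) (le_min hle ((jle i hi).trans h1)) (min_le_right _ _)
    simp only [hrr]; linarith
  have erf : ∀ η : ℕ, ((η : ℝ) / Q - (mu : ℝ) / s) / (1 - (y1 : ℝ) / Q) ≤ (((η * SQ - mu) * Q / (Q - y1) + 1 : ℕ) : ℝ) / s := by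
    intro η
    have k1 := cdiv_up ((η * SQ - mu) * Q) (Q - y1) (by omega)
    have k2 := csub_le (η * SQ) mu
    have k3 : (0 : ℝ) < (Q : ℝ) - y1 := by have : (y1 : ℝ) < Q := by exact_mod_cast cy1
                                           linarith
    push_cast [Nat.cast_sub cy1.le] at k1 k2 ⊢
    rw [div_le_div_iff₀ y1p h0]
    calc ((η : ℝ) / Q - (mu : ℝ) / s) * s = (η * SQ - mu : ℝ) := by rw [sQ]; field_simp
      _ ≤ ((η * SQ - mu : ℕ) : ℝ) := by linarith
      _ = ((η * SQ - mu : ℕ) : ℝ) * Q / ((Q : ℝ) - y1) * (1 - (y1 : ℝ) / Q) := by field_simp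
      _ ≤ _ := by gcongr
  have rhoB : ∀ σ ∈ Icc 0 τ, ∀ i ≤ N, i * H ≤ bY - τ - σ → ∀ η : ℕ, zv Q e i = (η : ℝ) / Q →
      d * rr σ / K ≤ (((η * SQ - mu) * Q / (Q - y1) + 1 : ℕ) : ℝ) / s := by
    intro σ hσ i hi hle η hη
    refine le_trans ?_ (erf η)
    rw [← hη, div_le_iff₀ Kp]
    calc d * rr σ ≤ K / (1 - (y1 : ℝ) / Q) * (zv Q e i - (mu : ℝ) / s) := by
          apply mul_le_mul dK (rrU σ hσ i hi hle) (rr0 σ hσ) (by positivity)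
      _ = _ := by ring
  set C := N * h2 + 256 * iM + 256 * iv - s with hC
  have CB : a2 + Mv + mv - 1 ≤ (C : ℝ) / s := by
    have := csub_le (N * h2 + 256 * iM + 256 * iv) s
    calc a2 + Mv + mv - 1 = (((N * h2 + 256 * iM + 256 * iv : ℕ) : ℝ) - s) / s := by
          rw [ha2, hMv, hmv]; push_cast; field_simp
      _ ≤ _ := by gcongr
  set J := 2 * τ + Mv + mv with hJ
  have ct := P.contr (J := J) (by linarith [MvB hZ])
  set F : ℝ → ℝ := fun σ => (J - 1 - τ + σ) * (exp (Y (-σ)) - exp (Z (-σ))) / K with hF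
  have Fc : Continuous F := by rw [hF]; fun_prop
  have Mv0 : 0 ≤ Mv := by rw [hMv]; positivity
  have mv0 : 0 ≤ mv := by rw [hmv]; positivity
  have t19 : 1 ≤ τ := by
    have : ((19 * s : ℕ) : ℝ) ≤ ((10 * (N * h) : ℕ) : ℝ) := by exact_mod_cast c19
    push_cast at this
    refine le_trans ?_ h1
    rw [hH, ← mul_div_assoc, le_div_iff₀ h0]; linarith
  have bound := thc_bd (s := s) (h := h) (Q := Q) (C := C) (A := N * h2) (F := F) (X := fun σ => Y (-σ)) (ρ := fun σ => d * rr σ / K) (τ := τ)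
    (erN := (e.getD (N - kb) Q * SQ - mu) * Q / (Q - y1) + 1) hs Qp Fc h2'
    (fun σ hσ => by have := hY.neg_ge hσ.1; linarith)
    (fun σ hσ => div_nonneg (mul_nonneg d0 (rr0 σ hσ)) Kp.le)
    (fun σ hσ => by
      have k1 := P.delta hσ.1 hσ.2
      have k2 := exp_sub_le (Y (-σ)) (Z (-σ))
      have k3 := hY.neg_ge hσ.1
      have k4 := rr0 σ hσ
      have ep := Real.exp_pos (Y (-σ))
      have k5 : exp (Y (-σ)) - exp (Z (-σ)) ≤ exp (Y (-σ)) * (K * (σ + Y (-σ)) + d * rr σ) :=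
        k2.trans (by gcongr)
      have k6 : 0 ≤ K * (σ + Y (-σ)) + d * rr σ := add_nonneg (mul_nonneg Kp.le (by linarith)) (mul_nonneg d0 k4)
      have k7 : J - 1 - τ + σ ≤ (C : ℝ) / s + σ := by linarith
      have k8 : 0 ≤ J - 1 - τ + σ := by linarith [hσ.1]
      simp only [hF]
      rw [div_le_iff₀ Kp]
      calc _ ≤ (J - 1 - τ + σ) * (exp (Y (-σ)) * (K * (σ + Y (-σ)) + d * rr σ)) := by gcongr
        _ ≤ ((C : ℝ) / s + σ) * (exp (Y (-σ)) * (K * (σ + Y (-σ)) + d * rr σ)) := by gcongr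
        _ = _ := by field_simp)
    (zs := z.reverse) (j := 0) (zc := Q) (w := 0) (ers := List.replicate kb 0 ++ e.tail.map fun η => (η * SQ - mu) * Q / (Q - y1) + 1)
    (fun σ k1 k2 => by
      rw [div_self Q0.ne', ← zv_zero Qp z]
      exact SY 0 (Nat.zero_le _) σ k1 k2)
    (by simp [div_self Q0.ne'])
    (fun i v hv x hx hT => by
        obtain ⟨hi, hv⟩ := zv_rev (Q := Q) hv
        rw [← hv]
        exact SY (i + 1) (by omega) x (by push_cast at hx ⊢; linarith) hT)
    (fun i r hi hr σ k0 k1 k2 k3 => by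
      simp only [List.length_reverse, zl] at hi
      simp only [Nat.cast_zero, zero_add] at k1 k2
      rcases lt_or_ge i kb with hik | hik
      · rw [List.getElem?_append_left (by simpa using hik), List.getElem?_replicate, if_pos hik] at hr
        have hr := Option.some.inj hr
        subst hr
        have ic : ((i : ℝ) + 1) ≤ kb := by exact_mod_cast hik
        have : ((i : ℝ) + 1) * H ≤ kb * H := by gcongr
        have : min (bY - τ - σ) τ = τ := min_eq_right (by linarith)
        simp [hrr, this]
      · rw [List.getElem?_append_right (by simpa using hik), List.length_replicate, List.getElem?_map] at hr
        obtain ⟨η, hη, rfl⟩ := Option.map_eq_some_iff.1 hr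
        refine rhoB σ ⟨k0, k3⟩ (N + kb - i - 1) (by omega) ?_ η ?_
        · have ic : ((N + kb - i - 1 : ℕ) : ℝ) = (N : ℝ) + kb - i - 1 := by
            rw [Nat.cast_sub (by omega), Nat.cast_sub (by omega)]; push_cast; ring
          rw [ic]
          nlinarith
        · obtain ⟨v, v1, v2⟩ := zv_get (Q := Q) (z := e) (j := N + kb - i - 1) (by omega) (by omega)
          rw [v2]
          rw [List.getElem?_tail] at hη
          rw [show i - kb + 1 = e.length - (N + kb - i - 1) by omega, v1] at hη
          rw [Option.some.inj hη])
    (fun σ k1 k2 => by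
      simp only [List.length_reverse, zl] at k1
      have nn : 0 ≤ (N : ℝ) * H := by positivity
      simp only [Nat.cast_zero, zero_add] at k1
      refine rhoB σ ⟨nn.trans k1, k2⟩ kb kbN (by linarith) _ ?_
      simp [zv, el])
    (by simp only [List.length_reverse, zl, Nat.cast_zero, zero_add]; exact h1) cth
  simp only [Nat.cast_zero, zero_mul] at bound
  have lt1 : (thc s h Q C (N * h2) ((e.getD (N - kb) Q * SQ - mu) * Q / (Q - y1) + 1)
    0 Q 0 z.reverse (List.replicate kb 0 ++ e.tail.map fun η => (η * SQ - mu) * Q / (Q - y1) + 1) : ℝ) / (s ^ 3 * Q) < 1 := by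
    rw [div_lt_one (by positivity)]
    exact_mod_cast cth
  have e1 : ∫ σ in (0 : ℝ)..τ, F σ = (∫ σ in (0 : ℝ)..τ, (J - 1 - τ + σ) * (exp (Y (-σ)) - exp (Z (-σ)))) / K := by
    simp only [hF]; rw [intervalIntegral.integral_div]
  rw [e1] at bound
  have := lt_of_le_of_lt bound lt1
  rw [div_lt_one Kp] at this
  linarith
end

section
variable {τ q b : ℝ} {Y : ℝ → ℝ}

lemma Orb.pre_le' (hY : Orb τ q b Y) {x y : ℝ} (h0 : -(b - τ) ≤ x) (hxy : x ≤ y) (h1 : y ≤ τ) : Y x ≤ Y y :=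
  hY.mono_pre.monotoneOn ⟨h0, by linarith⟩ ⟨by linarith, h1⟩ hxy

lemma Orb.dneg (hY : Orb τ q b Y) (k σ : ℝ) : HasDerivAt (fun s => Y (k - s)) (-(1 - exp (Y (k - σ - τ)))) σ :=
  HasDerivAt.comp_const_sub k σ (hY.dexp (k - σ))

lemma Orb.neg_lt (hY : Orb τ q b Y) (hb : 4 * τ ≤ b) : Y (-τ) < 0 := by
  have t0 := hY.H.τpos
  have := hY.mono_pre (show -τ ∈ Icc (-(b - τ)) τ from ⟨by linarith, by linarith⟩) (show (0 : ℝ) ∈ Icc (-(b - τ)) τ from ⟨by linarith, t0.le⟩) (by linarith)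
  rwa [hY.H.zero] at this

lemma Orb.M_ge (hY : Orb τ q b Y) (hb : 4 * τ ≤ b) : τ - 1 ≤ Y τ := by
  have t0 := hY.H.τpos
  have c := hY.cont
  have n := hY.neg_lt hb
  have n1 : exp (Y (-τ)) < 1 := by rw [← Real.exp_zero]; exact Real.exp_lt_exp.2 n
  have := decr_bound (a := 0) (b := τ) (c := 0) (u := fun σ => (1 - exp (Y (-τ))) * (σ + Y (τ - σ)) + exp (Y (0 - σ)))
    t0.le (by fun_prop)
    (fun σ _ => (((hasDerivAt_id σ).add (hY.dneg τ σ)).const_mul (1 - exp (Y (-τ)))).add ((hY.dneg 0 σ).exp))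
    (fun σ hσ => by
      have k1 := Real.exp_le_exp.2 (hY.pre_le' (x := 0 - σ - τ) (y := -τ) (by linarith [hσ.2]) (by linarith [hσ.1]) (by linarith))
      have k2 := Real.exp_pos (Y (0 - σ))
      rw [show τ - σ - τ = 0 - σ by ring]
      have k3 : exp (Y (0 - σ)) * exp (Y (0 - σ - τ)) ≤ exp (Y (0 - σ)) * exp (Y (-τ)) := by gcongr
      linarith)
  simp only [sub_self, zero_sub, sub_zero, hY.H.zero, Real.exp_zero, neg_zero, add_zero, zero_add, zero_mul] at this
  have : (1 - exp (Y (-τ))) * (τ - Y τ) ≤ (1 - exp (Y (-τ))) * 1 := by linarith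
  have := le_of_mul_le_mul_left this (by linarith)
  linarith

lemma Orb.supadd (hY : Orb τ q b Y) (hb : 4 * τ ≤ b) {σ : ℝ} (h0 : 0 ≤ σ) (h1 : σ ≤ τ) :
    Y (-τ - σ) ≤ Y (-τ) + Y (0 - σ) := by
  have t0 := hY.H.τpos
  have c := hY.cont
  have := decr_bound (a := 0) (b := σ) (c := 0) (u := fun σ => Y (-τ - σ) - Y (0 - σ)) h0 (by fun_prop)
    (fun s _ => (hY.dneg (-τ) s).sub (hY.dneg 0 s)) (fun s hs => by
      have k1 := Real.exp_le_exp.2 (hY.pre_le' (x := -τ - s - τ) (y := 0 - s - τ) (by linarith [hs.2]) (by linarith) (by linarith [hs.1]))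
      linarith)
  simp only [sub_zero, hY.H.zero] at this
  linarith

lemma Orb.g_le (hY : Orb τ q b Y) (hb : 4 * τ ≤ b) {σ : ℝ} (h0 : 0 ≤ σ) (h1 : σ ≤ τ) :
    σ + Y (0 - σ) ≤ exp (Y (-τ)) * (σ + Y (τ - σ) - Y τ) := by
  have c := hY.cont
  have := decr_bound (a := 0) (b := σ) (c := 0) (u := fun σ => σ + Y (0 - σ) - exp (Y (-τ)) * (σ + Y (τ - σ) - Y τ)) h0 (by fun_prop)
    (fun s _ => ((hasDerivAt_id s).add (hY.dneg 0 s)).sub ((((hasDerivAt_id s).add (hY.dneg τ s)).sub_const (Y τ)).const_mul (exp (Y (-τ)))))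
    (fun s hs => by
      have k1 := Real.exp_le_exp.2 (hY.supadd hb hs.1.le (hs.2.le.trans h1))
      rw [Real.exp_add] at k1
      rw [show τ - s - τ = 0 - s by ring, show 0 - s - τ = -τ - s by ring]
      linarith)
  simp only [sub_zero, hY.H.zero] at this
  linarith

lemma Orb.R_le (hY : Orb τ q b Y) (hb : 4 * τ ≤ b) :
    ∫ σ in (0 : ℝ)..τ, exp (Y (-σ)) * (σ + Y (-σ)) ≤ exp (Y (-τ)) / 2 := by
  have t0 := hY.H.τpos
  have c := hY.cont
  have mg := hY.M_ge hb
  have k1 : ∫ σ in (0 : ℝ)..τ, exp (Y (-σ)) * (σ + Y (-σ)) ≤ ∫ σ in (0 : ℝ)..τ, exp (Y (-τ)) * (exp (Y (0 - σ)) * (σ + Y (τ - σ) - Y τ)) := by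
    apply intervalIntegral.integral_mono_on t0.le (Continuous.intervalIntegrable (by fun_prop) _ _) (Continuous.intervalIntegrable (by fun_prop) _ _)
    intro σ hσ
    have := hY.g_le hb hσ.1 hσ.2
    rw [zero_sub] at this ⊢
    calc _ ≤ exp (Y (-σ)) * (exp (Y (-τ)) * (σ + Y (τ - σ) - Y τ)) := by gcongr
      _ = _ := by ring
  refine k1.trans ?_
  rw [intervalIntegral.integral_const_mul]
  have k2 := intervalIntegral.integral_eq_sub_of_hasDerivAt (a := 0) (b := τ) (f := fun s => (s + Y (τ - s) - Y τ) ^ 2 / 2)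
      (f' := fun σ => exp (Y (0 - σ)) * (σ + Y (τ - σ) - Y τ)) (fun s _ => by
        have := ((((hasDerivAt_id s).add (hY.dneg τ s)).sub_const (Y τ)).pow 2).div_const 2
        rw [show τ - s - τ = 0 - s by ring] at this
        exact this.congr_deriv (by simp; ring)) (by
        apply Continuous.intervalIntegrable; fun_prop)
  rw [k2]
  simp only [sub_self, sub_zero, hY.H.zero, zero_add, add_zero]
  have m1 := hY.M_le
  have m2 : exp (-τ) ≤ 1 := Real.exp_le_one_iff.2 (by linarith)
  have : (τ - Y τ) ^ 2 ≤ 1 := by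
    have : 0 ≤ τ - Y τ := by linarith
    exact pow_le_one₀ this (by linarith)
  have ep := Real.exp_pos (Y (-τ))
  have : exp (Y (-τ)) * (τ - Y τ) ^ 2 ≤ exp (Y (-τ)) * 1 := by gcongr
  simp
  linarith

lemma Orb.up_le (hY : Orb τ q b Y) {t : ℝ} (h0 : 0 ≤ t) (h1 : t ≤ τ) : Y t ≤ t + exp (-τ) - exp (t - τ) := by
  have t0 := hY.H.τpos
  have c := hY.cont
  have := decr_bound (a := 0) (b := t) (c := 0) (u := fun x => Y x - x + exp (x - τ))
    (u' := fun x => 1 - exp (Y (x - τ)) - 1 + exp (x - τ)) h0 (by fun_prop)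
    (fun x _ => by
      have h1 := (hY.dexp x).sub (hasDerivAt_id x)
      have h2 := (((hasDerivAt_id x).sub_const τ).exp)
      exact (h1.add h2).congr_deriv (by simp))
    (fun x hx => by
      have := hY.neg_ge (σ := τ - x) (by linarith [hx.2])
      rw [show -(τ - x) = x - τ by ring] at this
      have := Real.exp_le_exp.2 this
      linarith)
  rw [hY.H.zero] at this
  simp at this
  linarith

lemma Orb.J_le (hY : Orb τ q b Y) (hb : 4 * τ ≤ b) (hτ : 2.75 ≤ τ) (hq : q ≤ 2 * τ) : q + Y τ - Y (q + τ) ≤ 1.46 * exp τ := by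
  have t0 := hY.H.τpos
  have c := hY.cont
  have mg := hY.M_ge hb
  have ml := hY.M_le
  have sh : ∀ t, HasDerivAt (fun x => Y (x + τ)) (1 - exp (Y t)) t := fun t => by
    have := (hY.dexp (t + τ)).comp_add_const t τ
    rwa [show t + τ - τ = t by ring] at this
  have k1 := decr_bound (a := 0) (b := τ) (c := 0) (u := fun x => x - Y (x + τ) + exp (τ + exp (-τ)) * exp (-exp (x - τ)))
    (u' := fun x => 1 - (1 - exp (Y x)) + exp (τ + exp (-τ)) * (exp (-exp (x - τ)) * (-exp (x - τ)))) t0.le (by fun_prop)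
    (fun x _ => by
      have h2 := ((((hasDerivAt_id x).sub_const τ).exp).neg.exp).const_mul (exp (τ + exp (-τ)))
      exact (((hasDerivAt_id x).sub (sh x)).add h2).congr_deriv (by simp))
    (fun x hx => by
      have := Real.exp_le_exp.2 (hY.up_le hx.1.le hx.2.le)
      rw [show x + exp (-τ) - exp (x - τ) = (τ + exp (-τ)) + (-exp (x - τ) + (x - τ)) by ring, Real.exp_add, Real.exp_add (-exp (x - τ))] at this
      linarith)
  simp only [sub_self, Real.exp_zero, zero_add, zero_sub, zero_mul, add_zero] at k1
  rw [← Real.exp_add, ← Real.exp_add, show τ + exp (-τ) + -exp (-τ) = τ by ring] at k1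
  have cn : ∀ r, 0 ≤ r → r ≤ τ → Y (τ + r) ≤ Y τ - 7 / 11 * r ^ 2 / 2 := by
    intro r r0 r1
    have := decr_bound (a := 0) (b := r) (c := 0) (u := fun x => Y (τ + x) + 7 / 11 * x ^ 2 / 2) r0 (by fun_prop)
      (fun x _ => ((hY.dexp (τ + x)).comp_const_add τ x).add ((((hasDerivAt_id x).pow 2).const_mul (7 / 11)).div_const 2))
      (fun x hx => by
        rw [show τ + x - τ = x by ring]
        have e1 := Real.add_one_le_exp (Y x)
        have e2 := hY.conc (by linarith) hx.1.le (hx.2.le.trans r1)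
        have e3 : 7 / 11 ≤ Y τ / τ := by rw [div_le_div_iff₀ (by norm_num) t0]; linarith
        have e4 : 7 / 11 * x ≤ Y τ / τ * x := mul_le_mul_of_nonneg_right e3 hx.1.le
        simp
        linarith)
    simp at this
    linarith
  have k2 := decr_bound (a := τ) (b := q) (c := 0) (u := fun x => x - Y (x + τ) + 11 / 7 * exp (Y τ + 7 / 22 - 7 / 11 * (x - τ)))
    (u' := fun x => 1 - (1 - exp (Y x)) + 11 / 7 * (exp (Y τ + 7 / 22 - 7 / 11 * (x - τ)) * (-(7 / 11)))) hY.H.hq.le (by fun_prop)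
    (fun x _ => by
      have h2 := (((((hasDerivAt_id x).sub_const τ).const_mul (7 / 11)).const_sub (Y τ + 7 / 22)).exp).const_mul (11 / 7)
      exact (((hasDerivAt_id x).sub (sh x)).add h2).congr_deriv (by simp))
    (fun x hx => by
      have := cn (x - τ) (by linarith [hx.1]) (by linarith [hx.2])
      rw [show τ + (x - τ) = x by ring] at this
      have : Y x ≤ Y τ + 7 / 22 - 7 / 11 * (x - τ) := by nlinarith [sq_nonneg (x - τ - 1)]
      have := Real.exp_le_exp.2 this
      linarith)
  simp only [sub_self, mul_zero, sub_zero, zero_mul, add_zero] at k2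
  have p := Real.exp_pos (Y τ + 7 / 22 - 7 / 11 * (q - τ))
  have x1 : exp (Y τ + 7 / 22) ≤ exp (τ + exp (-τ) + -1) * exp (7 / 22) := by
    rw [← Real.exp_add]; apply Real.exp_le_exp.2; linarith
  have e1 : exp (7 / 22) ≤ (1.375 : ℝ) := by
    have := Real.exp_bound' (x := 7 / 22) (by norm_num) (by norm_num) (n := 5) (by norm_num)
    refine this.trans ?_
    norm_num [Finset.sum_range_succ, Nat.factorial]
  have X0 := Real.exp_pos (τ + exp (-τ) + -1)
  have x2 : exp (Y τ + 7 / 22) ≤ exp (τ + exp (-τ) + -1) * 1.375 := x1.trans (by gcongr)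
  have x3 : exp (τ + exp (-τ) + -1) ≤ exp τ * 0.395 := by
    have u1 : exp (-τ) ≤ 0.066 := by
      have h1 : exp (-τ) ≤ exp (-(1 : ℝ)) ^ 2 * exp (-(0.75 : ℝ)) := by
        rw [← Real.exp_nat_mul, ← Real.exp_add]; apply Real.exp_le_exp.2; norm_num; linarith
      have h2 := Real.exp_neg_one_lt_d9
      have h3 := Real.exp_bound' (x := 1 / 4) (by norm_num) (by norm_num) (n := 5) (by norm_num)
      have h4 : exp (-(0.75 : ℝ)) ≤ 0.475 := by
        rw [show (-(0.75 : ℝ)) = -1 + 1 / 4 by norm_num, Real.exp_add]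
        norm_num [Finset.sum_range_succ, Nat.factorial] at h3
        calc exp (-1) * exp (1 / 4) ≤ 0.36788 * 1.28403 := by
              apply mul_le_mul (by linarith) (by norm_num; linarith) (Real.exp_pos _).le (by norm_num)
          _ ≤ _ := by norm_num
      calc exp (-τ) ≤ _ := h1
        _ ≤ 0.3679 ^ 2 * 0.475 := by
            apply mul_le_mul _ h4 (Real.exp_pos _).le (by norm_num)
            apply pow_le_pow_left₀ (Real.exp_pos _).le; linarith
        _ ≤ _ := by norm_num
    rw [show τ + exp (-τ) + -1 = τ + (-1 + exp (-τ)) by ring, Real.exp_add]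
    have h2 := Real.exp_neg_one_lt_d9
    have h3 : exp (exp (-τ)) ≤ 1.07 := by
      have h3 := Real.exp_bound' (x := 0.066) (by norm_num) (by norm_num) (n := 3) (by norm_num)
      norm_num [Finset.sum_range_succ, Nat.factorial] at h3
      refine (Real.exp_le_exp.2 (u1.trans (by norm_num : (0.066 : ℝ) ≤ 33 / 500))).trans (h3.trans ?_)
      norm_num
    have : exp (-1 + exp (-τ)) ≤ 0.395 := by
      rw [Real.exp_add]
      calc _ ≤ 0.36788 * (1.07 : ℝ) := by
              apply mul_le_mul (by linarith) h3 (Real.exp_pos _).le (by norm_num)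
        _ ≤ _ := by norm_num
    gcongr
  have hh : τ + τ = 2 * τ := by ring
  linarith

lemma Orb.tail_le (hY : Orb τ q b Y) (hτ : 2.75 ≤ τ) (hm : 3 * τ ≤ -Y (q + τ)) (hy : exp (Y (-τ)) ≤ 0.1) :
    ∫ s in τ..(b - τ), exp (Y (q + s)) ≤ 0.14 := by
  have t0 := hY.H.τpos
  have c := hY.cont
  have sl := hY.slope
  have fc : Continuous fun s => exp (Y (q + s)) := by fun_prop
  rw [← intervalIntegral.integral_add_adjacent_intervals (fc.intervalIntegrable (μ := MeasureTheory.volume) τ (2 * τ)) (fc.intervalIntegrable (2 * τ) (b - τ))]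
  have k1 := int_bd fc (a := τ) (b := 2 * τ) (by linarith) (c := exp (-(2 * τ))) (fun x hx => by
    apply Real.exp_le_exp.2
    have := decr_bound (a := q + τ) (b := q + x) (c := 1) (by linarith [hx.1]) c (fun s _ => hY.dexp s) (fun s _ => by linarith [Real.exp_pos (Y (s - τ))])
    linarith [hx.2])
  have k2 : (2 * τ - τ) * exp (-(2 * τ)) ≤ 0.025 := by
    have h1 := Real.add_one_le_exp τ
    have h2 : exp (-(2 * τ)) = (exp τ)⁻¹ * exp (-τ) := by rw [← Real.exp_neg, ← Real.exp_add]; ring_nf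
    have ep := Real.exp_pos τ
    have h3 : τ * (exp τ)⁻¹ ≤ 0.37 := by
      rw [← div_eq_mul_inv, div_le_iff₀ ep]
      have := Real.add_one_le_exp (τ + -1)
      rw [Real.exp_add] at this
      have h2 := Real.exp_neg_one_lt_d9
      have : exp τ * exp (-1) ≤ exp τ * 0.37 := by gcongr; linarith
      linarith
    have h4 : exp (-τ) ≤ 0.066 := by
      have h1 : exp (-τ) ≤ exp (-(1 : ℝ)) ^ 2 * exp (-(0.75 : ℝ)) := by
        rw [← Real.exp_nat_mul, ← Real.exp_add]; apply Real.exp_le_exp.2; norm_num; linarith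
      have h2 := Real.exp_neg_one_lt_d9
      have h3 := Real.exp_bound' (x := 1 / 4) (by norm_num) (by norm_num) (n := 5) (by norm_num)
      have h4 : exp (-(0.75 : ℝ)) ≤ 0.475 := by
        rw [show (-(0.75 : ℝ)) = -1 + 1 / 4 by norm_num, Real.exp_add]
        norm_num [Finset.sum_range_succ, Nat.factorial] at h3
        calc exp (-1) * exp (1 / 4) ≤ 0.36788 * 1.28403 := by
              apply mul_le_mul (by linarith) (by norm_num; linarith) (Real.exp_pos _).le (by norm_num)
          _ ≤ _ := by norm_num
      calc exp (-τ) ≤ _ := h1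
        _ ≤ 0.3679 ^ 2 * 0.475 := by
            apply mul_le_mul _ h4 (Real.exp_pos _).le (by norm_num)
            apply pow_le_pow_left₀ (Real.exp_pos _).le; linarith
        _ ≤ _ := by norm_num
    rw [h2]
    calc _ = (τ * (exp τ)⁻¹) * exp (-τ) := by ring
      _ ≤ 0.37 * 0.066 := by apply mul_le_mul h3 h4 (Real.exp_pos _).le (by norm_num)
      _ ≤ _ := by norm_num
  have k3 : ∫ s in (2 * τ)..(b - τ), exp (Y (q + s)) ≤ ∫ s in (2 * τ)..(b - τ), 10 / 9 * (exp (Y (q + s)) * (1 - exp (Y (q + s - τ)))) := by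
    apply intervalIntegral.integral_mono_on (by linarith) (fc.intervalIntegrable _ _) (Continuous.intervalIntegrable (by fun_prop) _ _)
    intro s hs
    have e1 : Y (q + s - τ) = Y (s - τ - b) := by
      have := hY.per' (s - τ - b)
      rw [← this]; ring_nf
    have e2 := Real.exp_le_exp.2 (hY.pre_le' (x := s - τ - b) (y := -τ) (by linarith [hs.1]) (by linarith [hs.2]) (by linarith))
    rw [e1]
    have ep := Real.exp_pos (Y (q + s))
    have : exp (Y (q + s)) * 0.9 ≤ exp (Y (q + s)) * (1 - exp (Y (s - τ - b))) := by
      gcongr; linarith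
    linarith
  have k4 : ∫ s in (2 * τ)..(b - τ), exp (Y (q + s)) * (1 - exp (Y (q + s - τ))) = exp (Y (q + (b - τ))) - exp (Y (q + 2 * τ)) :=
    intervalIntegral.integral_eq_sub_of_hasDerivAt (f := fun s => exp (Y (q + s))) (fun s _ =>
      ((hY.dexp (q + s)).comp_const_add q s).exp) (Continuous.intervalIntegrable (by fun_prop) _ _)
  rw [intervalIntegral.integral_const_mul, k4] at k3
  have e3 := hY.per' (-τ)
  rw [show b + -τ = b - τ by ring] at e3
  rw [e3] at k3
  have := Real.exp_pos (Y (q + 2 * τ))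
  linarith

theorem reg2_sound (hτ : 2.75 ≤ τ) {qY bY qZ bZ : ℝ} {Y Z : ℝ → ℝ} (hY : Orb τ qY bY Y) (hZ : Orb τ qZ bZ Z)
    (A : AscLE Y τ Z τ) (hM : Y τ < Z τ)
    (mY : 3 * τ ≤ -Y (qY + τ)) (mZ : 3 * τ ≤ -Z (qZ + τ)) (hy : exp (Y (-τ)) ≤ 0.1)
    (hE : ∫ s in (0 : ℝ)..τ, exp (Y (qY + s)) ≤ 0.86) : False := by
  have t0 := hY.H.τpos
  have cY := hY.cont
  have cZ := hZ.cont
  have slY := hY.slope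
  have slZ := hZ.slope
  have b4 : 4 * τ ≤ bY := by linarith
  have b4' : 4 * τ ≤ bZ := by linarith
  have m1 := hY.M_ge b4
  have m2 := hZ.M_ge b4'
  have qY2 := hY.q_le (by linarith) (by linarith) (by linarith)
  have qZ2 := hZ.q_le (by linarith) (by linarith) (by linarith)
  have fc : Continuous fun s => exp (Y (qY + s)) := by fun_prop
  have E1 : ∫ s in (0 : ℝ)..(bY - τ), exp (Y (qY + s)) ≤ 1 := by
    rw [← intervalIntegral.integral_add_adjacent_intervals (fc.intervalIntegrable (μ := MeasureTheory.volume) 0 τ) (fc.intervalIntegrable τ (bY - τ))]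
    have := hY.tail_le hτ mY hy
    linarith
  have P : Pair τ qY bY qZ bZ Y Z := ⟨hY, hZ, A, hM, by linarith, by linarith, qY2, qZ2, E1⟩
  have Kp := P.Kpos
  set K := Y (qY + τ) - Z (qZ + τ) with hK
  have J1 := hZ.J_le b4' hτ qZ2
  have ct := P.contr (J := 1.46 * exp τ) J1
  have et := Real.add_one_le_exp τ
  have le1 : ∫ σ in (0 : ℝ)..τ, (1.46 * exp τ - 1 - τ + σ) * (exp (Y (-σ)) - exp (Z (-σ))) ≤
      ∫ σ in (0 : ℝ)..τ, (1.46 * exp τ * K) * (exp (Y (-σ)) * (σ + Y (-σ))) := by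
    apply intervalIntegral.integral_mono_on t0.le (Continuous.intervalIntegrable (by fun_prop) _ _) (Continuous.intervalIntegrable (by fun_prop) _ _)
    intro σ hσ
    have k1 := P.delta hσ.1 hσ.2
    rw [min_eq_right (by linarith [hσ.2]), sub_self, mul_zero, add_zero] at k1
    have k2 := exp_sub_le (Y (-σ)) (Z (-σ))
    have k3 := hY.neg_ge hσ.1
    have ep := Real.exp_pos (Y (-σ))
    have k5 : exp (Y (-σ)) - exp (Z (-σ)) ≤ exp (Y (-σ)) * (K * (σ + Y (-σ))) := k2.trans (by gcongr)
    have k6 : 0 ≤ exp (Y (-σ)) * (K * (σ + Y (-σ))) := mul_nonneg ep.le (mul_nonneg Kp.le (by linarith))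
    have k8 : 0 ≤ 1.46 * exp τ - 1 - τ + σ := by linarith [hσ.1]
    calc _ ≤ (1.46 * exp τ - 1 - τ + σ) * (exp (Y (-σ)) * (K * (σ + Y (-σ)))) := by gcongr
      _ ≤ (1.46 * exp τ) * (exp (Y (-σ)) * (K * (σ + Y (-σ)))) := by
        apply mul_le_mul_of_nonneg_right _ k6; linarith [hσ.2]
      _ = _ := by ring
  rw [intervalIntegral.integral_const_mul] at le1
  have R := hY.R_le b4
  have g := hY.g_le b4 t0.le le_rfl
  rw [sub_self, zero_sub, hY.H.zero, add_zero] at g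
  have g1 : exp (Y (-τ)) * (τ - Y τ) ≤ 0.1 * 1 := by
    apply mul_le_mul hy (by linarith) _ (by norm_num)
    have := hY.M_le
    have m2 : exp (-τ) ≤ 1 := Real.exp_le_one_iff.2 (by linarith)
    linarith
  have h1 : exp τ * exp (Y (-τ)) ≤ 1.12 := by
    rw [← Real.exp_add]
    have h3 := Real.exp_bound' (x := 0.1) (by norm_num) (by norm_num) (n := 3) (by norm_num)
    norm_num [Finset.sum_range_succ, Nat.factorial] at h3
    have : exp (τ + Y (-τ)) ≤ exp (1 / 10) := Real.exp_le_exp.2 (by linarith)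
    refine this.trans (h3.trans ?_)
    norm_num
  have h2 : 1.46 * exp τ * K * (∫ σ in (0 : ℝ)..τ, exp (Y (-σ)) * (σ + Y (-σ))) ≤ 1.46 * exp τ * K * (exp (Y (-τ)) / 2) := by gcongr
  have h3 : 1.46 * exp τ * K * (exp (Y (-τ)) / 2) ≤ 0.9 * K := by
    calc _ = (exp τ * exp (Y (-τ))) * (0.73 * K) := by ring
      _ ≤ 1.12 * (0.73 * K) := by gcongr
      _ ≤ _ := by linarith
  linarith
end

/-- no two ordered orbits with different maxima -/
def UQ (τ : ℝ) : Prop := ∀ (qY bY qZ bZ : ℝ) (Y Z : ℝ → ℝ), Orb τ qY bY Y → Orb τ qZ bZ Z →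
  AscLE Y τ Z τ → Y τ < Z τ → False

section
variable {s h h0 h2 Q SQ N iL qlo qhi rho mu kb i0 iv i2 iM : ℕ} {zin z e : List ℕ}

def etaChk (s h Q N i0 : ℕ) (z e : List ℕ) : Bool :=
  Nat.ble i0 s && (Nat.ble (N * h) (256 * i0) && (Nat.ble (e.getD 0 Q) (z.getD 0 Q) &&
    Nat.ble (e.getD 0 Q * sqU s 8 (eU s i0)) (Q * s)))

lemma eta_le (hc : etaChk s h Q N i0 z e = true) (hs : 0 < s) (Qp : 0 < Q) (el : e.length = N) (zl : z.length = N) :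
    zv Q e N ≤ exp (-((256 * i0 : ℕ) / s)) ∧ zv Q e N ≤ exp (-(N * ((h : ℝ) / s))) ∧ zv Q e N ≤ zv Q z N := by
  simp only [etaChk, Bool.and_eq_true, Nat.ble_eq] at hc
  obtain ⟨i0s, c1, c2, cη⟩ := hc
  have h0 : (0 : ℝ) < s := by exact_mod_cast hs
  have Q0 : (0 : ℝ) < Q := by exact_mod_cast Qp
  have eN : zv Q e N = ((e.getD 0 Q : ℕ) : ℝ) / Q := by simp [zv, el]
  have zN : zv Q z N = ((z.getD 0 Q : ℕ) : ℝ) / Q := by simp [zv, zl]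
  have k1 : zv Q e N ≤ exp (-((256 * i0 : ℕ) / s)) := by
    have u := sqU_le hs 8 _ _ (le_eU hs i0s)
    rw [show (2 : ℝ) ^ 8 * ((i0 : ℝ) / s) = (256 * i0 : ℕ) / s by push_cast; ring] at u
    have c : (((e.getD 0 Q) * sqU s 8 (eU s i0) : ℕ) : ℝ) ≤ ((Q * s : ℕ) : ℝ) := by exact_mod_cast cη
    push_cast at c
    rw [eN, Real.exp_neg, div_le_iff₀ Q0]
    have ep := Real.exp_pos (((256 * i0 : ℕ) : ℝ) / s)
    rw [inv_mul_eq_div, le_div_iff₀ ep]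
    calc _ ≤ ((e.getD 0 Q : ℕ) : ℝ) * (sqU s 8 (eU s i0) / s) := by gcongr
      _ = ((e.getD 0 Q : ℕ) : ℝ) * sqU s 8 (eU s i0) / s := by ring
      _ ≤ _ := by rw [div_le_iff₀ h0]; exact c
  refine ⟨k1, k1.trans (Real.exp_le_exp.2 (neg_le_neg ?_)), ?_⟩
  · rw [← mul_div_assoc]
    have : ((N * h : ℕ) : ℝ) ≤ ((256 * i0 : ℕ) : ℝ) := by exact_mod_cast c1
    gcongr
    exact_mod_cast this
  · rw [eN, zN]
    have : ((e.getD 0 Q : ℕ) : ℝ) ≤ ((z.getD 0 Q : ℕ) : ℝ) := by exact_mod_cast c2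
    gcongr

/-- run data plus the endpoint check -/
def sChk (s h Q SQ N iL qlo qhi rho i0 : ℕ) (zin z e : List ℕ) : Bool :=
  runChk s h Q SQ N iL qlo qhi rho zin z e && etaChk s h Q N i0 z e

theorem s_sound (hc : sChk s h Q SQ N iL qlo qhi rho i0 zin z e = true)
    (hP : PC (N * ((h : ℝ) / s)) (PR s h SQ zin)) :
    S1 (N * ((h : ℝ) / s)) ((h : ℝ) / s) N (zv Q z) (zv Q e) := by
  simp only [sChk, Bool.and_eq_true] at hc
  obtain ⟨par, mz, zl, el⟩ := runChk_par hc.1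
  obtain ⟨_, k2, k3⟩ := eta_le hc.2 par.s0 (mchk_lt mz) el zl
  exact run_S hc.1 hP k2 k3

theorem s_min (hc : sChk s h Q SQ N iL qlo qhi rho i0 zin z e = true)
    (hP : PC (N * ((h : ℝ) / s)) (PR s h SQ zin)) {τ q b : ℝ} {Y : ℝ → ℝ} (hY : Orb τ q b Y) (hτ : N * ((h : ℝ) / s) ≤ τ) :
    ((256 * i0 : ℕ) : ℝ) / s ≤ -Y (q + τ) := by
  have hS := s_sound hc hP
  simp only [sChk, Bool.and_eq_true] at hc
  obtain ⟨par, mz, zl, el⟩ := runChk_par hc.1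
  obtain ⟨k1, _, _⟩ := eta_le hc.2 par.s0 (mchk_lt mz) el zl
  have := Real.exp_le_exp.1 (((hS τ Y q b hτ hY).2 N le_rfl τ hτ le_rfl).trans k1)
  linarith

/-- passing from one parameter value to the next, same grid of values -/
theorem s_next (hc : sChk s h Q SQ N iL qlo qhi rho i0 zin z e = true)
    (hP : PC (N * ((h : ℝ) / s)) (PR s h SQ zin)) (hn : (Nat.ble h h2 && (Nat.ble (5 * h2) (2 * s) && mchk s 0 (pZ s SQ z.tail))) = true) :
    PC (N * ((h2 : ℝ) / s)) (PR s h2 SQ z) := by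
  have hS := s_sound hc hP
  simp only [sChk, Bool.and_eq_true] at hc
  simp only [Bool.and_eq_true, Nat.ble_eq] at hn
  obtain ⟨par, mz, zl, el⟩ := runChk_par hc.1
  have h0 : (0 : ℝ) < s := by exact_mod_cast par.s0
  have hle : (h : ℝ) / s ≤ (h2 : ℝ) / s := by
    have : (h : ℝ) ≤ h2 := by exact_mod_cast hn.1
    gcongr
  exact S_next ⟨par.sQ, par.s0, lt_of_lt_of_le par.h0 hn.1, hn.2.1, par.N3⟩ zl hS (by gcongr) hle hn.2.2

lemma zv_scale {k : ℕ} (hk : 0 < k) (z : List ℕ) (j : ℕ) : zv (Q * k) (z.map (· * k)) j = zv Q z j := by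
  have k0 : (k : ℝ) ≠ 0 := by exact_mod_cast hk.ne'
  simp only [zv, List.length_map, List.getD_eq_getElem?_getD, List.getElem?_map]
  rcases z[z.length - j]? with _ | v
  · simp
    rw [mul_div_mul_right _ _ k0]
  · simp
    rw [mul_div_mul_right _ _ k0]

/-- same, refining the grid of values by a factor `k` -/
theorem s_next' {k SQ' : ℕ} (hc : sChk s h Q SQ N iL qlo qhi rho i0 zin z e = true)
    (hP : PC (N * ((h : ℝ) / s)) (PR s h SQ zin))
    (hn : (Nat.ble h h2 && (Nat.ble (5 * h2) (2 * s) && (Nat.blt 0 k && (Nat.beq SQ (k * SQ') && mchk s 0 (pZ s SQ' (z.map (· * k)).tail))))) = true) :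
    PC (N * ((h2 : ℝ) / s)) (PR s h2 SQ' (z.map (· * k))) := by
  have hS := s_sound hc hP
  simp only [sChk, Bool.and_eq_true] at hc
  simp only [Bool.and_eq_true, Nat.ble_eq, Nat.blt_eq, Nat.beq_eq] at hn
  obtain ⟨n1, n2, n3, n4, n5⟩ := hn
  obtain ⟨par, mz, zl, el⟩ := runChk_par hc.1
  have h0 : (0 : ℝ) < s := by exact_mod_cast par.s0
  have hle : (h : ℝ) / s ≤ (h2 : ℝ) / s := by
    have : (h : ℝ) ≤ h2 := by exact_mod_cast n1
    gcongr
  have e : zv Q z = zv (Q * k) (z.map (· * k)) := funext fun j => (zv_scale n3 z j).symm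
  rw [e] at hS
  exact S_next (Q := Q * k) ⟨by rw [par.sQ, n4]; ring, par.s0, lt_of_lt_of_le par.h0 n1, n2, par.N3⟩ (by simpa using zl) hS (by gcongr) hle n5

def cChk (s h h2 Q SQ N iL qlo qhi rho mu kb i0 iv i2 iM : ℕ) (zin z e : List ℕ) : Bool :=
  sChk s h Q SQ N iL qlo qhi rho i0 zin z e && (cellChk s h h2 Q SQ N mu kb i0 iv i2 iM z e && vChk s h2 N mu)

theorem c_sound (hc : cChk s h h2 Q SQ N iL qlo qhi rho mu kb i0 iv i2 iM zin z e = true)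
    (hP : PC (N * ((h : ℝ) / s)) (PR s h SQ zin)) {τ : ℝ} (h1 : N * ((h : ℝ) / s) ≤ τ)
    (h2' : τ ≤ N * ((h2 : ℝ) / s)) : UQ τ := by
  simp only [cChk, Bool.and_eq_true] at hc
  intro qY bY qZ bZ Y Z hY hZ A hM
  exact cell_sound hc.2.1 hc.2.2 (s_sound hc.1 hP) h1 h2' hY hZ A hM

theorem c_next (hc : cChk s h h2 Q SQ N iL qlo qhi rho mu kb i0 iv i2 iM zin z e = true)
    (hP : PC (N * ((h : ℝ) / s)) (PR s h SQ zin)) (hn : (Nat.ble h h2 && (Nat.ble (5 * h2) (2 * s) && mchk s 0 (pZ s SQ z.tail))) = true) :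
    PC (N * ((h2 : ℝ) / s)) (PR s h2 SQ z) := by
  simp only [cChk, Bool.and_eq_true] at hc
  exact s_next hc.1 hP hn

def rChk (s h Q N : ℕ) (z e : List ℕ) : Bool :=
  Nat.ble (10 * z.getD 0 Q) Q && Nat.ble (100 * h * eSum Q e.reverse + 325 * s * e.getD 0 Q) (86 * s * Q) && Nat.ble (275 * s) (100 * (N * h))

theorem r_sound (hc : sChk s h Q SQ N iL qlo qhi rho i0 zin z e = true)
    (hP : PC (N * ((h : ℝ) / s)) (PR s h SQ zin)) (hr : rChk s h Q N z e = true) {τ : ℝ} (h1 : N * ((h : ℝ) / s) ≤ τ)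
    (h6 : τ ≤ 6) (hm : ∀ q b Y, Orb τ q b Y → 3 * τ ≤ -Y (q + τ)) : UQ τ := by
  have hS := s_sound hc hP
  simp only [sChk, Bool.and_eq_true] at hc
  simp only [rChk, Bool.and_eq_true, Nat.ble_eq] at hr
  obtain ⟨⟨r1, r2⟩, r3⟩ := hr
  obtain ⟨par, mz, zl, el⟩ := runChk_par hc.1
  have Qp := mchk_lt mz
  have Q0 : (0 : ℝ) < Q := by exact_mod_cast Qp
  have h0 : (0 : ℝ) < s := by exact_mod_cast par.s0
  have hh0 : (0 : ℝ) < h := by exact_mod_cast par.h0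
  intro qY bY qZ bZ Y Z hY hZ A hM
  obtain ⟨SY, SYe⟩ := hS τ Y qY bY h1 hY
  have a275 : 2.75 ≤ N * ((h : ℝ) / s) := by
    have : ((275 * s : ℕ) : ℝ) ≤ ((100 * (N * h) : ℕ) : ℝ) := by exact_mod_cast r3
    push_cast at this
    rw [← mul_div_assoc, le_div_iff₀ h0]; linarith
  have eN : zv Q e N = ((e.getD 0 Q : ℕ) : ℝ) / Q := by simp [zv, el]
  have zN : zv Q z N = ((z.getD 0 Q : ℕ) : ℝ) / Q := by simp [zv, zl]
  have cY := hY.cont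
  have fc : Continuous fun s => exp (Y (qY + s)) := by fun_prop
  refine reg2_sound (a275.trans h1) hY hZ A hM (hm _ _ _ hY) (hm _ _ _ hZ) ?_ ?_
  · refine (SY N le_rfl τ h1 le_rfl).trans ?_
    rw [zN, div_le_iff₀ Q0]
    have : ((10 * z.getD 0 Q : ℕ) : ℝ) ≤ (Q : ℝ) := by exact_mod_cast r1
    push_cast at this
    linarith
  · set H := (h : ℝ) / s with hH
    have H0 : 0 < H := by positivity
    have k1 := eSum_bd (Q := Q) fc H0.le (T := τ) (L := e.reverse) (j := 0) (c := Q)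
      (fun x hx hT => by
        rw [div_self Q0.ne', ← zv_zero Qp e]
        exact SYe 0 (Nat.zero_le _) x hx hT)
      (fun i v hv x hx hT => by
        obtain ⟨hi, hv⟩ := zv_rev (Q := Q) hv
        rw [← hv]
        exact SYe (i + 1) (by omega) x (by push_cast at hx ⊢; linarith) hT)
      (by rw [List.length_reverse, el]; push_cast; linarith)
    simp only [List.length_reverse, el, Nat.cast_zero, zero_mul, zero_add] at k1
    have k2 := int_bd fc h1 (c := ((e.getD 0 Q : ℕ) : ℝ) / Q) (fun x hx => by
      refine (SYe N le_rfl x hx.1 hx.2).trans eN.le)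
    have k4 := intervalIntegral.integral_add_adjacent_intervals (fc.intervalIntegrable (μ := MeasureTheory.volume) 0 (N * H)) (fc.intervalIntegrable (N * H) τ)
    have c : ((100 * h * eSum Q e.reverse + 325 * s * e.getD 0 Q : ℕ) : ℝ) ≤ ((86 * s * Q : ℕ) : ℝ) := by exact_mod_cast r2
    push_cast at c
    have k5 : (τ - N * H) * (((e.getD 0 Q : ℕ) : ℝ) / Q) ≤ 3.25 * (((e.getD 0 Q : ℕ) : ℝ) / Q) := by
      gcongr; linarith
    have k6 : H * eSum Q e.reverse / Q + 3.25 * (((e.getD 0 Q : ℕ) : ℝ) / Q) = (100 * h * eSum Q e.reverse + 325 * s * ((e.getD 0 Q : ℕ) : ℝ)) / (100 * s * Q) := by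
      rw [hH]; field_simp; ring
    have k7 : (100 * h * eSum Q e.reverse + 325 * s * ((e.getD 0 Q : ℕ) : ℝ)) / (100 * s * Q) ≤ 0.86 := by
      rw [div_le_iff₀ (by positivity)]
      linarith
    linarith
end

/-- uniqueness of the orbit from `UQ` -/
theorem UQ.orb_eq {τ : ℝ} (h : UQ τ) (hτ : 1.9 ≤ τ) : ∃ Z q b, Orb τ q b Z ∧ ∀ Y qY bY, Orb τ qY bY Y → Y = Z := by
  obtain ⟨Z, q, b, hZ, hA⟩ := exists_orb hτ
  refine ⟨Z, q, b, hZ, fun Y qY bY hY => ?_⟩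
  have A := hA Y qY bY hY
  rcases lt_or_ge (Y τ) (Z τ) with hl | hl
  · exact (h _ _ _ _ _ _ hY hZ A hl).elim
  · exact Orb.unique hY hZ (A.eq_of_max hY.H.τpos hY.cont hZ.cont hY.H.mono hZ.H.mono hY.H.zero hZ.H.zero hl)

/-- the grid property for the run with step `h` and value grid `SQ` -/
def GP (h SQ : ℕ) (z : List ℕ) : Prop :=
  PC ((128 : ℕ) * ((h : ℝ) / (1000000000000000 : ℕ))) (PR 1000000000000000 h SQ z)

def z0 : List ℕ := List.replicate 128 985100

def eTriv : List ℕ := List.replicate 128 2000000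

set_option maxRecDepth 100000 in
set_option maxHeartbeats 0 in
lemma gp0 : GP 14843750000000 1000000000 z0 := by
  refine lin_next (Q := 1000000) ⟨by norm_num, by norm_num, by norm_num, by norm_num, by norm_num⟩ (by decide +kernel) (by norm_num) ?_ (by decide +kernel)
  intro j hj
  have k : ∀ j < 129, 985100 ≤ z0.getD (z0.length - j) 1000000 := by decide +kernel
  have k1 : (985100 : ℝ) ≤ ((z0.getD (z0.length - j) 1000000 : ℕ) : ℝ) := by exact_mod_cast k j (by omega)
  rw [zv, le_div_iff₀ (by norm_num)]
  norm_num at k1 ⊢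
  linarith

def z1 : List ℕ :=
  [965382, 965382, 965382, 965382, 965382, 965382, 965382, 965382, 965382, 965382, 965382, 965382, 965382, 965382, 965382, 965382, 965382, 965382,
   965382, 965382, 965382, 965382, 965382, 965382, 965425, 965505, 965591, 965682, 965780, 965883, 965992, 966107, 966228, 966355, 966488, 966626,
   966770, 966920, 967076, 967237, 967405, 967577, 967756, 967940, 968130, 968325, 968526, 968733, 968945, 969162, 969385, 969614, 969848, 970087,
   970332, 970582, 970837, 971097, 971363, 971634, 971910, 972192, 972478, 972769, 973066, 973367, 973674, 973985, 974301, 974623, 974949, 975279,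
   975615, 975955, 976300, 976649, 977003, 977361, 977724, 978092, 978464, 978840, 979220, 979605, 979993, 980386, 980784, 981185, 981590, 981999,
   982412, 982829, 983249, 983673, 984101, 984533, 984968, 985407, 985849, 986294, 986743, 987195, 987651, 988109, 988570, 989035, 989502, 989973,
   990446, 990922, 991400, 991882, 992365, 992852, 993340, 993831, 994325, 994820, 995318, 995817, 996319, 996822, 997328, 997835, 998344, 998854,
   999366, 999879]

set_option maxRecDepth 100000 in
set_option maxHeartbeats 0 in
lemma run1 : runChk 1000000000000000 14843750000000 1000000 1000000000 128 503 258 259 385921840071 z0 z1 eTriv = true := by decide +kernel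

set_option maxRecDepth 100000 in
set_option maxHeartbeats 0 in
lemma gp1 : GP 14843750000000 1000000000 z1 := chain_step run1 (by decide +kernel) gp0

def z2 : List ℕ :=
  [943179, 943179, 943179, 943179, 943179, 943179, 943179, 943179, 943179, 943179, 943179, 943179, 943179, 943179, 943179, 943179, 943179, 943179,
   943179, 943179, 943179, 943179, 943179, 943264, 943385, 943514, 943653, 943802, 943959, 944127, 944303, 944489, 944684, 944889, 945103, 945326,
   945558, 945800, 946051, 946311, 946581, 946860, 947148, 947445, 947751, 948066, 948390, 948724, 949066, 949418, 949778, 950147, 950525, 950912,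
   951308, 951712, 952125, 952547, 952978, 953417, 953864, 954320, 954785, 955258, 955739, 956228, 956726, 957232, 957746, 958268, 958798, 959336,
   959881, 960435, 960996, 961565, 962141, 962725, 963316, 963915, 964521, 965134, 965755, 966382, 967017, 967658, 968306, 968961, 969622, 970291,
   970965, 971646, 972333, 973027, 973726, 974432, 975143, 975861, 976584, 977313, 978047, 978786, 979531, 980282, 981037, 981797, 982563, 983333,
   984108, 984887, 985671, 986459, 987252, 988048, 988849, 989654, 990462, 991274, 992090, 992909, 993731, 994557, 995385, 996217, 997051, 997888,
   998728, 999570]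

set_option maxRecDepth 100000 in
set_option maxHeartbeats 0 in
lemma run2 : runChk 1000000000000000 14843750000000 1000000 1000000000 128 487 241 242 412496469893 z1 z2 eTriv = true := by decide +kernel

set_option maxRecDepth 100000 in
set_option maxHeartbeats 0 in
lemma gp2 : GP 14843750000000 1000000000 z2 := chain_step run2 (by decide +kernel) gp1

def z3 : List ℕ :=
  [906821, 906821, 906821, 906821, 906821, 906821, 906821, 906821, 906821, 906821, 906821, 906821, 906821, 906821, 906821, 906821, 906821, 906821,
   906821, 906821, 906821, 906821, 906982, 907168, 907369, 907585, 907817, 908063, 908324, 908600, 908891, 909197, 909518, 909854, 910204, 910570,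
   910950, 911345, 911755, 912180, 912619, 913073, 913542, 914025, 914523, 915035, 915562, 916104, 916660, 917230, 917814, 918413, 919026, 919653,
   920294, 920949, 921618, 922301, 922997, 923708, 924432, 925170, 925921, 926686, 927464, 928256, 929061, 929879, 930710, 931554, 932410, 933280,
   934162, 935057, 935965, 936885, 937817, 938761, 939718, 940686, 941667, 942659, 943663, 944678, 945705, 946743, 947792, 948852, 949924, 951006,
   952098, 953202, 954315, 955439, 956574, 957718, 958872, 960036, 961209, 962392, 963584, 964785, 965995, 967214, 968442, 969678, 970923, 972175,
   973436, 974705, 975981, 977265, 978556, 979854, 981159, 982472, 983790, 985116, 986447, 987785, 989128, 990477, 991832, 993192, 994557, 995927,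
   997302, 998681]

set_option maxRecDepth 100000 in
set_option maxHeartbeats 0 in
lemma run3 : runChk 1000000000000000 14843750000000 1000000 1000000000 128 487 241 242 33886710583 z2 z3 eTriv = true := by decide +kernel

set_option maxRecDepth 100000 in
set_option maxHeartbeats 0 in
lemma gp3 : GP 14843750000000 1000000000 z3 := chain_step run3 (by decide +kernel) gp2

def z4 : List ℕ :=
  [847549, 847549, 847549, 847549, 847549, 847549, 847549, 847549, 847549, 847549, 847549, 847549, 847549, 847549, 847549, 847549, 847549, 847549,
   847736, 847980, 848246, 848536, 848849, 849186, 849546, 849930, 850336, 850767, 851220, 851697, 852197, 852720, 853267, 853836, 854429, 855045,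
   855684, 856346, 857031, 857739, 858470, 859224, 860000, 860800, 861622, 862466, 863334, 864224, 865136, 866070, 867027, 868007, 869008, 870032,
   871077, 872145, 873234, 874345, 875478, 876632, 877808, 879005, 880224, 881464, 882725, 884006, 885309, 886633, 887977, 889342, 890727, 892132,
   893558, 895003, 896469, 897954, 899459, 900984, 902527, 904091, 905673, 907274, 908894, 910532, 912189, 913864, 915557, 917269, 918998, 920744,
   922508, 924290, 926088, 927904, 929736, 931584, 933449, 935330, 937227, 939139, 941067, 943011, 944969, 946942, 948930, 950932, 952948, 954979,
   957023, 959080, 961151, 963235, 965331, 967440, 969561, 971694, 973838, 975994, 978162, 980340, 982528, 984727, 986937, 989155, 991384, 993621,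
   995867, 998122]

set_option maxRecDepth 100000 in
set_option maxHeartbeats 0 in
lemma run4 : runChk 1000000000000000 14843750000000 1000000 1000000000 128 488 240 241 393050599043 z3 z4 eTriv = true := by decide +kernel

set_option maxRecDepth 100000 in
set_option maxHeartbeats 0 in
lemma gp4 : GP 14843750000000 1000000000 z4 := chain_step run4 (by decide +kernel) gp3

def z5 : List ℕ :=
  [754862, 754862, 754862, 754862, 754862, 754862, 754862, 754862, 754862, 754862, 754951, 755164, 755412, 755694, 756012, 756364, 756751, 757172,
   757628, 758119, 758645, 759205, 759800, 760429, 761093, 761792, 762525, 763292, 764094, 764930, 765801, 766706, 767645, 768618, 769626, 770668,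
   771744, 772854, 773998, 775176, 776388, 777634, 778913, 780227, 781574, 782954, 784368, 785816, 787297, 788811, 790359, 791939, 793553, 795200,
   796880, 798593, 800338, 802116, 803927, 805770, 807645, 809553, 811493, 813465, 815469, 817505, 819573, 821672, 823803, 825965, 828158, 830382,
   832638, 834924, 837241, 839588, 841966, 844374, 846812, 849280, 851778, 854306, 856863, 859449, 862064, 864708, 867381, 870083, 872812, 875570,
   878356, 881169, 884010, 886878, 889774, 892696, 895644, 898619, 901621, 904647, 907700, 910778, 913881, 917009, 920161, 923337, 926538, 929762,
   933009, 936280, 939573, 942889, 946227, 949586, 952967, 956369, 959792, 963235, 966698, 970181, 973683, 977204, 980744, 984301, 987877, 991469,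
   995078, 998704]

set_option maxRecDepth 100000 in
set_option maxHeartbeats 0 in
lemma run5 : runChk 1000000000000000 14843750000000 1000000 1000000000 128 490 238 239 2987803273568 z4 z5 eTriv = true := by decide +kernel

set_option maxRecDepth 100000 in
set_option maxHeartbeats 0 in
lemma gp5 : GP 14843750000000 1000000000 z5 := chain_step run5 (by decide +kernel) gp4

def z6 : List ℕ :=
  [621776, 621864, 622000, 622183, 622414, 622692, 623017, 623389, 623808, 624275, 624788, 625349, 625956, 626610, 627311, 628059, 628854, 629695,
   630583, 631517, 632498, 633526, 634600, 635720, 636887, 638101, 639360, 640667, 642019, 643418, 644863, 646354, 647892, 649476, 651106, 652782,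
   654504, 656273, 658087, 659948, 661855, 663808, 665806, 667851, 669942, 672079, 674262, 676491, 678766, 681087, 683453, 685866, 688324, 690828,
   693378, 695974, 698615, 701302, 704035, 706814, 709638, 712507, 715423, 718383, 721390, 724441, 727538, 730681, 733869, 737102, 740380, 743703,
   747071, 750484, 753943, 757446, 760993, 764586, 768223, 771905, 775631, 779401, 783216, 787075, 790977, 794924, 798914, 802949, 807026, 811147,
   815311, 819518, 823769, 828062, 832397, 836775, 841195, 845657, 850161, 854706, 859293, 863921, 868590, 873300, 878050, 882840, 887670, 892540,
   897449, 902397, 907384, 912409, 917473, 922574, 927712, 932887, 938100, 943348, 948632, 953952, 959307, 964696, 970119, 975577, 981067, 986590,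
   992146, 997733]

set_option maxRecDepth 100000 in
set_option maxHeartbeats 0 in
lemma run6 : runChk 1000000000000000 14843750000000 1000000 1000000000 128 493 235 236 5132280634070 z5 z6 eTriv = true := by decide +kernel

set_option maxRecDepth 100000 in
set_option maxHeartbeats 0 in
lemma gp6 : GP 14843750000000 1000000000 z6 := chain_step run6 (by decide +kernel) gp5

def z7 : List ℕ :=
  [457005, 457654, 458356, 459113, 459925, 460791, 461711, 462685, 463713, 464795, 465931, 467121, 468364, 469662, 471013, 472418, 473877, 475390,
   476957, 478577, 480251, 481979, 483761, 485598, 487488, 489432, 491430, 493482, 495589, 497750, 499965, 502235, 504560, 506939, 509373, 511861,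
   514405, 517003, 519657, 522366, 525131, 527951, 530827, 533758, 536745, 539789, 542888, 546044, 549257, 552526, 555851, 559234, 562674, 566170,
   569725, 573336, 577006, 580733, 584518, 588362, 592264, 596224, 600243, 604320, 608457, 612653, 616907, 621222, 625596, 630030, 634523, 639077,
   643691, 648365, 653100, 657896, 662752, 667669, 672647, 677687, 682788, 687950, 693174, 698459, 703806, 709216, 714687, 720220, 725815, 731473,
   737193, 742975, 748820, 754727, 760697, 766729, 772824, 778981, 785202, 791484, 797830, 804237, 810708, 817241, 823836, 830493, 837213, 843995,
   850839, 857745, 864713, 871742, 878833, 885985, 893198, 900472, 907806, 915201, 922656, 930171, 937745, 945378, 953070, 960821, 968630, 976496,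
   984420, 992400]

set_option maxRecDepth 100000 in
set_option maxHeartbeats 0 in
lemma run7 : runChk 1000000000000000 14843750000000 1000000 1000000000 128 499 231 232 422279935709 z6 z7 eTriv = true := by decide +kernel

set_option maxRecDepth 100000 in
set_option maxHeartbeats 0 in
lemma gp7 : GP 14843750000000 1000000000 z7 := chain_step run7 (by decide +kernel) gp6

def z8 : List ℕ :=
  [307616, 309117, 310669, 312271, 313923, 315626, 317380, 319185, 321040, 322946, 324903, 326912, 328972, 331083, 333246, 335461, 337728, 340047,
   342419, 344843, 347321, 349851, 352435, 355072, 357763, 360508, 363307, 366161, 369070, 372034, 375054, 378129, 381260, 384448, 387692, 390994,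
   394352, 397769, 401243, 404776, 408367, 412018, 415728, 419498, 423328, 427218, 431170, 435183, 439257, 443394, 447593, 451856, 456181, 460570,
   465024, 469542, 474125, 478774, 483489, 488269, 493117, 498032, 503014, 508065, 513184, 518372, 523630, 528957, 534355, 539823, 545363, 550974,
   556657, 562413, 568242, 574145, 580121, 586172, 592297, 598498, 604774, 611126, 617555, 624061, 630644, 637305, 644044, 650861, 657758, 664734,
   671789, 678925, 686142, 693439, 700817, 708277, 715819, 723443, 731150, 738939, 746812, 754768, 762808, 770932, 779140, 787433, 795810, 804272,
   812819, 821451, 830169, 838972, 847860, 856834, 865894, 875040, 884271, 893589, 902992, 912481, 922056, 931716, 941462, 951293, 961209, 971210,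
   981296, 991467]

set_option maxRecDepth 100000 in
set_option maxHeartbeats 0 in
lemma run8 : runChk 1000000000000000 14843750000000 1000000 1000000000 128 513 227 228 4232817730570 z7 z8 eTriv = true := by decide +kernel

set_option maxRecDepth 100000 in
set_option maxHeartbeats 0 in
lemma gp8 : GP 14843750000000 1000000000 z8 := chain_step run8 (by decide +kernel) gp7

def z9 : List ℕ :=
  [229597, 231674, 233794, 235958, 238166, 240417, 242714, 245055, 247441, 249873, 252350, 254873, 257443, 260059, 262723, 265433, 268192, 270998,
   273853, 276757, 279710, 282713, 285766, 288869, 292023, 295229, 298486, 301796, 305158, 308573, 312042, 315564, 319142, 322774, 326462, 330205,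
   334005, 337863, 341777, 345750, 349781, 353871, 358021, 362231, 366502, 370834, 375228, 379684, 384203, 388786, 393432, 398144, 402921, 407763,
   412672, 417649, 422693, 427805, 432986, 438237, 443558, 448949, 454412, 459947, 465555, 471236, 476991, 482821, 488726, 494707, 500764, 506898,
   513111, 519401, 525771, 532221, 538750, 545361, 552054, 558829, 565687, 572629, 579654, 586765, 593961, 601243, 608612, 616068, 623612, 631244,
   638965, 646777, 654678, 662670, 670754, 678929, 687197, 695558, 704012, 712561, 721204, 729942, 738775, 747705, 756730, 765853, 775073, 784391,
   793806, 803320, 812933, 822644, 832455, 842366, 852377, 862487, 872699, 883010, 893423, 903936, 914550, 925266, 936082, 947000, 958018, 969138,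
   980359, 991681]

set_option maxRecDepth 100000 in
set_option maxHeartbeats 0 in
lemma run9 : runChk 1000000000000000 14843750000000 1000000 1000000000 128 531 224 225 10635222051260 z8 z9 eTriv = true := by decide +kernel

set_option maxRecDepth 100000 in
set_option maxHeartbeats 0 in
lemma gp9 : GP 14843750000000 1000000000 z9 := chain_step run9 (by decide +kernel) gp8

def z10 : List ℕ :=
  [205709, 207973, 210278, 212623, 215010, 217438, 219908, 222420, 224974, 227572, 230213, 232897, 235626, 238399, 241217, 244080, 246990, 249945,
   252947, 255996, 259093, 262238, 265431, 268673, 271965, 275307, 278699, 282142, 285636, 289183, 292782, 296434, 300140, 303900, 307714, 311584,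
   315510, 319492, 323531, 327627, 331782, 335995, 340268, 344601, 348994, 353449, 357965, 362543, 367185, 371890, 376660, 381495, 386395, 391362,
   396395, 401497, 406666, 411905, 417213, 422591, 428041, 433562, 439155, 444822, 450562, 456377, 462267, 468233, 474276, 480396, 486594, 492871,
   499227, 505663, 512180, 518778, 525459, 532222, 539070, 546001, 553018, 560120, 567309, 574585, 581949, 589401, 596943, 604574, 612296, 620109,
   628014, 636011, 644102, 652286, 660565, 668939, 677408, 685974, 694636, 703396, 712254, 721210, 730265, 739420, 748675, 758031, 767488, 777046,
   786706, 796469, 806334, 816303, 826376, 836552, 846832, 857218, 867708, 878303, 889004, 899810, 910722, 921739, 932863, 944093, 955429, 966872,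
   978420, 990075]

set_option maxRecDepth 100000 in
set_option maxHeartbeats 0 in
lemma run10 : runChk 1000000000000000 14843750000000 1000000 1000000000 128 542 223 224 5463018832284 z9 z10 eTriv = true := by decide +kernel

set_option maxRecDepth 100000 in
set_option maxHeartbeats 0 in
lemma gp10 : GP 14843750000000 1000000000 z10 := chain_step run10 (by decide +kernel) gp9

def z11 : List ℕ :=
  [200047, 202357, 204707, 207098, 209528, 211999, 214512, 217066, 219661, 222299, 224980, 227704, 230471, 233283, 236138, 239039, 241985, 244976,
   248014, 251098, 254230, 257409, 260636, 263911, 267236, 270611, 274035, 277510, 281037, 284615, 288245, 291928, 295665, 299455, 303300, 307200,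
   311156, 315168, 319236, 323362, 327546, 331789, 336091, 340453, 344876, 349359, 353905, 358513, 363183, 367918, 372717, 377581, 382511, 387507,
   392570, 397702, 402901, 408170, 413508, 418917, 424397, 429949, 435574, 441272, 447044, 452891, 458814, 464812, 470888, 477041, 483273, 489583,
   495973, 502444, 508996, 515630, 522347, 529147, 536032, 543001, 550055, 557196, 564424, 571740, 579144, 586637, 594220, 601893, 609657, 617514,
   625462, 633504, 641640, 649870, 658196, 666617, 675135, 683749, 692461, 701272, 710181, 719189, 728298, 737507, 746816, 756228, 765741, 775357,
   785076, 794898, 804824, 814854, 824989, 835229, 845574, 856025, 866581, 877244, 888014, 898890, 909873, 920963, 932160, 943465, 954877, 966396,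
   978023, 989757]

set_option maxRecDepth 100000 in
set_option maxHeartbeats 0 in
lemma run11 : runChk 1000000000000000 14843750000000 1000000 1000000000 128 546 222 223 4291482621734 z10 z11 eTriv = true := by decide +kernel

set_option maxRecDepth 100000 in
set_option maxHeartbeats 0 in
lemma gp11 : GP 14843750000000 1000000000 z11 := chain_step run11 (by decide +kernel) gp10

def z12 : List ℕ :=
  [198850, 201171, 203531, 205931, 208371, 210852, 213374, 215937, 218542, 221189, 223878, 226611, 229387, 232207, 235071, 237979, 240933, 243933,
   246978, 250070, 253210, 256396, 259631, 262914, 266246, 269628, 273060, 276542, 280076, 283661, 287298, 290988, 294732, 298529, 302381, 306288,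
   310250, 314269, 318344, 322477, 326668, 330917, 335226, 339594, 344023, 348514, 353066, 357680, 362358, 367099, 371905, 376775, 381712, 386715,
   391785, 396923, 402129, 407405, 412750, 418166, 423653, 429213, 434844, 440550, 446329, 452183, 458113, 464119, 470202, 476363, 482602, 488921,
   495319, 501798, 508358, 515000, 521725, 528534, 535426, 542404, 549467, 556617, 563854, 571179, 578592, 586094, 593686, 601369, 609143, 617009,
   624968, 633020, 641166, 649407, 657743, 666175, 674703, 683329, 692053, 700874, 709795, 718815, 727936, 737157, 746479, 755903, 765429, 775058,
   784790, 794625, 804565, 814609, 824758, 835012, 845372, 855837, 866409, 877087, 887872, 898764, 909763, 920869, 932083, 943404, 954833, 966369,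
   978013, 989765]

set_option maxRecDepth 100000 in
set_option maxHeartbeats 0 in
lemma run12 : runChk 1000000000000000 14843750000000 1000000 1000000000 128 547 222 223 4402371720777 z11 z12 eTriv = true := by decide +kernel

set_option maxRecDepth 100000 in
set_option maxHeartbeats 0 in
lemma gp12 : GP 14843750000000 1000000000 z12 := chain_step run12 (by decide +kernel) gp11

def z13 : List ℕ :=
  [198517, 200838, 203199, 205599, 208039, 210521, 213043, 215606, 218211, 220858, 223548, 226280, 229056, 231876, 234740, 237648, 240602, 243601,
   246646, 249738, 252877, 256063, 259298, 262580, 265912, 269293, 272724, 276206, 279739, 283323, 286960, 290649, 294392, 298188, 302039, 305945,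
   309907, 313924, 317999, 322131, 326320, 330569, 334876, 339244, 343672, 348161, 352712, 357325, 362001, 366741, 371546, 376415, 381350, 386352,
   391421, 396557, 401762, 407036, 412380, 417795, 423280, 428838, 434468, 440172, 445950, 451803, 457731, 463735, 469817, 475976, 482213, 488530,
   494926, 501403, 507962, 514602, 521326, 528132, 535023, 541999, 549061, 556209, 563444, 570766, 578178, 585678, 593269, 600950, 608722, 616586,
   624543, 632594, 640738, 648977, 657311, 665741, 674268, 682892, 691613, 700433, 709352, 718371, 727490, 736709, 746029, 755452, 764976, 774603,
   784334, 794168, 804106, 814148, 824295, 834548, 844906, 855370, 865941, 876617, 887401, 898291, 909289, 920394, 931607, 942927, 954355, 965890,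
   977533, 989284]

def e13 : List ℕ :=
  [121258, 121297, 121372, 121486, 121637, 121828, 122058, 122327, 122638, 122989, 123383, 123819, 124298, 124821, 125389, 126003, 126663, 127370,
   128126, 128932, 129787, 130694, 131654, 132666, 133734, 134858, 136039, 137278, 138578, 139938, 141361, 142849, 144402, 146023, 147713, 149473,
   151306, 153214, 155197, 157259, 159401, 161625, 163933, 166328, 168811, 171386, 174053, 176817, 179679, 182641, 185707, 188880, 192161, 195553,
   199060, 202685, 206430, 210299, 214294, 218419, 222677, 227071, 231605, 236282, 241106, 246080, 251208, 256493, 261938, 267549, 273328, 279279,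
   285406, 291713, 298204, 304882, 311752, 318817, 326082, 333549, 341224, 349110, 357211, 365531, 374073, 382841, 391840, 401073, 410543, 420254,
   430210, 440414, 450869, 461578, 472545, 483775, 495269, 507033, 519067, 531375, 543959, 556822, 569965, 583390, 597099, 611094, 625375, 639943,
   654800, 669946, 685381, 701105, 717117, 733418, 750007, 766881, 784040, 801483, 819206, 837208, 855486, 874037, 892857, 911943, 931290, 950895,
   970752, 990857]

set_option maxRecDepth 100000 in
set_option maxHeartbeats 0 in
lemma run13 : cChk 1000000000000000 14843750000000 14921875000000 1000000 1000000000 128 547 222 223 2028827468354 78021185331400 44 8241542002020 9963964884211 7460937500000 4133126529144 z12 z13 e13 = true := by decide +kernel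

set_option maxRecDepth 100000 in
set_option maxHeartbeats 0 in
lemma gp13 : GP 14921875000000 1000000000 z13 := c_next run13 gp12 (by decide +kernel)

def z14 : List ℕ :=
  [195463, 197785, 200146, 202548, 204989, 207471, 209993, 212557, 215163, 217811, 220501, 223234, 226011, 228831, 231696, 234605, 237560, 240560,
   243606, 246699, 249839, 253027, 256262, 259547, 262880, 266263, 269697, 273181, 276716, 280303, 283943, 287635, 291381, 295182, 299036, 302947,
   306913, 310935, 315015, 319152, 323348, 327603, 331917, 336292, 340727, 345225, 349784, 354406, 359092, 363842, 368657, 373537, 378484, 383498,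
   388579, 393729, 398948, 404237, 409596, 415027, 420529, 426104, 431753, 437476, 443273, 449147, 455096, 461123, 467228, 473411, 479673, 486016,
   492439, 498944, 505531, 512202, 518956, 525795, 532719, 539729, 546826, 554010, 561283, 568645, 576096, 583638, 591271, 598997, 606814, 614726,
   622731, 630831, 639026, 647318, 655706, 664192, 672776, 681459, 690241, 699123, 708106, 717191, 726377, 735665, 745057, 754552, 764151, 773855,
   783663, 793578, 803598, 813725, 823959, 834301, 844749, 855306, 865972, 876746, 887629, 898621, 909723, 920934, 932256, 943687, 955228, 966880,
   978642, 990513]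

def e14 : List ℕ :=
  [117382, 117408, 117470, 117570, 117707, 117882, 118095, 118348, 118640, 118973, 119347, 119762, 120220, 120722, 121267, 121857, 122492, 123174,
   123904, 124681, 125509, 126386, 127316, 128297, 129333, 130424, 131571, 132775, 134038, 135362, 136747, 138196, 139709, 141289, 142937, 144654,
   146443, 148305, 150243, 152257, 154351, 156526, 158784, 161127, 163559, 166080, 168694, 171402, 174208, 177114, 180122, 183236, 186457, 189789,
   193235, 196798, 200481, 204286, 208217, 212277, 216470, 220799, 225267, 229877, 234634, 239541, 244601, 249818, 255196, 260739, 266450, 272333,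
   278393, 284633, 291057, 297669, 304473, 311473, 318673, 326078, 333690, 341515, 349556, 357817, 366302, 375016, 383961, 393142, 402562, 412226,
   422136, 432297, 442712, 453384, 464317, 475515, 486981, 498719, 510732, 523022, 535592, 548444, 561580, 575003, 588714, 602716, 617008, 631593,
   646471, 661644, 677110, 692871, 708927, 725277, 741920, 758855, 776081, 793597, 811400, 829488, 847858, 866508, 885435, 904634, 924101, 943833,
   963824, 984070]

set_option maxRecDepth 100000 in
set_option maxHeartbeats 0 in
lemma run14 : cChk 1000000000000000 14921875000000 15000000000000 1000000 1000000000 128 548 222 223 8659830137590 74328421609167 45 8368444080684 10153367200703 7500000000000 4166433465035 z13 z14 e14 = true := by decide +kernel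

set_option maxRecDepth 100000 in
set_option maxHeartbeats 0 in
lemma gp14 : GP 15000000000000 1000000000 z14 := c_next run14 gp13 (by decide +kernel)

def z15 : List ℕ :=
  [191636, 193959, 196322, 198724, 201166, 203648, 206171, 208735, 211340, 213988, 216678, 219411, 222187, 225007, 227871, 230779, 233733, 236732,
   239778, 242870, 246009, 249196, 252431, 255714, 259047, 262430, 265863, 269346, 272881, 276468, 280108, 283800, 287547, 291347, 295203, 299114,
   303081, 307105, 311186, 315325, 319523, 323780, 328097, 332475, 336914, 341414, 345978, 350605, 355295, 360051, 364871, 369758, 374712, 379733,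
   384822, 389980, 395208, 400506, 405876, 411317, 416831, 422418, 428079, 433815, 439627, 445515, 451481, 457524, 463646, 469847, 476128, 482491,
   488935, 495461, 502071, 508765, 515544, 522408, 529359, 536397, 543523, 550738, 558042, 565436, 572921, 580498, 588167, 595930, 603787, 611738,
   619785, 627928, 636168, 644505, 652941, 661476, 670111, 678846, 687682, 696620, 705660, 714803, 724050, 733401, 742857, 752418, 762086, 771860,
   781741, 791729, 801826, 812031, 822346, 832769, 843303, 853947, 864702, 875567, 886544, 897633, 908833, 920146, 931571, 943108, 954758, 966521,
   978396, 990384]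

def e15 : List ℕ :=
  [112240, 112287, 112369, 112488, 112644, 112838, 113069, 113339, 113649, 113998, 114388, 114819, 115292, 115808, 116368, 116972, 117621, 118316,
   119059, 119850, 120690, 121580, 122521, 123515, 124563, 125665, 126824, 128040, 129316, 130651, 132049, 133509, 135035, 136628, 138289, 140019,
   141822, 143699, 145651, 147681, 149791, 151983, 154259, 156621, 159072, 161614, 164249, 166980, 169810, 172742, 175777, 178919, 182171, 185535,
   189015, 192614, 196335, 200180, 204154, 208259, 212500, 216879, 221400, 226067, 230883, 235853, 240979, 246266, 251717, 257337, 263129, 269098,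
   275247, 281581, 288103, 294819, 301731, 308844, 316163, 323691, 331433, 339393, 347575, 355983, 364621, 373493, 382604, 391957, 401556, 411406,
   421509, 431869, 442491, 453376, 464532, 475960, 487666, 499651, 511919, 524472, 537314, 550447, 563872, 577593, 591610, 605926, 620542, 635458,
   650677, 666198, 682022, 698149, 714579, 731311, 748344, 765678, 783310, 801239, 819464, 837980, 856787, 875879, 895255, 914909, 934838, 955037,
   975501, 996224]

set_option maxRecDepth 100000 in
set_option maxHeartbeats 0 in
lemma run15 : cChk 1000000000000000 15000000000000 15078125000000 1000000 1000000000 128 549 221 222 8686341807710 70758237177732 47 8543421174791 10345650198029 7539062500000 4199797669747 z14 z15 e15 = true := by decide +kernel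

set_option maxRecDepth 100000 in
set_option maxHeartbeats 0 in
lemma gp15 : GP 15078125000000 1000000000 z15 := c_next run15 gp14 (by decide +kernel)

def z16 : List ℕ :=
  [187488, 189812, 192174, 194575, 197016, 199497, 202019, 204582, 207186, 209831, 212519, 215250, 218023, 220840, 223702, 226608, 229558, 232555,
   235597, 238686, 241822, 245006, 248237, 251517, 254847, 258226, 261655, 265136, 268668, 272251, 275888, 279577, 283321, 287119, 290971, 294880,
   298845, 302866, 306945, 311083, 315279, 319535, 323851, 328228, 332666, 337167, 341731, 346358, 351049, 355806, 360628, 365517, 370473, 375497,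
   380590, 385752, 390984, 396287, 401662, 407109, 412629, 418224, 423893, 429637, 435458, 441356, 447332, 453386, 459520, 465734, 472029, 478406,
   484866, 491408, 498035, 504748, 511545, 518430, 525402, 532462, 539611, 546849, 554179, 561599, 569112, 576718, 584418, 592212, 600101, 608087,
   616169, 624349, 632627, 641004, 649481, 658059, 666738, 675518, 684402, 693389, 702480, 711676, 720977, 730384, 739898, 749519, 759249, 769086,
   779033, 789089, 799256, 809533, 819921, 830421, 841033, 851758, 862595, 873546, 884610, 895789, 907082, 918489, 930011, 941649, 953401, 965269,
   977252, 989351]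

def e16 : List ℕ :=
  [106543, 106575, 106641, 106743, 106881, 107055, 107266, 107514, 107800, 108125, 108489, 108894, 109338, 109825, 110353, 110925, 111541, 112201,
   112907, 113660, 114460, 115310, 116209, 117159, 118162, 119218, 120329, 121495, 122719, 124002, 125346, 126751, 128219, 129753, 131354, 133023,
   134762, 136574, 138460, 140421, 142462, 144582, 146786, 149074, 151449, 153914, 156471, 159122, 161871, 164720, 167671, 170728, 173893, 177170,
   180561, 184070, 187699, 191453, 195333, 199345, 203491, 207775, 212200, 216771, 221490, 226362, 231391, 236581, 241935, 247457, 253152, 259025,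
   265078, 271316, 277745, 284367, 291187, 298210, 305439, 312880, 320537, 328413, 336514, 344844, 353406, 362206, 371248, 380535, 390073, 399864,
   409913, 420225, 430802, 441648, 452770, 464170, 475852, 487821, 500078, 512628, 525473, 538616, 552060, 565806, 579857, 594215, 608881, 623857,
   639144, 654743, 670654, 686879, 703415, 720265, 737426, 754898, 772680, 790770, 809165, 827865, 846866, 866164, 885757, 905641, 925811, 946263,
   966992, 987993]

set_option maxRecDepth 100000 in
set_option maxHeartbeats 0 in
lemma run16 : cChk 1000000000000000 15078125000000 15156250000000 1000000 1000000000 128 550 221 222 4074776539459 67314155255894 50 8746900760946 10540565966215 7578125000000 4233218573448 z15 z16 e16 = true := by decide +kernel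

set_option maxRecDepth 100000 in
set_option maxHeartbeats 0 in
lemma gp16 : GP 15156250000000 1000000000 z16 := c_next run16 gp15 (by decide +kernel)

def z17 : List ℕ :=
  [183703, 186032, 188400, 190806, 193253, 195739, 198265, 200832, 203440, 206090, 208782, 211516, 214294, 217115, 219980, 222889, 225843, 228843,
   231889, 234982, 238121, 241308, 244543, 247827, 251160, 254543, 257976, 261461, 264997, 268585, 272225, 275919, 279668, 283470, 287328, 291242,
   295212, 299240, 303325, 307469, 311672, 315935, 320259, 324643, 329090, 333599, 338172, 342808, 347510, 352277, 357110, 362010, 366978, 372015,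
   377120, 382296, 387543, 392861, 398251, 403714, 409252, 414864, 420551, 426315, 432156, 438075, 444072, 450149, 456306, 462544, 468865, 475268,
   481754, 488325, 494981, 501723, 508552, 515469, 522474, 529569, 536754, 544030, 551397, 558858, 566411, 574059, 581802, 589641, 597577, 605610,
   613742, 621973, 630303, 638734, 647267, 655902, 664639, 673481, 682427, 691478, 700634, 709898, 719269, 728747, 738335, 748031, 757838, 767755,
   777783, 787923, 798175, 808540, 819019, 829611, 840318, 851139, 862076, 873129, 884298, 895583, 906985, 918504, 930141, 941895, 953767, 965757,
   977865, 990092]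

def e17 : List ℕ :=
  [100677, 100696, 100748, 100834, 100955, 101110, 101301, 101528, 101792, 102093, 102433, 102810, 103227, 103684, 104182, 104722, 105304, 105929,
   106599, 107314, 108075, 108883, 109740, 110646, 111603, 112611, 113673, 114789, 115961, 117190, 118478, 119827, 121237, 122710, 124248, 125854,
   127528, 129273, 131090, 132982, 134950, 136997, 139125, 141337, 143634, 146018, 148494, 151062, 153727, 156489, 159353, 162321, 165396, 168582,
   171880, 175295, 178829, 182486, 186270, 190184, 194231, 198415, 202740, 207209, 211827, 216598, 221525, 226612, 231864, 237284, 242878, 248649,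
   254602, 260740, 267069, 273594, 280317, 287245, 294382, 301731, 309299, 317088, 325105, 333353, 341838, 350563, 359533, 368753, 378227, 387960,
   397955, 408217, 418750, 429558, 440647, 452020, 463683, 475638, 487889, 500439, 513292, 526450, 539917, 553695, 567787, 582194, 596919, 611963,
   627328, 643015, 659024, 675357, 692014, 708994, 726297, 743922, 761869, 780136, 798721, 817621, 836836, 856360, 876192, 896328, 916763, 937492,
   958512, 979816]

set_option maxRecDepth 100000 in
set_option maxHeartbeats 0 in
lemma run17 : cChk 1000000000000000 15156250000000 15312500000000 1000000 1000000000 128 552 221 222 8561932041130 60794431734083 51 8968116716042 10938504809082 7656250000000 4300228226767 z16 z17 e17 = true := by decide +kernel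

set_option maxRecDepth 100000 in
set_option maxHeartbeats 0 in
lemma gp17 : GP 15312500000000 1000000000 z17 := c_next run17 gp16 (by decide +kernel)

def z18 : List ℕ :=
  [177687, 180010, 182371, 184770, 187210, 189688, 192207, 194766, 197366, 200009, 202692, 205418, 208187, 210999, 213855, 216756, 219702, 222693,
   225729, 228813, 231944, 235123, 238349, 241624, 244949, 248324, 251750, 255226, 258755, 262335, 265969, 269656, 273398, 277195, 281047, 284956,
   288922, 292945, 297027, 301168, 305368, 309629, 313951, 318335, 322782, 327292, 331866, 336504, 341208, 345979, 350817, 355723, 360697, 365741,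
   370855, 376041, 381297, 386627, 392030, 397507, 403060, 408688, 414393, 420175, 426037, 431978, 437998, 444100, 450283, 456549, 462899, 469333,
   475853, 482458, 489151, 495932, 502801, 509760, 516809, 523951, 531184, 538510, 545930, 553445, 561056, 568764, 576569, 584473, 592476, 600579,
   608783, 617089, 625498, 634010, 642627, 651349, 660176, 669110, 678152, 687303, 696562, 705932, 715412, 725003, 734707, 744523, 754454, 764498,
   774658, 784933, 795325, 805833, 816459, 827203, 838066, 849047, 860148, 871371, 882713, 894176, 905761, 917468, 929297, 941248, 953323, 965520,
   977841, 990285]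

def e18 : List ℕ :=
  [92515, 92541, 92600, 92692, 92817, 92975, 93167, 93395, 93657, 93955, 94290, 94662, 95072, 95521, 96009, 96537, 97106, 97718, 98372, 99070, 99813,
   100603, 101439, 102323, 103257, 104241, 105277, 106366, 107510, 108711, 109968, 111285, 112663, 114103, 115607, 117177, 118815, 120523, 122302,
   124156, 126085, 128092, 130180, 132351, 134607, 136951, 139385, 141912, 144534, 147256, 150078, 153006, 156040, 159186, 162445, 165822, 169319,
   172941, 176690, 180570, 184586, 188740, 193038, 197482, 202077, 206828, 211737, 216810, 222051, 227465, 233055, 238826, 244784, 250932, 257276,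
   263820, 270569, 277527, 284701, 292093, 299710, 307557, 315637, 323957, 332521, 341334, 350400, 359725, 369312, 379168, 389297, 399702, 410388,
   421363, 432629, 444192, 456055, 468224, 480701, 493491, 506596, 520021, 533768, 547840, 562240, 576971, 592034, 607431, 623164, 639235, 655644,
   672391, 689479, 706905, 724671, 742775, 761216, 779994, 799105, 818548, 838321, 858419, 878840, 899580, 920635, 941999, 963667, 985635]

set_option maxRecDepth 100000 in
set_option maxHeartbeats 0 in
lemma run18 : cChk 1000000000000000 15312500000000 15468750000000 1000000 1000000000 128 554 220 221 10848662289977 54751273042753 54 9298376773421 11347479835286 7734375000000 4367457978706 z17 z18 e18 = true := by decide +kernel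

set_option maxRecDepth 100000 in
set_option maxHeartbeats 0 in
lemma gp18 : GP 15468750000000 1000000000 z18 := c_next run18 gp17 (by decide +kernel)

def z19 : List ℕ :=
  [170714, 173027, 175378, 177767, 180195, 182662, 185169, 187717, 190305, 192934, 195604, 198317, 201073, 203871, 206714, 209600, 212532, 215509,
   218531, 221601, 224717, 227881, 231093, 234353, 237664, 241024, 244435, 247897, 251411, 254978, 258598, 262271, 265999, 269783, 273622, 277518,
   281472, 285483, 289553, 293682, 297872, 302122, 306434, 310808, 315246, 319747, 324314, 328945, 333643, 338408, 343241, 348142, 353113, 358154,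
   363266, 368450, 373707, 379038, 384443, 389923, 395480, 401114, 406825, 412615, 418485, 424436, 430468, 436583, 442780, 449062, 455429, 461882,
   468422, 475050, 481766, 488572, 495469, 502457, 509537, 516711, 523980, 531343, 538803, 546360, 554014, 561768, 569622, 577576, 585632, 593791,
   602053, 610420, 618892, 627471, 636157, 644950, 653853, 662865, 671989, 681223, 690571, 700031, 709606, 719295, 729100, 739022, 749061, 759218,
   769493, 779889, 790404, 801041, 811799, 822680, 833683, 844810, 856061, 867437, 878938, 890565, 902319, 914199, 926206, 938340, 950603, 962994,
   975514, 988162]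

def e19 : List ℕ :=
  [83333, 83366, 83430, 83525, 83652, 83810, 84000, 84223, 84480, 84771, 85096, 85458, 85855, 86289, 86760, 87270, 87820, 88409, 89040, 89713, 90429,
   91189, 91994, 92846, 93746, 94694, 95693, 96743, 97846, 99004, 100218, 101489, 102819, 104211, 105665, 107183, 108768, 110422, 112146, 113943,
   115814, 117763, 119791, 121901, 124095, 126377, 128748, 131211, 133770, 136427, 139186, 142048, 145019, 148100, 151296, 154610, 158045, 161604,
   165293, 169115, 173073, 177172, 181415, 185808, 190354, 195058, 199924, 204957, 210161, 215542, 221103, 226851, 232789, 238923, 245258, 251799,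
   258551, 265519, 272709, 280126, 287775, 295662, 303791, 312168, 320799, 329689, 338842, 348265, 357962, 367938, 378199, 388750, 399596, 410744,
   422199, 433964, 446046, 458447, 471174, 484229, 497616, 511340, 525404, 539811, 554564, 569666, 585120, 600927, 617089, 633608, 650486, 667723,
   685320, 703276, 721593, 740268, 759302, 778692, 798437, 818535, 838983, 859777, 880914, 902391, 924201, 946342, 968806, 991587]

set_option maxRecDepth 100000 in
set_option maxHeartbeats 0 in
lemma run19 : cChk 1000000000000000 15468750000000 15625000000000 1000000 1000000000 128 556 219 220 287523644869 49162474107750 59 9706682079950 11768065908949 7812500000000 4434903471020 z18 z19 e19 = true := by decide +kernel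

set_option maxRecDepth 100000 in
set_option maxHeartbeats 0 in
lemma gp19 : GP 15625000000000 1000000000 z19 := c_next run19 gp18 (by decide +kernel)

def z20 : List ℕ :=
  [164687, 166997, 169344, 171730, 174153, 176616, 179118, 181661, 184243, 186867, 189532, 192239, 194988, 197781, 200617, 203497, 206422, 209392,
   212408, 215471, 218581, 221738, 224944, 228199, 231503, 234857, 238262, 241719, 245227, 248789, 252404, 256073, 259797, 263577, 267413, 271306,
   275256, 279265, 283334, 287462, 291651, 295901, 300214, 304589, 309029, 313533, 318103, 322738, 327441, 332212, 337051, 341960, 346939, 351990,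
   357113, 362308, 367578, 372922, 378342, 383838, 389412, 395064, 400796, 406607, 412500, 418474, 424532, 430673, 436900, 443212, 449611, 456097,
   462672, 469337, 476092, 482939, 489879, 496912, 504039, 511262, 518582, 525999, 533514, 541129, 548844, 556660, 564579, 572601, 580728, 588960,
   597298, 605744, 614297, 622960, 631733, 640618, 649614, 658723, 667946, 677285, 686739, 696309, 705998, 715805, 725731, 735777, 745945, 756234,
   766647, 777183, 787843, 798629, 809540, 820578, 831744, 843037, 854459, 866011, 877693, 889505, 901448, 913524, 925731, 938071, 950544, 963151,
   975892, 988767]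

def e20 : List ℕ :=
  [73969, 74009, 74078, 74175, 74302, 74459, 74646, 74864, 75113, 75395, 75709, 76056, 76438, 76854, 77306, 77795, 78320, 78884, 79487, 80130, 80814,
   81540, 82310, 83124, 83983, 84890, 85844, 86849, 87904, 89012, 90174, 91391, 92666, 94001, 95396, 96854, 98376, 99966, 101624, 103354, 105157,
   107035, 108992, 111030, 113151, 115358, 117653, 120040, 122522, 125102, 127782, 130567, 133459, 136462, 139579, 142815, 146173, 149656, 153270,
   157017, 160902, 164930, 169105, 173430, 177912, 182554, 187362, 192340, 197493, 202827, 208346, 214056, 219961, 226069, 232383, 238910, 245655,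
   252624, 259822, 267256, 274930, 282851, 291025, 299458, 308154, 317121, 326364, 335889, 345701, 355806, 366209, 376919, 387940, 399279, 410940,
   422929, 435251, 447911, 460914, 474264, 487966, 502024, 516442, 531224, 546373, 561893, 577785, 594053, 610700, 627726, 645134, 662924, 681098,
   699655, 718596, 737920, 757627, 777715, 798181, 819025, 840242, 861830, 883785, 906102, 928777, 951804, 975178, 998892]

set_option maxRecDepth 100000 in
set_option maxHeartbeats 0 in
lemma run20 : cChk 1000000000000000 15625000000000 16015625000000 1000000 1000000000 128 560 218 219 4965234110134 37075457328988 61 10172301357328 12870313917949 8007812500000 4604433239056 z19 z20 e20 = true := by decide +kernel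

set_option maxRecDepth 100000 in
set_option maxHeartbeats 0 in
lemma gp20 : GP 16015625000000 1000000000 z20 := c_next run20 gp19 (by decide +kernel)

def z21 : List ℕ :=
  [152911, 155178, 157482, 159825, 162204, 164622, 167079, 169576, 172113, 174690, 177309, 179970, 182672, 185418, 188207, 191041, 193918, 196841,
   199811, 202827, 205890, 209001, 212161, 215369, 218628, 221936, 225297, 228709, 232174, 235693, 239265, 242892, 246575, 250314, 254110, 257964,
   261877, 265849, 269882, 273975, 278131, 282349, 286631, 290977, 295389, 299866, 304410, 309022, 313704, 318454, 323276, 328168, 333133, 338172,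
   343285, 348472, 353737, 359078, 364497, 369996, 375575, 381234, 386976, 392801, 398710, 404704, 410785, 416952, 423208, 429553, 435989, 442515,
   449135, 455848, 462656, 469559, 476560, 483659, 490856, 498154, 505552, 513054, 520658, 528368, 536183, 544106, 552136, 560275, 568525, 576886,
   585360, 593947, 602649, 611467, 620401, 629455, 638627, 647920, 657334, 666871, 676531, 686316, 696226, 706265, 716430, 726725, 737149, 747706,
   758393, 769214, 780168, 791259, 802485, 813847, 825348, 836987, 848766, 860685, 872746, 884948, 897294, 909783, 922416, 935195, 948118, 961188,
   974406, 987770]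

def e21 : List ℕ :=
  [59162, 59183, 59229, 59299, 59395, 59516, 59664, 59839, 60041, 60271, 60529, 60817, 61134, 61482, 61860, 62271, 62715, 63192, 63703, 64250, 64834,
   65454, 66113, 66812, 67551, 68332, 69156, 70025, 70939, 71901, 72912, 73973, 75087, 76254, 77476, 78756, 80096, 81497, 82961, 84491, 86089, 87758,
   89499, 91315, 93209, 95185, 97243, 99388, 101623, 103950, 106374, 108896, 111522, 114254, 117096, 120053, 123127, 126323, 129646, 133100, 136688,
   140416, 144289, 148311, 152487, 156822, 161322, 165992, 170837, 175863, 181076, 186481, 192084, 197891, 203909, 210143, 216600, 223286, 230208,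
   237372, 244785, 252453, 260383, 268581, 277056, 285812, 294857, 304198, 313841, 323794, 334063, 344657, 355582, 366845, 378452, 390410, 402725,
   415404, 428452, 441875, 455679, 469869, 484450, 499428, 514806, 530589, 546782, 563387, 580409, 597850, 615712, 633998, 652710, 671848, 691414,
   711408, 731829, 752677, 773951, 795649, 817768, 840306, 863260, 886624, 910394, 934566, 959132, 984088]

set_option maxRecDepth 100000 in
set_option maxHeartbeats 0 in
lemma run21 : cChk 1000000000000000 16015625000000 16406250000000 1000000 1000000000 128 565 217 218 1590023581979 27417402304881 69 11044827236862 14049131960061 8203125000000 4775220445817 z20 z21 e21 = true := by decide +kernel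

set_option maxRecDepth 100000 in
set_option maxHeartbeats 0 in
lemma gp21 : GP 16406250000000 1000000000 z21 := c_next run21 gp20 (by decide +kernel)

def z22 : List ℕ :=
  [141807, 144031, 146292, 148589, 150924, 153297, 155708, 158159, 160650, 163181, 165753, 168366, 171022, 173720, 176462, 179248, 182078, 184954,
   187876, 190845, 193861, 196925, 200037, 203199, 206412, 209675, 212990, 216357, 219778, 223252, 226782, 230366, 234007, 237705, 241461, 245276,
   249150, 253085, 257080, 261139, 265260, 269445, 273694, 278010, 282392, 286842, 291360, 295948, 300606, 305335, 310137, 315012, 319962, 324986,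
   330087, 335266, 340523, 345860, 351277, 356775, 362356, 368022, 373772, 379607, 385531, 391542, 397642, 403834, 410116, 416492, 422961, 429526,
   436187, 442946, 449803, 456761, 463819, 470980, 478244, 485614, 493089, 500672, 508363, 516164, 524076, 532101, 540239, 548492, 556862, 565349,
   573954, 582680, 591527, 600497, 609590, 618809, 628154, 637627, 647229, 656961, 666825, 676822, 686952, 697219, 707621, 718162, 728841, 739661,
   750623, 761727, 772975, 784368, 795908, 807594, 819429, 831414, 843550, 855837, 868277, 880871, 893619, 906524, 919585, 932804, 946181, 959717,
   973414, 987272]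

def e22 : List ℕ :=
  [43925, 43950, 43997, 44063, 44151, 44261, 44392, 44546, 44723, 44923, 45147, 45395, 45669, 45968, 46294, 46648, 47029, 47439, 47878, 48348, 48850,
   49383, 49951, 50552, 51190, 51864, 52576, 53327, 54120, 54954, 55832, 56755, 57725, 58744, 59813, 60934, 62110, 63342, 64632, 65982, 67396, 68875,
   70422, 72039, 73730, 75497, 77343, 79271, 81285, 83387, 85582, 87872, 90262, 92755, 95356, 98068, 100896, 103845, 106918, 110121, 113459, 116937,
   120559, 124331, 128259, 132349, 136606, 141036, 145646, 150441, 155429, 160615, 166007, 171612, 177436, 183487, 189772, 196299, 203074, 210106,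
   217403, 224972, 232821, 240958, 249392, 258129, 267180, 276550, 286251, 296291, 306678, 317421, 328528, 340007, 351865, 364113, 376756, 389803,
   403262, 417139, 431443, 446179, 461355, 476976, 493050, 509581, 526575, 544037, 561972, 580383, 599275, 618650, 638511, 658860, 679699, 701028,
   722849, 745160, 767962, 791251, 815027, 839286, 864025, 889239, 914923, 941071, 967678, 994734]

set_option maxRecDepth 100000 in
set_option maxHeartbeats 0 in
lemma run22 : cChk 1000000000000000 16406250000000 16796875000000 1000000 1000000000 128 574 215 216 833622404462 19863734384001 82 12208091999450 15308047622630 8398437500000 4947203765288 z21 z22 e22 = true := by decide +kernel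

set_option maxRecDepth 100000 in
set_option maxHeartbeats 0 in
lemma gp22 : GP 16796875000000 1000000000 z22 := c_next run22 gp21 (by decide +kernel)

def z23 : List ℕ :=
  [132624, 134794, 137001, 139244, 141524, 143843, 146199, 148595, 151030, 153505, 156021, 158579, 161178, 163820, 166506, 169236, 172010, 174830,
   177696, 180609, 183569, 186578, 189635, 192742, 195900, 199109, 202370, 205684, 209051, 212473, 215950, 219484, 223074, 226722, 230428, 234194,
   238021, 241909, 245859, 249872, 253949, 258091, 262299, 266574, 270917, 275329, 279810, 284363, 288987, 293685, 298456, 303303, 308225, 313225,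
   318303, 323461, 328698, 334018, 339421, 344907, 350478, 356136, 361881, 367715, 373639, 379654, 385761, 391961, 398257, 404649, 411138, 417725,
   424413, 431202, 438093, 445088, 452189, 459396, 466711, 474135, 481670, 489317, 497078, 504953, 512944, 521053, 529282, 537630, 546101, 554695,
   563413, 572258, 581231, 590332, 599565, 608929, 618427, 628059, 637828, 647735, 657782, 667969, 678298, 688771, 699389, 710153, 721066, 732128,
   743340, 754705, 766224, 777897, 789727, 801715, 813861, 826169, 838637, 851269, 864065, 877027, 890155, 903452, 916917, 930553, 944360, 958339,
   972492, 986820]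

def e23 : List ℕ :=
  [31927, 31940, 31969, 32014, 32076, 32155, 32252, 32367, 32500, 32651, 32822, 33013, 33224, 33456, 33709, 33984, 34282, 34604, 34950, 35321, 35717,
   36140, 36591, 37071, 37580, 38119, 38691, 39295, 39934, 40609, 41320, 42070, 42859, 43691, 44565, 45484, 46451, 47466, 48532, 49651, 50825, 52057,
   53348, 54703, 56122, 57610, 59168, 60801, 62511, 64301, 66176, 68138, 70191, 72340, 74588, 76940, 79400, 81973, 84663, 87476, 90416, 93489, 96700,
   100056, 103561, 107222, 111046, 115038, 119206, 123556, 128095, 132831, 137771, 142923, 148294, 153893, 159728, 165807, 172139, 178732, 185596,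
   192739, 200171, 207900, 215937, 224290, 232970, 241987, 251351, 261074, 271164, 281631, 292487, 303741, 315402, 327481, 339988, 352932, 366323,
   380171, 394484, 409271, 424541, 440303, 456565, 473334, 490618, 508423, 526756, 545624, 565031, 584984, 605485, 626538, 648148, 670317, 693045,
   716335, 740187, 764600, 789573, 815103, 841189, 867826, 895010, 922735, 950995, 979783]

set_option maxRecDepth 100000 in
set_option maxHeartbeats 0 in
lemma run23 : cChk 1000000000000000 16796875000000 17578125000000 1000000 1000000000 128 584 214 215 9003936747 9757059700615 91 13454308965572 18085020744249 8789062500000 5294528246968 z22 z23 e23 = true := by decide +kernel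

set_option maxRecDepth 100000 in
set_option maxHeartbeats 0 in
lemma gp23 : GP 17578125000000 1000000000 z23 := c_next run23 gp22 (by decide +kernel)

def z24 : List ℕ :=
  [117816, 119867, 121954, 124077, 126237, 128434, 130669, 132943, 135256, 137609, 140003, 142438, 144915, 147435, 149998, 152605, 155257, 157954,
   160698, 163489, 166328, 169215, 172152, 175139, 178177, 181267, 184409, 187606, 190856, 194162, 197525, 200944, 204421, 207958, 211554, 215212,
   218931, 222713, 226559, 230469, 234446, 238490, 242601, 246782, 251033, 255355, 259750, 264218, 268761, 273379, 278075, 282848, 287702, 292635,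
   297651, 302750, 307933, 313202, 318558, 324002, 329535, 335160, 340877, 346688, 352593, 358596, 364696, 370895, 377196, 383598, 390104, 396716,
   403435, 410261, 417198, 424246, 431407, 438683, 446074, 453584, 461213, 468963, 476836, 484834, 492957, 501209, 509590, 518102, 526747, 535527,
   544443, 553498, 562693, 572029, 581510, 591135, 600908, 610830, 620903, 631129, 641509, 652045, 662740, 673595, 684612, 695793, 707139, 718653,
   730336, 742191, 754218, 766421, 778800, 791357, 804095, 817015, 830119, 843409, 856886, 870552, 884410, 898460, 912704, 927144, 941782, 956619,
   971657, 986897]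

def e24 : List ℕ :=
  [17939, 17951, 17973, 18007, 18052, 18108, 18176, 18256, 18349, 18454, 18572, 18704, 18850, 19010, 19186, 19376, 19583, 19806, 20046, 20304, 20580,
   20876, 21192, 21528, 21887, 22268, 22672, 23101, 23556, 24038, 24548, 25087, 25657, 26259, 26896, 27567, 28276, 29023, 29811, 30642, 31518, 32441,
   33414, 34438, 35517, 36653, 37849, 39109, 40434, 41830, 43298, 44843, 46469, 48180, 49979, 51872, 53863, 55957, 58158, 60473, 62907, 65465, 68153,
   70979, 73947, 77066, 80341, 83781, 87393, 91185, 95165, 99341, 103722, 108317, 113136, 118187, 123481, 129027, 134836, 140919, 147287, 153950,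
   160920, 168208, 175828, 183791, 192111, 200800, 209871, 219337, 229211, 239506, 250236, 261413, 273052, 285165, 297767, 310869, 324486, 338630,
   353315, 368552, 384355, 400735, 417704, 435273, 453453, 472255, 491689, 511763, 532487, 553867, 575913, 598630, 622024, 646100, 670861, 696311,
   722453, 749286, 776811, 805027, 833932, 863522, 893793, 924739, 956354, 988628]

set_option maxRecDepth 100000 in
set_option maxHeartbeats 0 in
lemma run24 : cChk 1000000000000000 17578125000000 18359375000000 1000000 1000000000 128 601 211 212 6010014115290 4353457859340 112 15706163717518 21237449179149 9179687500000 5645973317916 z23 z24 e24 = true := by decide +kernel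

set_option maxRecDepth 100000 in
set_option maxHeartbeats 0 in
lemma gp24 : GP 18359375000000 1000000000 z24 := c_next run24 gp23 (by decide +kernel)

def z25 : List ℕ :=
  [105314, 107243, 109208, 111208, 113245, 115318, 117429, 119578, 121767, 123994, 126262, 128572, 130922, 133316, 135752, 138233, 140758, 143329,
   145946, 148610, 151322, 154083, 156893, 159754, 162667, 165631, 168649, 171721, 174848, 178031, 181271, 184568, 187925, 191341, 194819, 198358,
   201960, 205627, 209359, 213157, 217022, 220956, 224960, 229034, 233181, 237401, 241695, 246065, 250513, 255038, 259643, 264329, 269098, 273950,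
   278887, 283910, 289021, 294221, 299513, 304896, 310373, 315945, 321614, 327381, 333248, 339216, 345288, 351464, 357746, 364137, 370637, 377248,
   383973, 390813, 397769, 404844, 412040, 419357, 426798, 434366, 442061, 449886, 457842, 465933, 474158, 482522, 491025, 499670, 508458, 517392,
   526475, 535707, 545091, 554630, 564325, 574178, 584193, 594370, 604712, 615222, 625902, 636754, 647780, 658982, 670363, 681925, 693671, 705602,
   717722, 730031, 742534, 755231, 768126, 781220, 794516, 808017, 821724, 835640, 849768, 864109, 878666, 893441, 908436, 923654, 939097, 954767,
   970666, 986797]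

def e25 : List ℕ :=
  [8429, 8432, 8442, 8457, 8479, 8507, 8542, 8583, 8631, 8687, 8750, 8821, 8899, 8986, 9082, 9186, 9300, 9424, 9557, 9701, 9857, 10023, 10202, 10394,
   10599, 10818, 11051, 11300, 11565, 11848, 12148, 12468, 12807, 13167, 13550, 13957, 14388, 14846, 15331, 15846, 16393, 16972, 17586, 18237, 18928,
   19660, 20435, 21258, 22130, 23054, 24033, 25071, 26172, 27338, 28574, 29884, 31272, 32743, 34302, 35954, 37704, 39558, 41522, 43603, 45806, 48139,
   50610, 53225, 55992, 58921, 62020, 65298, 68765, 72430, 76304, 80397, 84721, 89287, 94108, 99195, 104562, 110222, 116189, 122478, 129104, 136083,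
   143429, 151158, 159288, 167834, 176814, 186245, 196144, 206530, 217420, 228833, 240787, 253300, 266391, 280078, 294380, 309316, 324902, 341158,
   358100, 375747, 394114, 413219, 433077, 453704, 475114, 497320, 520337, 544175, 568847, 594362, 620728, 647955, 676048, 705012, 734852, 765570,
   797166, 829640, 862990, 897212, 932301, 968248]

set_option maxRecDepth 100000 in
set_option maxHeartbeats 0 in
lemma run25 : cChk 1000000000000000 18359375000000 18750000000000 1000000 1000000000 128 626 209 210 10212881787119 2795837771391 128 18656549356872 22967290610823 9375000000000 5823117034018 z24 z25 e25 = true := by decide +kernel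

set_option maxRecDepth 100000 in
set_option maxHeartbeats 0 in
lemma gp25 : GP 18750000000000 1000000000 z25 := c_next run25 gp24 (by decide +kernel)

def z26 : List ℕ :=
  [99587, 101455, 103356, 105293, 107266, 109276, 111323, 113408, 115531, 117694, 119897, 122140, 124426, 126753, 129123, 131537, 133996, 136500,
   139051, 141648, 144293, 146987, 149731, 152525, 155370, 158268, 161219, 164224, 167284, 170401, 173574, 176806, 180097, 183448, 186860, 190334,
   193872, 197475, 201143, 204878, 208681, 212553, 216495, 220509, 224596, 228757, 232993, 237306, 241697, 246168, 250719, 255352, 260068, 264870,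
   269757, 274733, 279798, 284953, 290201, 295543, 300980, 306514, 312147, 317880, 323715, 329654, 335698, 341849, 348109, 354480, 360963, 367560,
   374273, 381105, 388056, 395129, 402325, 409647, 417097, 424677, 432388, 440233, 448214, 456333, 464592, 472993, 481538, 490230, 499071, 508063,
   517209, 526509, 535968, 545587, 555369, 565315, 575429, 585713, 596169, 606799, 617606, 628593, 639762, 651116, 662656, 674386, 686308, 698425,
   710739, 723253, 735969, 748891, 762019, 775358, 788910, 802677, 816663, 830869, 845298, 859953, 874836, 889950, 905298, 920882, 936705, 952769,
   969077, 985631]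

def e26 : List ℕ :=
  [4955, 4960, 4970, 4983, 5000, 5022, 5048, 5078, 5113, 5154, 5199, 5249, 5305, 5367, 5435, 5509, 5589, 5677, 5771, 5873, 5983, 6102, 6229, 6365,
   6511, 6668, 6835, 7014, 7205, 7409, 7626, 7858, 8106, 8369, 8650, 8950, 9269, 9609, 9971, 10357, 10768, 11205, 11671, 12168, 12697, 13260, 13860,
   14499, 15180, 15905, 16678, 17501, 18378, 19313, 20309, 21370, 22501, 23706, 24990, 26358, 27815, 29368, 31022, 32783, 34659, 36657, 38784, 41049,
   43459, 46024, 48752, 51655, 54741, 58022, 61509, 65214, 69149, 73327, 77762, 82466, 87456, 92748, 98356, 104298, 110590, 117250, 124296, 131747,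
   139622, 147940, 156721, 165986, 175756, 186051, 196895, 208308, 220313, 232933, 246189, 260104, 274701, 290003, 306031, 322809, 340358, 358700,
   377855, 397846, 418691, 440410, 463022, 486545, 510995, 536387, 562737, 590058, 618361, 647656, 677954, 709261, 741583, 774923, 809284, 844666,
   881067, 918483, 956908, 996334]

set_option maxRecDepth 100000 in
set_option maxHeartbeats 0 in
lemma run26 : cChk 1000000000000000 18750000000000 19531250000000 1000000 1000000000 128 645 207 208 1067091958881 1058594625566 128 20731864637472 26761009576091 9765625000000 6180019556740 z25 z26 e26 = true := by decide +kernel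

set_option maxRecDepth 100000 in
set_option maxHeartbeats 0 in
lemma gp26 : GP 19531250000000 1000000000 z26 := c_next run26 gp25 (by decide +kernel)

def z27 : List ℕ :=
  [89674, 91424, 93208, 95028, 96882, 98773, 100699, 102664, 104666, 106708, 108788, 110910, 113072, 115276, 117522, 119813, 122147, 124526, 126952,
   129424, 131945, 134513, 137131, 139800, 142519, 145291, 148118, 150997, 153932, 156924, 159974, 163081, 166248, 169476, 172766, 176120, 179537,
   183019, 186568, 190185, 193870, 197626, 201454, 205355, 209330, 213380, 217508, 221714, 226000, 230367, 234817, 239351, 243971, 248678, 253474,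
   258361, 263340, 268412, 273581, 278847, 284210, 289675, 295243, 300914, 306692, 312578, 318574, 324681, 330902, 337239, 343694, 350268, 356964,
   363785, 370731, 377805, 385010, 392347, 399821, 407430, 415179, 423070, 431105, 439287, 447618, 456101, 464736, 473529, 482482, 491595, 500873,
   510318, 519933, 529719, 539681, 549820, 560140, 570644, 581334, 592213, 603285, 614550, 626014, 637679, 649548, 661623, 673909, 686408, 699123,
   712058, 725213, 738596, 752206, 766049, 780127, 794443, 809001, 823804, 838854, 854156, 869712, 885526, 901601, 917940, 934548, 951425, 968576,
   986006]

def e27 : List ℕ :=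
  [2239, 2241, 2246, 2252, 2261, 2272, 2285, 2301, 2319, 2340, 2363, 2389, 2419, 2451, 2487, 2526, 2568, 2615, 2665, 2720, 2779, 2843, 2912, 2987,
   3067, 3153, 3245, 3344, 3451, 3566, 3688, 3820, 3961, 4113, 4275, 4449, 4636, 4836, 5050, 5280, 5527, 5791, 6075, 6379, 6706, 7056, 7432, 7836,
   8269, 8735, 9234, 9771, 10348, 10967, 11632, 12347, 13115, 13941, 14828, 15781, 16805, 17905, 19088, 20358, 21722, 23188, 24762, 26452, 28267,
   30215, 32305, 34547, 36952, 39530, 42293, 45254, 48425, 51819, 55453, 59340, 63498, 67942, 72691, 77762, 83175, 88949, 95105, 101664, 108649,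
   116082, 123987, 132388, 141311, 150781, 160824, 171468, 182739, 194666, 207277, 220600, 234665, 249500, 265134, 281597, 298918, 317125, 336247,
   356313, 377349, 399382, 422439, 446544, 471723, 497997, 525389, 553918, 583603, 614462, 646509, 679757, 714218, 749900, 786810, 824953, 864329,
   904938, 946776, 989837]

set_option maxRecDepth 100000 in
set_option maxHeartbeats 0 in
lemma run27 : cChk 1000000000000000 19531250000000 20312500000000 1000000 1000000000 128 670 205 206 9342159326512 353991934100 128 23834861769020 31040023855149 10156250000000 6540131197561 z26 z27 e27 = true := by decide +kernel

set_option maxRecDepth 100000 in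
set_option maxHeartbeats 0 in
lemma gp27 : GP 20312500000000 1000000000 z27 := c_next run27 gp26 (by decide +kernel)

def z28 : List ℕ :=
  [80299, 81937, 83608, 85313, 87052, 88826, 90637, 92484, 94368, 96291, 98252, 100253, 102295, 104378, 106503, 108670, 110882, 113138, 115439,
   117787, 120183, 122626, 125119, 127662, 130256, 132903, 135602, 138356, 141165, 144031, 146954, 149935, 152977, 156079, 159244, 162472, 165765,
   169123, 172549, 176043, 179606, 183241, 186949, 190730, 194587, 198520, 202532, 206623, 210796, 215052, 219392, 223818, 228332, 232935, 237630,
   242417, 247299, 252277, 257353, 262530, 267808, 273190, 278678, 284274, 289980, 295797, 301729, 307776, 313942, 320228, 326636, 333170, 339830,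
   346620, 353542, 360598, 367791, 375123, 382597, 390215, 397980, 405894, 413960, 422181, 430560, 439099, 447801, 456669, 465706, 474915, 484299,
   493861, 503604, 513530, 523644, 533949, 544446, 555141, 566036, 577134, 588439, 599954, 611683, 623629, 635796, 648187, 660806, 673657, 686742,
   700066, 713633, 727446, 741510, 755827, 770402, 785238, 800340, 815711, 831356, 847278, 863481, 879970, 896747, 913819, 931187, 948857, 966832,
   985117]

def e28 : List ℕ :=
  [812, 813, 815, 817, 821, 826, 831, 838, 845, 854, 864, 875, 888, 902, 917, 934, 953, 973, 995, 1020, 1046, 1074, 1105, 1139, 1175, 1214, 1257,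
   1303, 1352, 1406, 1464, 1526, 1594, 1666, 1745, 1830, 1922, 2022, 2129, 2246, 2372, 2508, 2655, 2815, 2988, 3175, 3378, 3598, 3837, 4096, 4377,
   4682, 5014, 5373, 5764, 6188, 6649, 7149, 7693, 8284, 8926, 9624, 10382, 11206, 12101, 13074, 14130, 15277, 16522, 17874, 19340, 20931, 22657,
   24528, 26555, 28751, 31128, 33703, 36488, 39500, 42756, 46274, 50072, 54170, 58589, 63350, 68478, 73997, 79930, 86306, 93152, 100495, 108367,
   116798, 125819, 135464, 145767, 156762, 168484, 180971, 194259, 208385, 223388, 239306, 256177, 274041, 292935, 312899, 333969, 356185, 379582,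
   404198, 430065, 457219, 485692, 515514, 546714, 579319, 613353, 648840, 685798, 724244, 764193, 805655, 848639, 893148, 939183, 986742]

set_option maxRecDepth 100000 in
set_option maxHeartbeats 0 in
lemma run28 : cChk 1000000000000000 20312500000000 21093750000000 1000000 1000000000 128 703 203 204 2313391914860 103160838995 128 27796905370932 35856399984513 10546875000000 6903146568498 z27 z28 e28 = true := by decide +kernel

set_option maxRecDepth 100000 in
set_option maxHeartbeats 0 in
lemma gp28 : GP 21093750000000 1000000000 z28 := c_next run28 gp27 (by decide +kernel)

def z29 : List ℕ :=
  [72205, 73736, 75300, 76897, 78528, 80193, 81893, 83629, 85402, 87211, 89059, 90946, 92873, 94840, 96849, 98900, 100994, 103132, 105314, 107543,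
   109819, 112142, 114514, 116936, 119409, 121934, 124511, 127143, 129829, 132572, 135373, 138232, 141150, 144130, 147172, 150277, 153448, 156684,
   159988, 163361, 166805, 170319, 173908, 177570, 181309, 185126, 189022, 192999, 197058, 201202, 205431, 209748, 214155, 218652, 223243, 227928,
   232710, 237591, 242572, 247656, 252845, 258141, 263545, 269060, 274689, 280433, 286294, 292276, 298380, 304608, 310964, 317449, 324067, 330819,
   337709, 344738, 351910, 359227, 366693, 374310, 382080, 390007, 398094, 406344, 414759, 423344, 432100, 441032, 450142, 459435, 468912, 478578,
   488436, 498490, 508743, 519199, 529861, 540733, 551819, 563123, 574649, 586400, 598380, 610594, 623046, 635739, 648678, 661867, 675311, 689013,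
   702978, 717210, 731714, 746495, 761556, 776903, 792540, 808471, 824702, 841237, 858081, 875239, 892715, 910515, 928642, 947103, 965902, 985045]

def e29 : List ℕ :=
  [255, 255, 256, 257, 258, 260, 262, 264, 267, 270, 274, 278, 283, 288, 294, 301, 308, 316, 324, 333, 344, 355, 367, 380, 395, 411, 428, 446, 467,
   489, 513, 539, 568, 599, 633, 670, 711, 755, 803, 856, 913, 977, 1046, 1121, 1204, 1295, 1394, 1503, 1623, 1755, 1899, 2058, 2232, 2424, 2635,
   2868, 3123, 3405, 3714, 4055, 4430, 4844, 5299, 5800, 6351, 6958, 7626, 8361, 9170, 10059, 11037, 12111, 13291, 14587, 16010, 17571, 19284, 21161,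
   23217, 25469, 27932, 30626, 33569, 36783, 40288, 44110, 48272, 52801, 57725, 63074, 68878, 75171, 81987, 89361, 97330, 105935, 115215, 125213,
   135971, 147535, 159951, 173265, 187525, 202781, 219083, 236480, 255024, 274765, 295754, 318042, 341680, 366715, 393199, 421177, 450696, 481799,
   514530, 548928, 585031, 622872, 662484, 703893, 747126, 792201, 839136, 887942, 938626, 991192]

set_option maxRecDepth 100000 in
set_option maxHeartbeats 0 in
lemma run29 : cChk 1000000000000000 21093750000000 21484375000000 1000000 1000000000 128 741 201 202 1464366762236 52651102614 128 32321260069678 38483773767450 10742187500000 7085655743005 z28 z29 e29 = true := by decide +kernel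

set_option maxRecDepth 100000 in
set_option maxHeartbeats 0 in
lemma gp29 : GP 21484375000000 100000 (z29.map (· * 10000)) := by
  have hc := run29
  rw [cChk, Bool.and_eq_true] at hc
  exact s_next' hc.1 gp28 (by decide +kernel)

def z30 : List ℕ :=
  [685386291, 700204133, 715340855, 730803256, 746598274, 762732994, 779214649, 796050622, 813248448, 830815822, 848760598, 867090790, 885814583,
   904940329, 924476552, 944431954, 964815416, 985636002, 1006902964, 1028625741, 1050813971, 1073477485, 1096626319, 1120270713, 1144421116,
   1169088191, 1194282818, 1220016099, 1246299360, 1273144161, 1300562290, 1328565780, 1357166901, 1386378175, 1416212374, 1446682527, 1477801923,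
   1509584120, 1542042943, 1575192496, 1609047163, 1643621611, 1678930800, 1714989986, 1751814724, 1789420878, 1827824621, 1867042443, 1907091158,
   1947987905, 1989750159, 2032395731, 2075942779, 2120409808, 2165815681, 2212179622, 2259521222, 2307860443, 2357217630, 2407613509, 2459069199,
   2511606215, 2565246475, 2620012304, 2675926443, 2733012054, 2791292724, 2850792476, 2911535767, 2973547503, 3036853039, 3101478185, 3167449217,
   3234792877, 3303536383, 3373707431, 3445334206, 3518445382, 3593070133, 3669238132, 3746979564, 3826325126, 3907306033, 3989954025, 4074301370,
   4160380870, 4248225866, 4337870239, 4429348420, 4522695388, 4617946679, 4715138385, 4814307160, 4915490225, 5018725363, 5124050932, 5231505857,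
   5341129640, 5452962353, 5567044647, 5683417747, 5802123455, 5923204145, 6046702769, 6172662849, 6301128477, 6432144313, 6565755582, 6702008067,
   6840948108, 6982622591, 7127078948, 7274365147, 7424529680, 7577621561, 7733690311, 7892785950, 8054958981, 8220260381, 8388741586, 8560454472,
   8735451341, 8913784906, 9095508262, 9280674878, 9469338561, 9661553444, 9857373950]

def e30 : List ℕ :=
  [1152119, 1154154, 1157714, 1162866, 1169682, 1178246, 1188646, 1200981, 1215361, 1231906, 1250748, 1272034, 1295927, 1322604, 1352262, 1385121,
   1421420, 1461426, 1505433, 1553768, 1606791, 1664902, 1728544, 1798206, 1874433, 1957829, 2049064, 2148881, 2258107, 2377659, 2508560, 2651945,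
   2809078, 2981366, 3170375, 3377850, 3605736, 3856202, 4131662, 4434812, 4768658, 5136551, 5542232, 5989873, 6484131, 7030200, 7633874, 8301620,
   9040646, 9858994, 10765629, 11770543, 12884867, 14121002, 15492751, 17015473, 18706249, 20584065, 22670007, 24987482, 27562449, 30423677,
   33603021, 37135721, 41060723, 45421027, 50264056, 55642053, 61612502, 68238579, 75589624, 83741640, 92777822, 102791836, 113884449, 126165865,
   139755549, 154783460, 171390748, 189730455, 209968233, 232283067, 256867990, 283930803, 313694769, 346399294, 382300572, 421672196, 464805718,
   512011151, 563617403, 619972632, 681444504, 748420360, 821307258, 900531898, 986540409, 1079797992, 1180788401, 1290013266, 1407991241,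
   1535256968, 1672359859, 1819862686, 1978339979, 2148376229, 2330563899, 2525501240, 2733789929, 2956032520, 3192829735, 3444777595, 3712464398,
   3996467577, 4297350441, 4615658835, 4951917712, 5306627673, 5680261467, 6073260510, 6486031412, 6918942574, 7372320860, 7846448368, 8341559336,
   8857837232, 9395412009, 9954357570]

set_option maxRecDepth 100000 in
set_option maxHeartbeats 0 in
lemma run30 : sChk 1000000000000000 21484375000000 10000000000 100000 128 769 200 201 7825160653808 35424731041703 (z29.map (· * 10000)) z30 e30 = true := by decide +kernel

set_option maxRecDepth 100000 in
set_option maxHeartbeats 0 in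
lemma gp30 : GP 22656250000000 100000 z30 := s_next run30 gp29 (by decide +kernel)

def z31 : List ℕ :=
  [585477709, 598849795, 612526261, 626513988, 640820012, 655451521, 670415867, 685720563, 701373292, 717381903, 733754424, 750499057, 767624188,
   785138389, 803050420, 821369235, 840103987, 859264028, 878858920, 898898433, 919392553, 940351484, 961785656, 983705727, 1006122587, 1029047368,
   1052491442, 1076466430, 1100984208, 1126056909, 1151696931, 1177916942, 1204729884, 1232148979, 1260187737, 1288859959, 1318179743, 1348161493,
   1378819921, 1410170058, 1442227254, 1475007191, 1508525883, 1542799690, 1577845317, 1613679826, 1650320643, 1687785561, 1726092749, 1765260763,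
   1805308545, 1846255441, 1888121197, 1930925978, 1974690367, 2019435375, 2065182453, 2111953494, 2159770845, 2208657315, 2258636181, 2309731197,
   2361966605, 2415367140, 2469958040, 2525765057, 2582814461, 2641133052, 2700748169, 2761687696, 2823980075, 2887654312, 2952739987, 3019267264,
   3087266897, 3156770245, 3227809273, 3300416569, 3374625347, 3450469462, 3527983414, 3607202358, 3688162115, 3770899182, 3855450735, 3941854645,
   4030149481, 4120374523, 4212569767, 4306775935, 4403034483, 4501387610, 4601878263, 4704550149, 4809447736, 4916616267, 5026101761, 5137951025,
   5252211655, 5368932044, 5488161389, 5609949692, 5734347768, 5861407250, 5991180586, 6123721051, 6259082741, 6397320580, 6538490321, 6682648542,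
   6829852650, 6980160878, 7133632283, 7290326743, 7450304952, 7613628419, 7780359455, 7950561173, 8124297475, 8301633043, 8482633329, 8667364544,
   8855893638, 9048288294, 9244616901, 9444948543, 9649352974, 9857900596]

def e31 : List ℕ :=
  [198565, 198828, 199397, 200286, 201512, 203094, 205052, 207408, 210189, 213423, 217141, 221379, 226176, 231577, 237629, 244390, 251919, 260286,
   269568, 279852, 291234, 303824, 317743, 333130, 350139, 368945, 389744, 412758, 438237, 466464, 497758, 532481, 571041, 613903, 661591, 714702,
   773912, 839989, 913805, 996352, 1088758, 1192305, 1308453, 1438863, 1585426, 1750296, 1935925, 2145105, 2381017, 2647281, 2948020, 3287927,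
   3672343, 4107342, 4599833, 5157669, 5789771, 6506266, 7318648, 8239943, 9284912, 10470260, 11814880, 13340111, 15070036, 17031799, 19255962,
   21776886, 24633155, 27868033, 31529964, 35674353, 40362539, 45663194, 51652541, 58415414, 66046068, 74649041, 84340070, 95247041, 107511003,
   121287204, 136746183, 154074875, 173477753, 195177981, 219418579, 246463570, 276599131, 310134699, 347404040, 388766255, 434606711, 485337876,
   541400042, 603261909, 671421021, 746404029, 828766753, 919094038, 1017999376, 1126124269, 1244137338, 1372733138, 1512630682, 1664571660,
   1829318340, 2007651151, 2200365948, 2408270956, 2632183399, 2872925829, 3131322158, 3408193428, 3704353317, 4020603426, 4357728368, 4716490686,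
   5097625651, 5501835962, 5929786399, 6382098465, 6859345078, 7362045332, 7890659402, 8445583616, 9027145754, 9635600620]

set_option maxRecDepth 100000 in
set_option maxHeartbeats 0 in
lemma run31 : sChk 1000000000000000 22656250000000 10000000000 100000 128 820 198 199 3273750221856 42292837272431 z30 z31 e31 = true := by decide +kernel

set_option maxRecDepth 100000 in
set_option maxHeartbeats 0 in
lemma gp31 : GP 24218750000000 100000 z31 := s_next run31 gp30 (by decide +kernel)

def z32 : List ℕ :=
  [483716413, 495365166, 507298221, 519522482, 532045024, 544873091, 558014098, 571475642, 585265501, 599391640, 613862217, 628685579, 643870282,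
   659425080, 675358944, 691681048, 708400797, 725527815, 743071958, 761043314, 779452215, 798309239, 817625214, 837411226, 857678627, 878439036,
   899704350, 921486746, 943798692, 966652951, 990062586, 1014040970, 1038601793, 1063759067, 1089527136, 1115920679, 1142954722, 1170644644,
   1199006186, 1228055458, 1257808944, 1288283520, 1319496451, 1351465408, 1384208472, 1417744145, 1452091364, 1487269499, 1523298373, 1560198266,
   1597989931, 1636694595, 1676333975, 1716930294, 1758506276, 1801085173, 1844690768, 1889347384, 1935079904, 1981913775, 2029875022, 2078990261,
   2129286710, 2180792201, 2233535195, 2287544790, 2342850739, 2399483461, 2457474053, 2516854303, 2577656706, 2639914481, 2703661572, 2768932680,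
   2835763261, 2904189547, 2974248568, 3045978152, 3119416951, 3194604450, 3271580988, 3350387765, 3431066863, 3513661263, 3598214851, 3684772446,
   3773379808, 3864083651, 3956931667, 4051972536, 4149255943, 4248832594, 4350754227, 4455073636, 4561844680, 4671122303, 4782962540, 4897422543,
   5014560591, 5134436101, 5257109652, 5382642987, 5511099038, 5642541929, 5777036999, 5914650807, 6055451146, 6199507056, 6346888838, 6497668053,
   6651917548, 6809711450, 6971125183, 7136235473, 7305120350, 7477859164, 7654532579, 7835222578, 8020012470, 8208986886, 8402231778, 8599834423,
   8801883409, 9008468637, 9219681314, 9435613935, 9656360284, 9882015413]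

def e32 : List ℕ :=
  [8300, 8314, 8343, 8390, 8455, 8540, 8645, 8772, 8924, 9102, 9308, 9544, 9815, 10123, 10471, 10865, 11309, 11809, 12371, 13002, 13712, 14509,
   15405, 16413, 17548, 18827, 20270, 21900, 23745, 25835, 28208, 30905, 33976, 37479, 41483, 46067, 51325, 57365, 64318, 72336, 81596, 92311,
   104729, 119144, 135903, 155416, 178168, 204732, 235787, 272135, 314726, 364684, 423336, 492256, 573301, 668667, 780949, 913209, 1069058, 1252754,
   1469310, 1724623, 2025623, 2380443, 2798615, 3291299, 3871534, 4554540, 5358323, 6303754, 7415173, 8720764, 10253202, 12050294, 14155704,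
   16619750, 19500302, 22863761, 26786151, 31354307, 36667177, 42837226, 49991968, 58275598, 67850746, 78900329, 91629518, 106267792, 123071074,
   142323939, 164341877, 189473579, 218103236, 250652817, 287584291, 329401766, 376653506, 429933782, 489884514, 557196668, 632611354, 716920574,
   810967594, 915646863, 1031903470, 1160732065, 1303175232, 1460321269, 1633301341, 1823286007, 2031481080, 2259122832, 2507472544, 2777810405,
   3071428788, 3389624930, 3733693060, 4104916019, 4504556436, 4933847525, 5393983576, 5886110232, 6411314631, 6970615505, 7564953349, 8195180746,
   8862052945, 9566218814]

set_option maxRecDepth 100000 in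
set_option maxHeartbeats 0 in
lemma run32 : sChk 1000000000000000 24218750000000 10000000000 100000 128 915 195 196 4133756447957 54694550717160 z31 z32 e32 = true := by decide +kernel

set_option maxRecDepth 100000 in
set_option maxHeartbeats 0 in
lemma gp32 : GP 25781250000000 100000 z32 := s_next run32 gp31 (by decide +kernel)

def z33 : List ℕ :=
  [390139103, 400313371, 410752573, 421463587, 432453468, 443729453, 455298967, 467169624, 479349235, 491845814, 504667579, 517822960, 531320605,
   545169383, 559378392, 573956963, 588914666, 604261320, 620006992, 636162009, 652736962, 669742715, 687190409, 705091470, 723457617, 742300868,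
   761633547, 781468297, 801818078, 822696185, 844116250, 866092252, 888638527, 911769775, 935501071, 959847870, 984826023, 1010451780, 1036741805,
   1063713183, 1091383432, 1119770512, 1148892837, 1178769287, 1209419216, 1240862467, 1273119382, 1306210815, 1340158142, 1374983277, 1410708683,
   1447357385, 1484952983, 1523519668, 1563082233, 1603666089, 1645297281, 1688002498, 1731809093, 1776745098, 1822839235, 1870120940, 1918620371,
   1968368432, 2019396784, 2071737869, 2125424919, 2180491984, 2236973941, 2294906520, 2354326318, 2415270822, 2477778426, 2541888454, 2607641174,
   2675077828, 2744240646, 2815172870, 2887918774, 2962523688, 3039034019, 3117497276, 3197962088, 3280478232, 3365096655, 3451869497, 3540850114,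
   3632093107, 3725654342, 3821590975, 3919961482, 4020825677, 4124244744, 4230281259, 4338999216, 4450464055, 4564742686, 4681903517, 4802016478,
   4925153049, 5051386286, 5180790847, 5313443018, 5449420740, 5588803634, 5731673027, 5878111978, 6028205302, 6182039596, 6339703265, 6501286544,
   6666881519, 6836582158, 7010484323, 7188685802, 7371286322, 7558387572, 7750093221, 7946508938, 8147742406, 8353903339, 8565103494, 8781456687,
   9003078800, 9230087792, 9462603705, 9700748671, 9944646912]

def e33 : List ℕ :=
  [133, 134, 134, 135, 137, 139, 141, 144, 147, 151, 156, 161, 167, 174, 182, 192, 202, 214, 228, 244, 263, 284, 308, 336, 368, 405, 448, 498, 556,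
   625, 705, 799, 910, 1041, 1197, 1383, 1604, 1869, 2187, 2570, 3032, 3591, 4269, 5093, 6098, 7326, 8828, 10671, 12935, 15722, 19157, 23398, 28639,
   35125, 43159, 53117, 65471, 80803, 99839, 123480, 152841, 189303, 234575, 290765, 360470, 446921, 554084, 686845, 851177, 1054388, 1305400,
   1615081, 1996636, 2466070, 3042733, 3749955, 4615786, 5673852, 6964345, 8535161, 10443193, 12755806, 15552500, 18926782, 22988255, 27864938,
   33705826, 40683701, 48998185, 58879045, 70589746, 84431217, 100745845, 119921636, 142396534, 168662839, 199271684, 234837496, 276042391,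
   323640404, 378461485, 441415160, 513493762, 595775126, 689424649, 795696598, 915934578, 1051571042, 1204125757, 1375203146, 1566488420,
   1779742441, 2016795288, 2279538471, 2569915811, 2889912989, 3241545801, 3626847185, 4047853089, 4506587306, 5005045387, 5545177780, 6128872374,
   6757936613, 7434079396, 8158892943, 8933834867, 9760210652]

set_option maxRecDepth 100000 in
set_option maxHeartbeats 0 in
lemma run33 : sChk 1000000000000000 25781250000000 10000000000 100000 128 1036 192 193 3256193357878 70841426879845 z32 z33 e33 = true := by decide +kernel

set_option maxRecDepth 100000 in
set_option maxHeartbeats 0 in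
lemma r30 : rChk 1000000000000000 21484375000000 10000000000 128 z30 e30 = true := by decide +kernel

lemma uq_all {τ : ℝ} (h1 : 1.9 ≤ τ) (h2 : τ ≤ 6) : UQ τ := by
  by_cases c13 : τ ≤ 1.91
  · exact c_sound run13 gp12 (by norm_num at *; linarith) (by norm_num at *; linarith)
  by_cases c14 : τ ≤ 1.92
  · exact c_sound run14 gp13 (by norm_num at *; linarith) (by norm_num at *; linarith)
  by_cases c15 : τ ≤ 1.93
  · exact c_sound run15 gp14 (by norm_num at *; linarith) (by norm_num at *; linarith)
  by_cases c16 : τ ≤ 1.94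
  · exact c_sound run16 gp15 (by norm_num at *; linarith) (by norm_num at *; linarith)
  by_cases c17 : τ ≤ 1.96
  · exact c_sound run17 gp16 (by norm_num at *; linarith) (by norm_num at *; linarith)
  by_cases c18 : τ ≤ 1.98
  · exact c_sound run18 gp17 (by norm_num at *; linarith) (by norm_num at *; linarith)
  by_cases c19 : τ ≤ 2.0
  · exact c_sound run19 gp18 (by norm_num at *; linarith) (by norm_num at *; linarith)
  by_cases c20 : τ ≤ 2.05
  · exact c_sound run20 gp19 (by norm_num at *; linarith) (by norm_num at *; linarith)
  by_cases c21 : τ ≤ 2.1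
  · exact c_sound run21 gp20 (by norm_num at *; linarith) (by norm_num at *; linarith)
  by_cases c22 : τ ≤ 2.15
  · exact c_sound run22 gp21 (by norm_num at *; linarith) (by norm_num at *; linarith)
  by_cases c23 : τ ≤ 2.25
  · exact c_sound run23 gp22 (by norm_num at *; linarith) (by norm_num at *; linarith)
  by_cases c24 : τ ≤ 2.35
  · exact c_sound run24 gp23 (by norm_num at *; linarith) (by norm_num at *; linarith)
  by_cases c25 : τ ≤ 2.4
  · exact c_sound run25 gp24 (by norm_num at *; linarith) (by norm_num at *; linarith)
  by_cases c26 : τ ≤ 2.5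
  · exact c_sound run26 gp25 (by norm_num at *; linarith) (by norm_num at *; linarith)
  by_cases c27 : τ ≤ 2.6
  · exact c_sound run27 gp26 (by norm_num at *; linarith) (by norm_num at *; linarith)
  by_cases c28 : τ ≤ 2.7
  · exact c_sound run28 gp27 (by norm_num at *; linarith) (by norm_num at *; linarith)
  by_cases c29 : τ ≤ 2.75
  · exact c_sound run29 gp28 (by norm_num at *; linarith) (by norm_num at *; linarith)
  refine r_sound run30 gp29 r30 (by norm_num at *; linarith) h2 (fun q b Y hY => ?_)
  by_cases c30 : τ ≤ 2.95
  · have := s_min run30 gp29 hY (by norm_num at *; linarith)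
    norm_num at *; linarith
  by_cases c31 : τ ≤ 3.6
  · have := s_min run31 gp30 hY (by norm_num at *; linarith)
    norm_num at *; linarith
  by_cases c32 : τ ≤ 4.66
  · have := s_min run32 gp31 hY (by norm_num at *; linarith)
    norm_num at *; linarith
  have := s_min run33 gp32 hY (by norm_num at *; linarith)
  norm_num at *; linarith

lemma final_aux : ∀ α ∈ Set.Icc (1.9 : ℝ) 6.0, (∃ x : ℝ → ℝ, SOPS α x) ∧
    (∀ x y : ℝ → ℝ, SOPS α x → SOPS α y → ∃ τ : ℝ, ∀ t : ℝ, y t = x (t + τ)) := by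
  intro α hα
  have p : 0 < α := by have := hα.1; norm_num at this; linarith
  obtain ⟨Z, q, b, hZ, hu⟩ := (uq_all hα.1 (by have := hα.2; norm_num at this; linarith)).orb_eq hα.1
  refine ⟨⟨_, Orb.sops p hZ⟩, fun x y hx hy => ?_⟩
  obtain ⟨U, q1, b1, t1, o1, e1⟩ := hx.orb p
  obtain ⟨V, q2, b2, t2, o2, e2⟩ := hy.orb p
  refine ⟨t1 - t2, fun t => ?_⟩
  rw [e1, e2, hu _ _ _ o1, hu _ _ _ o2]
  congr 1
  ring

theorem wright_unique_SOPS_on_interval :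
    ∀ α : ℝ, α ∈ Set.Icc (1.9 : ℝ) 6.0 →
      (∃ x : ℝ → ℝ, SOPS α x) ∧
      (∀ x y : ℝ → ℝ, SOPS α x → SOPS α y →
        ∃ τ : ℝ, ∀ t : ℝ, y t = x (t + τ)) := final_aux
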